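/- Suppose r_Q ≥ r_C ≥ 1 and s ≥ 4 r_Q + ⌊20 r_C / 3⌋ + 1. Then for every highly non-singular system of r_C cubic equations Σ_{j=1}^s c_{ij} x_j^3 = 0 (1 ≤ i ≤ r_C) and r_Q quadratic equations Σ_{j=1}^s d_{ij} x_j^2 = 0 (1 ≤ i ≤ r_Q) with nonzero integer coefficients, which possesses a non-singular real solution with all coordinates positive and, for every prime p, a non-singular solution in ℚ_p^s, there exists C > 0 such that the number N(P) of integer solutions x with 1 ≤ x_j ≤ P satisfies N(P) = (C + o(1)) P^{s − 3r_C − 2r_Q} as P → ∞. -/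

import Mathlib

open Finset

/-- A cubic–quadratic system (`r_C` cubic forms `c`, `r_Q` quadratic forms `d`)
is highly non-singular: all coefficients are nonzero, and every `r_C × r_C`
minor of `(c_{ij})` and every `r_Q × r_Q` minor of `(d_{ij})` is nonzero. -/
def CQHighlyNonSingular (rC rQ s : ℕ) (c : Fin rC → Fin s → ℤ)
    (d : Fin rQ → Fin s → ℤ) : Prop :=
  (∀ i j, c i j ≠ 0) ∧ (∀ i j, d i j ≠ 0) ∧
  (∀ J : Fin rC → Fin s, Function.Injective J →
    (Matrix.of fun i m => c i (J m)).det ≠ 0) ∧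
  (∀ J : Fin rQ → Fin s, Function.Injective J →
    (Matrix.of fun i m => d i (J m)).det ≠ 0)

/-- `x` is a solution of the cubic–quadratic system over a commutative ring. -/
def CQIsSol {A : Type*} [CommRing A] (rC rQ s : ℕ) (c : Fin rC → Fin s → ℤ)
    (d : Fin rQ → Fin s → ℤ) (x : Fin s → A) : Prop :=
  (∀ i, ∑ j, (c i j : A) * x j ^ 3 = 0) ∧ (∀ i, ∑ j, (d i j : A) * x j ^ 2 = 0)

/-- The Jacobian (rows `3 c_{ij} x_j²` and `2 d_{ij} x_j`) has full rank
`r_C + r_Q` at `x`. -/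
def CQJacFullRank {A : Type*} [CommRing A] (rC rQ s : ℕ) (c : Fin rC → Fin s → ℤ)
    (d : Fin rQ → Fin s → ℤ) (x : Fin s → A) : Prop :=
  (Matrix.of fun (i : Fin rC ⊕ Fin rQ) (j : Fin s) =>
    Sum.elim (fun i₁ : Fin rC => 3 * (c i₁ j : A) * x j ^ 2)
      (fun i₂ : Fin rQ => 2 * (d i₂ j : A) * x j) i).rank = rC + rQ

/-- The number of solutions `x ∈ [1,P]^s` of the cubic–quadratic system. -/
noncomputable def CQNcount (rC rQ s : ℕ) (c : Fin rC → Fin s → ℤ) (d : Fin rQ → Fin s → ℤ)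
    (P : ℕ) : ℕ :=
  Nat.card {x : Fin s → ℕ // (∀ j, 1 ≤ x j ∧ x j ≤ P) ∧
    CQIsSol rC rQ s c d fun j => (x j : ℤ)}

namespace CQ
open MeasureTheory

/-- The circle `ℝ / ℤ`. -/
abbrev 𝕋 := UnitAddCircle

/-- The standard character of the circle. -/
noncomputable def ee (t : 𝕋) : ℂ := (AddCircle.toCircle t : ℂ)

lemma ee_add (s t : 𝕋) : ee (s + t) = ee s * ee t := by
  simp [ee, AddCircle.toCircle_add]

@[simp] lemma ee_zero : ee 0 = 1 := by simp [ee]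

@[simp] lemma norm_ee (t : 𝕋) : ‖ee t‖ = 1 := Circle.norm_coe _

lemma ee_neg (t : 𝕋) : ee (-t) = (starRingEnd ℂ) (ee t) := by
  rw [ee, ee, AddCircle.toCircle_neg, Circle.coe_inv_eq_conj]

lemma ee_sub (s t : 𝕋) : ee (s - t) = ee s * (starRingEnd ℂ) (ee t) := by
  rw [sub_eq_add_neg, ee_add, ee_neg]

lemma ee_sum {ι : Type*} (s : Finset ι) (f : ι → 𝕋) : ee (∑ i ∈ s, f i) = ∏ i ∈ s, ee (f i) := by
  classical
  induction s using Finset.induction_on with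
  | empty => simp
  | insert a s ha ih => rw [sum_insert ha, prod_insert ha, ee_add, ih]

@[fun_prop] lemma continuous_ee : Continuous ee :=
  continuous_subtype_val.comp AddCircle.continuous_toCircle

lemma ee_coe (x : ℝ) : ee (x : 𝕋) = Complex.exp (2 * Real.pi * x * Complex.I) := by
  rw [ee, AddCircle.toCircle_apply_mk]
  simp

lemma ee_eq_one_iff (t : 𝕋) : ee t = 1 ↔ t = 0 := by
  constructor
  · intro h
    apply AddCircle.injective_toCircle (T := (1:ℝ)) one_ne_zero
    apply Circle.coe_injective
    simpa [ee] using h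
  · rintro rfl; simp

section analysis
variable {X : Type*} [TopologicalSpace X] [CompactSpace X] [MeasurableSpace X]
  [OpensMeasurableSpace X] {E : Type*} [NormedAddCommGroup E] (μ : Measure X) [IsFiniteMeasure μ]

lemma integrable_cont {f : X → E} (hf : Continuous f) : Integrable f μ :=
  hf.integrable_of_hasCompactSupport (HasCompactSupport.of_compactSpace f)

/-- Hölder's inequality in interpolation form for continuous functions on a compact space. -/
lemma holder_cont {f g : X → ℝ} (hf : Continuous f) (hg : Continuous g) (hf0 : ∀ x, 0 ≤ f x)
    (hg0 : ∀ x, 0 ≤ g x) {θ : ℝ} (h0 : 0 < θ) (h1 : θ < 1) :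
    ∫ x, f x ^ θ * g x ^ (1 - θ) ∂μ ≤ (∫ x, f x ∂μ) ^ θ * (∫ x, g x ∂μ) ^ (1 - θ) := by
  have h1' : 0 < 1 - θ := by linarith
  have hpq : (1 / θ).HolderConjugate (1 / (1 - θ)) := by
    rw [Real.holderConjugate_iff]
    refine ⟨?_, by simp⟩
    rw [lt_div_iff₀ h0]; linarith
  have cf : Continuous fun x => f x ^ θ := hf.rpow_const fun x => Or.inr h0.le
  have cg : Continuous fun x => g x ^ (1 - θ) := hg.rpow_const fun x => Or.inr h1'.le
  have mem : ∀ {u : X → ℝ} (p : ENNReal), Continuous u → MemLp u p μ := by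
    intro u p hu
    obtain ⟨C, hC⟩ := (isCompact_range hu).isBounded.exists_norm_le
    exact MemLp.of_bound (integrable_cont μ hu).1 C (ae_of_all _ fun x => hC _ ⟨x, rfl⟩)
  have := integral_mul_le_Lp_mul_Lq_of_nonneg (μ := μ) hpq
    (ae_of_all _ fun x => Real.rpow_nonneg (hf0 x) θ)
    (ae_of_all _ fun x => Real.rpow_nonneg (hg0 x) (1 - θ)) (mem _ cf) (mem _ cg)
  refine this.trans (le_of_eq ?_)
  have e1 : ∀ x, (f x ^ θ) ^ (1 / θ) = f x := fun x => by
    rw [← Real.rpow_mul (hf0 x), mul_one_div_cancel h0.ne', Real.rpow_one]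
  have e2 : ∀ x, (g x ^ (1 - θ)) ^ (1 / (1 - θ)) = g x := fun x => by
    rw [← Real.rpow_mul (hg0 x), mul_one_div_cancel h1'.ne', Real.rpow_one]
  simp only [e1, e2, one_div_one_div]

end analysis

/-- A bound for the number of divisors. -/
lemma card_divisors_bound (ε : ℝ) (hε : 0 < ε) :
    ∃ C : ℝ, 1 ≤ C ∧ ∀ n : ℕ, n ≠ 0 → (#n.divisors : ℝ) ≤ C * (n : ℝ) ^ ε := by
  set K : ℝ := max 1 (1 / (ε * Real.log 2)) with hK
  have hK1 : 1 ≤ K := le_max_left _ _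
  have hl2 : 0 < Real.log 2 := Real.log_pos (by norm_num)
  obtain ⟨p0, hp0⟩ := exists_nat_gt ((2:ℝ) ^ (1 / ε))
  refine ⟨K ^ p0, one_le_pow₀ hK1, fun n hn => ?_⟩
  have key : ∀ p ∈ n.primeFactors, ((n.factorization p + 1 : ℕ) : ℝ) ≤
      (if p < p0 then K else 1) * ((p : ℝ) ^ (n.factorization p)) ^ ε := by
    intro p hp
    have hp2 : 2 ≤ p := (Nat.prime_of_mem_primeFactors hp).two_le
    have hp2' : (2:ℝ) ≤ p := by exact_mod_cast hp2
    set a := n.factorization p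
    rw [← Real.rpow_natCast, ← Real.rpow_mul (by positivity)]
    split_ifs with h
    · have h1 : (2:ℝ) ^ ((a:ℝ) * ε) ≤ (p:ℝ) ^ ((a:ℝ) * ε) :=
        Real.rpow_le_rpow (by norm_num) hp2' (by positivity)
      have h2 : Real.log 2 * ((a:ℝ) * ε) + 1 ≤ (2:ℝ) ^ ((a:ℝ) * ε) := by
        rw [Real.rpow_def_of_pos (by norm_num)]; exact Real.add_one_le_exp _
      have h3 : 1 ≤ K * (ε * Real.log 2) := by
        have : 1 / (ε * Real.log 2) ≤ K := le_max_right _ _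
        rwa [div_le_iff₀ (by positivity)] at this
      push_cast
      calc (a:ℝ) + 1 ≤ K * (Real.log 2 * ((a:ℝ) * ε) + 1) := by
            nlinarith [mul_le_mul_of_nonneg_left h3 (Nat.cast_nonneg (α := ℝ) a)]
        _ ≤ _ := by gcongr; linarith
    · push Not at h
      have h1 : (2:ℝ) ^ (1 / ε) ≤ p := hp0.le.trans (by exact_mod_cast h)
      have h2 : (2:ℝ) ≤ (p:ℝ) ^ ε := by
        calc (2:ℝ) = ((2:ℝ) ^ (1 / ε)) ^ ε := by
              rw [← Real.rpow_mul (by norm_num), one_div_mul_cancel hε.ne', Real.rpow_one]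
          _ ≤ _ := Real.rpow_le_rpow (by positivity) h1 hε.le
      rw [one_mul, mul_comm, Real.rpow_mul (by positivity), Real.rpow_natCast]
      calc ((a + 1 : ℕ) : ℝ) ≤ 2 ^ a := by
            exact_mod_cast Nat.lt_two_pow_self
        _ ≤ _ := by gcongr
  rw [Nat.card_divisors hn]
  push_cast
  calc ∏ p ∈ n.primeFactors, ((n.factorization p : ℝ) + 1)
      ≤ ∏ p ∈ n.primeFactors, ((if p < p0 then K else 1) * ((p : ℝ) ^ (n.factorization p)) ^ ε) := by
        apply prod_le_prod
        · intros; positivity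
        · intro p hp; exact_mod_cast key p hp
    _ = (∏ p ∈ n.primeFactors, (if p < p0 then K else 1)) * (n : ℝ) ^ ε := by
        rw [prod_mul_distrib]
        congr 1
        rw [Real.finsetProd_rpow _ _ (fun _ _ => by positivity)]
        congr 1
        conv_rhs => rw [← Nat.prod_factorization_pow_eq_self hn]
        rw [Finsupp.prod]; push_cast; rfl
    _ ≤ K ^ p0 * (n : ℝ) ^ ε := by
        gcongr
        rw [prod_ite, prod_const, prod_const_one, mul_one]
        apply pow_le_pow_right₀ hK1
        calc _ ≤ #(range p0) := card_le_card (fun x hx => by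
              simp only [mem_filter] at hx; exact mem_range.2 hx.2)
          _ = p0 := card_range p0

end CQ

namespace CQ

section congruence_count

variable {p : ℤ} (hp : Prime p) (hp2 : ¬ p ∣ 2) (hp3 : ¬ p ∣ 3) {ν : ℤ} (hν : ¬ p ∣ ν)
include hp hp2 hp3 hν

omit hp3 in
lemma unit_dvd {a : ℕ} (ha : 1 ≤ a) (m : ℕ) (z t : ℤ) (h : p ^ m ∣ t * (2 * ν + p ^ a * z)) :
    p ^ m ∣ t := by
  refine (IsCoprime.dvd_of_dvd_mul_right ?_ h)
  apply IsCoprime.pow_left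
  rw [Prime.coprime_iff_not_dvd hp]
  intro h1
  have h2 : p ∣ p ^ a * z := (dvd_pow_self p (by omega)).mul_right z
  rw [dvd_add_left h2] at h1
  rcases hp.dvd_or_dvd h1 with h | h
  · exact hp2 h
  · exact hν h

lemma quad_lift {a : ℕ} (ha : 1 ≤ a) (c v : ℕ) (hv : v ≤ c)
    {x y z w z' w' : ℤ} (hD : v = c ∨ ¬ p ^ (v + 1) ∣ x - y) (hDv : p ^ v ∣ x - y)
    (h1 : p ^ c ∣ 2 * ν * (x + z - y - w) + p ^ a * (x ^ 2 + z ^ 2 - y ^ 2 - w ^ 2))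
    (h2 : p ^ c ∣ 3 * ν * (x ^ 2 + z ^ 2 - y ^ 2 - w ^ 2)
      + 2 * p ^ a * (x ^ 3 + z ^ 3 - y ^ 3 - w ^ 3))
    (h1' : p ^ c ∣ 2 * ν * (x + z' - y - w') + p ^ a * (x ^ 2 + z' ^ 2 - y ^ 2 - w' ^ 2))
    (h2' : p ^ c ∣ 3 * ν * (x ^ 2 + z' ^ 2 - y ^ 2 - w' ^ 2)
      + 2 * p ^ a * (x ^ 3 + z' ^ 3 - y ^ 3 - w' ^ 3)) :
    p ^ (c - v) ∣ w - w' := by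
  have hp0 : p ≠ 0 := hp.ne_zero
  obtain ⟨A, hA⟩ : ∃ A : ℤ → ℤ → ℤ, ∀ x y, A x y = 2 * ν + p ^ a * (x + y) :=
    ⟨_, fun _ _ => rfl⟩
  obtain ⟨B, hB⟩ : ∃ B : ℤ → ℤ → ℤ, ∀ x y,
      B x y = 3 * ν * (x + y) + 2 * p ^ a * (x ^ 2 + x * y + y ^ 2) := ⟨_, fun _ _ => rfl⟩
  have hH : ∀ z w, p ^ c ∣ 2 * ν * (x + z - y - w) + p ^ a * (x ^ 2 + z ^ 2 - y ^ 2 - w ^ 2) →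
      p ^ c ∣ 3 * ν * (x ^ 2 + z ^ 2 - y ^ 2 - w ^ 2)
      + 2 * p ^ a * (x ^ 3 + z ^ 3 - y ^ 3 - w ^ 3) →
      p ^ (c - v) ∣ B x y * A z w - A x y * B z w := by
    intro z w h1 h2
    have h3 : p ^ c ∣ (x - y) * (B x y * A z w - A x y * B z w) := by
      have := dvd_sub (h2.mul_right (A z w)) (h1.mul_right (B z w))
      exact this.trans (Eq.dvd (by simp only [hA, hB]; ring))
    rcases hD with rfl | hD
    · simp
    · obtain ⟨u, hu⟩ := hDv
      have hu1 : ¬ p ∣ u := by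
        rintro ⟨k, rfl⟩; exact hD ⟨k, by rw [hu]; ring⟩
      have h4 : p ^ v * p ^ (c - v) ∣ p ^ v * (u * (B x y * A z w - A x y * B z w)) := by
        rw [← pow_add, Nat.add_sub_cancel' hv, ← mul_assoc, ← hu]; exact h3
      have h5 := (mul_dvd_mul_iff_left (pow_ne_zero v hp0)).1 h4
      exact IsCoprime.dvd_of_dvd_mul_left
        (IsCoprime.pow_left ((Prime.coprime_iff_not_dvd hp).2 hu1)) h5
  have hHd := dvd_sub (hH z w h1 h2) (hH z' w' h1' h2')
  have hφ : p ^ c ∣ (z - z') * (2 * ν + p ^ a * (z + z')) - (w - w') * (2 * ν + p ^ a * (w + w')) := by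
    exact (dvd_sub h1 h1').trans (Eq.dvd (by ring))
  have main : ∀ m, m ≤ c - v → p ^ m ∣ w - w' := by
    intro m
    induction m with
    | zero => intro; simp
    | succ m ih =>
      intro hm
      obtain ⟨T, hT⟩ := ih (by omega)
      have e1 : p ^ m ∣ z - z' := by
        apply unit_dvd hp hp2 hν ha m (z + z')
        have := dvd_add ((pow_dvd_pow p (show m ≤ c by omega)).trans hφ)
          (Dvd.dvd.mul_right (Dvd.intro T hT.symm) (2 * ν + p ^ a * (w + w')))
        simpa using this
      obtain ⟨S, hS⟩ := e1
      have cancel : ∀ R : ℤ, p ^ (m + 1) ∣ p ^ m * R → p ∣ R := by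
        intro R hR
        rw [pow_succ] at hR
        exact (mul_dvd_mul_iff_left (pow_ne_zero m hp0)).1 hR
      obtain ⟨a', rfl⟩ : ∃ a', a = a' + 1 := ⟨a - 1, by omega⟩
      have e2 : p ∣ S * (2 * ν + p ^ (a' + 1) * (z + z')) - T * (2 * ν + p ^ (a' + 1) * (w + w')) := by
        apply cancel
        have := (pow_dvd_pow p (show m + 1 ≤ c by omega)).trans hφ
        exact this.trans (Eq.dvd (by linear_combination (2*ν) * hS - (2*ν)*hT + p^(a'+1)*(z+z')*hS - p^(a'+1)*(w+w')*hT))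
      have e3 : p ∣ 2 * (ν * (S - T)) := by
        have : 2 * (ν * (S - T)) = (S * (2 * ν + p ^ (a' + 1) * (z + z')) -
          T * (2 * ν + p ^ (a' + 1) * (w + w'))) - p * (p ^ a' * (S * (z + z') - T * (w + w'))) := by
          ring
        rw [this]; exact dvd_sub e2 (dvd_mul_right _ _)
      have e4 : p ∣ S - T :=
        (hp.dvd_or_dvd ((hp.dvd_or_dvd e3).resolve_left hp2)).resolve_left hν
      obtain ⟨k, hk⟩ := e4
      have e5 : p ∣ B x y * (p ^ (a' + 1) * (T + S)) - A x y * (3 * ν * (T + S) +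
          2 * p ^ (a' + 1) * (S * (z + z' + w) + T * (w + w' + z'))) := by
        apply cancel
        have := (pow_dvd_pow p hm).trans hHd
        refine this.trans (Eq.dvd ?_)
        have h6 : z = z' + p ^ m * S := by linarith
        have h7 : w = w' + p ^ m * T := by linarith
        simp only [hA, hB]
        rw [h6, h7]; ring
      have e6 : p ∣ 2 * (2 * (3 * (ν * (ν * T)))) := by
        have hS' : S = T + p * k := by linarith
        obtain ⟨r, hr⟩ := e5
        refine ⟨-r + B x y * (p ^ a' * (T + S)) - p ^ a' * (x + y) * (3 * ν * (T + S) +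
          2 * p ^ (a' + 1) * (S * (z + z' + w) + T * (w + w' + z'))) -
          2 * ν * (2 * p ^ a' * (S * (z + z' + w) + T * (w + w' + z'))) - 6 * ν ^ 2 * k, ?_⟩
        have : A x y = 2 * ν + p * (p ^ a' * (x + y)) := by simp only [hA]; ring
        rw [this] at hr
        generalize B x y = b at hr
        rw [hS'] at hr ⊢
        linear_combination (-1) * hr
      have e7 : p ∣ T := by
        have := (hp.dvd_or_dvd e6).resolve_left hp2
        have := (hp.dvd_or_dvd this).resolve_left hp2
        have := (hp.dvd_or_dvd this).resolve_left hp3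
        have := (hp.dvd_or_dvd this).resolve_left hν
        exact (hp.dvd_or_dvd this).resolve_left hν
      obtain ⟨r, hr⟩ := e7
      exact ⟨r, by rw [hT, hr]; ring⟩
  exact main _ le_rfl

end congruence_count

/-- The congruence conditions on quadruples appearing in the efficient congruencing step. -/
def GoodQuad (p a c : ℕ) (ν : ℤ) (k : ℕ × ℕ × ℕ × ℕ) : Prop :=
  (p : ℤ) ^ c ∣ 2 * ν * ((k.1 : ℤ) + k.2.1 - k.2.2.1 - k.2.2.2)
      + (p : ℤ) ^ a * ((k.1 : ℤ) ^ 2 + (k.2.1 : ℤ) ^ 2 - (k.2.2.1 : ℤ) ^ 2 - (k.2.2.2 : ℤ) ^ 2) ∧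
  (p : ℤ) ^ c ∣ 3 * ν * ((k.1 : ℤ) ^ 2 + (k.2.1 : ℤ) ^ 2 - (k.2.2.1 : ℤ) ^ 2 - (k.2.2.2 : ℤ) ^ 2)
      + 2 * (p : ℤ) ^ a *
        ((k.1 : ℤ) ^ 3 + (k.2.1 : ℤ) ^ 3 - (k.2.2.1 : ℤ) ^ 3 - (k.2.2.2 : ℤ) ^ 3)

lemma exists_val (p : ℤ) (c : ℕ) (d : ℤ) :
    ∃ v ≤ c, p ^ v ∣ d ∧ (v = c ∨ ¬ p ^ (v + 1) ∣ d) := by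
  classical
  refine ⟨Nat.findGreatest (fun v => p ^ v ∣ d) c, Nat.findGreatest_le c, ?_, ?_⟩
  · exact Nat.findGreatest_spec (P := fun v => p ^ v ∣ d) (Nat.zero_le c) (by simp)
  · rcases (Nat.findGreatest_le (P := fun v => p ^ v ∣ d) c).eq_or_lt with h | h
    · exact Or.inl h
    · exact Or.inr (Nat.findGreatest_is_greatest (P := fun v => p ^ v ∣ d) (Nat.lt_succ_self _) h)

open Classical in
lemma card_goodQuad {p : ℕ} (hp : p.Prime) (hp3 : 3 < p) {ν : ℤ} (hν : ¬ (p : ℤ) ∣ ν) {a : ℕ}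
    (ha : 1 ≤ a) (c : ℕ) :
    #((range (p ^ c) ×ˢ range (p ^ c) ×ˢ range (p ^ c) ×ˢ range (p ^ c)).filter
      (GoodQuad p a c ν)) ≤ (c + 1) * p ^ (2 * c) := by
  have hpZ : Prime (p : ℤ) := Nat.prime_iff_prime_int.1 hp
  have hn2 : ¬ (p : ℤ) ∣ 2 := by
    intro h; have := Int.le_of_dvd (by norm_num) h; omega
  have hn3 : ¬ (p : ℤ) ∣ 3 := by
    intro h; have := Int.le_of_dvd (by norm_num) h; omega
  have hpp : ∀ m, 0 < p ^ m := fun m => pow_pos hp.pos m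
  choose v hvc hvd hv using fun k : ℕ × ℕ × ℕ × ℕ => exists_val p c ((k.1 : ℤ) - k.2.2.1)
  have hcard : #(range (c + 1) ×ˢ range (p ^ c) ×ˢ range (p ^ c)) = (c + 1) * p ^ (2 * c) := by
    simp only [card_product, card_range]; ring
  rw [← hcard]
  have pcv : ∀ k, p ^ c = p ^ v k * p ^ (c - v k) := fun k => by
    rw [← pow_add, Nat.add_sub_cancel' (hvc k)]
  refine card_le_card_of_injOn
    (fun k => (v k, k.1, (k.2.2.1 / p ^ v k) * p ^ v k + k.2.2.2 / p ^ (c - v k))) ?_ ?_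
  · intro k hk
    simp only [coe_filter, mem_product, mem_range, Set.mem_ofPred_eq] at hk
    obtain ⟨⟨h1, h2, h3, h4⟩, -⟩ := hk
    simp only [coe_product, coe_range, Set.mem_prod, Set.mem_Iio]
    refine ⟨Nat.lt_succ_of_le (hvc k), h1, ?_⟩
    have e1 : k.2.2.1 / p ^ v k < p ^ (c - v k) := by
      rw [Nat.div_lt_iff_lt_mul (hpp _), mul_comm, ← pcv]; exact h3
    have e2 : k.2.2.2 / p ^ (c - v k) < p ^ v k := by
      rw [Nat.div_lt_iff_lt_mul (hpp _), ← pcv]; exact h4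
    calc _ < (k.2.2.1 / p ^ v k) * p ^ v k + p ^ v k := by omega
      _ = (k.2.2.1 / p ^ v k + 1) * p ^ v k := by ring
      _ ≤ p ^ (c - v k) * p ^ v k := Nat.mul_le_mul_right _ e1
      _ = p ^ c := by rw [mul_comm, ← pcv]
  · rintro ⟨x, z, y, w⟩ hk ⟨x', z', y', w'⟩ hk' he
    simp only [coe_filter, mem_product, mem_range, Set.mem_ofPred_eq] at hk hk'
    obtain ⟨⟨b1, b2, b3, b4⟩, g1, g2⟩ := hk
    obtain ⟨⟨b1', b2', b3', b4'⟩, g1', g2'⟩ := hk'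
    simp only [Prod.mk.injEq] at he
    obtain ⟨e1, rfl, e3⟩ := he
    have d1 := hvd (x, z, y, w)
    have d1' := hvd (x, z', y', w')
    have q1 := hv (x, z, y, w)
    have hc1 := hvc (x, z, y, w)
    have pc1 := pcv (x, z, y, w)
    rw [← e1] at d1' e3
    generalize v (x, z, y, w) = u at *
    simp only at *
    have f1 : w / p ^ (c - u) < p ^ u := by
      rw [Nat.div_lt_iff_lt_mul (hpp _), ← pc1]; exact b4
    have f2 : w' / p ^ (c - u) < p ^ u := by
      rw [Nat.div_lt_iff_lt_mul (hpp _), ← pc1]; exact b4'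
    have e4 : w / p ^ (c - u) = w' / p ^ (c - u) := by
      have := congrArg (· % p ^ u) e3
      simpa [Nat.add_mod, Nat.mod_eq_of_lt f1, Nat.mod_eq_of_lt f2] using this
    have e5 : y / p ^ u = y' / p ^ u := by
      rw [e4] at e3
      exact Nat.eq_of_mul_eq_mul_right (hpp u) (by omega)
    have e6 : y % p ^ u = y' % p ^ u := by
      have : (p : ℤ) ^ u ∣ (y : ℤ) - y' := by
        have := dvd_sub d1' d1
        exact this.trans (Eq.dvd (by ring))
      have := Int.emod_eq_emod_iff_emod_sub_eq_zero.2 (Int.emod_eq_zero_of_dvd this)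
      exact_mod_cast this
    have hy : y = y' := by
      rw [← Nat.div_add_mod y (p ^ u), ← Nat.div_add_mod y' (p ^ u), e5, e6]
    subst hy
    have lift := quad_lift hpZ hn2 hn3 hν ha c u hc1 q1 d1 g1 g2 g1' g2'
    have e7 : w % p ^ (c - u) = w' % p ^ (c - u) := by
      have := Int.emod_eq_emod_iff_emod_sub_eq_zero.2 (Int.emod_eq_zero_of_dvd lift)
      exact_mod_cast this
    have hw : w = w' := by
      rw [← Nat.div_add_mod w (p ^ (c - u)), ← Nat.div_add_mod w' (p ^ (c - u)), e4, e7]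
    subst hw
    have hz : (p : ℤ) ^ c ∣ (z : ℤ) - z' := by
      apply unit_dvd hpZ hn2 hν ha c (z + z')
      have := dvd_sub g1 g1'
      exact this.trans (Eq.dvd (by ring))
    have : z % p ^ c = z' % p ^ c := by
      have := Int.emod_eq_emod_iff_emod_sub_eq_zero.2 (Int.emod_eq_zero_of_dvd hz)
      exact_mod_cast this
    rw [Nat.mod_eq_of_lt b2, Nat.mod_eq_of_lt b2'] at this
    rw [this]

end CQ

namespace CQ
open MeasureTheory

section orthogonality

variable {X : Type*} [TopologicalSpace X] [CompactSpace X] [MeasurableSpace X]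
  [OpensMeasurableSpace X] (μ : Measure X) [IsFiniteMeasure μ] {κ : Type*}

local notation "conj" => starRingEnd ℂ

lemma norm_sum_pow_two (K : Finset κ) (f : κ → ℂ) :
    ((‖∑ k ∈ K, f k‖ ^ 2 : ℝ) : ℂ) = ∑ k ∈ K ×ˢ K, f k.1 * conj (f k.2) := by
  rw [Complex.ofReal_pow, ← Complex.mul_conj', map_sum, sum_mul_sum, sum_product]

lemma norm_sum_pow_four (K : Finset κ) (f : κ → ℂ) :
    ((‖∑ k ∈ K, f k‖ ^ 4 : ℝ) : ℂ) = ∑ k ∈ K ×ˢ K ×ˢ K ×ˢ K,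
      f k.1 * f k.2.1 * conj (f k.2.2.1) * conj (f k.2.2.2) := by
  have : ((‖∑ k ∈ K, f k‖ ^ 4 : ℝ) : ℂ) = (∑ k ∈ K, f k) * ((∑ k ∈ K, f k) *
      (conj (∑ k ∈ K, f k) * conj (∑ k ∈ K, f k))) := by
    have h := Complex.mul_conj' (∑ k ∈ K, f k)
    push_cast
    linear_combination (-((∑ k ∈ K, f k) * conj (∑ k ∈ K, f k)) - (‖∑ k ∈ K, f k‖ : ℂ) ^ 2) * h
  rw [this, map_sum, sum_mul_sum, ← sum_product', sum_mul_sum, ← sum_product', sum_mul_sum,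
    ← sum_product']
  refine sum_congr rfl fun k _ => by ring

lemma integral_pow_two_le {K : Finset κ} {f : κ → X → ℂ} (hf : ∀ k, Continuous (f k)) {Ψ : X → ℝ}
    (hΨ : Continuous Ψ) {M : ℝ}
    (hoff : ∀ i ∈ K, ∀ j ∈ K, i ≠ j → ∫ x, f i x * conj (f j x) * (Ψ x : ℂ) ∂μ = 0)
    (hM : ∀ i ∈ K, ∫ x, ‖f i x‖ ^ 2 * Ψ x ∂μ ≤ M) :
    ∫ x, ‖∑ k ∈ K, f k x‖ ^ 2 * Ψ x ∂μ ≤ #K * M := by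
  classical
  have key : ((∫ x, ‖∑ k ∈ K, f k x‖ ^ 2 * Ψ x ∂μ : ℝ) : ℂ) =
      ∑ k ∈ K, ((∫ x, ‖f k x‖ ^ 2 * Ψ x ∂μ : ℝ) : ℂ) := by
    rw [← integral_complex_ofReal]
    simp_rw [Complex.ofReal_mul, norm_sum_pow_two, sum_mul]
    rw [integral_finsetSum _ fun i _ => integrable_cont μ (by fun_prop), sum_product]
    refine sum_congr rfl fun i hi => ?_
    rw [sum_eq_single i (fun j hj hij => hoff i hi j hj hij.symm) (fun h => absurd hi h),
      ← integral_complex_ofReal]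
    simp_rw [Complex.mul_conj', Complex.ofReal_mul, Complex.ofReal_pow]
  have key2 : ∫ x, ‖∑ k ∈ K, f k x‖ ^ 2 * Ψ x ∂μ = ∑ k ∈ K, ∫ x, ‖f k x‖ ^ 2 * Ψ x ∂μ := by
    exact_mod_cast key
  rw [key2, ← nsmul_eq_mul]
  exact sum_le_card_nsmul _ _ _ hM

open Classical in
lemma integral_pow_four_le {K : Finset κ} {f : κ → X → ℂ} (hf : ∀ k, Continuous (f k))
    {Ψ : X → ℝ} (hΨ : Continuous Ψ) (hΨ0 : ∀ x, 0 ≤ Ψ x) {M : ℝ} (good : κ × κ × κ × κ → Prop)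
    (hoff : ∀ k ∈ K ×ˢ K ×ˢ K ×ˢ K, ¬ good k → ∫ x, f k.1 x * f k.2.1 x * conj (f k.2.2.1 x) *
      conj (f k.2.2.2 x) * (Ψ x : ℂ) ∂μ = 0)
    (hM : ∀ i ∈ K, ∫ x, ‖f i x‖ ^ 4 * Ψ x ∂μ ≤ M) :
    ∫ x, ‖∑ k ∈ K, f k x‖ ^ 4 * Ψ x ∂μ ≤ #((K ×ˢ K ×ˢ K ×ˢ K).filter good) * M := by
  have hI : ∀ i, Integrable (fun x => ‖f i x‖ ^ 4 * Ψ x) μ := fun i =>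
    integrable_cont μ (by fun_prop)
  have key : ((∫ x, ‖∑ k ∈ K, f k x‖ ^ 4 * Ψ x ∂μ : ℝ) : ℂ) =
      ∑ k ∈ (K ×ˢ K ×ˢ K ×ˢ K).filter good, ∫ x, f k.1 x * f k.2.1 x * conj (f k.2.2.1 x) *
      conj (f k.2.2.2 x) * (Ψ x : ℂ) ∂μ := by
    rw [← integral_complex_ofReal]
    simp_rw [Complex.ofReal_mul, norm_sum_pow_four, sum_mul]
    rw [integral_finsetSum _ fun i _ => integrable_cont μ (by fun_prop), sum_filter]
    refine sum_congr rfl fun k hk => ?_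
    split_ifs with h
    · rfl
    · exact hoff k hk h
  have hnn : 0 ≤ ∫ x, ‖∑ k ∈ K, f k x‖ ^ 4 * Ψ x ∂μ :=
    integral_nonneg fun x => mul_nonneg (by positivity) (hΨ0 x)
  have h1 : ∫ x, ‖∑ k ∈ K, f k x‖ ^ 4 * Ψ x ∂μ =
      ‖((∫ x, ‖∑ k ∈ K, f k x‖ ^ 4 * Ψ x ∂μ : ℝ) : ℂ)‖ := by
    rw [Complex.norm_real, Real.norm_of_nonneg hnn]
  rw [h1, key, ← nsmul_eq_mul]
  refine (norm_sum_le _ _).trans (sum_le_card_nsmul _ _ _ fun k hk => ?_)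
  obtain ⟨hk, -⟩ := mem_filter.1 hk
  simp only [mem_product] at hk
  obtain ⟨m1, m2, m3, m4⟩ := hk
  calc _ ≤ ∫ x, ‖f k.1 x * f k.2.1 x * conj (f k.2.2.1 x) * conj (f k.2.2.2 x) * (Ψ x : ℂ)‖ ∂μ :=
        norm_integral_le_integral_norm _
    _ ≤ ∫ x, (1 / 4 : ℝ) * (‖f k.1 x‖ ^ 4 * Ψ x + ‖f k.2.1 x‖ ^ 4 * Ψ x +
          ‖f k.2.2.1 x‖ ^ 4 * Ψ x + ‖f k.2.2.2 x‖ ^ 4 * Ψ x) ∂μ := by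
        refine integral_mono (integrable_cont μ (by fun_prop)) ?_ fun x => ?_
        · exact (((hI _).add (hI _)).add (hI _)).add (hI _) |>.const_mul _
        · simp only [norm_mul, RCLike.norm_conj, Complex.norm_real, Real.norm_of_nonneg (hΨ0 x)]
          rw [← add_mul, ← add_mul, ← add_mul, ← mul_assoc]
          refine mul_le_mul_of_nonneg_right ?_ (hΨ0 x)
          generalize ‖f k.1 x‖ = a
          generalize ‖f k.2.1 x‖ = b
          generalize ‖f k.2.2.1 x‖ = c
          generalize ‖f k.2.2.2 x‖ = d
          nlinarith [sq_nonneg (a * b - c * d), sq_nonneg (a ^ 2 - b ^ 2),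
            sq_nonneg (c ^ 2 - d ^ 2)]
    _ ≤ M := by
        rw [integral_const_mul, integral_add (integrable_cont μ (by fun_prop)) (hI _),
          integral_add (integrable_cont μ (by fun_prop)) (hI _), integral_add (hI _) (hI _)]
        linarith [hM _ m1, hM _ m2, hM _ m3, hM _ m4]

end orthogonality

/-- A character twist makes the integral vanish. -/
lemma integral_eq_zero_of_twist {G : Type*} [AddGroup G] [MeasurableSpace G] [MeasurableAdd G]
    (μ : Measure G) [μ.IsAddRightInvariant] {F : G → ℂ} (τ : G) {c : ℂ} (hc : c ≠ 1)
    (h : ∀ x, F (x + τ) = c * F x) : ∫ x, F x ∂μ = 0 := by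
  have h1 : ∫ x, F (x + τ) ∂μ = ∫ x, F x ∂μ := integral_add_right_eq_self F τ
  simp_rw [h] at h1
  rw [integral_const_mul] at h1
  have : (c - 1) * ∫ x, F x ∂μ = 0 := by linear_combination h1
  exact (mul_eq_zero.1 this).resolve_left (sub_ne_zero.2 hc)


/-- The three-dimensional torus. -/
abbrev G3 := 𝕋 × 𝕋 × 𝕋

instance : IsProbabilityMeasure (volume : Measure 𝕋) := ⟨by simp⟩

instance : (volume : Measure (𝕋 × 𝕋)).IsAddHaarMeasure := Measure.prod.instIsAddHaarMeasure _ _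

instance : (volume : Measure G3).IsAddHaarMeasure := Measure.prod.instIsAddHaarMeasure _ _

/-- The phase of the cubic moment curve. -/
noncomputable def ph (x : ℤ) (α : G3) : 𝕋 := x • α.1 + (x ^ 2) • α.2.1 + (x ^ 3) • α.2.2

/-- The Vinogradov exponential sum over a finite set of integers. -/
noncomputable def fS (S : Finset ℤ) (α : G3) : ℂ := ∑ x ∈ S, ee (ph x α)

@[fun_prop] lemma continuous_ph (x : ℤ) : Continuous (ph x) := by unfold ph; fun_prop

@[fun_prop] lemma continuous_fS (S : Finset ℤ) : Continuous (fS S) := by unfold fS; fun_prop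

lemma ph_add (x : ℤ) (α β : G3) : ph x (α + β) = ph x α + ph x β := by
  simp only [ph, Prod.fst_add, Prod.snd_add, smul_add]; abel

/-- The translation-dilation endomorphism. -/
noncomputable def tdHom (η q : ℤ) : G3 →+ G3 where
  toFun α := (q • α.1 + (2 * η * q) • α.2.1 + (3 * η ^ 2 * q) • α.2.2,
    (q ^ 2) • α.2.1 + (3 * η * q ^ 2) • α.2.2, (q ^ 3) • α.2.2)
  map_zero' := by simp
  map_add' α β := by
    ext <;> simp only [Prod.fst_add, Prod.snd_add, smul_add] <;> abel

lemma continuous_tdHom (η q : ℤ) : Continuous (tdHom η q) := by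
  show Continuous fun α : G3 => (_ : G3)
  simp only [tdHom, AddMonoidHom.coe_mk, ZeroHom.coe_mk]
  fun_prop

lemma exists_zsmul_eq (q : ℤ) (hq : q ≠ 0) (t : 𝕋) : ∃ u : 𝕋, q • u = t := by
  obtain ⟨x, rfl⟩ := QuotientAddGroup.mk_surjective t
  refine ⟨((x / q : ℝ) : 𝕋), ?_⟩
  rw [← AddCircle.coe_zsmul]
  congr 1
  simp only [zsmul_eq_mul]
  field_simp

lemma tdHom_surjective (η q : ℤ) (hq : q ≠ 0) : Function.Surjective (tdHom η q) := by
  rintro ⟨a, b, c⟩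
  obtain ⟨z, rfl⟩ := exists_zsmul_eq (q ^ 3) (pow_ne_zero 3 hq) c
  obtain ⟨y, hy⟩ := exists_zsmul_eq (q ^ 2) (pow_ne_zero 2 hq) (b - (3 * η * q ^ 2) • z)
  obtain ⟨x, hx⟩ := exists_zsmul_eq q hq (a - (2 * η * q) • y - (3 * η ^ 2 * q) • z)
  refine ⟨(x, y, z), ?_⟩
  simp [tdHom, hx, hy]
  abel

lemma measurePreserving_tdHom (η q : ℤ) (hq : q ≠ 0) :
    MeasurePreserving (tdHom η q) volume volume :=
  AddMonoidHom.measurePreserving (continuous_tdHom η q) (tdHom_surjective η q hq) rfl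

lemma ph_tdHom (η q x : ℤ) (α : G3) : ph (η + q * x) α = ph η α + ph x (tdHom η q α) := by
  simp only [ph, tdHom, AddMonoidHom.coe_mk, ZeroHom.coe_mk]
  module

/-- Translation-dilation invariance of mean values. -/
lemma integral_fS_image (S : Finset ℤ) (η q : ℤ) (hq : q ≠ 0) (k : ℕ) :
    ∫ α, ‖fS (S.image fun x => η + q * x) α‖ ^ k = ∫ α, ‖fS S α‖ ^ k := by
  have h1 : ∀ α, ‖fS (S.image fun x => η + q * x) α‖ = ‖fS S (tdHom η q α)‖ := by
    intro α
    rw [fS, sum_image (fun x _ y _ h => by simpa [hq] using h)]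
    simp_rw [ph_tdHom, ee_add, ← mul_sum]
    rw [norm_mul, norm_ee, one_mul, fS]
  simp_rw [h1]
  have mp := measurePreserving_tdHom η q hq
  have h2 := integral_map (f := fun α => ‖fS S α‖ ^ k) mp.aemeasurable
    (by fun_prop : Continuous fun α => ‖fS S α‖ ^ k).aestronglyMeasurable
  rw [← h2, mp.map_eq]

end CQ

namespace CQ
open MeasureTheory

/-- The elements of `I` congruent to `ξ` modulo `q`. -/
def cls (I : Finset ℤ) (q ξ : ℤ) : Finset ℤ := I.filter fun x => q ∣ x - ξ

lemma mem_cls {I : Finset ℤ} {q ξ x : ℤ} : x ∈ cls I q ξ ↔ x ∈ I ∧ q ∣ x - ξ := by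
  simp [cls]

lemma sum_cls {E : Type*} [AddCommMonoid E] (I : Finset ℤ) {q : ℤ} {r : ℕ} (hq : 0 < q)
    (hr : 0 < r) (ξ : ℤ) (f : ℤ → E) :
    ∑ x ∈ cls I q ξ, f x = ∑ k ∈ range r, ∑ x ∈ cls I (q * r) (ξ + q * k), f x := by
  have hr' : (0 : ℤ) < r := by exact_mod_cast hr
  rw [← sum_fiberwise_of_maps_to (t := range r) (g := fun x => (((x - ξ) / q) % r).toNat)]
  · refine sum_congr rfl fun k hk => sum_congr ?_ fun _ _ => rfl
    have hk := mem_range.1 hk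
    ext x
    simp only [mem_filter, mem_cls, and_assoc]
    refine and_congr_right fun _ => ?_
    constructor
    · rintro ⟨⟨m, hm⟩, h⟩
      rw [hm, Int.mul_ediv_cancel_left _ hq.ne'] at h
      have h1 : m % r = k := by
        have := Int.emod_nonneg m hr'.ne'
        omega
      refine ⟨m / r, ?_⟩
      have := Int.emod_add_mul_ediv m r
      rw [h1] at this
      linear_combination hm - q * this
    · rintro ⟨m, hm⟩
      have e : x - ξ = q * (k + r * m) := by linarith
      refine ⟨⟨_, e⟩, ?_⟩
      rw [e, Int.mul_ediv_cancel_left _ hq.ne', Int.add_mul_emod_self_left,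
        Int.emod_eq_of_lt (by omega) (by omega)]
      simp
  · intro x _
    simp only [mem_range]
    have := Int.emod_nonneg ((x - ξ) / q) hr'.ne'
    have := Int.emod_lt_of_pos ((x - ξ) / q) hr'
    omega

lemma zsmul_inv_eq_zero {m : ℤ} (hm : m ≠ 0) (n : ℤ) :
    n • (((1 : ℝ) / m : ℝ) : 𝕋) = 0 ↔ m ∣ n := by
  rw [← AddCircle.coe_zsmul, AddCircle.coe_eq_zero_iff]
  have hm' : (m : ℝ) ≠ 0 := by exact_mod_cast hm
  constructor
  · rintro ⟨k, hk⟩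
    refine ⟨k, ?_⟩
    simp only [zsmul_eq_mul, mul_one, mul_one_div] at hk
    rw [eq_div_iff hm'] at hk
    have : k * m = n := by exact_mod_cast hk
    linarith
  · rintro ⟨k, rfl⟩
    refine ⟨k, ?_⟩
    simp only [zsmul_eq_mul, mul_one, mul_one_div, Int.cast_mul]
    field_simp

lemma zsmul_inv_congr {m : ℤ} (hm : m ≠ 0) {n n' : ℤ} (h : m ∣ n - n') :
    n • (((1 : ℝ) / m : ℝ) : 𝕋) = n' • (((1 : ℝ) / m : ℝ) : 𝕋) := by
  rw [← sub_eq_zero, ← sub_smul, zsmul_inv_eq_zero hm]; exact h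

lemma fS_add_of_const {S : Finset ℤ} {τ : G3} {θ : 𝕋} (h : ∀ x ∈ S, ph x τ = θ) (α : G3) :
    fS S (α + τ) = ee θ * fS S α := by
  rw [fS, fS, mul_sum]
  refine sum_congr rfl fun x hx => ?_
  rw [ph_add, ee_add, h x hx, mul_comm]

lemma norm_fS_add_of_const {S : Finset ℤ} {τ : G3} {θ : 𝕋} (h : ∀ x ∈ S, ph x τ = θ) (α : G3) :
    ‖fS S (α + τ)‖ = ‖fS S α‖ := by
  rw [fS_add_of_const h, norm_mul, norm_ee, one_mul]

/-- A shift detecting `A (x - η)^3 + B (x - η)^2`. -/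
noncomputable def shift3 (A B η : ℤ) (t : 𝕋) : G3 :=
  ((3 * A * η ^ 2 - 2 * B * η) • t, (B - 3 * A * η) • t, A • t)

lemma ph_shift3 (A B η x : ℤ) (t : 𝕋) : ph x (shift3 A B η t) =
    (A * (x - η) ^ 3 + B * (x - η) ^ 2 + (A * η ^ 3 - B * η ^ 2)) • t := by
  simp only [ph, shift3, smul_smul, ← add_smul]
  congr 1
  ring

lemma two_term_vanish {S T U : Finset ℤ} {τ : G3} {θ φ ψ : 𝕋} (hS : ∀ x ∈ S, ph x τ = θ)
    (hT : ∀ x ∈ T, ph x τ = φ) (hU : ∀ x ∈ U, ph x τ = ψ) (k : ℕ) (h : θ - φ ≠ 0) :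
    ∫ α, fS S α * (starRingEnd ℂ) (fS T α) * ((‖fS U α‖ ^ k : ℝ) : ℂ) = 0 := by
  refine integral_eq_zero_of_twist _ τ (c := ee (θ - φ)) (mt (ee_eq_one_iff _).1 h) fun α => ?_
  rw [fS_add_of_const hS, fS_add_of_const hT, norm_fS_add_of_const hU, ee_sub, map_mul]
  ring

lemma four_term_vanish {S : Fin 4 → Finset ℤ} {U : Finset ℤ} {τ : G3} {θ : Fin 4 → 𝕋} {ψ : 𝕋}
    (hS : ∀ i, ∀ x ∈ S i, ph x τ = θ i) (hU : ∀ x ∈ U, ph x τ = ψ) (k : ℕ)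
    (h : θ 0 + θ 1 - θ 2 - θ 3 ≠ 0) :
    ∫ α, fS (S 0) α * fS (S 1) α * (starRingEnd ℂ) (fS (S 2) α) * (starRingEnd ℂ) (fS (S 3) α)
      * ((‖fS U α‖ ^ k : ℝ) : ℂ) = 0 := by
  refine integral_eq_zero_of_twist _ τ (c := ee (θ 0 + θ 1 - θ 2 - θ 3))
    (mt (ee_eq_one_iff _).1 h) fun α => ?_
  simp only [fS_add_of_const (hS _), norm_fS_add_of_const hU, ee_sub, ee_add, map_mul]
  ring

/-- Mixed mean values `∫ |f_a(ξ)|^k |f_b(η)|^l`. -/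
noncomputable def mixI (I : Finset ℤ) (p : ℤ) (k l a b : ℕ) (ξ η : ℤ) : ℝ :=
  ∫ α, ‖fS (cls I (p ^ a) ξ) α‖ ^ k * ‖fS (cls I (p ^ b) η) α‖ ^ l

lemma fS_cls (I : Finset ℤ) {p a m : ℕ} (hp : 0 < p) (ham : a ≤ m) (ξ : ℤ) (α : G3) :
    fS (cls I ((p : ℤ) ^ a) ξ) α =
      ∑ k ∈ range (p ^ (m - a)), fS (cls I ((p : ℤ) ^ m) (ξ + (p : ℤ) ^ a * k)) α := by
  have hp' : (0 : ℤ) < p := by exact_mod_cast hp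
  have := sum_cls I (q := (p : ℤ) ^ a) (r := p ^ (m - a)) (by positivity) (by positivity) ξ
    (fun x => ee (ph x α))
  rw [fS, this]
  refine sum_congr rfl fun k _ => ?_
  push_cast
  rw [← pow_add, Nat.add_sub_cancel' ham, fS]

lemma mixI_two_le (I : Finset ℤ) {p : ℕ} (hp : p.Prime) (hp3 : 3 < p) {a b : ℕ} (ha : 1 ≤ a)
    (hab : a ≤ 3 * b) {ξ η : ℤ} (h : ¬ (p : ℤ) ∣ ξ - η) {M : ℝ}
    (hM : ∀ ξ', ¬ (p : ℤ) ∣ ξ' - η → mixI I p 2 10 (3 * b) b ξ' η ≤ M) :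
    mixI I p 2 10 a b ξ η ≤ (p : ℝ) ^ (3 * b - a) * M := by
  have hpZ : Prime (p : ℤ) := Nat.prime_iff_prime_int.1 hp
  have hn3 : ¬ (p : ℤ) ∣ 3 := by
    intro h; have := Int.le_of_dvd (by norm_num) h; omega
  have hp0 : (p : ℤ) ≠ 0 := hpZ.ne_zero
  have hpa : (p : ℤ) ∣ (p : ℤ) ^ a := dvd_pow_self _ (by omega)
  have key := integral_pow_two_le (volume : Measure G3) (K := range (p ^ (3 * b - a)))
    (f := fun k => fS (cls I ((p : ℤ) ^ (3 * b)) (ξ + (p : ℤ) ^ a * k)))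
    (fun k => by fun_prop) (Ψ := fun α => ‖fS (cls I ((p : ℤ) ^ b) η) α‖ ^ 10) (by fun_prop)
    (M := M) ?_ ?_
  · rw [mixI]
    simp_rw [fS_cls I hp.pos hab ξ]
    simpa using key
  · intro i hi j hj hij
    have h3 := pow_ne_zero (3 * b) hp0
    have hcl : ∀ k : ℕ, ∀ x ∈ cls I ((p : ℤ) ^ (3 * b)) (ξ + (p : ℤ) ^ a * k),
        ph x (shift3 1 0 η (((1 : ℝ) / ((p : ℤ) ^ (3 * b) : ℤ) : ℝ) : 𝕋)) =
        ((ξ + (p : ℤ) ^ a * k - η) ^ 3 + η ^ 3) • (((1 : ℝ) / ((p : ℤ) ^ (3 * b) : ℤ) : ℝ) : 𝕋) := by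
      intro k x hx
      obtain ⟨m, hm⟩ := (mem_cls.1 hx).2
      rw [ph_shift3]
      apply zsmul_inv_congr h3
      have : x = (p : ℤ) ^ (3 * b) * m + (ξ + (p : ℤ) ^ a * k) := by linarith
      rw [this]
      generalize ξ + (p : ℤ) ^ a * k = y
      generalize (p : ℤ) ^ (3 * b) = q
      exact ⟨m * ((q * m + y - η) ^ 2 + (q * m + y - η) * (y - η) + (y - η) ^ 2), by ring⟩
    refine two_term_vanish (hcl i) (hcl j)
      (ψ := η ^ 3 • (((1 : ℝ) / ((p : ℤ) ^ (3 * b) : ℤ) : ℝ) : 𝕋)) ?_ 10 ?_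
    · intro x hx
      obtain ⟨m, hm⟩ := (mem_cls.1 hx).2
      rw [ph_shift3]
      apply zsmul_inv_congr h3
      rw [hm]
      exact ⟨m ^ 3, by ring⟩
    · rw [← sub_smul, Ne, zsmul_inv_eq_zero h3]
      intro hd
      apply hij
      have e : (ξ + (p : ℤ) ^ a * i - η) ^ 3 + η ^ 3 - ((ξ + (p : ℤ) ^ a * j - η) ^ 3 + η ^ 3) =
        ((ξ + (p : ℤ) ^ a * i - η) ^ 2 + (ξ + (p : ℤ) ^ a * i - η) * (ξ + (p : ℤ) ^ a * j - η) +
          (ξ + (p : ℤ) ^ a * j - η) ^ 2) * ((p : ℤ) ^ a * (i - j)) := by ring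
      rw [e] at hd
      have hu : ¬ (p : ℤ) ∣ ((ξ + (p : ℤ) ^ a * i - η) ^ 2 +
          (ξ + (p : ℤ) ^ a * i - η) * (ξ + (p : ℤ) ^ a * j - η) +
          (ξ + (p : ℤ) ^ a * j - η) ^ 2) := by
        intro hu
        have h5 : (p : ℤ) ∣ 3 * ((ξ - η) * (ξ - η)) := by
          obtain ⟨r, hr⟩ := hpa
          obtain ⟨s, hs⟩ := hu
          rw [hr] at hs
          refine ⟨s - (r * (2 * (ξ - η) * i + (ξ - η) * j + (ξ - η) * i + 2 * (ξ - η) * j) +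
            p * r ^ 2 * (i ^ 2 + i * j + j ^ 2)), ?_⟩
          linear_combination hs
        exact h ((hpZ.dvd_or_dvd ((hpZ.dvd_or_dvd h5).resolve_left hn3)).elim id id)
      have h6 := IsCoprime.dvd_of_dvd_mul_left
        (IsCoprime.pow_left (m := 3 * b) ((Prime.coprime_iff_not_dvd hpZ).2 hu)) hd
      have h7 : (p : ℤ) ^ (3 * b - a) ∣ (i : ℤ) - j := by
        rw [← Nat.add_sub_cancel' hab, pow_add] at h6
        exact (mul_dvd_mul_iff_left (pow_ne_zero a hp0)).1 h6
      have h8 := Int.emod_eq_emod_iff_emod_sub_eq_zero.2 (Int.emod_eq_zero_of_dvd h7)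
      have h9 : i % p ^ (3 * b - a) = j % p ^ (3 * b - a) := by exact_mod_cast h8
      rwa [Nat.mod_eq_of_lt (mem_range.1 hi), Nat.mod_eq_of_lt (mem_range.1 hj)] at h9
  · intro i _
    refine hM _ fun hd => h ?_
    have := dvd_sub hd (hpa.mul_right (i : ℤ))
    exact this.trans (Eq.dvd (by ring))


lemma mixI_four_le (I : Finset ℤ) {p : ℕ} (hp : p.Prime) (hp3 : 3 < p) {a b : ℕ} (ha : 1 ≤ a)
    (hab : a ≤ b) {ξ η : ℤ} (h : ¬ (p : ℤ) ∣ ξ - η) {M : ℝ} (hM0 : 0 ≤ M)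
    (hM : ∀ ξ', ¬ (p : ℤ) ∣ ξ' - η → mixI I p 4 8 (2 * b - a) b ξ' η ≤ M) :
    mixI I p 4 8 a b ξ η ≤ (2 * (b - a) + 1 : ℕ) * (p : ℝ) ^ (4 * (b - a)) * M := by
  classical
  have hpZ : Prime (p : ℤ) := Nat.prime_iff_prime_int.1 hp
  have hp0 : (p : ℤ) ≠ 0 := hpZ.ne_zero
  have hpa : (p : ℤ) ∣ (p : ℤ) ^ a := dvd_pow_self _ (by omega)
  set c := 2 * (b - a) with hc
  set m := 2 * b - a with hm
  have hma : m - a = c := by omega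
  have key := integral_pow_four_le (volume : Measure G3) (K := range (p ^ c))
    (f := fun k => fS (cls I ((p : ℤ) ^ m) (ξ + (p : ℤ) ^ a * k)))
    (fun k => by fun_prop) (Ψ := fun α => ‖fS (cls I ((p : ℤ) ^ b) η) α‖ ^ 8) (by fun_prop)
    (fun _ => by positivity) (M := M) (GoodQuad p a c (ξ - η)) ?_ ?_
  · rw [mixI]
    simp_rw [fS_cls I hp.pos (show a ≤ m by omega) ξ, hma]
    refine key.trans (mul_le_mul_of_nonneg_right ?_ hM0)
    rw [show 4 * (b - a) = 2 * c by omega]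
    exact_mod_cast card_goodQuad hp hp3 h ha c
  · rintro ⟨k0, k1, k2, k3⟩ - hk
    have hm0 := pow_ne_zero m hp0
    have h2b := pow_ne_zero (2 * b) hp0
    obtain ⟨y, hy⟩ : ∃ y : Fin 4 → ℤ, y = ![(k0 : ℤ), k1, k2, k3] := ⟨_, rfl⟩
    rw [GoodQuad, not_and_or] at hk
    simp only at hk ⊢
    have case (A B : ℤ) (q : ℤ) (hq : q ≠ 0)
        (hcl : ∀ z w : ℤ, q ∣ A * (ξ + (p : ℤ) ^ a * z + (p : ℤ) ^ m * w - η) ^ 3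
          + B * (ξ + (p : ℤ) ^ a * z + (p : ℤ) ^ m * w - η) ^ 2
          - (A * (ξ + (p : ℤ) ^ a * z - η) ^ 3 + B * (ξ + (p : ℤ) ^ a * z - η) ^ 2))
        (hU : ∀ z, q ∣ A * ((p : ℤ) ^ b * z) ^ 3 + B * ((p : ℤ) ^ b * z) ^ 2)
        (hne : ¬ q ∣ A * ((ξ + (p : ℤ) ^ a * k0 - η) ^ 3 + (ξ + (p : ℤ) ^ a * k1 - η) ^ 3
          - (ξ + (p : ℤ) ^ a * k2 - η) ^ 3 - (ξ + (p : ℤ) ^ a * k3 - η) ^ 3)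
          + B * ((ξ + (p : ℤ) ^ a * k0 - η) ^ 2 + (ξ + (p : ℤ) ^ a * k1 - η) ^ 2
          - (ξ + (p : ℤ) ^ a * k2 - η) ^ 2 - (ξ + (p : ℤ) ^ a * k3 - η) ^ 2)) :
        ∫ α, fS (cls I ((p : ℤ) ^ m) (ξ + (p : ℤ) ^ a * k0)) α *
          fS (cls I ((p : ℤ) ^ m) (ξ + (p : ℤ) ^ a * k1)) α *
          (starRingEnd ℂ) (fS (cls I ((p : ℤ) ^ m) (ξ + (p : ℤ) ^ a * k2)) α) *
          (starRingEnd ℂ) (fS (cls I ((p : ℤ) ^ m) (ξ + (p : ℤ) ^ a * k3)) α) *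
          ((‖fS (cls I ((p : ℤ) ^ b) η) α‖ ^ 8 : ℝ) : ℂ) = 0 := by
      set t : 𝕋 := (((1 : ℝ) / (q : ℤ) : ℝ) : 𝕋) with ht
      have := four_term_vanish (S := fun i => cls I ((p : ℤ) ^ m) (ξ + (p : ℤ) ^ a * y i))
        (U := cls I ((p : ℤ) ^ b) η) (τ := shift3 A B η t)
        (θ := fun i => (A * (ξ + (p : ℤ) ^ a * y i - η) ^ 3 + B * (ξ + (p : ℤ) ^ a * y i - η) ^ 2
          + (A * η ^ 3 - B * η ^ 2)) • t) (ψ := (A * η ^ 3 - B * η ^ 2) • t) ?_ ?_ 8 ?_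
      · simpa [hy] using this
      · intro i x hx
        obtain ⟨w, hw⟩ := (mem_cls.1 hx).2
        rw [ph_shift3]
        apply zsmul_inv_congr hq
        have : x = ξ + (p : ℤ) ^ a * y i + (p : ℤ) ^ m * w := by linarith
        rw [this]
        exact (hcl (y i) w).trans (Eq.dvd (by ring))
      · intro x hx
        obtain ⟨w, hw⟩ := (mem_cls.1 hx).2
        rw [ph_shift3]
        apply zsmul_inv_congr hq
        rw [hw]
        exact (hU w).trans (Eq.dvd (by ring))
      · rw [← add_smul, ← sub_smul, ← sub_smul, Ne, zsmul_inv_eq_zero hq]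
        refine fun hd => hne (hd.trans (Eq.dvd ?_))
        simp only [hy, Matrix.cons_val]
        ring
    have hmm : (p : ℤ) ^ m = (p : ℤ) ^ a * (p : ℤ) ^ c := by
      rw [← pow_add]; congr 1; omega
    have h2bb : (p : ℤ) ^ (2 * b) = (p : ℤ) ^ a * ((p : ℤ) ^ a * (p : ℤ) ^ c) := by
      rw [← pow_add, ← pow_add]; congr 1; omega
    have hpb : (p : ℤ) ^ (2 * b) = (p : ℤ) ^ b * (p : ℤ) ^ b := by
      rw [← pow_add]; congr 1; omega
    have hpb' : (p : ℤ) ^ (2 * b) = (p : ℤ) ^ m * (p : ℤ) ^ a := by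
      rw [← pow_add]; congr 1; omega
    rcases hk with hk | hk
    · refine case 0 1 ((p : ℤ) ^ m) hm0 ?_ ?_ ?_
      · intro z w
        exact ⟨w * (2 * (ξ + (p : ℤ) ^ a * z - η) + (p : ℤ) ^ m * w), by ring⟩
      · intro z
        refine (pow_dvd_pow (p : ℤ) (show m ≤ 2 * b by omega)).trans ?_
        rw [hpb]
        exact ⟨z ^ 2, by ring⟩
      · rw [hmm]
        intro hd
        apply hk
        have hd2 : (p : ℤ) ^ a * (p : ℤ) ^ c ∣ (p : ℤ) ^ a * (2 * (ξ - η) *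
          ((k0 : ℤ) + k1 - k2 - k3) + (p : ℤ) ^ a * ((k0 : ℤ) ^ 2 + (k1 : ℤ) ^ 2 - (k2 : ℤ) ^ 2 -
          (k3 : ℤ) ^ 2)) := hd.trans (Eq.dvd (by ring))
        exact (mul_dvd_mul_iff_left (pow_ne_zero a hp0)).1 hd2
    · refine case 2 (-3 * (ξ - η)) ((p : ℤ) ^ (2 * b)) h2b ?_ ?_ ?_
      · intro z w
        have e : ∀ u v : ℤ, 2 * (u + (p : ℤ) ^ m * w) ^ 3 + (-3 * v) * (u + (p : ℤ) ^ m * w) ^ 2 -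
          (2 * u ^ 3 + (-3 * v) * u ^ 2) = 6 * u * (u - v) * w * (p : ℤ) ^ m +
          (3 * (2 * u - v) + 2 * (p : ℤ) ^ m * w) * w ^ 2 * ((p : ℤ) ^ m * (p : ℤ) ^ m) := by
          intro u v; ring
        have e2 := e (ξ + (p : ℤ) ^ a * z - η) (ξ - η)
        rw [show ξ + (p : ℤ) ^ a * z - η + (p : ℤ) ^ m * w =
          ξ + (p : ℤ) ^ a * z + (p : ℤ) ^ m * w - η by ring] at e2
        rw [e2]
        apply dvd_add
        · rw [hpb']
          exact ⟨6 * (ξ + (p : ℤ) ^ a * z - η) * z * w, by ring⟩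
        · apply Dvd.dvd.mul_left
          rw [← pow_add]
          exact pow_dvd_pow _ (by omega)
      · intro z
        rw [hpb]
        exact ⟨2 * (p : ℤ) ^ b * z ^ 3 - 3 * (ξ - η) * z ^ 2, by ring⟩
      · rw [h2bb]
        intro hd
        apply hk
        have hd2 : (p : ℤ) ^ a * ((p : ℤ) ^ a * (p : ℤ) ^ c) ∣ (p : ℤ) ^ a * ((p : ℤ) ^ a *
          (3 * (ξ - η) * ((k0 : ℤ) ^ 2 + (k1 : ℤ) ^ 2 - (k2 : ℤ) ^ 2 - (k3 : ℤ) ^ 2) +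
            2 * (p : ℤ) ^ a * ((k0 : ℤ) ^ 3 + (k1 : ℤ) ^ 3 - (k2 : ℤ) ^ 3 - (k3 : ℤ) ^ 3))) :=
          hd.trans (Eq.dvd (by ring))
        exact (mul_dvd_mul_iff_left (pow_ne_zero a hp0)).1
          ((mul_dvd_mul_iff_left (pow_ne_zero a hp0)).1 hd2)
  · intro i _
    refine hM _ fun hd => h ?_
    have := dvd_sub hd (hpa.mul_right (i : ℤ))
    exact this.trans (Eq.dvd (by ring))

/-- The twelfth moment of an exponential sum over a set of integers. -/
noncomputable def M12 (S : Finset ℤ) : ℝ := ∫ α, ‖fS S α‖ ^ 12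

lemma M12_nonneg (S : Finset ℤ) : 0 ≤ M12 S := integral_nonneg fun _ => by positivity

lemma norm_fS_le (S : Finset ℤ) (α : G3) : ‖fS S α‖ ≤ #S := by
  refine (norm_sum_le _ _).trans ?_
  simp

instance : IsProbabilityMeasure (volume : Measure (𝕋 × 𝕋)) :=
  Measure.prod.instIsProbabilityMeasure _ _

instance : IsProbabilityMeasure (volume : Measure G3) :=
  Measure.prod.instIsProbabilityMeasure _ _

lemma M12_le_card (S : Finset ℤ) : M12 S ≤ (#S : ℝ) ^ 12 := by
  calc M12 S ≤ ∫ _ : G3, (#S : ℝ) ^ 12 := by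
        refine integral_mono (integrable_cont _ (by fun_prop)) (integrable_const _) fun α => ?_
        exact pow_le_pow_left₀ (norm_nonneg _) (norm_fS_le S α) 12
    _ = _ := by simp

lemma norm_sum_pow_twelve (p : ℕ) (z : ℕ → ℂ) :
    ‖∑ k ∈ range p, z k‖ ^ 12 ≤ 2 ^ 12 * ∑ k ∈ range p, ‖z k‖ ^ 12 + (2 * p : ℝ) ^ 12 *
      ∑ k ∈ range p, ∑ l ∈ (range p).erase k, ‖z k‖ ^ 4 * ‖z l‖ ^ 8 := by
  rcases Nat.eq_zero_or_pos p with rfl | hp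
  · simp
  have hnn : 0 ≤ ∑ k ∈ range p, ∑ l ∈ (range p).erase k, ‖z k‖ ^ 4 * ‖z l‖ ^ 8 :=
    sum_nonneg fun _ _ => sum_nonneg fun _ _ => by positivity
  obtain ⟨l, hl, hmax⟩ := exists_max_image (range p) (fun k => ‖z k‖) ⟨0, by simpa using hp⟩
  have hl12 : ‖z l‖ ^ 12 ≤ ∑ k ∈ range p, ‖z k‖ ^ 12 :=
    single_le_sum (f := fun k => ‖z k‖ ^ 12) (fun _ _ => by positivity) hl
  have hsplit : ‖∑ k ∈ range p, z k‖ ≤ ‖z l‖ + ∑ k ∈ (range p).erase l, ‖z k‖ := by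
    rw [← add_sum_erase _ _ hl]
    exact (norm_add_le _ _).trans (add_le_add le_rfl (norm_sum_le _ _))
  rcases ((range p).erase l).eq_empty_or_nonempty with he | hne
  · rw [he, sum_empty, add_zero] at hsplit
    calc _ ≤ ‖z l‖ ^ 12 := pow_le_pow_left₀ (norm_nonneg _) hsplit 12
      _ ≤ 2 ^ 12 * ∑ k ∈ range p, ‖z k‖ ^ 12 := by linarith [norm_nonneg (z l), pow_nonneg (norm_nonneg (z l)) 12]
      _ ≤ _ := le_add_of_nonneg_right (by positivity)
  · obtain ⟨m, hm, hmmax⟩ := exists_max_image _ (fun k => ‖z k‖) hne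
    have hs2 : ∑ k ∈ (range p).erase l, ‖z k‖ ≤ p * ‖z m‖ := by
      refine (sum_le_card_nsmul _ _ _ hmmax).trans ?_
      rw [nsmul_eq_mul]
      refine mul_le_mul_of_nonneg_right ?_ (norm_nonneg _)
      exact_mod_cast (card_le_card (erase_subset _ _)).trans (by simp)
    rcases le_total (p * ‖z m‖) ‖z l‖ with h | h
    · have : ‖∑ k ∈ range p, z k‖ ≤ 2 * ‖z l‖ := by linarith
      calc _ ≤ (2 * ‖z l‖) ^ 12 := pow_le_pow_left₀ (norm_nonneg _) this 12
        _ = 2 ^ 12 * ‖z l‖ ^ 12 := by ring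
        _ ≤ 2 ^ 12 * ∑ k ∈ range p, ‖z k‖ ^ 12 := by linarith
        _ ≤ _ := le_add_of_nonneg_right (by positivity)
    · have : ‖∑ k ∈ range p, z k‖ ≤ 2 * p * ‖z m‖ := by linarith
      have hml : ‖z m‖ ≤ ‖z l‖ := hmax m (mem_of_mem_erase hm)
      have hmr := mem_of_mem_erase hm
      have hlm : l ∈ (range p).erase m := mem_erase.2 ⟨(ne_of_mem_erase hm).symm, hl⟩
      calc _ ≤ (2 * p * ‖z m‖) ^ 12 := pow_le_pow_left₀ (norm_nonneg _) this 12
        _ = (2 * p) ^ 12 * (‖z m‖ ^ 4 * ‖z m‖ ^ 8) := by ring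
        _ ≤ (2 * p) ^ 12 * (‖z m‖ ^ 4 * ‖z l‖ ^ 8) := by gcongr
        _ ≤ (2 * p) ^ 12 * ∑ k ∈ range p, ∑ l ∈ (range p).erase k, ‖z k‖ ^ 4 * ‖z l‖ ^ 8 := by
            refine mul_le_mul_of_nonneg_left ?_ (by positivity)
            refine le_trans ?_ (single_le_sum (f := fun k => ∑ l ∈ (range p).erase k,
              ‖z k‖ ^ 4 * ‖z l‖ ^ 8) (fun _ _ => sum_nonneg fun _ _ => by positivity) hmr)
            exact single_le_sum (f := fun l => ‖z m‖ ^ 4 * ‖z l‖ ^ 8)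
              (fun _ _ => by positivity) hlm
        _ ≤ _ := le_add_of_nonneg_left
            (mul_nonneg (by norm_num) (sum_nonneg fun _ _ => by positivity))

/-- The bound `M12 ≤ e^κ X^E` over all intervals. -/
def Vin (κ E : ℝ) : Prop :=
  ∀ (N : ℤ) (X : ℕ), 1 ≤ X → M12 (Ioc N (N + X)) ≤ Real.exp (κ + E * Real.log X)

lemma Vin.mono {κ E E' : ℝ} (h : Vin κ E) (hE : E ≤ E') : Vin κ E' := fun N X hX =>
  (h N X hX).trans <| Real.exp_le_exp.2 <| by
    have := Real.log_nonneg (show (1 : ℝ) ≤ X by exact_mod_cast hX)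
    gcongr

lemma cls_Ioc (M N : ℤ) {q : ℤ} (hq : 0 < q) (η : ℤ) :
    cls (Ioc M N) q η = (Ioc ((M - η) / q) ((N - η) / q)).image fun x => η + q * x := by
  ext x
  simp only [mem_cls, mem_Ioc, mem_image]
  constructor
  · rintro ⟨⟨h1, h2⟩, m, hm⟩
    refine ⟨m, ⟨?_, ?_⟩, by linarith⟩
    · rw [Int.ediv_lt_iff_lt_mul hq]; linarith
    · rw [Int.le_ediv_iff_mul_le hq]; linarith
  · rintro ⟨m, ⟨h1, h2⟩, rfl⟩
    rw [Int.ediv_lt_iff_lt_mul hq] at h1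
    rw [Int.le_ediv_iff_mul_le hq] at h2
    exact ⟨⟨by linarith, by linarith⟩, m, by ring⟩

lemma Vin.cls {κ E : ℝ} (h : Vin κ E) (hE : 0 ≤ E) (N : ℤ) (X : ℕ) {q : ℕ} (hq : 0 < q)
    (hqX : q ≤ X) (η : ℤ) : M12 (cls (Ioc N (N + X)) q η) ≤
      Real.exp (κ + E * (Real.log 2 + Real.log X - Real.log q)) := by
  have hq' : (0 : ℤ) < q := by exact_mod_cast hq
  rw [cls_Ioc _ _ hq', M12, integral_fS_image _ _ _ hq'.ne']
  set A := (N - η) / (q : ℤ)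
  set B := (N + X - η) / (q : ℤ)
  have hlen : ((B - A) * q : ℤ) ≤ 2 * X := by
    have h1 : B * q ≤ N + X - η := Int.ediv_mul_le _ hq'.ne'
    have h2 : N - η < A * q + q := Int.lt_ediv_add_one_mul_self _ hq' |>.trans_eq (by ring)
    have h3 : (q : ℤ) ≤ X := by exact_mod_cast hqX
    nlinarith
  rcases le_or_gt B A with hBA | hBA
  · rw [Ioc_eq_empty (not_lt.2 hBA)]
    simp only [fS, sum_empty, norm_zero, ne_eq, OfNat.ofNat_ne_zero, not_false_eq_true, zero_pow,
      integral_zero]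
    positivity
  · obtain ⟨L, hL⟩ : ∃ L : ℕ, (L : ℤ) = B - A := ⟨(B - A).toNat, by omega⟩
    have hL1 : 1 ≤ L := by omega
    have := h A L hL1
    rw [hL, add_sub_cancel] at this
    refine this.trans (Real.exp_le_exp.2 ?_)
    have hL0 : (0 : ℝ) < L := by exact_mod_cast hL1
    have hX0 : (0 : ℝ) < X := by exact_mod_cast hq.trans_le hqX
    have hq0 : (0 : ℝ) < q := by exact_mod_cast hq
    have : Real.log L ≤ Real.log 2 + Real.log X - Real.log q := by
      rw [le_sub_iff_add_le, ← Real.log_mul hL0.ne' hq0.ne', ← Real.log_mul two_ne_zero hX0.ne']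
      apply Real.log_le_log (by positivity)
      rw [← hL] at hlen
      exact_mod_cast hlen
    gcongr

lemma rpow_mix {u v : ℝ} (hu : 0 ≤ u) (hv : 0 ≤ v) (a b a' b' A B : ℕ) {θ : ℝ} (h0 : 0 ≤ θ)
    (h1 : θ ≤ 1) (hA : a * θ + a' * (1 - θ) = A) (hB : b * θ + b' * (1 - θ) = B) :
    (u ^ a * v ^ b) ^ θ * (u ^ a' * v ^ b') ^ (1 - θ) = u ^ A * v ^ B := by
  have h1' : 0 ≤ 1 - θ := by linarith
  rw [Real.mul_rpow (by positivity) (by positivity), Real.mul_rpow (by positivity) (by positivity)]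
  simp only [← Real.rpow_natCast, ← Real.rpow_mul hu, ← Real.rpow_mul hv]
  rw [← hA, ← hB, Real.rpow_add_of_nonneg hu (by positivity) (by positivity),
    Real.rpow_add_of_nonneg hv (by positivity) (by positivity)]
  ring

lemma mixI_nonneg (I : Finset ℤ) (p : ℤ) (k l a b : ℕ) (ξ η : ℤ) : 0 ≤ mixI I p k l a b ξ η :=
  integral_nonneg fun _ => by positivity

/-- Hölder's inequality for products of powers of two exponential sums. -/
lemma holder_fS (S T : Finset ℤ) (a b a' b' A B : ℕ) {θ : ℝ} (h0 : 0 < θ)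
    (h1 : θ < 1) (hA : a * θ + a' * (1 - θ) = A) (hB : b * θ + b' * (1 - θ) = B) :
    ∫ α, ‖fS S α‖ ^ A * ‖fS T α‖ ^ B ≤ (∫ α, ‖fS S α‖ ^ a * ‖fS T α‖ ^ b) ^ θ *
      (∫ α, ‖fS S α‖ ^ a' * ‖fS T α‖ ^ b') ^ (1 - θ) := by
  have := holder_cont (volume : Measure G3) (f := fun α => ‖fS S α‖ ^ a * ‖fS T α‖ ^ b)
    (g := fun α => ‖fS S α‖ ^ a' * ‖fS T α‖ ^ b') (by fun_prop) (by fun_prop)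
    (fun _ => by positivity) (fun _ => by positivity) h0 h1
  simp_rw [rpow_mix (norm_nonneg _) (norm_nonneg _) a b a' b' A B h0.le h1.le hA hB] at this
  exact this

lemma holder_exp {J A B θ s t : ℝ} (h0 : 0 < θ) (h1 : θ < 1) (h : J ≤ A ^ θ * B ^ (1 - θ))
    (hA0 : 0 ≤ A) (hB0 : 0 ≤ B) (hA : A ≤ Real.exp s) (hB : B ≤ Real.exp t) :
    J ≤ Real.exp (s * θ + t * (1 - θ)) := by
  refine h.trans ?_
  rw [Real.exp_add, Real.exp_mul, Real.exp_mul]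
  have : 0 < 1 - θ := by linarith
  gcongr

lemma Vin.cls_pow {κ E : ℝ} (h : Vin κ E) (hE : 0 ≤ E) (N : ℤ) (X : ℕ) {p b : ℕ} (hp : 0 < p)
    (hpX : p ^ b ≤ X) (η : ℤ) : M12 (CQ.cls (Ioc N (N + X)) ((p : ℤ) ^ b) η) ≤
      Real.exp (κ + E * (Real.log 2 + Real.log X - b * Real.log p)) := by
  have := h.cls hE N X (q := p ^ b) (by positivity) hpX η
  push_cast at this
  rwa [Real.log_pow] at this

/-- The estimate for mixed moments produced by `n` steps of efficient congruencing. -/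
def VinStep (Δ : ℝ) (n B : ℕ) (κ : ℝ) : Prop :=
  ∀ (p : ℕ), p.Prime → 3 < p → ∀ (N : ℤ) (X a b : ℕ) (ξ η : ℤ), ¬ (p : ℤ) ∣ ξ - η → 1 ≤ a →
    a ≤ b → b ≤ B → p ^ (3 ^ n * b) ≤ X →
    mixI (Ioc N (N + X)) p 4 8 a b ξ η ≤ Real.exp (κ + (6 + Δ) * Real.log X -
      (2 * a + 4 * b + n * Δ / 6 * (3 * b - a)) * Real.log p)

lemma vinStep_zero {Δ κ : ℝ} (hΔ : 0 ≤ Δ) (h : Vin κ (6 + Δ)) (B : ℕ) :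
    VinStep Δ 0 B (κ + (6 + Δ) * Real.log 2) := by
  intro p hp hp3 N X a b ξ η hne ha hab hbB hX
  rw [pow_zero, one_mul] at hX
  have h1 := h.cls_pow (by linarith) N X hp.pos ((Nat.pow_le_pow_right hp.pos hab).trans hX) ξ
  have h2 := h.cls_pow (by linarith) N X hp.pos hX η
  have h3 := holder_fS (cls (Ioc N (N + X)) ((p : ℤ) ^ a) ξ) (cls (Ioc N (N + X)) ((p : ℤ) ^ b) η)
    12 0 0 12 4 8 (θ := 1 / 3) (by norm_num) (by norm_num) (by norm_num) (by norm_num)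
  simp only [pow_zero, one_mul, mul_one] at h3
  refine (holder_exp (by norm_num) (by norm_num) h3 (M12_nonneg _) (M12_nonneg _) h1 h2).trans
    (Real.exp_le_exp.2 ?_)
  have hy : 0 ≤ Real.log p := Real.log_nonneg (by exact_mod_cast hp.one_le)
  have : 0 ≤ (a : ℝ) * Δ * Real.log p := by positivity
  have : 0 ≤ (b : ℝ) * Δ * Real.log p := by positivity
  norm_num
  nlinarith

lemma vinStep_succ {Δ κ : ℝ} (hΔ : 0 ≤ Δ) (h : Vin κ (6 + Δ)) (n B : ℕ) {κ' : ℝ}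
    (hs : VinStep Δ n (3 * B) κ') :
    ∃ κ'', VinStep Δ (n + 1) B κ'' := by
  refine ⟨Real.log (2 * B + 1) + κ' / 2 + (κ + (6 + Δ) * Real.log 2) / 2, ?_⟩
  intro p hp hp3 N X a b ξ η hne ha hab hbB hX
  have e3 : 3 ^ (n + 1) * b = 3 ^ n * (3 * b) := by ring
  rw [e3] at hX
  have hX2 : p ^ (3 ^ n * (2 * b - a)) ≤ X :=
    (Nat.pow_le_pow_right hp.pos (Nat.mul_le_mul_left _ (by omega))).trans hX
  have hXb : p ^ b ≤ X := (Nat.pow_le_pow_right hp.pos (by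
    have : 1 ≤ 3 ^ n := Nat.one_le_pow _ _ (by norm_num)
    nlinarith)).trans hX
  have hne' : ∀ u v : ℤ, ¬ (p : ℤ) ∣ u - v → ¬ (p : ℤ) ∣ v - u := fun u v h => by
    rwa [dvd_sub_comm]
  set I := Ioc N (N + (X : ℤ)) with hI
  set y := Real.log p with hy
  set x := Real.log X with hx
  have hy0 : 0 ≤ y := Real.log_nonneg (by exact_mod_cast hp.one_le)
  have hp0 : (0 : ℝ) < p := by exact_mod_cast hp.pos
  have hpy : (p : ℝ) = Real.exp y := (Real.exp_log hp0).symm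
  have hcast : ((2 * b - a : ℕ) : ℝ) = 2 * b - a := by
    rw [Nat.cast_sub (by omega)]; push_cast; ring
  have hA : ∀ ξ', ¬ (p : ℤ) ∣ ξ' - η → mixI I p 2 10 (3 * b) b ξ' η ≤ Real.exp
      ((κ' + (6 + Δ) * x - (2 * b + 4 * (3 * b) + n * Δ / 6 * (3 * (3 * b) - b)) * y) * (1 / 4) +
        (κ + (6 + Δ) * (Real.log 2 + x - b * y)) * (1 - 1 / 4)) := by
    intro ξ' hξ'
    have h1 := hs p hp hp3 N X b (3 * b) η ξ' (hne' _ _ hξ') (by omega) (by omega) (by omega) hX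
    have h2 := h.cls_pow (by linarith) N X hp.pos hXb η
    have h3 := holder_fS (cls I ((p : ℤ) ^ b) η) (cls I ((p : ℤ) ^ (3 * b)) ξ')
      4 8 12 0 10 2 (θ := 1 / 4) (by norm_num) (by norm_num) (by norm_num) (by norm_num)
    simp only [pow_zero, mul_one] at h3
    have h4 : mixI I p 2 10 (3 * b) b ξ' η = ∫ α, ‖fS (cls I ((p : ℤ) ^ b) η) α‖ ^ 10 *
      ‖fS (cls I ((p : ℤ) ^ (3 * b)) ξ') α‖ ^ 2 := by
      rw [mixI]; simp_rw [mul_comm]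
    rw [h4]
    have := holder_exp (by norm_num) (by norm_num) h3 (mixI_nonneg _ _ _ _ _ _ _ _) (M12_nonneg _)
      h1 h2
    push_cast at this
    exact this
  have hB : ∀ ξ', ¬ (p : ℤ) ∣ ξ' - η → mixI I p 2 10 (2 * b - a) b ξ' η ≤ Real.exp ((b + a) * y +
      ((κ' + (6 + Δ) * x - (2 * b + 4 * (3 * b) + n * Δ / 6 * (3 * (3 * b) - b)) * y) * (1 / 4) +
        (κ + (6 + Δ) * (Real.log 2 + x - b * y)) * (1 - 1 / 4))) := by
    intro ξ' hξ'
    refine (mixI_two_le I hp hp3 (by omega) (by omega) hξ' hA).trans (le_of_eq ?_)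
    rw [show 3 * b - (2 * b - a) = b + a by omega, hpy, ← Real.exp_nat_mul, ← Real.exp_add]
    push_cast
    rfl
  have hC := mixI_four_le I hp hp3 ha hab hne (Real.exp_pos _).le fun ξ' hξ' => by
    have h1 := hs p hp hp3 N X b (2 * b - a) η ξ' (hne' _ _ hξ') (by omega) (by omega) (by omega)
      hX2
    have h3 := holder_fS (cls I ((p : ℤ) ^ (2 * b - a)) ξ') (cls I ((p : ℤ) ^ b) η)
      8 4 2 10 4 8 (θ := 1 / 3) (by norm_num) (by norm_num) (by norm_num) (by norm_num)
    have h4 : mixI I p 4 8 b (2 * b - a) η ξ' = ∫ α, ‖fS (cls I ((p : ℤ) ^ (2 * b - a)) ξ') α‖ ^ 8 *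
      ‖fS (cls I ((p : ℤ) ^ b) η) α‖ ^ 4 := by
      rw [mixI]; simp_rw [mul_comm]
    rw [h4] at h1
    exact holder_exp (by norm_num) (by norm_num) h3 (integral_nonneg fun _ => by positivity)
      (mixI_nonneg _ _ _ _ _ _ _ _) h1 (hB ξ' hξ')
  refine hC.trans ?_
  have hc1 : ((2 * (b - a) + 1 : ℕ) : ℝ) ≤ Real.exp (Real.log (2 * B + 1)) := by
    rw [Real.exp_log (by positivity)]
    exact_mod_cast (by omega : 2 * (b - a) + 1 ≤ 2 * B + 1)
  have hc2 : (p : ℝ) ^ (4 * (b - a)) = Real.exp (4 * (b - a) * y) := by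
    rw [hpy, ← Real.exp_nat_mul]
    push_cast [Nat.cast_sub hab]
    rfl
  rw [hc2]
  calc _ ≤ Real.exp (Real.log (2 * B + 1)) * Real.exp (4 * (b - a) * y) * _ := by gcongr
    _ ≤ _ := by
      rw [← Real.exp_add, ← Real.exp_add]
      refine Real.exp_le_exp.2 ?_
      rw [hcast]
      push_cast
      have : 0 ≤ (a : ℝ) * Δ * y := by positivity
      nlinarith

lemma exists_vinStep {Δ κ : ℝ} (hΔ : 0 ≤ Δ) (h : Vin κ (6 + Δ)) (n : ℕ) :
    ∀ B, ∃ κ', VinStep Δ n B κ' := by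
  induction n with
  | zero => exact fun B => ⟨_, vinStep_zero hΔ h B⟩
  | succ n ih => exact fun B => vinStep_succ hΔ h n B (ih (3 * B)).choose_spec

lemma M12_le_of_prime {Δ κ κ' : ℝ} (hΔ : 0 ≤ Δ) (h : Vin κ (6 + Δ)) {n : ℕ} (hn : 27 ≤ n * Δ)
    (hs : VinStep Δ n 1 κ') {p : ℕ} (hp : p.Prime) (hp3 : 3 < p) (N : ℤ) (X : ℕ)
    (hX : p ^ 3 ^ n ≤ X) : M12 (Ioc N (N + X)) ≤
      2 ^ 12 * (Real.exp (κ + (6 + Δ) * Real.log 2) + Real.exp κ') *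
        Real.exp ((6 + Δ) * Real.log X - Real.log p) := by
  set I := Ioc N (N + (X : ℤ)) with hI
  set y := Real.log p with hy
  set x := Real.log X with hx
  have hp0 : (0 : ℝ) < p := by exact_mod_cast hp.pos
  have hpy : (p : ℝ) = Real.exp y := (Real.exp_log hp0).symm
  have hy0 : 0 ≤ y := Real.log_nonneg (by exact_mod_cast hp.one_le)
  have hpX : p ≤ X := by
    refine le_trans ?_ hX
    exact Nat.le_self_pow (by positivity) p
  have hdec : ∀ α, fS I α = ∑ k ∈ range p, fS (cls I ((p : ℤ) ^ 1) k) α := by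
    intro α
    have := fS_cls I hp.pos (Nat.zero_le 1) 0 α
    simpa [cls] using this
  have h1 : M12 I ≤ 2 ^ 12 * ∑ k ∈ range p, M12 (cls I ((p : ℤ) ^ 1) k) + (2 * p : ℝ) ^ 12 *
      ∑ k ∈ range p, ∑ l ∈ (range p).erase k, mixI I p 4 8 1 1 k l := by
    calc M12 I ≤ ∫ α, (2 ^ 12 * ∑ k ∈ range p, ‖fS (cls I ((p : ℤ) ^ 1) k) α‖ ^ 12 +
          (2 * p : ℝ) ^ 12 * ∑ k ∈ range p, ∑ l ∈ (range p).erase k,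
          ‖fS (cls I ((p : ℤ) ^ 1) k) α‖ ^ 4 * ‖fS (cls I ((p : ℤ) ^ 1) l) α‖ ^ 8) := by
          refine integral_mono (integrable_cont _ (by fun_prop)) (integrable_cont _ (by fun_prop))
            fun α => ?_
          simp only
          rw [hdec α]
          exact norm_sum_pow_twelve p fun k => fS (cls I ((p : ℤ) ^ 1) k) α
      _ = _ := by
          rw [integral_add (integrable_cont _ (by fun_prop)) (integrable_cont _ (by fun_prop)),
            integral_const_mul, integral_const_mul,
            integral_finsetSum _ fun i _ => integrable_cont _ (by fun_prop),
            integral_finsetSum _ fun i _ => integrable_cont _ (by fun_prop)]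
          congr 2
          refine sum_congr rfl fun k _ => ?_
          rw [integral_finsetSum _ fun i _ => integrable_cont _ (by fun_prop)]
          rfl
  have h2 : ∑ k ∈ range p, M12 (cls I ((p : ℤ) ^ 1) k) ≤
      Real.exp y * Real.exp (κ + (6 + Δ) * (Real.log 2 + x - y)) := by
    have := sum_le_card_nsmul (range p) (fun k : ℕ => M12 (cls I ((p : ℤ) ^ 1) k)) _ fun k _ =>
      h.cls_pow (by linarith) N X hp.pos (b := 1) (by simpa using hpX) k
    rw [card_range, nsmul_eq_mul, hpy] at this
    simpa using this
  have h3 : ∑ k ∈ range p, ∑ l ∈ (range p).erase k, mixI I p 4 8 1 1 k l ≤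
      Real.exp y * (Real.exp y * Real.exp (κ' + (6 + Δ) * x - (6 + n * Δ / 6 * 2) * y)) := by
    have hin : ∀ k ∈ range p, ∑ l ∈ (range p).erase k, mixI I p 4 8 1 1 k l ≤
        Real.exp y * Real.exp (κ' + (6 + Δ) * x - (6 + n * Δ / 6 * 2) * y) := by
      intro k hk
      refine (sum_le_card_nsmul _ _ (Real.exp (κ' + (6 + Δ) * x - (6 + n * Δ / 6 * 2) * y))
        fun l hl => ?_).trans ?_
      · have hne : ¬ (p : ℤ) ∣ (k : ℤ) - l := by
          intro hd
          have h8 := Int.emod_eq_emod_iff_emod_sub_eq_zero.2 (Int.emod_eq_zero_of_dvd hd)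
          have h9 : k % p = l % p := by exact_mod_cast h8
          rw [Nat.mod_eq_of_lt (mem_range.1 hk),
            Nat.mod_eq_of_lt (mem_range.1 (mem_of_mem_erase hl))] at h9
          exact ne_of_mem_erase hl h9.symm
        refine (hs p hp hp3 N X 1 1 k l hne le_rfl le_rfl le_rfl (by simpa using hX)).trans ?_
        refine Real.exp_le_exp.2 (le_of_eq ?_)
        push_cast
        ring
      · rw [nsmul_eq_mul, ← hpy]
        gcongr
        exact_mod_cast (card_le_card (erase_subset _ _)).trans (by simp)
    have := sum_le_card_nsmul _ _ _ hin
    rw [card_range, nsmul_eq_mul] at this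
    rwa [← hpy] at this ⊢
  have hΔy : 0 ≤ Δ * y := by positivity
  have hny : 27 * y ≤ n * Δ * y := by gcongr
  have h4 : 2 ^ 12 * (Real.exp y * Real.exp (κ + (6 + Δ) * (Real.log 2 + x - y))) ≤
      2 ^ 12 * (Real.exp (κ + (6 + Δ) * Real.log 2) * Real.exp ((6 + Δ) * x - y)) := by
    rw [← Real.exp_add, ← Real.exp_add]
    refine mul_le_mul_of_nonneg_left (Real.exp_le_exp.2 ?_) (by norm_num)
    nlinarith
  have h5 : (2 * p : ℝ) ^ 12 * (Real.exp y * (Real.exp y * Real.exp (κ' + (6 + Δ) * x -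
      (6 + n * Δ / 6 * 2) * y))) ≤ 2 ^ 12 * (Real.exp κ' * Real.exp ((6 + Δ) * x - y)) := by
    rw [mul_pow, hpy, ← Real.exp_nat_mul, mul_assoc, ← Real.exp_add, ← Real.exp_add,
      ← Real.exp_add, ← Real.exp_add]
    refine mul_le_mul_of_nonneg_left (Real.exp_le_exp.2 ?_) (by norm_num)
    push_cast
    nlinarith
  calc _ ≤ _ := h1
    _ ≤ 2 ^ 12 * _ + (2 * p : ℝ) ^ 12 * _ := by gcongr
    _ ≤ _ := add_le_add h4 h5
    _ = _ := by ring


lemma Vin.improve {Δ κ : ℝ} (hΔ : 0 ≤ Δ) (h : Vin κ (6 + Δ)) {n : ℕ} (hn : 27 ≤ n * Δ) :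
    ∃ κ'', Vin κ'' (6 + Δ - 1 / 3 ^ n) := by
  obtain ⟨κ', hs⟩ := exists_vinStep hΔ h n 1
  set D : ℝ := 2 ^ 12 * (Real.exp (κ + (6 + Δ) * Real.log 2) + Real.exp κ') with hD
  have hD0 : 0 < D := by positivity
  refine ⟨max (12 * (3 ^ n * Real.log 8)) (Real.log D + Real.log 4), fun N X hX => ?_⟩
  have hX0 : (0 : ℝ) < X := by exact_mod_cast hX
  have hx0 : 0 ≤ Real.log X := Real.log_nonneg (by exact_mod_cast hX)
  have h3n : (0 : ℝ) < 3 ^ n := by positivity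
  rcases lt_or_ge X (8 ^ 3 ^ n) with hlt | hge
  · have h1 := M12_le_card (Ioc N (N + (X : ℤ)))
    simp only [Int.card_Ioc, add_sub_cancel_left, Int.toNat_natCast] at h1
    refine h1.trans ?_
    rw [← Real.exp_log hX0, ← Real.exp_nat_mul]
    rw [Real.exp_log hX0]
    refine Real.exp_le_exp.2 ?_
    have h2 : Real.log X ≤ 3 ^ n * Real.log 8 := by
      have : Real.log X ≤ Real.log (8 ^ 3 ^ n) :=
        Real.log_le_log hX0 (by exact_mod_cast hlt.le)
      rw [Real.log_pow] at this
      exact_mod_cast this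
    have h3 : 0 ≤ (6 + Δ - 1 / 3 ^ n) * Real.log X := by
      apply mul_nonneg _ hx0
      have : 1 / (3 : ℝ) ^ n ≤ 1 := by
        rw [div_le_one h3n]; exact one_le_pow₀ (by norm_num)
      linarith
    have := le_max_left (12 * (3 ^ n * Real.log 8)) (Real.log D + Real.log 4)
    push_cast
    linarith
  · set R : ℝ := (X : ℝ) ^ ((1 : ℝ) / 3 ^ n) with hR
    have hRpow : R ^ 3 ^ n = X := by
      rw [hR, ← Real.rpow_natCast, ← Real.rpow_mul hX0.le]
      push_cast
      rw [one_div_mul_cancel h3n.ne', Real.rpow_one]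
    have hR0 : 0 < R := by positivity
    have hR8 : 8 ≤ R := by
      have : (8 : ℝ) ^ 3 ^ n ≤ R ^ 3 ^ n := by rw [hRpow]; exact_mod_cast hge
      exact le_of_pow_le_pow_left₀ (by positivity) hR0.le this
    obtain ⟨p, hp, hYp, hpY⟩ := Nat.exists_prime_lt_and_le_two_mul ⌊R / 2⌋₊ (by
      have : 1 ≤ ⌊R / 2⌋₊ := by rw [Nat.one_le_floor_iff]; linarith
      omega)
    have hfl : R / 2 < ⌊R / 2⌋₊ + 1 := Nat.lt_floor_add_one _
    have hpR : R / 4 ≤ p := by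
      have : (⌊R / 2⌋₊ : ℝ) + 1 ≤ p := by exact_mod_cast hYp
      linarith
    have hpR2 : (p : ℝ) ≤ R := by
      have h1 : (p : ℝ) ≤ 2 * ⌊R / 2⌋₊ := by exact_mod_cast hpY
      have h2 : (⌊R / 2⌋₊ : ℝ) ≤ R / 2 := Nat.floor_le (by positivity)
      linarith
    have hp3 : 3 < p := by
      have : 4 ≤ ⌊R / 2⌋₊ := Nat.le_floor (by push_cast; linarith)
      omega
    have hpX : p ^ 3 ^ n ≤ X := by
      have : (p : ℝ) ^ 3 ^ n ≤ X := by rw [← hRpow]; gcongr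
      exact_mod_cast this
    refine (M12_le_of_prime hΔ h hn hs hp hp3 N X hpX).trans ?_
    rw [← hD, ← Real.exp_log hD0, ← Real.exp_add]
    rw [Real.exp_log hD0]
    refine Real.exp_le_exp.2 ?_
    have h5 : 1 / 3 ^ n * Real.log X - Real.log 4 ≤ Real.log p := by
      rw [← Real.log_rpow hX0, ← Real.log_div hR0.ne' (by norm_num)]
      exact Real.log_le_log (by positivity) hpR
    have := le_max_right (12 * (3 ^ n * Real.log 8)) (Real.log D + Real.log 4)
    linarith

/-- The main conjecture in Vinogradov's mean value theorem for cubes, at the critical moment. -/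
theorem vinogradov_cubic (ε : ℝ) (hε : 0 < ε) : ∃ κ, Vin κ (6 + ε) := by
  obtain ⟨n, hn⟩ := exists_nat_ge (27 / ε)
  have hnε : 27 ≤ n * ε := by rwa [div_le_iff₀ hε] at hn
  have h3n : (0 : ℝ) < 1 / 3 ^ n := by positivity
  have key : ∀ k : ℕ, ∃ κ, Vin κ (6 + max ε (6 - k * (1 / 3 ^ n))) := by
    intro k
    induction k with
    | zero =>
      refine ⟨0, Vin.mono (E := 12) (fun N X hX => ?_) ?_⟩
      · have hX0 : (0 : ℝ) < X := by exact_mod_cast hX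
        have h1 := M12_le_card (Ioc N (N + (X : ℤ)))
        simp only [Int.card_Ioc, add_sub_cancel_left, Int.toNat_natCast] at h1
        refine h1.trans (le_of_eq ?_)
        rw [zero_add, mul_comm, Real.exp_mul, Real.exp_log hX0]
        norm_cast
      · have := le_max_right ε (6 - ((0 : ℕ) : ℝ) * (1 / 3 ^ n))
        push_cast at this ⊢
        linarith
    | succ k ih =>
      obtain ⟨κ, h⟩ := ih
      set Δ := max ε (6 - k * (1 / 3 ^ n)) with hΔ
      have hΔε : ε ≤ Δ := le_max_left _ _
      obtain ⟨κ', h'⟩ := h.improve (by linarith) (n := n)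
        (hnε.trans (by gcongr))
      rcases le_total ε (6 - k * (1 / 3 ^ n)) with h1 | h1
      · refine ⟨κ', h'.mono ?_⟩
        rw [hΔ, max_eq_right h1]
        have := le_max_right ε (6 - ((k + 1 : ℕ) : ℝ) * (1 / 3 ^ n))
        push_cast at this ⊢
        linarith
      · refine ⟨κ, h.mono ?_⟩
        rw [hΔ, max_eq_left h1]
        have := le_max_left ε (6 - ((k + 1 : ℕ) : ℝ) * (1 / 3 ^ n))
        linarith
  obtain ⟨k, hk⟩ := exists_nat_ge (6 / (1 / 3 ^ n : ℝ))
  obtain ⟨κ, h⟩ := key k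
  rw [div_le_iff₀ h3n] at hk
  rw [max_eq_left (by linarith)] at h
  exact ⟨κ, h⟩

lemma exists_rep (t : 𝕋) : ∃ r : ℝ, (r : 𝕋) = t ∧ |r| = ‖t‖ ∧ |r| ≤ 1 / 2 := by
  obtain ⟨x, rfl⟩ := QuotientAddGroup.mk_surjective t
  refine ⟨x - round x, ?_, ?_, abs_sub_round x⟩
  · show ((x - round x : ℝ) : 𝕋) = (x : 𝕋)
    rw [AddCircle.coe_sub, sub_eq_self, AddCircle.coe_eq_zero_iff]
    exact ⟨round x, by simp⟩
  · exact (UnitAddCircle.norm_eq).symm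

lemma norm_coe_le (x : ℝ) (m : ℤ) : ‖(x : 𝕋)‖ ≤ |x - m| := by
  rw [UnitAddCircle.norm_eq]; exact round_le x m

lemma norm_coe_eq (x : ℝ) : ∃ m : ℤ, ‖(x : 𝕋)‖ = |x - m| := ⟨round x, UnitAddCircle.norm_eq⟩

lemma norm_ee_coe_sub_one (r : ℝ) : ‖ee (r : 𝕋) - 1‖ = 2 * |Real.sin (Real.pi * r)| := by
  have : (2 * Real.pi * r * Complex.I : ℂ) = Complex.I * ((2 * Real.pi * r : ℝ) : ℂ) := by
    push_cast; ring
  rw [ee_coe, this, Complex.norm_exp_I_mul_ofReal_sub_one, norm_mul]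
  simp only [Real.norm_eq_abs]
  rw [abs_of_pos (by norm_num : (0:ℝ) < 2)]
  congr 3
  ring

lemma norm_ee_sub_one_le (t : 𝕋) : ‖ee t - 1‖ ≤ 2 * Real.pi * ‖t‖ := by
  obtain ⟨r, rfl, hr, -⟩ := exists_rep t
  rw [norm_ee_coe_sub_one, ← hr]
  have := Real.abs_sin_le_abs (x := Real.pi * r)
  rw [abs_mul, abs_of_pos Real.pi_pos] at this
  linarith

lemma le_norm_ee_sub_one (t : 𝕋) : 4 * ‖t‖ ≤ ‖ee t - 1‖ := by
  obtain ⟨r, rfl, hr, h2⟩ := exists_rep t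
  rw [norm_ee_coe_sub_one, ← hr]
  have := Real.mul_abs_le_abs_sin (x := Real.pi * r) (by
    rw [abs_mul, abs_of_pos Real.pi_pos]; nlinarith [Real.pi_pos])
  rw [abs_mul, abs_of_pos Real.pi_pos, ← mul_assoc, div_mul_cancel₀ _ Real.pi_pos.ne'] at this
  linarith

lemma norm_sum_ee_mul_le (A : ℤ) (n : ℕ) (t c : 𝕋) :
    ‖∑ x ∈ Ioc A (A + n), ee (x • t + c)‖ * ‖t‖ ≤ 1 / 2 := by
  have h : (∑ x ∈ Ioc A (A + n), ee (x • t + c)) * (ee t - 1) =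
      ee ((A + n + 1) • t + c) - ee ((A + 1) • t + c) := by
    induction n with
    | zero => simp
    | succ n ih =>
      have : Ioc A (A + ((n + 1 : ℕ) : ℤ)) = insert (A + n + 1) (Ioc A (A + n)) := by
        ext x; simp only [mem_insert, mem_Ioc]; push_cast; omega
      rw [this, sum_insert (by simp), add_mul, ih, mul_sub, ← ee_add]
      have : ((A + n + 1 : ℤ) • t + c + t) = (A + ((n + 1 : ℕ) : ℤ) + 1) • t + c := by
        push_cast; module
      rw [this]; ring
  have h2 := congrArg norm h
  rw [norm_mul] at h2
  have h3 : ‖ee ((A + n + 1) • t + c) - ee ((A + 1) • t + c)‖ ≤ 2 := by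
    refine (norm_sub_le _ _).trans ?_
    simp only [norm_ee]; norm_num
  have h4 := le_norm_ee_sub_one t
  nlinarith [norm_nonneg (∑ x ∈ Ioc A (A + n), ee (x • t + c))]

/-- A smooth version of `min (X, 1 / ‖t‖)`. -/
noncomputable def kq (X : ℝ) (t : 𝕋) : ℝ := X / (1 + X * ‖t‖)

lemma kq_nonneg {X : ℝ} (hX : 0 ≤ X) (t : 𝕋) : 0 ≤ kq X t := by unfold kq; positivity

lemma kq_le {X : ℝ} (hX : 0 ≤ X) (t : 𝕋) : kq X t ≤ X :=
  div_le_self hX (by nlinarith [norm_nonneg t, mul_nonneg hX (norm_nonneg t)])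

lemma kq_neg (X : ℝ) (t : 𝕋) : kq X (-t) = kq X t := by rw [kq, kq, norm_neg]

lemma kq_mono {X Y : ℝ} (hX : 0 ≤ X) (h : X ≤ Y) (t : 𝕋) : kq X t ≤ kq Y t := by
  unfold kq
  have := norm_nonneg t
  have hY := hX.trans h
  rw [div_le_div_iff₀ (by positivity) (by positivity)]
  nlinarith

lemma norm_sum_ee_le (A : ℤ) (n : ℕ) (t c : 𝕋) :
    ‖∑ x ∈ Ioc A (A + n), ee (x • t + c)‖ ≤ 2 * kq n t := by
  have h1 := norm_sum_ee_mul_le A n t c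
  have h2 : ‖∑ x ∈ Ioc A (A + n), ee (x • t + c)‖ ≤ n := by
    refine (norm_sum_le _ _).trans ?_
    simp
  have h3 := norm_nonneg t
  have h4 : (0 : ℝ) ≤ n := Nat.cast_nonneg n
  rw [kq, ← mul_div_assoc, le_div_iff₀ (by positivity)]
  nlinarith

lemma sum_inv_le_log (n : ℕ) : ∑ c ∈ range n, (if c = 0 then (0 : ℝ) else 1 / c) ≤
    1 + Real.log n := by
  rcases Nat.eq_zero_or_pos n with rfl | hn
  · simp
  have h := harmonic_le_one_add_log (n - 1)
  obtain ⟨m, rfl⟩ := Nat.exists_eq_succ_of_ne_zero hn.ne'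
  rw [sum_range_succ']
  simp only [Nat.succ_eq_add_one, Nat.add_sub_cancel] at h ⊢
  have e : ∑ k ∈ range m, (if k + 1 = 0 then (0 : ℝ) else 1 / ((k + 1 : ℕ) : ℝ)) =
      (harmonic m : ℝ) := by
    simp [harmonic, one_div]
  rw [e]
  simp only [if_true, add_zero]
  refine h.trans ?_
  rcases Nat.eq_zero_or_pos m with rfl | hm
  · simp
  · gcongr
    linarith

/-- Sum of `min (X, 1 / ‖u‖)` over well-spaced points. -/
lemma sum_kq_spaced {ι : Type*} (s : Finset ι) (u : ι → 𝕋) {X : ℝ} (hX : 0 ≤ X) {q : ℕ}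
    (hq : 0 < q) (hu : ∀ i ∈ s, ∀ j ∈ s, i ≠ j → 1 / (q : ℝ) ≤ ‖u i - u j‖) :
    ∑ i ∈ s, kq X (u i) ≤ 2 * (X + q * (1 + Real.log q)) := by
  have hq' : (0 : ℝ) < q := by exact_mod_cast hq
  have hrep : ∀ t : 𝕋, ∃ r : ℝ, (r : 𝕋) = t ∧ 0 ≤ r ∧ r < 1 := by
    intro t
    obtain ⟨x, rfl⟩ := QuotientAddGroup.mk_surjective t
    refine ⟨Int.fract x, ?_, Int.fract_nonneg x, Int.fract_lt_one x⟩
    show ((Int.fract x : ℝ) : 𝕋) = (x : 𝕋)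
    rw [Int.fract, AddCircle.coe_sub, sub_eq_self, AddCircle.coe_eq_zero_iff]
    exact ⟨⌊x⌋, by simp⟩
  choose r hr h0 h1 using hrep
  set c : ι → ℕ := fun i => ⌊q * r (u i)⌋₊ with hc
  have hcq : ∀ i, c i < q := fun i => by
    rw [hc, Nat.floor_lt (by have := h0 (u i); positivity)]
    nlinarith [h1 (u i)]
  have hinj : Set.InjOn c s := by
    intro i hi j hj hij
    by_contra hne
    have h := hu i hi j hj hne
    have e : u i - u j = ((r (u i) - r (u j) : ℝ) : 𝕋) := by rw [AddCircle.coe_sub, hr, hr]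
    have h3 : ‖u i - u j‖ ≤ |r (u i) - r (u j)| := by
      rw [e]; simpa using norm_coe_le (r (u i) - r (u j)) 0
    have a1 := Nat.floor_le (by have := h0 (u i); positivity : 0 ≤ q * r (u i))
    have a2 := Nat.floor_le (by have := h0 (u j); positivity : 0 ≤ q * r (u j))
    have b1 := Nat.lt_floor_add_one (q * r (u i))
    have b2 := Nat.lt_floor_add_one (q * r (u j))
    have e2 : ⌊q * r (u i)⌋₊ = ⌊q * r (u j)⌋₊ := hij
    rw [e2] at a1 b1
    have : |r (u i) - r (u j)| < 1 / q := by
      rw [abs_lt, neg_lt, lt_div_iff₀ hq', lt_div_iff₀ hq']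
      constructor <;> nlinarith
    linarith
  set H : ℕ → ℝ := fun k => if k = 0 then X else q / k with hH
  have hH0 : ∀ k, 0 ≤ H k := fun k => by simp only [hH]; split_ifs <;> positivity
  have hHb : ∀ (k : ℕ) (t : 𝕋), k ≤ q * ‖t‖ → kq X t ≤ H k := by
    intro k t hk
    simp only [hH]
    split_ifs with h
    · exact kq_le hX t
    · have hk0 : (0 : ℝ) < k := by exact_mod_cast Nat.pos_of_ne_zero h
      have hn := norm_nonneg t
      rw [kq, div_le_div_iff₀ (by positivity) hk0]
      nlinarith
  have hb : ∀ i, kq X (u i) ≤ H (c i) + H (q - 1 - c i) := by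
    intro i
    have a1 := Nat.floor_le (by have := h0 (u i); positivity : 0 ≤ q * r (u i))
    have b1 := Nat.lt_floor_add_one (q * r (u i))
    have hn : r (u i) ≤ ‖u i‖ ∨ 1 - r (u i) ≤ ‖u i‖ := by
      obtain ⟨m, hm⟩ := norm_coe_eq (r (u i))
      rw [hr] at hm
      rw [hm]
      rcases le_or_gt m 0 with h | h
      · have : (m : ℝ) ≤ 0 := by exact_mod_cast h
        exact Or.inl (le_trans (by linarith) (le_abs_self _))
      · have : (1 : ℝ) ≤ m := by exact_mod_cast h
        exact Or.inr (le_trans (by linarith) (neg_le_abs _))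
    rcases hn with hn | hn
    · have := hHb (c i) (u i) (a1.trans (by gcongr))
      linarith [hH0 (q - 1 - c i)]
    · have := hHb (q - 1 - c i) (u i) (by
        have h2 := hcq i
        rw [Nat.sub_sub, Nat.cast_sub (by omega)]
        push_cast
        simp only [hc]
        nlinarith)
      linarith [hH0 (c i)]
  calc ∑ i ∈ s, kq X (u i) ≤ ∑ i ∈ s, (H (c i) + H (q - 1 - c i)) := sum_le_sum fun i _ => hb i
    _ = ∑ k ∈ s.image c, (H k + H (q - 1 - k)) := (sum_image (f := fun k => H k + H (q - 1 - k)) hinj).symm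
    _ ≤ ∑ k ∈ range q, (H k + H (q - 1 - k)) := by
        refine sum_le_sum_of_subset_of_nonneg ?_ fun k _ _ => add_nonneg (hH0 _) (hH0 _)
        intro k hk
        obtain ⟨i, _, rfl⟩ := mem_image.1 hk
        exact mem_range.2 (hcq i)
    _ = 2 * ∑ k ∈ range q, H k := by
        rw [sum_add_distrib, sum_range_reflect H q]; ring
    _ ≤ _ := by
        gcongr
        have : ∀ k ∈ range q, H k = (if k = 0 then X else 0) +
            q * (if k = 0 then (0 : ℝ) else 1 / k) := by
          intro k _
          simp only [hH]; split_ifs <;> simp [div_eq_mul_inv]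
        rw [sum_congr rfl this, sum_add_distrib, ← mul_sum, sum_ite_eq' (range q) 0 fun _ => X]
        have := sum_inv_le_log q
        rw [if_pos (mem_range.2 hq)]
        gcongr

/-- Dirichlet approximation with a minimal denominator, and the resulting spacing. -/
lemma exists_dirichlet (α : 𝕋) {n : ℕ} (hn : 0 < n) : ∃ q : ℕ, 0 < q ∧ q ≤ n ∧
    ‖q • α‖ ≤ 1 / (n + 1) ∧ ∀ j : ℕ, 0 < j → 2 * j ≤ q → 1 / ((2 * q : ℕ) : ℝ) ≤ ‖j • α‖ := by
  classical
  have hex : ∃ q : ℕ, 0 < q ∧ q ≤ n ∧ ‖q • α‖ ≤ 1 / ((n : ℝ) + 1) := by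
    obtain ⟨j, hj, h⟩ := AddCircle.exists_norm_nsmul_le α hn
    obtain ⟨h1, h2⟩ := Set.mem_Icc.1 hj
    exact ⟨j, h1, h2, by simpa using h⟩
  have hmin := fun m hm => Nat.find_min (m := m) hex hm
  obtain ⟨h1, h2, h3⟩ := Nat.find_spec hex
  set q := Nat.find hex with hq
  refine ⟨q, h1, h2, h3, fun j hj hjq => ?_⟩
  obtain ⟨r, rfl⟩ := QuotientAddGroup.mk_surjective α
  have key : ∀ k : ℕ, k • ((r : ℝ) : 𝕋) = ((k * r : ℝ) : 𝕋) := fun k => by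
    rw [← AddCircle.coe_nsmul, nsmul_eq_mul]
  change ∀ m, m < q → ¬ (0 < m ∧ m ≤ n ∧ ‖m • ((r : ℝ) : 𝕋)‖ ≤ 1 / ((n : ℝ) + 1)) at hmin
  change ‖q • ((r : ℝ) : 𝕋)‖ ≤ _ at h3
  change _ ≤ ‖j • ((r : ℝ) : 𝕋)‖
  simp_rw [key] at *
  obtain ⟨a, ha⟩ := norm_coe_eq (q * r)
  obtain ⟨m, hm⟩ := norm_coe_eq (j * r)
  rw [ha] at h3
  have hq0 : (0 : ℝ) < q := by exact_mod_cast h1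
  have hj0 : (0 : ℝ) < j := by exact_mod_cast hj
  have hjq' : 2 * (j : ℝ) ≤ q := by exact_mod_cast hjq
  have hnn : (1 : ℝ) / (n + 1) ≤ 1 / q := by
    apply one_div_le_one_div_of_le hq0
    have : (q : ℝ) ≤ n := by exact_mod_cast h2
    linarith
  have hne : (j : ℤ) * a - q * m ≠ 0 := by
    intro h0
    obtain ⟨g, q', a', hg0, hq', ha'⟩ : ∃ (g q' : ℕ) (a' : ℤ), 1 < g ∧ q = g * q' ∧ a = g * a' := by
      refine ⟨Int.gcd q a, q / Int.gcd q a, a / Int.gcd q a, ?_, ?_, ?_⟩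
      · by_contra hle
        have hpos : 0 < Int.gcd q a := Int.gcd_pos_of_ne_zero_left _ (by exact_mod_cast h1.ne')
        have h1' : Int.gcd q a = 1 := by omega
        have hdvd : (q : ℤ) ∣ j := by
          refine (Int.isCoprime_iff_gcd_eq_one.2 h1').dvd_of_dvd_mul_right (?_ : (q : ℤ) ∣ j * a)
          exact ⟨m, by linarith⟩
        have := Nat.le_of_dvd hj (by exact_mod_cast hdvd)
        omega
      · exact (Nat.mul_div_cancel' (by exact_mod_cast Int.gcd_dvd_left (q : ℤ) a)).symm
      · exact (Int.mul_ediv_cancel' (Int.gcd_dvd_right (q : ℤ) a)).symm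
    have hq'0 : 0 < q' := Nat.pos_of_ne_zero (by rintro rfl; omega)
    have hlt : q' < q := by rw [hq']; nlinarith
    refine hmin q' hlt ⟨hq'0, by omega, ?_⟩
    refine (norm_coe_le _ a').trans (le_trans ?_ h3)
    have e : (q : ℝ) * r - a = g * (q' * r - a') := by
      rw [hq', ha']; push_cast; ring
    rw [e, abs_mul, abs_of_nonneg (Nat.cast_nonneg (α := ℝ) g)]
    have : (1 : ℝ) ≤ g := by exact_mod_cast hg0.le
    nlinarith [abs_nonneg ((q' : ℝ) * r - a')]
  have hone : (1 : ℝ) ≤ |(j : ℝ) * a - q * m| := by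
    have : (1 : ℤ) ≤ |(j : ℤ) * a - q * m| := Int.one_le_abs hne
    exact_mod_cast this
  rw [hm]
  have e : (j : ℝ) * a - q * m = q * (j * r - m) - j * (q * r - a) := by ring
  have h5 : |(j : ℝ) * a - q * m| ≤ q * |j * r - m| + j * |q * r - a| := by
    rw [e]
    refine (abs_sub _ _).trans ?_
    rw [abs_mul, abs_mul, abs_of_pos hq0, abs_of_pos hj0]
  have h6 : (j : ℝ) * |q * r - a| ≤ 1 / 2 := by
    calc (j : ℝ) * |q * r - a| ≤ (q / 2) * (1 / q) := by
          apply mul_le_mul (by linarith) (h3.trans hnn) (abs_nonneg _) (by positivity)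
      _ = 1 / 2 := by field_simp
  rw [div_le_iff₀ (by positivity)]
  push_cast
  linarith

lemma sum_range_mul_le {f : ℕ → ℝ} {B : ℝ} {b : ℕ} (h : ∀ i, ∑ j ∈ range b, f (i + j) ≤ B)
    (k : ℕ) : ∑ n ∈ range (k * b), f n ≤ k * B := by
  induction k with
  | zero => simp
  | succ k ih =>
    rw [Nat.succ_mul, sum_range_add]
    push_cast
    linarith [h (k * b)]

/-- Sums of `min (X, 1 / ‖nα‖)` when `α` has no small denominator. -/
lemma sum_kq_le (α : 𝕋) {X R δ : ℝ} (hX : 0 ≤ X) (hR : 0 < R) {Q : ℕ} (hQ : 0 < Q)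
    (hδ : 1 / ((Q : ℝ) + 1) ≤ δ) (h : ∀ q : ℕ, 0 < q → (q : ℝ) ≤ R → δ < ‖q • α‖) (N : ℕ) :
    ∑ n ∈ range N, kq X (n • α) ≤
      4 * N * X / R + 2 * X + (8 * N + 4 * Q) * (1 + Real.log (2 * Q)) := by
  obtain ⟨q, hq0, hqQ, hq, hsp⟩ := exists_dirichlet α hQ
  have hqR : R < q := by
    by_contra hle
    push Not at hle
    linarith [h q hq0 hle]
  set b := (q + 1) / 2 with hb
  have hb0 : 0 < b := by omega
  have hblock : ∀ i, ∑ j ∈ range b, kq X ((i + j) • α) ≤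
      2 * (X + ((2 * q : ℕ) : ℝ) * (1 + Real.log ((2 * q : ℕ) : ℝ))) := by
    intro i
    refine sum_kq_spaced _ (fun j => (i + j) • α) hX (by omega) fun j hj k hk hjk => ?_
    have hj' := mem_range.1 hj
    have hk' := mem_range.1 hk
    rcases lt_or_gt_of_ne hjk with hlt | hlt
    · have e : (i + j) • α - (i + k) • α = -((k - j) • α) := by
        obtain ⟨l, rfl⟩ := Nat.exists_eq_add_of_lt hlt
        rw [show j + l + 1 - j = l + 1 by omega]
        module
      rw [e, norm_neg]
      exact hsp _ (by omega) (by omega)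
    · have e : (i + j) • α - (i + k) • α = ((j - k) • α) := by
        obtain ⟨l, rfl⟩ := Nat.exists_eq_add_of_lt hlt
        rw [show k + l + 1 - k = l + 1 by omega]
        module
      rw [e]
      exact hsp _ (by omega) (by omega)
  set B := 2 * (X + ((2 * q : ℕ) : ℝ) * (1 + Real.log ((2 * q : ℕ) : ℝ))) with hB
  set k := N / b + 1 with hk
  have hNk : N ≤ k * b := by
    have := Nat.div_add_mod N b
    have := Nat.mod_lt N hb0
    rw [hk]; nlinarith
  have hq0' : (0 : ℝ) < q := by exact_mod_cast hq0
  have hlog : 0 ≤ Real.log ((2 * q : ℕ) : ℝ) := Real.log_natCast_nonneg _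
  have hlog2 : Real.log ((2 * q : ℕ) : ℝ) ≤ Real.log (2 * Q) := by
    apply Real.log_le_log (by positivity)
    exact_mod_cast (by omega : 2 * q ≤ 2 * Q)
  have hkq : (k : ℝ) ≤ 2 * N / q + 1 := by
    have h1 : ((N / b : ℕ) : ℝ) ≤ N / b := Nat.cast_div_le
    have h2 : (q : ℝ) / 2 ≤ b := by
      rw [div_le_iff₀ (by norm_num)]
      exact_mod_cast (by omega : q ≤ b * 2)
    have h3 : (N : ℝ) / b ≤ N / (q / 2) := by gcongr
    rw [hk]; push_cast
    have h4 : (N : ℝ) / (q / 2) = 2 * N / q := by field_simp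
    linarith
  have hB0 : 0 ≤ B := by positivity
  calc ∑ n ∈ range N, kq X (n • α) ≤ ∑ n ∈ range (k * b), kq X (n • α) :=
        sum_le_sum_of_subset_of_nonneg (range_mono hNk) fun _ _ _ => kq_nonneg hX _
    _ ≤ k * B := sum_range_mul_le hblock k
    _ ≤ (2 * N / q + 1) * B := by gcongr
    _ = 4 * N * X / q + 2 * X + (8 * N + 4 * q) * (1 + Real.log ((2 * q : ℕ) : ℝ)) := by
        rw [hB]; push_cast; field_simp; ring
    _ ≤ _ := by
        have : (q : ℝ) ≤ Q := by exact_mod_cast hqQ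
        gcongr

lemma log_bound {ε : ℝ} (hε : 0 < ε) : ∃ C : ℝ, 1 ≤ C ∧ ∀ X : ℕ, 1 ≤ X →
    1 + Real.log (2 * (X : ℝ) ^ 3) ≤ C * (X : ℝ) ^ ε := by
  refine ⟨2 + 3 / ε, by have : 0 < 3 / ε := by positivity
                        linarith, fun X hX => ?_⟩
  have hX' : (1 : ℝ) ≤ X := by exact_mod_cast hX
  have h1 : Real.log X ≤ (X : ℝ) ^ ε / ε := Real.log_le_rpow_div (by positivity) hε
  have h2 : 1 ≤ (X : ℝ) ^ ε := Real.one_le_rpow hX' hε.le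
  rw [Real.log_mul (by norm_num) (by positivity), Real.log_pow]
  have h3 : Real.log 2 < 1 := by linarith [Real.log_two_lt_d9]
  have e : (2 + 3 / ε) * (X : ℝ) ^ ε = 2 * (X : ℝ) ^ ε + 3 * ((X : ℝ) ^ ε / ε) := by ring
  rw [e]
  push_cast
  linarith

/-- The sum controlling Weyl differencing. -/
noncomputable def wS (X : ℕ) (α : 𝕋) : ℝ :=
  ∑ h ∈ Icc 1 X, ∑ l ∈ Icc 1 X, kq X ((6 * (h * l)) • α)

lemma wS_le_divisors (X : ℕ) (α : 𝕋) {D : ℝ} (hD0 : 0 ≤ D)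
    (hD : ∀ n : ℕ, n ≠ 0 → n ≤ X ^ 2 → (#n.divisors : ℝ) ≤ D) :
    wS X α ≤ D * ∑ n ∈ range (6 * X ^ 2 + 1), kq X (n • α) := by
  classical
  have hnn : ∀ t, 0 ≤ kq X t := kq_nonneg (Nat.cast_nonneg X)
  rw [wS, ← sum_product']
  have hmap : ∀ p ∈ Icc 1 X ×ˢ Icc 1 X, p.1 * p.2 ∈ Icc 1 (X ^ 2) := by
    rintro ⟨h, l⟩ hp
    simp only [mem_product, mem_Icc] at hp ⊢
    exact ⟨Nat.mul_pos hp.1.1 hp.2.1, by rw [sq]; exact Nat.mul_le_mul hp.1.2 hp.2.2⟩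
  rw [← sum_fiberwise_of_maps_to hmap]
  have h1 : ∀ n ∈ Icc 1 (X ^ 2), ∑ p ∈ (Icc 1 X ×ˢ Icc 1 X) with p.1 * p.2 = n,
      kq X ((6 * (p.1 * p.2)) • α) ≤ D * kq X ((6 * n) • α) := by
    intro n hn
    rw [mem_Icc] at hn
    rw [sum_congr rfl (g := fun _ => kq X ((6 * n) • α)) (fun p hp => by rw [(mem_filter.1 hp).2]),
      sum_const, nsmul_eq_mul]
    refine mul_le_mul_of_nonneg_right (le_trans ?_ (hD n (by omega) hn.2)) (hnn _)
    have : {p ∈ Icc 1 X ×ˢ Icc 1 X | p.1 * p.2 = n} ⊆ n.divisorsAntidiagonal := by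
      intro p hp
      rw [Nat.mem_divisorsAntidiagonal]
      exact ⟨(mem_filter.1 hp).2, by omega⟩
    have := card_le_card this
    rw [← Nat.map_div_right_divisors, card_map] at this
    exact_mod_cast this
  refine (sum_le_sum h1).trans ?_
  rw [← mul_sum]
  refine mul_le_mul_of_nonneg_left ?_ hD0
  have := sum_image (s := Icc 1 (X ^ 2)) (g := fun n => 6 * n) (f := fun n => kq X (n • α))
    (fun x _ y _ h => by simpa using h)
  rw [← this]
  refine sum_le_sum_of_subset_of_nonneg ?_ fun _ _ _ => hnn _
  intro m hm
  obtain ⟨n, hn, rfl⟩ := mem_image.1 hm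
  rw [mem_Icc] at hn
  rw [mem_range]
  omega

/-- `α` is within `δ` of having a multiple by some `q ≤ R` vanish. -/
def majA (R δ : ℝ) (α : 𝕋) : Prop := ∃ q : ℕ, 0 < q ∧ (q : ℝ) ≤ R ∧ ‖q • α‖ ≤ δ

lemma wS_le {ε : ℝ} (hε : 0 < ε) : ∃ C : ℝ, 1 ≤ C ∧ ∀ X : ℕ, 1 ≤ X → ∀ R : ℝ, 1 ≤ R → R ≤ X →
    ∀ α, ¬ majA R (R / (X : ℝ) ^ 3) α → wS X α ≤ C * (X : ℝ) ^ (3 + ε) / R := by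
  obtain ⟨C1, hC1, hd⟩ := card_divisors_bound (ε / 4) (by linarith)
  obtain ⟨C2, hC2, hl⟩ := log_bound (ε := ε / 2) (by linarith)
  refine ⟨C1 * (90 * C2), by nlinarith, fun X hX R hR hRX α hα => ?_⟩
  have hX' : (1 : ℝ) ≤ X := by exact_mod_cast hX
  have hX0 : (0 : ℝ) < X := by linarith
  have hR0 : 0 < R := by linarith
  have h1 := wS_le_divisors X α (D := C1 * (X : ℝ) ^ (ε / 2)) (by positivity) (by
    intro n hn hnX
    refine (hd n hn).trans ?_
    have : (n : ℝ) ≤ (X : ℝ) ^ (2 : ℝ) := by norm_cast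
    calc C1 * (n : ℝ) ^ (ε / 4) ≤ C1 * ((X : ℝ) ^ (2 : ℝ)) ^ (ε / 4) := by gcongr
      _ = C1 * (X : ℝ) ^ (ε / 2) := by rw [← Real.rpow_mul hX0.le]; ring_nf)
  have hXR : (1 : ℝ) ≤ (X : ℝ) ^ 3 / R := by
    rw [le_div_iff₀ hR0]
    nlinarith [mul_le_mul hX' hX' zero_le_one hX0.le, sq_nonneg ((X : ℝ) - 1)]
  set Q := ⌊(X : ℝ) ^ 3 / R⌋₊ with hQ
  have hQ1 : 0 < Q := Nat.floor_pos.2 hXR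
  have hQle : (Q : ℝ) ≤ (X : ℝ) ^ 3 / R := Nat.floor_le (by positivity)
  have hQlt : (X : ℝ) ^ 3 / R < Q + 1 := Nat.lt_floor_add_one _
  have hδ : 1 / ((Q : ℝ) + 1) ≤ R / (X : ℝ) ^ 3 := by
    rw [div_le_div_iff₀ (by positivity) (by positivity)]
    rw [div_lt_iff₀ hR0] at hQlt
    linarith
  have hQ0 : (0 : ℝ) < Q := by exact_mod_cast hQ1
  have h2 := sum_kq_le α hX0.le hR0 hQ1 hδ (fun q hq hqR => by
    by_contra hle
    exact hα ⟨q, hq, hqR, not_lt.1 hle⟩) (6 * X ^ 2 + 1)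
  set Z := (X : ℝ) ^ 3 / R with hZ
  have hXZ : (X : ℝ) ^ 2 ≤ Z := by
    rw [hZ, le_div_iff₀ hR0]; nlinarith [sq_nonneg (X : ℝ)]
  have hX1 : (1 : ℝ) ≤ (X : ℝ) ^ 2 := one_le_pow₀ hX'
  have hXX : (X : ℝ) ≤ (X : ℝ) ^ 2 := by nlinarith
  have hlog : 1 + Real.log (2 * Q) ≤ C2 * (X : ℝ) ^ (ε / 2) := by
    refine le_trans ?_ (hl X hX)
    gcongr
    exact hQle.trans (div_le_self (by positivity) hR)
  have hlog1 : 1 ≤ C2 * (X : ℝ) ^ (ε / 2) :=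
    one_le_mul_of_one_le_of_one_le hC2 (Real.one_le_rpow hX' (by linarith))
  have h3 : ∑ n ∈ range (6 * X ^ 2 + 1), kq X (n • α) ≤ 90 * Z * (C2 * (X : ℝ) ^ (ε / 2)) := by
    refine h2.trans ?_
    push_cast
    have a1 : 4 * (6 * (X : ℝ) ^ 2 + 1) * X / R ≤ 28 * Z := by
      rw [hZ, ← mul_div_assoc]
      refine div_le_div_of_nonneg_right ?_ hR0.le
      nlinarith [mul_le_mul_of_nonneg_right hX1 hX0.le]
    have a2 : (8 * (6 * (X : ℝ) ^ 2 + 1) + 4 * Q) * (1 + Real.log (2 * Q)) ≤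
        (60 * Z) * (C2 * (X : ℝ) ^ (ε / 2)) := by
      refine mul_le_mul (by linarith) hlog ?_ (by linarith)
      have : (1 : ℝ) ≤ Q := by exact_mod_cast hQ1
      have := Real.log_nonneg (show (1 : ℝ) ≤ 2 * Q by linarith)
      linarith
    have a3 : 30 * Z ≤ 30 * Z * (C2 * (X : ℝ) ^ (ε / 2)) :=
      le_mul_of_one_le_right (by linarith) hlog1
    linarith
  calc wS X α ≤ _ := h1
    _ ≤ C1 * (X : ℝ) ^ (ε / 2) * (90 * Z * (C2 * (X : ℝ) ^ (ε / 2))) := by gcongr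
    _ = C1 * (90 * C2) * (((X : ℝ) ^ (ε / 2) * (X : ℝ) ^ (ε / 2)) * (X : ℝ) ^ 3) / R := by
        rw [hZ]; ring
    _ = _ := by
        rw [← Real.rpow_natCast, ← Real.rpow_add hX0, ← Real.rpow_add hX0]
        congr 3
        push_cast; ring

end CQ

namespace CQ
open MeasureTheory

local notation "conj" => starRingEnd ℂ

lemma Ioc_int_succ (n : ℕ) : Ioc (0 : ℤ) ((n + 1 : ℕ) : ℤ) = insert ((n : ℤ) + 1) (Ioc 0 (n : ℤ)) := by
  ext x; simp only [mem_insert, mem_Ioc]; push_cast; omega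

lemma sum_Ioc_int_succ {E : Type*} [AddCommMonoid E] (u : ℤ → E) (n : ℕ) :
    ∑ x ∈ Ioc (0 : ℤ) ((n + 1 : ℕ) : ℤ), u x = u (n + 1) + ∑ x ∈ Ioc (0 : ℤ) n, u x := by
  rw [Ioc_int_succ, sum_insert (by simp)]

lemma sum_Ioc_int_reflect {E : Type*} [AddCommMonoid E] (u : ℤ → E) (n : ℕ) :
    ∑ l ∈ Icc 1 n, u ((n : ℤ) + 1 - l) = ∑ x ∈ Ioc (0 : ℤ) n, u x := by
  refine sum_bij (fun l _ => (n : ℤ) + 1 - l) ?_ ?_ ?_ fun _ _ => rfl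
  · intro l hl; simp only [mem_Icc, mem_Ioc] at hl ⊢; omega
  · intro a ha b hb h; simp only [mem_Icc] at ha hb; omega
  · intro x hx
    simp only [mem_Ioc] at hx
    exact ⟨(n + 1 - x).toNat, by simp only [mem_Icc]; omega, by omega⟩

/-- The squared modulus of a sum in terms of its autocorrelations. -/
lemma norm_sq_sum_eq (u : ℤ → ℂ) (n : ℕ) :
    ‖∑ x ∈ Ioc (0 : ℤ) n, u x‖ ^ 2 = ∑ x ∈ Ioc (0 : ℤ) n, ‖u x‖ ^ 2 +
      2 * (∑ l ∈ Icc 1 n, ∑ y ∈ Ioc (0 : ℤ) ((n - l : ℕ) : ℤ), u (y + l) * conj (u y)).re := by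
  induction n with
  | zero => simp
  | succ n ih =>
    have h1 : ∑ l ∈ Icc 1 (n + 1), ∑ y ∈ Ioc (0 : ℤ) ((n + 1 - l : ℕ) : ℤ), u (y + l) * conj (u y) =
        u (n + 1) * conj (∑ x ∈ Ioc (0 : ℤ) n, u x) +
        ∑ l ∈ Icc 1 n, ∑ y ∈ Ioc (0 : ℤ) ((n - l : ℕ) : ℤ), u (y + l) * conj (u y) := by
      rw [← sum_Ioc_int_reflect, map_sum, mul_sum, ← sum_add_distrib,
        sum_Icc_succ_top (by omega : 1 ≤ n + 1)]
      simp only [Nat.sub_self, Nat.cast_zero, Ioc_self, sum_empty, add_zero]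
      refine sum_congr rfl fun l hl => ?_
      rw [mem_Icc] at hl
      rw [show n + 1 - l = (n - l) + 1 by omega, sum_Ioc_int_succ]
      congr 2
      · congr 1; push_cast [Nat.cast_sub hl.2]; ring
      · congr 2; push_cast [Nat.cast_sub hl.2]; ring
    rw [h1, sum_Ioc_int_succ, sum_Ioc_int_succ, Complex.add_re, mul_add, ← Complex.normSq_eq_norm_sq,
      Complex.normSq_add, Complex.normSq_eq_norm_sq, Complex.normSq_eq_norm_sq, ih]
    ring

lemma norm_sq_sum_le (u : ℤ → ℂ) (hu : ∀ x, ‖u x‖ ≤ 1) (n : ℕ) :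
    ‖∑ x ∈ Ioc (0 : ℤ) n, u x‖ ^ 2 ≤ n +
      2 * ∑ l ∈ Icc 1 n, ‖∑ y ∈ Ioc (0 : ℤ) ((n - l : ℕ) : ℤ), u (y + l) * conj (u y)‖ := by
  rw [norm_sq_sum_eq]
  have h1 : ∑ x ∈ Ioc (0 : ℤ) n, ‖u x‖ ^ 2 ≤ n := by
    have := sum_le_card_nsmul (Ioc (0 : ℤ) n) (fun x => ‖u x‖ ^ 2) 1 fun x _ =>
      pow_le_one₀ (norm_nonneg _) (hu x)
    simpa using this
  have h2 := (Complex.re_le_norm (∑ l ∈ Icc 1 n, ∑ y ∈ Ioc (0 : ℤ) ((n - l : ℕ) : ℤ),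
    u (y + l) * conj (u y))).trans (norm_sum_le _ _)
  linarith

/-- Weyl's bound for quadratic exponential sums. -/
lemma norm_sq_quad_le (X : ℕ) (a b c : 𝕋) : ‖∑ z ∈ Ioc (0 : ℤ) X, ee ((z ^ 2) • b + z • a + c)‖ ^ 2 ≤
    X + 4 * ∑ l ∈ Icc 1 X, kq X ((2 * l) • b) := by
  refine (norm_sq_sum_le _ (fun _ => (norm_ee _).le) X).trans ?_
  rw [show (4 : ℝ) = 2 * 2 by norm_num, mul_assoc]
  gcongr
  rw [mul_sum _ _ (2 : ℝ)]
  refine sum_le_sum fun l _ => ?_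
  have h : ∀ y : ℤ, ee (((y + l) ^ 2) • b + (y + (l : ℤ)) • a + c) *
      conj (ee ((y ^ 2) • b + y • a + c)) =
      ee (y • ((2 * l) • b) + ((l ^ 2) • b + l • a)) := by
    intro y
    rw [← ee_sub]; congr 1
    module
  simp_rw [h]
  have := norm_sum_ee_le 0 (X - l) ((2 * l) • b) ((l ^ 2) • b + l • a)
  rw [zero_add] at this
  refine this.trans ?_
  gcongr
  exact kq_mono (Nat.cast_nonneg _) (by exact_mod_cast Nat.sub_le _ _) _

/-- The cubic-quadratic Weyl sum. -/
noncomputable def gS (X : ℕ) (α β : 𝕋) : ℂ := ∑ x ∈ Ioc (0 : ℤ) X, ee ((x ^ 3) • α + (x ^ 2) • β)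

@[fun_prop] lemma continuous_gS {Z : Type*} [TopologicalSpace Z] {f g : Z → 𝕋} (hf : Continuous f)
    (hg : Continuous g) (X : ℕ) : Continuous fun z => gS X (f z) (g z) := by unfold gS; fun_prop

/-- Weyl's inequality. -/
lemma norm_gS_pow_four_le (X : ℕ) (α β : 𝕋) :
    ‖gS X α β‖ ^ 4 ≤ 10 * (X : ℝ) ^ 3 + 32 * X * wS X α := by
  have h1 := norm_sq_sum_le (fun x => ee ((x ^ 3) • α + (x ^ 2) • β)) (fun _ => (norm_ee _).le) X
  set G : ℕ → ℝ := fun l => ‖∑ y ∈ Ioc (0 : ℤ) ((X - l : ℕ) : ℤ),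
    ee (((y + l) ^ 3) • α + ((y + l) ^ 2) • β) * conj (ee ((y ^ 3) • α + (y ^ 2) • β))‖ with hG
  change ‖gS X α β‖ ^ 2 ≤ X + 2 * ∑ l ∈ Icc 1 X, G l at h1
  have hX0 : (0 : ℝ) ≤ X := Nat.cast_nonneg X
  have h2 : ∀ l ∈ Icc 1 X, G l ^ 2 ≤ X + 4 * ∑ h ∈ Icc 1 X, kq X ((6 * (h * l)) • α) := by
    intro l hl
    have h : ∀ y : ℤ, ee (((y + l) ^ 3) • α + ((y + l) ^ 2) • β) *
        conj (ee ((y ^ 3) • α + (y ^ 2) • β)) =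
        ee ((y ^ 2) • ((3 * l) • α) + y • ((3 * l ^ 2) • α + (2 * l) • β) +
          ((l ^ 3) • α + (l ^ 2) • β)) := by
      intro y
      rw [← ee_sub]; congr 1
      module
    simp only [hG]
    simp_rw [h]
    refine (norm_sq_quad_le _ _ _ _).trans ?_
    have hle : ((X - l : ℕ) : ℝ) ≤ X := by exact_mod_cast Nat.sub_le _ _
    gcongr
    refine (sum_le_sum_of_subset_of_nonneg (Icc_subset_Icc_right (Nat.sub_le X l))
      fun _ _ _ => kq_nonneg (Nat.cast_nonneg _) _).trans ?_
    refine sum_le_sum fun h _ => ?_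
    rw [smul_smul, show 2 * h * (3 * l) = 6 * (h * l) by ring]
    exact kq_mono (Nat.cast_nonneg _) hle _
  have h3 : ∑ l ∈ Icc 1 X, G l ^ 2 ≤ X ^ 2 + 4 * wS X α := by
    refine (sum_le_sum h2).trans ?_
    rw [sum_add_distrib, ← mul_sum, sum_comm, wS]
    simp [sq]
  have h4 : (∑ l ∈ Icc 1 X, G l) ^ 2 ≤ X * (X ^ 2 + 4 * wS X α) := by
    refine (sq_sum_le_card_mul_sum_sq).trans ?_
    simp only [Nat.card_Icc, Nat.add_sub_cancel]
    gcongr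
  have hG0 : 0 ≤ ∑ l ∈ Icc 1 X, G l := sum_nonneg fun l _ => norm_nonneg _
  have h5 : ‖gS X α β‖ ^ 4 ≤ (X + 2 * ∑ l ∈ Icc 1 X, G l) ^ 2 := by
    rw [show ‖gS X α β‖ ^ 4 = (‖gS X α β‖ ^ 2) ^ 2 by ring]
    gcongr
  have h6 : (X : ℝ) ^ 2 ≤ X ^ 3 := by
    rcases Nat.eq_zero_or_pos X with rfl | h
    · simp
    · have : (1 : ℝ) ≤ X := by exact_mod_cast h
      exact pow_le_pow_right₀ this (by norm_num)
  nlinarith [sq_nonneg ((X : ℝ) - 2 * ∑ l ∈ Icc 1 X, G l)]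

end CQ

namespace CQ
open MeasureTheory

local notation "conj" => starRingEnd ℂ

/-- The Fejér kernel. -/
noncomputable def fj (M : ℕ) (θ : 𝕋) : ℝ := ‖∑ x ∈ Ioc (0 : ℤ) M, ee (x • θ)‖ ^ 2 / M

lemma fj_nonneg (M : ℕ) (θ : 𝕋) : 0 ≤ fj M θ := by unfold fj; positivity

lemma fj_ge (M : ℕ) (hM : 0 < M) (θ : 𝕋) (h : 8 * M * ‖θ‖ ≤ 1) : (M : ℝ) ≤ 64 * fj M θ := by
  have hM0 : (0 : ℝ) < M := by exact_mod_cast hM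
  have h1 : ‖∑ x ∈ Ioc (0 : ℤ) M, ee (x • θ) - M‖ ≤ M * (7 / 8) := by
    have e : ∑ x ∈ Ioc (0 : ℤ) M, ee (x • θ) - M = ∑ x ∈ Ioc (0 : ℤ) M, (ee (x • θ) - 1) := by
      rw [sum_sub_distrib]; simp
    rw [e]
    refine (norm_sum_le _ _).trans ?_
    have : ∀ x ∈ Ioc (0 : ℤ) M, ‖ee (x • θ) - 1‖ ≤ 7 / 8 := by
      intro x hx
      rw [mem_Ioc] at hx
      have h2 : ‖x • θ‖ ≤ M * ‖θ‖ := by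
        refine (norm_zsmul_le _ _).trans ?_
        have h0 : (0 : ℝ) ≤ x := by exact_mod_cast hx.1.le
        have h3 : (x : ℝ) ≤ M := by exact_mod_cast hx.2
        rw [Int.norm_eq_abs, abs_of_nonneg h0]
        gcongr
      have h4 := norm_ee_sub_one_le (x • θ)
      have h5 := Real.pi_lt_d2
      nlinarith [norm_nonneg (x • θ), Real.pi_pos]
    have := sum_le_card_nsmul _ _ _ this
    simpa using this
  have h2 : (M : ℝ) / 8 ≤ ‖∑ x ∈ Ioc (0 : ℤ) M, ee (x • θ)‖ := by
    have h3 := norm_sub_norm_le (M : ℂ) (M - ∑ x ∈ Ioc (0 : ℤ) M, ee (x • θ))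
    rw [sub_sub_cancel, norm_sub_rev, Complex.norm_natCast] at h3
    linarith
  rw [fj, ← mul_div_assoc, le_div_iff₀ hM0]
  nlinarith

/-- The number of dyadic scales up to `X`. -/
def lg (X : ℕ) : ℕ := Nat.log 2 X + 1

/-- A nonnegative majorant of the Dirichlet kernel. -/
noncomputable def dk (X : ℕ) (θ : 𝕋) : ℝ := ∑ k ∈ range (lg X), fj (2 ^ k) θ

lemma dk_nonneg (X : ℕ) (θ : 𝕋) : 0 ≤ dk X θ := sum_nonneg fun _ _ => fj_nonneg _ _

lemma dirichlet_le (X : ℕ) (A : ℤ) (θ : 𝕋) :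
    ‖∑ x ∈ Ioc A (A + X), ee (x • θ)‖ ≤ 512 * dk X θ := by
  set S := ‖∑ x ∈ Ioc A (A + X), ee (x • θ)‖ with hS
  have h1 : S * ‖θ‖ ≤ 1 / 2 := by simpa using norm_sum_ee_mul_le A X θ 0
  have h2 : S ≤ X := by
    refine (norm_sum_le _ _).trans ?_
    simp
  have hfj : ∀ k, k < lg X → fj (2 ^ k) θ ≤ dk X θ := fun k hk =>
    single_le_sum (f := fun k => fj (2 ^ k) θ) (fun _ _ => fj_nonneg _ _) (mem_range.2 hk)
  have hn := norm_nonneg θ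
  rcases lt_or_ge 1 (8 * ‖θ‖) with h | h
  · have h0 := hfj 0 (by simp [lg])
    have : fj (2 ^ 0) θ = 1 := by
      simp [fj, show Ioc (0 : ℤ) 1 = {1} from rfl]
    rw [this] at h0
    nlinarith [norm_nonneg (∑ x ∈ Ioc A (A + X), ee (x • θ))]
  · have hex : ∃ k, k < lg X ∧ 8 * ((2 ^ k : ℕ) : ℝ) * ‖θ‖ ≤ 1 ∧
        (k + 1 < lg X → 1 < 8 * ((2 ^ (k + 1) : ℕ) : ℝ) * ‖θ‖) := by
      by_contra hcon
      push Not at hcon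
      have hall : ∀ k, k < lg X → 8 * ((2 ^ k : ℕ) : ℝ) * ‖θ‖ ≤ 1 := by
        intro k
        induction k with
        | zero => intro _; simpa using h
        | succ k ih => intro hk; exact (hcon k (by omega) (ih (by omega))).2
      have := hcon (lg X - 1) (by simp [lg]) (hall _ (by simp [lg]))
      have h0 : 1 ≤ lg X := by simp [lg]
      omega
    obtain ⟨k, hk, hk1, hk2⟩ := hex
    have h3 := fj_ge (2 ^ k) (by positivity) θ hk1
    have h4 := hfj k hk
    rcases lt_or_ge (k + 1) (lg X) with hlt | hge
    · have h5 := hk2 hlt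
      rw [pow_succ] at h5
      push_cast at h5 h3
      have h6 : S ≤ 8 * 2 ^ k := by
        by_contra hc
        push Not at hc
        nlinarith
      linarith
    · have h5 : X < 2 ^ (k + 1) := by
        have := Nat.lt_pow_succ_log_self (b := 2) (by norm_num) X
        have e : k + 1 = Nat.log 2 X + 1 := by simp only [lg] at hge hk; omega
        rw [e]; exact this
      have h6 : (X : ℝ) < 2 ^ k * 2 := by rw [← pow_succ]; exact_mod_cast h5
      push_cast at h3
      linarith

lemma dk_expand (X : ℕ) (hX : 1 ≤ X) : ∃ c : ℤ → ℝ, (∀ h, 0 ≤ c h) ∧ (∀ h, c h ≤ lg X) ∧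
    ∀ θ, (dk X θ : ℂ) = ∑ h ∈ Ioo (-(X : ℤ)) X, (c h : ℂ) * ee (h • θ) := by
  classical
  set n : ℕ → ℤ → ℕ := fun M h => #{p ∈ Ioc (0 : ℤ) M ×ˢ Ioc (0 : ℤ) M | p.1 - p.2 = h} with hn
  have hnM : ∀ M h, n M h ≤ M := by
    intro M h
    have : n M h ≤ #(Ioc (0 : ℤ) M) := by
      refine card_le_card_of_injOn (fun p => p.1) ?_ ?_
      · intro p hp
        simp only [coe_filter, mem_product, Set.mem_ofPred_eq] at hp
        exact hp.1.1
      · intro p hp p' hp' hpp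
        simp only [coe_filter, mem_product, Set.mem_ofPred_eq] at hp hp' hpp
        ext
        · exact hpp
        · omega
    simpa using this
  refine ⟨fun h => ∑ k ∈ range (lg X), (n (2 ^ k) h : ℝ) / ((2 ^ k : ℕ) : ℝ),
    fun h => sum_nonneg fun _ _ => by positivity, fun h => ?_, fun θ => ?_⟩
  · have := sum_le_card_nsmul (range (lg X)) (fun k => (n (2 ^ k) h : ℝ) / ((2 ^ k : ℕ) : ℝ)) 1
      fun k _ => div_le_one_of_le₀ (by exact_mod_cast hnM _ _) (by positivity)
    simpa using this
  · have key : ∀ k ∈ range (lg X), (fj (2 ^ k) θ : ℂ) = ∑ h ∈ Ioo (-(X : ℤ)) X,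
        (((n (2 ^ k) h : ℝ) / ((2 ^ k : ℕ) : ℝ) : ℝ) : ℂ) * ee (h • θ) := by
      intro k hk
      have hkX : 2 ^ k ≤ X := by
        refine Nat.pow_le_of_le_log (by omega) ?_
        have := mem_range.1 hk
        simp only [lg] at this; omega
      generalize 2 ^ k = M at hkX
      rw [fj, Complex.ofReal_div, norm_sum_pow_two]
      have hmap : ∀ p ∈ Ioc (0 : ℤ) M ×ˢ Ioc (0 : ℤ) M, p.1 - p.2 ∈ Ioo (-(X : ℤ)) X := by
        intro p hp
        simp only [mem_product, mem_Ioc, mem_Ioo] at hp ⊢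
        omega
      rw [← sum_fiberwise_of_maps_to hmap, sum_div]
      refine sum_congr rfl fun h _ => ?_
      rw [sum_congr rfl (g := fun _ => ee (h • θ)) (fun p hp => by
        rw [← ee_sub, ← sub_smul, (mem_filter.1 hp).2]), sum_const, nsmul_eq_mul]
      push_cast
      ring
    rw [dk, Complex.ofReal_sum, sum_congr rfl key, sum_comm]
    refine sum_congr rfl fun h _ => ?_
    rw [Complex.ofReal_sum, sum_mul]

@[fun_prop] lemma continuous_dk (X : ℕ) : Continuous (dk X) := by unfold dk fj; fun_prop

lemma integral_ee_zsmul {m : ℤ} (hm : m ≠ 0) : ∫ θ : 𝕋, ee (m • θ) = 0 := by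
  obtain ⟨u, hu⟩ := exists_zsmul_eq m hm ((1 / 2 : ℝ) : 𝕋)
  have h2 : ee ((1 / 2 : ℝ) : 𝕋) ≠ 1 := by
    rw [Ne, ee_eq_one_iff, AddCircle.coe_eq_zero_iff]
    rintro ⟨n, hn⟩
    have h3 : (2 * n : ℝ) = 1 := by simp at hn; linarith
    have : 2 * n = 1 := by exact_mod_cast h3
    omega
  refine integral_eq_zero_of_twist volume u h2 fun x => ?_
  rw [smul_add, ee_add, hu, mul_comm]

lemma integral_dk_le (X : ℕ) (hX : 1 ≤ X) : ∫ θ, dk X θ ≤ lg X := by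
  obtain ⟨c, hc0, hcL, hc⟩ := dk_expand X hX
  have : ((∫ θ, dk X θ : ℝ) : ℂ) = (c 0 : ℂ) := by
    rw [← integral_complex_ofReal]
    simp_rw [hc]
    rw [integral_finsetSum _ fun i _ => integrable_cont _ (by fun_prop),
      sum_eq_single 0 (fun h _ hh => by rw [integral_const_mul, integral_ee_zsmul hh, mul_zero])
      (fun h => absurd (mem_Ioo.2 ⟨by omega, by omega⟩) h)]
    simp
  have h : ∫ θ, dk X θ = c 0 := by exact_mod_cast this
  rw [h]; exact hcL 0

end CQ

namespace CQ
open MeasureTheory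

/-- The point at which the kernel is evaluated after a shift by `z`. -/
noncomputable def zpt (z : ℤ) (a : G3) : 𝕋 := a.1 + (2 * z) • a.2.1 + (3 * z ^ 2) • a.2.2

/-- The averaged kernel. -/
noncomputable def kk (X : ℕ) (a : G3) : ℝ := (∑ z ∈ Ioc (0 : ℤ) X, dk X (zpt z a)) / X

@[fun_prop] lemma continuous_kk (X : ℕ) : Continuous (kk X) := by
  unfold kk zpt; fun_prop

lemma kk_nonneg (X : ℕ) (a : G3) : 0 ≤ kk X a :=
  div_nonneg (sum_nonneg fun _ _ => dk_nonneg _ _) (Nat.cast_nonneg _)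

lemma integral_ee_G3 {k l m : ℤ} (h : k ≠ 0 ∨ l ≠ 0 ∨ m ≠ 0) :
    ∫ a : G3, ee (k • a.1 + l • a.2.1 + m • a.2.2) = 0 := by
  have half : ee ((1 / 2 : ℝ) : 𝕋) ≠ 1 := by
    rw [Ne, ee_eq_one_iff, AddCircle.coe_eq_zero_iff]
    rintro ⟨n, hn⟩
    have h3 : (2 * n : ℝ) = 1 := by simp at hn; linarith
    have : 2 * n = 1 := by exact_mod_cast h3
    omega
  obtain ⟨τ, hτ⟩ : ∃ τ : G3, k • τ.1 + l • τ.2.1 + m • τ.2.2 = ((1 / 2 : ℝ) : 𝕋) := by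
    rcases h with h | h | h
    · obtain ⟨u, hu⟩ := exists_zsmul_eq k h ((1 / 2 : ℝ) : 𝕋)
      exact ⟨(u, 0, 0), by simpa using hu⟩
    · obtain ⟨u, hu⟩ := exists_zsmul_eq l h ((1 / 2 : ℝ) : 𝕋)
      exact ⟨(0, u, 0), by simpa using hu⟩
    · obtain ⟨u, hu⟩ := exists_zsmul_eq m h ((1 / 2 : ℝ) : 𝕋)
      exact ⟨(0, 0, u), by simpa using hu⟩
  refine integral_eq_zero_of_twist volume τ half fun x => ?_
  rw [← hτ, ← ee_add]
  congr 1
  simp only [Prod.fst_add, Prod.snd_add, smul_add]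
  abel

section count
variable {h₁ h₂ h₃ z₁ z₂ z₃ : ℤ}

lemma triple_cases (e0 : h₁ + h₂ + h₃ = 0) (e1 : h₁ * z₁ + h₂ * z₂ + h₃ * z₃ = 0)
    (e2 : h₁ * z₁ ^ 2 + h₂ * z₂ ^ 2 + h₃ * z₃ ^ 2 = 0) :
    (z₂ = z₁ ∧ z₃ = z₁ ∧ h₃ = -h₁ - h₂) ∨ (z₂ = z₁ ∧ h₂ = -h₁ ∧ h₃ = 0) ∨
    (z₃ = z₁ ∧ h₃ = -h₁ ∧ h₂ = 0) ∨ (z₃ = z₂ ∧ h₃ = -h₂ ∧ h₁ = 0) ∨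
    (h₁ = 0 ∧ h₂ = 0 ∧ h₃ = 0) := by
  have f1 : h₁ * ((z₁ - z₂) * (z₁ - z₃)) = 0 := by
    linear_combination e2 - (z₂ + z₃) * e1 + z₂ * z₃ * e0
  have f2 : h₂ * ((z₂ - z₁) * (z₂ - z₃)) = 0 := by
    linear_combination e2 - (z₁ + z₃) * e1 + z₁ * z₃ * e0
  have f3 : h₃ * ((z₃ - z₁) * (z₃ - z₂)) = 0 := by
    linear_combination e2 - (z₁ + z₂) * e1 + z₁ * z₂ * e0
  simp only [mul_eq_zero, sub_eq_zero] at f1 f2 f3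
  omega

end count

/-- The index set of the kernel. -/
noncomputable def kI (X : ℕ) : Finset (ℤ × ℤ) := Ioo (-(X : ℤ)) X ×ˢ Ioc (0 : ℤ) X

open Classical in
lemma card_triples (X : ℕ) : #{p ∈ kI X ×ˢ kI X ×ˢ kI X |
    p.1.1 + p.2.1.1 + p.2.2.1 = 0 ∧ p.1.1 * p.1.2 + p.2.1.1 * p.2.1.2 + p.2.2.1 * p.2.2.2 = 0 ∧
    p.1.1 * p.1.2 ^ 2 + p.2.1.1 * p.2.1.2 ^ 2 + p.2.2.1 * p.2.2.2 ^ 2 = 0} ≤ 40 * X ^ 3 := by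
  set I := Ioc (-(X : ℤ)) X with hI
  set Q := I ×ˢ I ×ˢ I with hQ
  have hQc : #Q = 8 * X ^ 3 := by
    simp only [hQ, card_product, hI, Int.card_Ioc]
    rw [show ((X : ℤ) - -X).toNat = 2 * X by omega]; ring
  set f1 : ℤ × ℤ × ℤ → (ℤ × ℤ) × (ℤ × ℤ) × (ℤ × ℤ) :=
    fun t => ((t.1, t.2.2), (t.2.1, t.2.2), (-t.1 - t.2.1, t.2.2))
  set f2 : ℤ × ℤ × ℤ → (ℤ × ℤ) × (ℤ × ℤ) × (ℤ × ℤ) :=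
    fun t => ((t.1, t.2.1), (-t.1, t.2.1), (0, t.2.2))
  set f3 : ℤ × ℤ × ℤ → (ℤ × ℤ) × (ℤ × ℤ) × (ℤ × ℤ) :=
    fun t => ((t.1, t.2.1), (0, t.2.2), (-t.1, t.2.1))
  set f4 : ℤ × ℤ × ℤ → (ℤ × ℤ) × (ℤ × ℤ) × (ℤ × ℤ) :=
    fun t => ((0, t.2.2), (t.1, t.2.1), (-t.1, t.2.1))
  set f5 : ℤ × ℤ × ℤ → (ℤ × ℤ) × (ℤ × ℤ) × (ℤ × ℤ) :=
    fun t => ((0, t.1), (0, t.2.1), (0, t.2.2))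
  have hsub : {p ∈ kI X ×ˢ kI X ×ˢ kI X |
    p.1.1 + p.2.1.1 + p.2.2.1 = 0 ∧ p.1.1 * p.1.2 + p.2.1.1 * p.2.1.2 + p.2.2.1 * p.2.2.2 = 0 ∧
    p.1.1 * p.1.2 ^ 2 + p.2.1.1 * p.2.1.2 ^ 2 + p.2.2.1 * p.2.2.2 ^ 2 = 0} ⊆
      Q.image f1 ∪ (Q.image f2 ∪ (Q.image f3 ∪ (Q.image f4 ∪ Q.image f5))) := by
    rintro ⟨⟨h₁, z₁⟩, ⟨h₂, z₂⟩, ⟨h₃, z₃⟩⟩ hp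
    simp only [mem_filter, mem_product, kI, mem_Ioo, mem_Ioc] at hp
    obtain ⟨hb, e0, e1, e2⟩ := hp
    simp only [mem_union, mem_image, hQ, mem_product, hI, mem_Ioc, Prod.exists]
    rcases triple_cases e0 e1 e2 with ⟨rfl, rfl, rfl⟩ | ⟨rfl, rfl, rfl⟩ | ⟨rfl, rfl, rfl⟩ |
      ⟨rfl, rfl, rfl⟩ | ⟨rfl, rfl, rfl⟩
    · exact Or.inl ⟨h₁, h₂, z₃, by omega, rfl⟩
    · exact Or.inr (Or.inl ⟨h₁, z₂, z₃, by omega, rfl⟩)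
    · exact Or.inr (Or.inr (Or.inl ⟨h₁, z₃, z₂, by omega, rfl⟩))
    · exact Or.inr (Or.inr (Or.inr (Or.inl ⟨h₂, z₃, z₁, by omega, rfl⟩)))
    · exact Or.inr (Or.inr (Or.inr (Or.inr ⟨z₁, z₂, z₃, by omega, rfl⟩)))
  refine (card_le_card hsub).trans ?_
  have hc : ∀ f : ℤ × ℤ × ℤ → (ℤ × ℤ) × (ℤ × ℤ) × (ℤ × ℤ), #(Q.image f) ≤ 8 * X ^ 3 := fun f =>
    card_image_le.trans hQc.le
  have u1 := card_union_le (Q.image f1) (Q.image f2 ∪ (Q.image f3 ∪ (Q.image f4 ∪ Q.image f5)))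
  have u2 := card_union_le (Q.image f2) (Q.image f3 ∪ (Q.image f4 ∪ Q.image f5))
  have u3 := card_union_le (Q.image f3) (Q.image f4 ∪ Q.image f5)
  have u4 := card_union_le (Q.image f4) (Q.image f5)
  have c1 := hc f1
  have c2 := hc f2
  have c3 := hc f3
  have c4 := hc f4
  have c5 := hc f5
  omega

lemma kk_expand (X : ℕ) (hX : 1 ≤ X) : ∃ c : ℤ → ℝ, (∀ h, 0 ≤ c h) ∧ (∀ h, c h ≤ lg X) ∧
    ∀ a, (kk X a : ℂ) = (∑ p ∈ kI X, (c p.1 : ℂ) * ee (p.1 • zpt p.2 a)) / X := by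
  obtain ⟨c, h0, hL, hc⟩ := dk_expand X hX
  refine ⟨c, h0, hL, fun a => ?_⟩
  rw [kk, Complex.ofReal_div, Complex.ofReal_sum, kI, sum_product, sum_comm]
  simp_rw [hc]
  simp

/-- The third moment of the averaged kernel. -/
lemma integral_kk_cube (X : ℕ) (hX : 1 ≤ X) : ∫ a, kk X a ^ 3 ≤ 40 * (lg X : ℝ) ^ 3 := by
  classical
  obtain ⟨c, h0, hL, hc⟩ := kk_expand X hX
  have hX0 : (0 : ℝ) < X := by exact_mod_cast hX
  have hnn : 0 ≤ ∫ a, kk X a ^ 3 := integral_nonneg fun a => pow_nonneg (kk_nonneg X a) 3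
  have key : ((∫ a, kk X a ^ 3 : ℝ) : ℂ) = ∑ p ∈ kI X ×ˢ kI X ×ˢ kI X, ∫ a : G3,
      ((c p.1.1 * c p.2.1.1 * c p.2.2.1 / X ^ 3 : ℝ) : ℂ) *
      ee (p.1.1 • zpt p.1.2 a + p.2.1.1 • zpt p.2.1.2 a + p.2.2.1 • zpt p.2.2.2 a) := by
    rw [← integral_complex_ofReal, ← integral_finsetSum _ fun i _ => integrable_cont _ (by
      unfold zpt; fun_prop)]
    refine integral_congr_ae (ae_of_all _ fun a => ?_)
    show ((kk X a ^ 3 : ℝ) : ℂ) = _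
    push_cast
    rw [hc, div_pow, pow_three, sum_mul_sum, ← sum_product', sum_mul_sum, ← sum_product', sum_div]
    refine sum_congr rfl fun p _ => ?_
    rw [ee_add, ee_add]; ring
  have h1 : ∫ a, kk X a ^ 3 = ‖((∫ a, kk X a ^ 3 : ℝ) : ℂ)‖ := by
    rw [Complex.norm_real, Real.norm_of_nonneg hnn]
  have hterm : ∀ p ∈ kI X ×ˢ kI X ×ˢ kI X, ‖∫ a : G3,
      ((c p.1.1 * c p.2.1.1 * c p.2.2.1 / X ^ 3 : ℝ) : ℂ) *
      ee (p.1.1 • zpt p.1.2 a + p.2.1.1 • zpt p.2.1.2 a + p.2.2.1 • zpt p.2.2.2 a)‖ ≤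
      if (p.1.1 + p.2.1.1 + p.2.2.1 = 0 ∧
        p.1.1 * p.1.2 + p.2.1.1 * p.2.1.2 + p.2.2.1 * p.2.2.2 = 0 ∧
        p.1.1 * p.1.2 ^ 2 + p.2.1.1 * p.2.1.2 ^ 2 + p.2.2.1 * p.2.2.2 ^ 2 = 0)
      then (lg X : ℝ) ^ 3 / X ^ 3 else 0 := by
    rintro ⟨⟨h₁, z₁⟩, ⟨h₂, z₂⟩, ⟨h₃, z₃⟩⟩ -
    simp only
    rw [integral_const_mul]
    have hph : ∀ a : G3, h₁ • zpt z₁ a + h₂ • zpt z₂ a + h₃ • zpt z₃ a = (h₁ + h₂ + h₃) • a.1 +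
        (2 * (h₁ * z₁ + h₂ * z₂ + h₃ * z₃)) • a.2.1 +
        (3 * (h₁ * z₁ ^ 2 + h₂ * z₂ ^ 2 + h₃ * z₃ ^ 2)) • a.2.2 := by
      intro a; simp only [zpt]; module
    simp_rw [hph]
    split_ifs with h
    · rw [norm_mul, Complex.norm_real, Real.norm_of_nonneg (by
        have := h0 h₁; have := h0 h₂; have := h0 h₃; positivity)]
      have hb : ‖∫ a : G3, ee ((h₁ + h₂ + h₃) • a.1 + (2 * (h₁ * z₁ + h₂ * z₂ + h₃ * z₃)) • a.2.1 +
        (3 * (h₁ * z₁ ^ 2 + h₂ * z₂ ^ 2 + h₃ * z₃ ^ 2)) • a.2.2)‖ ≤ 1 := by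
        refine (norm_integral_le_of_norm_le_const (C := 1) (ae_of_all _ fun a => (norm_ee _).le)).trans ?_
        simp
      refine (mul_le_of_le_one_right (by
        have := h0 h₁; have := h0 h₂; have := h0 h₃; positivity) hb).trans ?_
      have := h0 h₁; have := h0 h₂; have := h0 h₃
      rw [pow_three (lg X : ℝ), ← mul_assoc]
      gcongr <;> exact hL _
    · rw [integral_ee_G3 (by by_contra hcon; push Not at hcon; omega), mul_zero, norm_zero]
  rw [h1, key]
  refine (norm_sum_le _ _).trans ((sum_le_sum hterm).trans ?_)
  rw [← sum_filter, sum_const, nsmul_eq_mul]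
  have := card_triples X
  have hc' : (#{p ∈ kI X ×ˢ kI X ×ˢ kI X |
    p.1.1 + p.2.1.1 + p.2.2.1 = 0 ∧ p.1.1 * p.1.2 + p.2.1.1 * p.2.1.2 + p.2.2.1 * p.2.2.2 = 0 ∧
    p.1.1 * p.1.2 ^ 2 + p.2.1.1 * p.2.1.2 ^ 2 + p.2.2.1 * p.2.2.2 ^ 2 = 0} : ℝ) ≤ 40 * X ^ 3 := by
    exact_mod_cast (le_of_eq (by congr)).trans this
  calc _ ≤ (40 * (X : ℝ) ^ 3) * ((lg X : ℝ) ^ 3 / X ^ 3) := by gcongr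
    _ = _ := by field_simp

lemma sum_Ioo_le (X : ℕ) (f : ℕ → ℝ) (hf : ∀ n, 0 ≤ f n) :
    ∑ h ∈ Ioo (-(X : ℤ)) X, f h.natAbs ≤ f 0 + 2 * ∑ h ∈ Icc 1 X, f h := by
  classical
  have hsub : Ioo (-(X : ℤ)) X ⊆ insert 0 ((Icc 1 X).image (fun h : ℕ => (h : ℤ)) ∪
      (Icc 1 X).image (fun h : ℕ => -(h : ℤ))) := by
    intro h hh
    simp only [mem_Ioo, mem_insert, mem_union, mem_image, mem_Icc] at hh ⊢
    rcases lt_trichotomy h 0 with h0 | h0 | h0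
    · exact Or.inr (Or.inr ⟨h.natAbs, by omega, by omega⟩)
    · exact Or.inl h0
    · exact Or.inr (Or.inl ⟨h.natAbs, by omega, by omega⟩)
  refine (sum_le_sum_of_subset_of_nonneg hsub fun _ _ _ => hf _).trans ?_
  have h0 : (0 : ℤ) ∉ (Icc 1 X).image (fun h : ℕ => (h : ℤ)) ∪
      (Icc 1 X).image (fun h : ℕ => -(h : ℤ)) := by
    simp only [mem_union, mem_image, mem_Icc]; rintro (⟨a, h1, h2⟩ | ⟨a, h1, h2⟩) <;> omega
  rw [sum_insert h0, Int.natAbs_zero]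
  gcongr
  have hu := sum_union_inter (s₁ := (Icc 1 X).image (fun h : ℕ => (h : ℤ)))
    (s₂ := (Icc 1 X).image (fun h : ℕ => -(h : ℤ))) (f := fun h : ℤ => f h.natAbs)
  have hi : 0 ≤ ∑ h ∈ (Icc 1 X).image (fun h : ℕ => (h : ℤ)) ∩
    (Icc 1 X).image (fun h : ℕ => -(h : ℤ)), f h.natAbs := sum_nonneg fun _ _ => hf _
  rw [sum_image (fun _ _ _ _ h => by simpa using h), sum_image (fun _ _ _ _ h => by simpa using h)]
    at hu
  simp only [Int.natAbs_natCast, Int.natAbs_neg] at hu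
  linarith

/-- The pointwise bound for the averaged kernel. -/
lemma kk_sq_le (X : ℕ) (hX : 1 ≤ X) (a : G3) :
    kk X a ^ 2 ≤ 2 * (lg X : ℝ) ^ 2 * (3 * X + 8 * wS X a.2.2 / X) := by
  obtain ⟨c, h0, hL, hc⟩ := kk_expand X hX
  have hX0 : (0 : ℝ) < X := by exact_mod_cast hX
  set S : ℤ → ℝ := fun h => ‖∑ z ∈ Ioc (0 : ℤ) X, ee (h • zpt z a)‖ with hS
  have h1 : kk X a ≤ (lg X : ℝ) * (∑ h ∈ Ioo (-(X : ℤ)) X, S h) / X := by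
    have : kk X a = ‖(kk X a : ℂ)‖ := by
      rw [Complex.norm_real, Real.norm_of_nonneg (kk_nonneg X a)]
    rw [this, hc, norm_div, Complex.norm_natCast]
    gcongr
    rw [kI, sum_product, mul_sum]
    refine (norm_sum_le _ _).trans (sum_le_sum fun h _ => ?_)
    simp only
    rw [← mul_sum, norm_mul, Complex.norm_real, Real.norm_of_nonneg (h0 h)]
    exact mul_le_mul_of_nonneg_right (hL h) (norm_nonneg _)
  set f : ℕ → ℝ := fun h => if h = 0 then (X : ℝ) ^ 2 else
    X + 4 * ∑ l ∈ Icc 1 X, kq X ((6 * (h * l)) • a.2.2) with hf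
  have hf0 : ∀ n, 0 ≤ f n := fun n => by
    simp only [hf]
    split_ifs
    · positivity
    · have : 0 ≤ ∑ l ∈ Icc 1 X, kq X ((6 * (n * l)) • a.2.2) :=
        sum_nonneg fun _ _ => kq_nonneg hX0.le _
      positivity
  have h2 : ∀ h : ℤ, S h ^ 2 ≤ f h.natAbs := by
    intro h
    simp only [hf]
    split_ifs with hh
    · have : S h ≤ X := by
        refine (norm_sum_le _ _).trans ?_
        simp
      exact pow_le_pow_left₀ (norm_nonneg _) this 2
    · have e : ∀ z : ℤ, h • zpt z a = (z ^ 2) • ((3 * h) • a.2.2) + z • ((2 * h) • a.2.1) + h • a.1 := by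
        intro z; simp only [zpt]; module
      simp only [hS, e]
      refine (norm_sq_quad_le _ _ _ _).trans ?_
      gcongr with l hl
      rcases Int.natAbs_eq h with h' | h'
      · have : (2 * l) • (3 * h) • a.2.2 = (6 * (h.natAbs * l)) • a.2.2 := by
          rw [← natCast_zsmul, ← natCast_zsmul, smul_smul]; congr 1; push_cast
          rw [← Int.natCast_natAbs, ← h']; ring
        rw [this]
      · have : (2 * l) • (3 * h) • a.2.2 = -((6 * (h.natAbs * l)) • a.2.2) := by
          rw [← natCast_zsmul, ← natCast_zsmul, smul_smul, ← neg_smul]; congr 1; push_cast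
          rw [← Int.natCast_natAbs]
          have : (h.natAbs : ℤ) = -h := by omega
          rw [this]; ring
        rw [this, kq_neg]
  have h3 : ∑ h ∈ Ioo (-(X : ℤ)) X, S h ^ 2 ≤ 3 * X ^ 2 + 8 * wS X a.2.2 := by
    refine (sum_le_sum fun h _ => h2 h).trans ((sum_Ioo_le X f hf0).trans ?_)
    have e : ∑ h ∈ Icc 1 X, f h = X * X + 4 * wS X a.2.2 := by
      rw [wS, mul_sum, sum_congr rfl (g := fun h : ℕ => (X : ℝ) +
        4 * ∑ l ∈ Icc 1 X, kq X ((6 * (h * l)) • a.2.2))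
        (fun h hh => by simp only [hf]; rw [if_neg (by rw [mem_Icc] at hh; omega)]), sum_add_distrib]
      simp
    rw [e]
    simp only [hf, if_true]
    linarith
  have h4 : (∑ h ∈ Ioo (-(X : ℤ)) X, S h) ^ 2 ≤ 2 * X * (3 * X ^ 2 + 8 * wS X a.2.2) := by
    refine sq_sum_le_card_mul_sum_sq.trans ?_
    refine mul_le_mul ?_ h3 (sum_nonneg fun _ _ => by positivity) (by positivity)
    rw [Int.card_Ioo]
    exact_mod_cast (by omega : ((X : ℤ) - -X - 1).toNat ≤ 2 * X)
  calc kk X a ^ 2 ≤ ((lg X : ℝ) * (∑ h ∈ Ioo (-(X : ℤ)) X, S h) / X) ^ 2 :=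
        pow_le_pow_left₀ (kk_nonneg X a) h1 2
    _ = (lg X : ℝ) ^ 2 / X ^ 2 * (∑ h ∈ Ioo (-(X : ℤ)) X, S h) ^ 2 := by ring
    _ ≤ (lg X : ℝ) ^ 2 / X ^ 2 * (2 * X * (3 * X ^ 2 + 8 * wS X a.2.2)) := by gcongr
    _ = _ := by field_simp

lemma continuous_integral {Z Y : Type*} [TopologicalSpace Z] [FirstCountableTopology Z]
    [LocallyCompactSpace Z] [TopologicalSpace Y] [CompactSpace Y] [MeasurableSpace Y]
    [OpensMeasurableSpace Y] {μ : Measure Y} [IsFiniteMeasure μ] {f : Z → Y → ℝ}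
    (hf : Continuous fun p : Z × Y => f p.1 p.2) : Continuous fun z => ∫ y, f z y ∂μ := by
  simpa using continuous_parametric_integral_of_continuous (μ := μ) (f := f) hf isCompact_univ

lemma gS_eq_integral (X : ℕ) {z : ℤ} (hz : z ∈ Ioc (0 : ℤ) X) (α β : 𝕋) :
    gS X α β = ee ((z ^ 2) • β - (z ^ 3) • α) * ∫ θ : 𝕋, fS (Ioc 0 (2 * X))
      (θ + (3 * z ^ 2) • α - (2 * z) • β, β - (3 * z) • α, α) *
        ∑ y ∈ Ioc z (z + X), ee (y • (-θ)) := by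
  rw [mem_Ioc] at hz
  set b : ℤ → 𝕋 := fun y => y • ((3 * z ^ 2) • α - (2 * z) • β) + (y ^ 2) • (β - (3 * z) • α) +
    (y ^ 3) • α with hb
  have h1 : ∀ θ : 𝕋, fS (Ioc 0 (2 * X))
      (θ + (3 * z ^ 2) • α - (2 * z) • β, β - (3 * z) • α, α) *
        ∑ y ∈ Ioc z (z + X), ee (y • (-θ)) =
      ∑ y ∈ Ioc (0 : ℤ) (2 * X), ∑ w ∈ Ioc z (z + X), ee (b y) * ee ((y - w) • θ) := by
    intro θ
    rw [fS, sum_mul_sum]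
    refine sum_congr rfl fun y _ => sum_congr rfl fun w _ => ?_
    rw [← ee_add, ← ee_add]
    congr 1
    simp only [ph, hb]
    module
  simp_rw [h1]
  rw [integral_finsetSum _ fun i _ => integrable_cont _ (by fun_prop)]
  have h2 : ∀ y ∈ Ioc (0 : ℤ) (2 * X), ∫ θ : 𝕋, ∑ w ∈ Ioc z (z + X), ee (b y) * ee ((y - w) • θ) =
      if y ∈ Ioc z (z + X) then ee (b y) else 0 := by
    intro y _
    rw [integral_finsetSum _ fun i _ => integrable_cont _ (by fun_prop)]
    simp_rw [integral_const_mul]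
    have : ∀ w ∈ Ioc z (z + X), ee (b y) * ∫ θ : 𝕋, ee ((y - w) • θ) = if w = y then ee (b y) else 0 := by
      intro w _
      split_ifs with h
      · subst h; simp [ee_zero]
      · rw [integral_ee_zsmul (by omega), mul_zero]
    rw [sum_congr rfl this, sum_ite_eq']
  rw [sum_congr rfl h2, ← sum_filter, mul_sum, gS]
  refine sum_bij (fun x _ => x + z) ?_ ?_ ?_ ?_
  · intro x hx; rw [mem_Ioc] at hx; rw [mem_filter, mem_Ioc, mem_Ioc]; omega
  · intro x _ y _ h; simpa using h
  · intro y hy; rw [mem_filter, mem_Ioc, mem_Ioc] at hy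
    exact ⟨y - z, by rw [mem_Ioc]; omega, by ring⟩
  · intro x _
    rw [← ee_add]
    congr 1
    simp only [hb]
    module

lemma jensen_pow {f w : 𝕋 → ℝ} (hf : Continuous f) (hw : Continuous w) (hf0 : ∀ x, 0 ≤ f x)
    (hw0 : ∀ x, 0 ≤ w x) {m : ℕ} (hm : 2 ≤ m) :
    (∫ x, f x * w x) ^ m ≤ (∫ x, f x ^ m * w x) * (∫ x, w x) ^ (m - 1) := by
  have hm0 : (0 : ℝ) < m := by exact_mod_cast (by omega : 0 < m)
  have hm1 : (1 : ℝ) < m := by exact_mod_cast hm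
  have h := holder_cont volume (f := fun x => f x ^ m * w x) (g := w) (by fun_prop) hw
    (fun x => mul_nonneg (pow_nonneg (hf0 x) m) (hw0 x)) hw0 (θ := 1 / m) (by positivity)
    (by rw [div_lt_one hm0]; exact hm1)
  have e : ∀ x, (f x ^ m * w x) ^ (1 / (m : ℝ)) * w x ^ (1 - 1 / (m : ℝ)) = f x * w x := by
    intro x
    rw [Real.mul_rpow (pow_nonneg (hf0 x) m) (hw0 x), one_div, Real.pow_rpow_inv_natCast (hf0 x) (by omega),
      mul_assoc]
    congr 1
    rcases (hw0 x).eq_or_lt with h0 | h0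
    · rw [← h0, Real.zero_rpow (by positivity), zero_mul]
    · rw [← Real.rpow_add h0]; simp
  simp_rw [e] at h
  have n1 : 0 ≤ ∫ x, f x ^ m * w x :=
    integral_nonneg fun x => mul_nonneg (pow_nonneg (hf0 x) m) (hw0 x)
  have n2 : 0 ≤ ∫ x, w x := integral_nonneg hw0
  refine (pow_le_pow_left₀ (integral_nonneg fun x => mul_nonneg (hf0 x) (hw0 x)) h m).trans_eq ?_
  rw [mul_pow, one_div, Real.rpow_inv_natCast_pow n1 (by omega), ← Real.rpow_natCast (_ ^ _) m,
    ← Real.rpow_mul n2, ← Real.rpow_natCast _ (m - 1)]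
  congr 2
  rw [Nat.cast_sub (by omega)]
  field_simp
  simp

lemma gS_pow_le (X : ℕ) (hX : 1 ≤ X) {z : ℤ} (hz : z ∈ Ioc (0 : ℤ) X) (α β : 𝕋) {m : ℕ} (hm : 2 ≤ m) :
    ‖gS X α β‖ ^ m ≤ 512 ^ m * (lg X : ℝ) ^ (m - 1) * ∫ θ : 𝕋, ‖fS (Ioc 0 (2 * X))
      (θ + (3 * z ^ 2) • α - (2 * z) • β, β - (3 * z) • α, α)‖ ^ m * dk X θ := by
  have h1 : ‖gS X α β‖ ≤ 512 * ∫ θ : 𝕋, ‖fS (Ioc 0 (2 * X))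
      (θ + (3 * z ^ 2) • α - (2 * z) • β, β - (3 * z) • α, α)‖ * dk X θ := by
    rw [gS_eq_integral X hz, norm_mul, norm_ee, one_mul, ← integral_const_mul]
    refine (norm_integral_le_integral_norm _).trans (integral_mono (integrable_cont _ (by fun_prop))
      (integrable_cont _ (by fun_prop)) fun θ => ?_)
    simp only
    rw [norm_mul]
    have : ‖∑ y ∈ Ioc z (z + X), ee (y • (-θ))‖ ≤ 512 * dk X θ := by
      refine le_trans (le_of_eq ?_) (dirichlet_le X z θ)
      simp_rw [smul_neg, ee_neg]
      rw [← map_sum, Complex.norm_conj]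
    calc _ ≤ _ := mul_le_mul_of_nonneg_left this (norm_nonneg _)
      _ = _ := by ring
  have h2 := jensen_pow (f := fun θ : 𝕋 => ‖fS (Ioc 0 (2 * X))
      (θ + (3 * z ^ 2) • α - (2 * z) • β, β - (3 * z) • α, α)‖) (w := dk X) (by fun_prop) (by fun_prop)
      (fun _ => norm_nonneg _) (dk_nonneg X) hm
  have n0 : 0 ≤ ∫ θ, dk X θ := integral_nonneg (dk_nonneg X)
  have n1 : 0 ≤ ∫ θ : 𝕋, ‖fS (Ioc 0 (2 * X))
      (θ + (3 * z ^ 2) • α - (2 * z) • β, β - (3 * z) • α, α)‖ ^ m * dk X θ :=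
    integral_nonneg fun θ => mul_nonneg (by positivity) (dk_nonneg X θ)
  calc ‖gS X α β‖ ^ m ≤ _ := pow_le_pow_left₀ (norm_nonneg _) h1 m
    _ = 512 ^ m * (∫ θ : 𝕋, ‖fS (Ioc 0 (2 * X))
      (θ + (3 * z ^ 2) • α - (2 * z) • β, β - (3 * z) • α, α)‖ * dk X θ) ^ m := by rw [mul_pow]
    _ ≤ 512 ^ m * (_ * (lg X : ℝ) ^ (m - 1)) := by
        refine mul_le_mul_of_nonneg_left (h2.trans ?_) (by positivity)
        exact mul_le_mul_of_nonneg_left (pow_le_pow_left₀ n0 (integral_dk_le X hX) _) n1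
    _ = _ := by ring

/-- Moments of the cubic-quadratic sum in terms of the Vinogradov sum, by shifting variables. -/
lemma gS_moment_le (X : ℕ) (hX : 1 ≤ X) (α : 𝕋) {m : ℕ} (hm : 2 ≤ m) :
    ∫ β, ‖gS X α β‖ ^ m ≤ 512 ^ m * (lg X : ℝ) ^ (m - 1) *
      ∫ b : 𝕋, ∫ a : 𝕋, ‖fS (Ioc 0 (2 * X)) (a, b, α)‖ ^ m * kk X (a, b, α) := by
  have hX0 : (0 : ℝ) < X := by exact_mod_cast hX
  have h1 : ∀ z ∈ Ioc (0 : ℤ) X, ∫ β, ‖gS X α β‖ ^ m ≤ 512 ^ m * (lg X : ℝ) ^ (m - 1) *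
      ∫ b : 𝕋, ∫ a : 𝕋, ‖fS (Ioc 0 (2 * X)) (a, b, α)‖ ^ m * dk X (zpt z (a, b, α)) := by
    intro z hz
    set H : 𝕋 → 𝕋 → ℝ := fun b a => ‖fS (Ioc 0 (2 * X)) (a, b, α)‖ ^ m * dk X (zpt z (a, b, α))
      with hH
    have hHc : Continuous fun p : 𝕋 × 𝕋 => H p.1 p.2 := by simp only [hH, zpt]; fun_prop
    have e1 : ∀ β : 𝕋, ∫ θ : 𝕋, ‖fS (Ioc 0 (2 * X))
        (θ + (3 * z ^ 2) • α - (2 * z) • β, β - (3 * z) • α, α)‖ ^ m * dk X θ =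
        ∫ a, H (β - (3 * z) • α) a := by
      intro β
      rw [← integral_add_right_eq_self (H (β - (3 * z) • α)) ((3 * z ^ 2) • α - (2 * z) • β)]
      refine integral_congr_ae (.of_forall fun θ => ?_)
      simp only [hH, zpt]
      congr 3
      · rw [add_sub_assoc]
      · module
    have e2 : ∫ b, ∫ a, H b a = ∫ β : 𝕋, ∫ a, H (β - (3 * z) • α) a :=
      (integral_sub_right_eq_self (fun b => ∫ a, H b a) ((3 * z) • α)).symm
    rw [e2, ← integral_const_mul]
    refine integral_mono (integrable_cont _ (by fun_prop)) (integrable_cont _ ?_) fun β => ?_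
    · exact continuous_const.mul ((continuous_integral hHc).comp (by fun_prop))
    · simp only
      rw [← e1]
      exact gS_pow_le X hX hz α β hm
  have h2 : ∫ b : 𝕋, ∫ a : 𝕋, ‖fS (Ioc 0 (2 * X)) (a, b, α)‖ ^ m * kk X (a, b, α) =
      (∑ z ∈ Ioc (0 : ℤ) X, ∫ b : 𝕋, ∫ a : 𝕋,
        ‖fS (Ioc 0 (2 * X)) (a, b, α)‖ ^ m * dk X (zpt z (a, b, α))) / X := by
    rw [← integral_finsetSum, ← integral_div]
    · congr 1; ext b
      rw [← integral_finsetSum, ← integral_div]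
      · congr 1; ext a
        rw [kk, ← mul_sum, mul_div_assoc]
      · exact fun z _ => integrable_cont _ (by unfold zpt; fun_prop)
    · exact fun z _ => integrable_cont _ (continuous_integral (by unfold zpt; fun_prop))
  rw [h2, ← mul_div_assoc, le_div_iff₀ hX0, mul_sum]
  refine le_trans (le_of_eq ?_) (sum_le_sum h1)
  simp [mul_comm]

lemma integral_G3 {h : G3 → ℝ} (hh : Continuous h) : ∫ a, h a = ∫ c : 𝕋, ∫ b : 𝕋, ∫ a : 𝕋, h (a, b, c) := by
  have e1 : ∫ a, h a = ∫ p : 𝕋 × 𝕋, ∫ a : 𝕋, h (a, p) := integral_prod_symm h (integrable_cont _ hh)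
  have hc : Continuous fun p : 𝕋 × 𝕋 => ∫ a : 𝕋, h (a, p) := continuous_integral (by fun_prop)
  rw [e1]
  exact integral_prod_symm _ (integrable_cont _ hc)

lemma isClosed_majA (R δ : ℝ) : IsClosed {α | majA R δ α} := by
  have : {α | majA R δ α} = ⋃ q ∈ {q : ℕ | 0 < q ∧ (q : ℝ) ≤ R}, {α : 𝕋 | ‖q • α‖ ≤ δ} := by
    ext α; simp [majA, and_assoc]
  rw [this]
  refine Set.Finite.isClosed_biUnion ?_ fun q _ => isClosed_le (by fun_prop) continuous_const
  refine (Set.finite_Iic ⌊R⌋₊).subset fun q hq => ?_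
  exact Nat.le_floor hq.2

lemma volume_majA_le {R δ : ℝ} (hR : 0 ≤ R) (hδ : 0 ≤ δ) :
    (volume : Measure 𝕋).real {α | majA R δ α} ≤ R * (2 * δ) := by
  have h1 : {α | majA R δ α} ⊆ ⋃ q ∈ Icc 1 ⌊R⌋₊, {α : 𝕋 | ‖q • α‖ ≤ δ} := by
    rintro α ⟨q, h0, hq, h⟩
    simp only [Set.mem_iUnion]
    exact ⟨q, by rw [mem_Icc]; exact ⟨h0, Nat.le_floor hq⟩, h⟩
  have h2 : ∀ q ∈ Icc 1 ⌊R⌋₊, (volume : Measure 𝕋).real {α : 𝕋 | ‖q • α‖ ≤ δ} ≤ 2 * δ := by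
    intro q hq
    rw [mem_Icc] at hq
    let φ : 𝕋 →+ 𝕋 := nsmulAddMonoidHom q
    have hs : Function.Surjective φ := fun t => by
      obtain ⟨u, hu⟩ := exists_zsmul_eq q (by omega) t
      exact ⟨u, by simpa [φ] using hu⟩
    have mp : MeasurePreserving φ volume volume :=
      AddMonoidHom.measurePreserving (by simp only [φ]; exact continuous_nsmul q) hs rfl
    have e : {α : 𝕋 | ‖q • α‖ ≤ δ} = φ ⁻¹' (Metric.closedBall 0 δ) := by
      ext α; simp [φ]
    rw [e, measureReal_def, mp.measure_preimage measurableSet_closedBall.nullMeasurableSet,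
      AddCircle.volume_closedBall, ENNReal.toReal_ofReal (by positivity)]
    exact min_le_right _ _
  calc _ ≤ (volume : Measure 𝕋).real (⋃ q ∈ Icc 1 ⌊R⌋₊, {α : 𝕋 | ‖q • α‖ ≤ δ}) := measureReal_mono h1 (measure_ne_top _ _)
    _ ≤ ∑ q ∈ Icc 1 ⌊R⌋₊, (volume : Measure 𝕋).real {α : 𝕋 | ‖q • α‖ ≤ δ} :=
        measureReal_biUnion_finset_le _ _
    _ ≤ ∑ q ∈ Icc 1 ⌊R⌋₊, 2 * δ := sum_le_sum h2
    _ = ⌊R⌋₊ * (2 * δ) := by simp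
    _ ≤ _ := by gcongr; exact Nat.floor_le hR

open Classical in
lemma card_quads_le (X : ℕ) {D : ℝ} (hD0 : 0 ≤ D)
    (hD : ∀ n : ℕ, n ≠ 0 → n ≤ X ^ 2 → (#n.divisors : ℝ) ≤ D) :
    (#{k ∈ Ioc (0 : ℤ) X ×ˢ Ioc (0 : ℤ) X ×ˢ Ioc (0 : ℤ) X ×ˢ Ioc (0 : ℤ) X |
      k.1 ^ 2 + k.2.1 ^ 2 = k.2.2.1 ^ 2 + k.2.2.2 ^ 2} : ℝ) ≤ (X : ℝ) ^ 2 * (1 + D) := by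
  set I := Ioc (0 : ℤ) X with hI
  set G := {k ∈ I ×ˢ I ×ˢ I ×ˢ I | k.1 ^ 2 + k.2.1 ^ 2 = k.2.2.1 ^ 2 + k.2.2.2 ^ 2} with hG
  have cI : #I = X := by simp [hI]
  have hmem : ∀ k ∈ G, (k.1 ∈ I ∧ k.2.1 ∈ I ∧ k.2.2.1 ∈ I ∧ k.2.2.2 ∈ I) ∧
      k.1 ^ 2 + k.2.1 ^ 2 = k.2.2.1 ^ 2 + k.2.2.2 ^ 2 := by
    intro k hk
    simpa only [hG, mem_filter, mem_product] using hk
  have h1 : (#{k ∈ G | k.1 = k.2.2.1} : ℝ) ≤ (X : ℝ) ^ 2 := by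
    have : #{k ∈ G | k.1 = k.2.2.1} ≤ #(I ×ˢ I) := by
      refine card_le_card_of_injOn (fun k => (k.1, k.2.1)) ?_ ?_
      · intro k hk
        rw [mem_coe, mem_filter] at hk
        exact mem_coe.2 (mem_product.2 ⟨(hmem k hk.1).1.1, (hmem k hk.1).1.2.1⟩)
      · rintro ⟨a, b, c, d⟩ hk ⟨a', b', c', d'⟩ hk' h
        rw [mem_coe, mem_filter] at hk hk'
        obtain ⟨⟨_, q2, _, q4⟩, q5⟩ := hmem _ hk.1
        obtain ⟨⟨_, r2, _, r4⟩, r5⟩ := hmem _ hk'.1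
        have k2 := hk.2
        have k2' := hk'.2
        simp only [hI, mem_Ioc, Prod.mk.injEq] at *
        obtain ⟨rfl, rfl⟩ := h
        subst k2 k2'
        have e1 : b ^ 2 = d ^ 2 := by linarith
        have e2 : b ^ 2 = d' ^ 2 := by linarith
        have : d = d' := (pow_left_inj₀ (by omega) (by omega) two_ne_zero).1 (e1.symm.trans e2)
        simp [this]
    rw [card_product, cI] at this
    calc _ ≤ ((X * X : ℕ) : ℝ) := by exact_mod_cast this
      _ = _ := by push_cast; ring
  have h2 : (#{k ∈ G | ¬ k.1 = k.2.2.1} : ℝ) ≤ D * (X : ℝ) ^ 2 := by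
    set f : ℤ × ℤ × ℤ × ℤ → ℤ × ℤ := fun k => (k.1, k.2.2.1) with hf
    have him : ∀ k ∈ ({k ∈ G | ¬ k.1 = k.2.2.1}), f k ∈ I ×ˢ I := by
      intro k hk
      rw [mem_filter] at hk
      exact mem_product.2 ⟨(hmem k hk.1).1.1, (hmem k hk.1).1.2.2.1⟩
    rw [card_eq_sum_card_fiberwise him]
    push_cast
    have hb : ∀ p ∈ I ×ˢ I, (#{k ∈ {k ∈ G | ¬ k.1 = k.2.2.1} | f k = p} : ℝ) ≤ D := by
      rintro ⟨a, c⟩ hp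
      rw [mem_product] at hp
      by_cases hac : a = c
      · rw [filter_eq_empty_iff.2]
        · simpa using hD0
        · rintro k hk hk2
          rw [mem_filter] at hk
          simp only [hf, Prod.mk.injEq] at hk2
          exact hk.2 (by rw [hk2.1, hk2.2, hac])
      · have hp1 := hp.1
        have hp2 := hp.2
        simp only [hI, mem_Ioc] at hp1 hp2
        have hn : (a ^ 2 - c ^ 2).natAbs ≠ 0 := by
          rw [Int.natAbs_ne_zero]
          intro h
          exact hac ((pow_left_inj₀ hp1.1.le hp2.1.le two_ne_zero).1 (by linarith))
        have hnX : (a ^ 2 - c ^ 2).natAbs ≤ X ^ 2 := by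
          zify
          rw [abs_le]
          constructor <;> nlinarith [sq_nonneg a, sq_nonneg c]
        refine le_trans ?_ (hD _ hn hnX)
        norm_cast
        refine card_le_card_of_injOn (fun k => (k.2.1 + k.2.2.2).natAbs) ?_ ?_
        · rintro ⟨a', b, c', d⟩ hk
          rw [mem_coe, mem_filter, mem_filter] at hk
          obtain ⟨_, q5⟩ := hmem _ hk.1.1
          have k2 := hk.2
          simp only [hf, Prod.mk.injEq] at k2 q5
          obtain ⟨rfl, rfl⟩ := k2
          rw [mem_coe, Nat.mem_divisors]
          refine ⟨Int.natAbs_dvd_natAbs.2 ⟨d - b, ?_⟩, hn⟩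
          simp only
          linarith
        · rintro ⟨a', b, c', d⟩ hk ⟨a'', b', c'', d'⟩ hk' h
          rw [mem_coe, mem_filter, mem_filter] at hk hk'
          obtain ⟨⟨_, q2, _, q4⟩, q5⟩ := hmem _ hk.1.1
          obtain ⟨⟨_, r2, _, r4⟩, r5⟩ := hmem _ hk'.1.1
          have k2 := hk.2
          have k2' := hk'.2
          simp only [hf, Prod.mk.injEq, hI, mem_Ioc] at *
          obtain ⟨rfl, rfl⟩ := k2
          obtain ⟨rfl, rfl⟩ := k2'
          have e1 : b + d = b' + d' := by omega
          have e2 : (d - b) * (b + d) = (d' - b') * (b + d) := by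
            rw [show (d' - b') * (b + d) = (d' - b') * (b' + d') by rw [e1]]; linarith
          have e3 := mul_right_cancel₀ (by omega : b + d ≠ 0) e2
          refine ⟨rfl, by omega, rfl, by omega⟩
    calc _ ≤ ∑ p ∈ I ×ˢ I, D := sum_le_sum hb
      _ = _ := by rw [sum_const, card_product, cI, nsmul_eq_mul]; push_cast; ring
  have h3 := card_filter_add_card_filter_not (s := G) (fun k => k.1 = k.2.2.1)
  have h4 : (#G : ℝ) = #{k ∈ G | k.1 = k.2.2.1} + #{k ∈ G | ¬ k.1 = k.2.2.1} := by
    rw [← h3]; push_cast; ring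
  rw [h4]
  linarith

/-- The fourth moment over the quadratic variable, uniformly in the cubic one. -/
lemma fourth_moment_le {ε : ℝ} (hε : 0 < ε) : ∃ C : ℝ, 1 ≤ C ∧ ∀ X : ℕ, 1 ≤ X → ∀ α : 𝕋,
    ∫ β, ‖gS X α β‖ ^ 4 ≤ C * (X : ℝ) ^ ε * (X : ℝ) ^ 2 := by
  classical
  obtain ⟨C1, hC1, hd⟩ := card_divisors_bound (ε / 2) (by linarith)
  refine ⟨1 + C1, by linarith, fun X hX α => ?_⟩
  have hX' : (1 : ℝ) ≤ X := by exact_mod_cast hX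
  have h1 := integral_pow_four_le (volume : Measure 𝕋) (K := Ioc (0 : ℤ) X)
    (f := fun x β => ee ((x ^ 3) • α + (x ^ 2) • β)) (fun k => by fun_prop) (Ψ := fun _ => 1)
    continuous_const (fun _ => zero_le_one) (M := 1)
    (fun k => k.1 ^ 2 + k.2.1 ^ 2 = k.2.2.1 ^ 2 + k.2.2.2 ^ 2) (by
      rintro ⟨a, b, c, d⟩ _ hk
      have e : ∀ β : 𝕋, ee ((a ^ 3) • α + (a ^ 2) • β) * ee ((b ^ 3) • α + (b ^ 2) • β) *
          (starRingEnd ℂ) (ee ((c ^ 3) • α + (c ^ 2) • β)) *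
          (starRingEnd ℂ) (ee ((d ^ 3) • α + (d ^ 2) • β)) * ((1 : ℝ) : ℂ) =
          ee ((a ^ 3 + b ^ 3 - c ^ 3 - d ^ 3) • α) * ee ((a ^ 2 + b ^ 2 - c ^ 2 - d ^ 2) • β) := by
        intro β
        rw [← ee_neg, ← ee_neg, ← ee_add, ← ee_add, ← ee_add, ← ee_add, Complex.ofReal_one, mul_one]
        congr 1
        module
      simp only [e]
      rw [integral_const_mul, integral_ee_zsmul, mul_zero]
      intro h
      exact hk (by simp only; linarith)) (fun i _ => by simp [norm_ee])
  simp only [mul_one] at h1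
  refine h1.trans (le_trans (le_of_eq (by congr!))
    ((card_quads_le X (D := C1 * (X : ℝ) ^ ε) (by positivity) ?_).trans ?_))
  · intro n hn hnX
    refine (hd n hn).trans ?_
    have : (n : ℝ) ≤ (X : ℝ) ^ (2 : ℝ) := by norm_cast
    calc C1 * (n : ℝ) ^ (ε / 2) ≤ C1 * ((X : ℝ) ^ (2 : ℝ)) ^ (ε / 2) := by gcongr
      _ = C1 * (X : ℝ) ^ ε := by rw [← Real.rpow_mul (by positivity)]; ring_nf
  · have : 1 ≤ (X : ℝ) ^ ε := Real.one_le_rpow hX' hε.le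
    nlinarith [mul_le_mul_of_nonneg_left this (sq_nonneg (X : ℝ))]

lemma wS_le_cube (X : ℕ) (α : 𝕋) : wS X α ≤ (X : ℝ) ^ 3 := by
  calc wS X α ≤ ∑ h ∈ Icc 1 X, ∑ l ∈ Icc 1 X, (X : ℝ) :=
        sum_le_sum fun h _ => sum_le_sum fun l _ => kq_le (Nat.cast_nonneg X) _
    _ = _ := by simp; ring

lemma continuous_gS_moment (X : ℕ) {r : ℝ} (hr : 0 ≤ r) :
    Continuous fun α => ∫ β, ‖gS X α β‖ ^ r := by
  refine continuous_integral (Continuous.rpow_const ?_ fun _ => Or.inr hr)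
  unfold gS; fun_prop

lemma continuous_gS_moment_pow (X : ℕ) (m : ℕ) : Continuous fun α => ∫ β, ‖gS X α β‖ ^ m := by
  refine continuous_integral ?_
  unfold gS; fun_prop

lemma setIntegral_gS_twelve_le {X : ℕ} (hX : 1 ≤ X) {S : Set 𝕋} {κ : ℝ}
    (hS : MeasurableSet S) (hκ : ∀ α ∈ S, ∀ a b, kk X (a, b, α) ^ 2 ≤ κ) (hκ0 : 0 ≤ κ) :
    (∫ α in S, ∫ β, ‖gS X α β‖ ^ 12) ^ 2 ≤
      (512 ^ 12 * (lg X : ℝ) ^ 11 * M12 (Ioc 0 (2 * X))) ^ 2 * κ := by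
  have hc : Continuous fun p : 𝕋 × 𝕋 => ∫ a : 𝕋, ‖fS (Ioc 0 (2 * X)) (a, p.2, p.1)‖ ^ 12 :=
    continuous_integral (by fun_prop)
  have hc2 : Continuous fun α : 𝕋 => ∫ b : 𝕋, ∫ a : 𝕋, ‖fS (Ioc 0 (2 * X)) (a, b, α)‖ ^ 12 :=
    continuous_integral hc
  have h1 : ∀ α ∈ S, ∫ β, ‖gS X α β‖ ^ 12 ≤ 512 ^ 12 * (lg X : ℝ) ^ 11 * √κ *
      ∫ b : 𝕋, ∫ a : 𝕋, ‖fS (Ioc 0 (2 * X)) (a, b, α)‖ ^ 12 := by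
    intro α hα
    have hcb : Continuous fun b : 𝕋 => ∫ a : 𝕋, ‖fS (Ioc 0 (2 * X)) (a, b, α)‖ ^ 12 :=
      continuous_integral (by fun_prop)
    refine (gS_moment_le X hX α (by norm_num : 2 ≤ 12)).trans ?_
    rw [mul_assoc (512 ^ 12 * _) (√κ)]
    have hpos : 0 ≤ 512 ^ 12 * (lg X : ℝ) ^ (12 - 1) := by positivity
    refine mul_le_mul_of_nonneg_left ?_ hpos
    rw [← integral_const_mul]
    refine integral_mono (integrable_cont _ (continuous_integral (by fun_prop)))
      (integrable_cont _ (continuous_const.mul hcb)) fun b => ?_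
    simp only
    rw [← integral_const_mul]
    refine integral_mono (integrable_cont _ (by fun_prop)) (integrable_cont _ (by fun_prop))
      fun a => ?_
    have hk : kk X (a, b, α) ≤ √κ := Real.le_sqrt_of_sq_le (hκ α hα a b)
    have hp : 0 ≤ ‖fS (Ioc 0 (2 * X)) (a, b, α)‖ ^ 12 := pow_nonneg (norm_nonneg _) 12
    have := mul_le_mul_of_nonneg_left hk hp
    simp only
    linarith
  have h2 : ∫ α in S, ∫ β, ‖gS X α β‖ ^ 12 ≤ 512 ^ 12 * (lg X : ℝ) ^ 11 * √κ *
      M12 (Ioc 0 (2 * X)) := by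
    rw [M12, integral_G3 (by fun_prop), ← integral_const_mul]
    calc _ ≤ ∫ α in S, 512 ^ 12 * (lg X : ℝ) ^ 11 * √κ *
          ∫ b : 𝕋, ∫ a : 𝕋, ‖fS (Ioc 0 (2 * X)) (a, b, α)‖ ^ 12 :=
          setIntegral_mono_on (integrable_cont _ (continuous_gS_moment_pow X 12))
            (integrable_cont _ (continuous_const.mul hc2)) hS h1
      _ ≤ _ := setIntegral_le_integral (integrable_cont _ (continuous_const.mul hc2))
          (.of_forall fun α => mul_nonneg (by positivity)
            (integral_nonneg fun b => integral_nonneg fun a => by positivity))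
  have h0 : 0 ≤ ∫ α in S, ∫ β, ‖gS X α β‖ ^ 12 :=
    integral_nonneg fun α => integral_nonneg fun β => by positivity
  calc _ ≤ _ := pow_le_pow_left₀ h0 h2 2
    _ = (512 ^ 12 * (lg X : ℝ) ^ 11 * M12 (Ioc 0 (2 * X))) ^ 2 * √κ ^ 2 := by ring
    _ = _ := by rw [Real.sq_sqrt hκ0]

lemma integral_gS_eight_le {X : ℕ} (hX : 1 ≤ X) :
    (∫ α, ∫ β, ‖gS X α β‖ ^ 8) ^ 3 ≤
      (512 ^ 8 * (lg X : ℝ) ^ 7) ^ 3 * M12 (Ioc 0 (2 * X)) ^ 2 * (40 * (lg X : ℝ) ^ 3) := by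
  have h0 : 0 ≤ ∫ α, ∫ β, ‖gS X α β‖ ^ 8 :=
    integral_nonneg fun α => integral_nonneg fun β => by positivity
  have h1 : ∫ α, ∫ β, ‖gS X α β‖ ^ 8 ≤ 512 ^ 8 * (lg X : ℝ) ^ 7 *
      ∫ a : G3, ‖fS (Ioc 0 (2 * X)) a‖ ^ 8 * kk X a := by
    rw [integral_G3 (by fun_prop), ← integral_const_mul]
    refine integral_mono (integrable_cont _ (continuous_gS_moment_pow X 8))
      (integrable_cont _ (continuous_const.mul (continuous_integral (continuous_integral (by fun_prop)))))
      fun α => gS_moment_le X hX α (by norm_num)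
  have h2 := holder_cont (volume : Measure G3) (f := fun a => ‖fS (Ioc 0 (2 * X)) a‖ ^ 12)
    (g := fun a => kk X a ^ 3) (by fun_prop) (by fun_prop) (fun a => by positivity)
    (fun a => pow_nonneg (kk_nonneg X a) 3) (θ := 2 / 3) (by norm_num) (by norm_num)
  have e : ∀ a : G3, (‖fS (Ioc 0 (2 * X)) a‖ ^ 12) ^ (2 / 3 : ℝ) * (kk X a ^ 3) ^ (1 - 2 / 3 : ℝ) =
      ‖fS (Ioc 0 (2 * X)) a‖ ^ 8 * kk X a := by
    intro a
    rw [← Real.rpow_natCast _ 12, ← Real.rpow_mul (norm_nonneg _), ← Real.rpow_natCast _ 3,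
      ← Real.rpow_mul (kk_nonneg X a)]
    norm_num
  simp_rw [e] at h2
  have n1 : 0 ≤ ∫ a : G3, kk X a ^ 3 := integral_nonneg fun a => pow_nonneg (kk_nonneg X a) 3
  have n2 : 0 ≤ ∫ a : G3, ‖fS (Ioc 0 (2 * X)) a‖ ^ 8 * kk X a :=
    integral_nonneg fun a => mul_nonneg (by positivity) (kk_nonneg X a)
  have h3 : (∫ a : G3, ‖fS (Ioc 0 (2 * X)) a‖ ^ 8 * kk X a) ^ 3 ≤
      M12 (Ioc 0 (2 * X)) ^ 2 * (40 * (lg X : ℝ) ^ 3) := by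
    refine (pow_le_pow_left₀ n2 h2 3).trans ?_
    rw [mul_pow, ← Real.rpow_natCast (_ ^ _) 3, ← Real.rpow_mul (integral_nonneg fun a => by positivity),
      ← Real.rpow_natCast (_ ^ _) 3, ← Real.rpow_mul n1]
    norm_num
    rw [M12]
    exact mul_le_mul_of_nonneg_left (integral_kk_cube X hX) (sq_nonneg _)
  calc _ ≤ _ := pow_le_pow_left₀ h0 h1 3
    _ = (512 ^ 8 * (lg X : ℝ) ^ 7) ^ 3 * (∫ a : G3, ‖fS (Ioc 0 (2 * X)) a‖ ^ 8 * kk X a) ^ 3 := by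
        ring
    _ ≤ _ := by rw [mul_assoc]; exact mul_le_mul_of_nonneg_left h3 (by positivity)

lemma holder_gS (X : ℕ) (S : Set 𝕋) {m n : ℕ} {r θ : ℝ} (h0 : 0 < θ) (h1 : θ < 1)
    (hr : m * θ + n * (1 - θ) = r) : ∫ α in S, ∫ β, ‖gS X α β‖ ^ r ≤
      (∫ α in S, ∫ β, ‖gS X α β‖ ^ m) ^ θ * (∫ α in S, ∫ β, ‖gS X α β‖ ^ n) ^ (1 - θ) := by
  have hr0 : 0 ≤ r := by rw [← hr]; have : 0 < 1 - θ := by linarith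
                         positivity
  have cg : Continuous fun p : 𝕋 × 𝕋 => gS X p.1 p.2 := by unfold gS; fun_prop
  have h := holder_cont ((volume.restrict S).prod (volume : Measure 𝕋))
    (f := fun p => ‖gS X p.1 p.2‖ ^ m) (g := fun p => ‖gS X p.1 p.2‖ ^ n)
    (by fun_prop) (by fun_prop) (fun _ => by positivity) (fun _ => by positivity) h0 h1
  have e : ∀ p : 𝕋 × 𝕋, (‖gS X p.1 p.2‖ ^ m) ^ θ * (‖gS X p.1 p.2‖ ^ n) ^ (1 - θ) =
      ‖gS X p.1 p.2‖ ^ r := by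
    intro p
    have hp := norm_nonneg (gS X p.1 p.2)
    rw [← Real.rpow_natCast _ m, ← Real.rpow_mul hp, ← Real.rpow_natCast _ n, ← Real.rpow_mul hp,
      ← Real.rpow_add_of_nonneg hp (by positivity)
        (mul_nonneg (Nat.cast_nonneg n) (by linarith)), hr]
  simp_rw [e] at h
  rw [integral_prod _ (integrable_cont _ (cg.norm.rpow_const fun _ => Or.inr hr0)),
    integral_prod _ (integrable_cont _ (by fun_prop)),
    integral_prod _ (integrable_cont _ (by fun_prop))] at h
  exact h

lemma rpow_mul_rpow_le {x y B θ : ℝ} {a b n : ℕ} (hx : 0 ≤ x) (hy : 0 ≤ y) (hB : 0 ≤ B)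
    (hn : n ≠ 0) (hθ : θ * n = a) (hθ' : (1 - θ) * n = b) (h : x ^ a * y ^ b ≤ B ^ n) :
    x ^ θ * y ^ (1 - θ) ≤ B := by
  refine le_of_pow_le_pow_left₀ hn hB (le_trans (le_of_eq ?_) h)
  rw [mul_pow, ← Real.rpow_natCast (x ^ θ) n, ← Real.rpow_mul hx, ← Real.rpow_natCast (y ^ (1 - θ)) n,
    ← Real.rpow_mul hy, hθ, hθ', Real.rpow_natCast, Real.rpow_natCast]

lemma moment_core {X : ℕ} (hX : 1 ≤ X) {Λ : ℝ} (hΛ : 1 ≤ Λ) (hl : (lg X : ℝ) ≤ Λ)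
    (hM : M12 (Ioc 0 (2 * X)) ≤ Λ * (X : ℝ) ^ 6)
    (h4 : ∀ α, ∫ β, ‖gS X α β‖ ^ 4 ≤ Λ * (X : ℝ) ^ 2)
    {w : ℝ} (hww : w = 512 ^ 12)
    (hw : ∀ R : ℝ, 1 ≤ R → R ≤ X → ∀ α, ¬ majA R (R / (X : ℝ) ^ 3) α → wS X α ≤ Λ * (X : ℝ) ^ 3 / R) :
    ∫ α, ∫ β, ‖gS X α β‖ ^ (32 / 3 : ℝ) ≤ 2 * w * Λ ^ 13 * (X : ℝ) ^ (17 / 3 : ℝ) := by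
  have hX' : (1 : ℝ) ≤ X := by exact_mod_cast hX
  have hX0 : (0 : ℝ) < X := by linarith
  have hΛ0 : 0 < Λ := by linarith
  have hw0 : 0 < w := by rw [hww]; positivity
  have hw8 : (512 : ℝ) ^ 8 * 512 ^ 8 * 512 ^ 8 = w ^ 2 := by rw [hww]; norm_num
  have hwa : (44 : ℝ) ^ 5 * 4 ≤ w ^ 2 := by rw [hww]; norm_num
  have hwb : (44 : ℝ) ^ 12 * 40 ^ 4 ≤ w ^ 4 := by rw [hww]; norm_num
  set B : ℝ := w * Λ ^ 12 * (X : ℝ) ^ (17 / 3 : ℝ) with hB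
  have hB0 : 0 ≤ B := by positivity
  have hXr : ((X : ℝ) ^ (17 / 3 : ℝ)) ^ 12 = (X : ℝ) ^ 68 := by
    rw [← Real.rpow_natCast _ 12, ← Real.rpow_mul hX0.le, ← Real.rpow_natCast _ 68]; norm_num
  have hB12 : B ^ 12 = w ^ 12 * Λ ^ 144 * (X : ℝ) ^ 68 := by
    rw [hB, mul_pow, hXr]; ring
  have kkb : ∀ R : ℝ, 1 ≤ R → R ≤ X → ∀ α, wS X α ≤ Λ * (X : ℝ) ^ 3 / R → ∀ a b,
      kk X (a, b, α) ^ 2 ≤ 22 * Λ ^ 3 * (X : ℝ) ^ 2 / R := by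
    intro R hR hRX α hα a b
    refine (kk_sq_le X hX (a, b, α)).trans ?_
    have hR0 : 0 < R := by linarith
    have e1 : (X : ℝ) ≤ Λ * (X : ℝ) ^ 2 / R := by
      rw [le_div_iff₀ hR0]
      nlinarith [mul_le_mul_of_nonneg_left hRX hX0.le, mul_nonneg (sub_nonneg.2 hΛ) (sq_nonneg (X : ℝ))]
    have e2 : wS X α / X ≤ Λ * (X : ℝ) ^ 2 / R := by
      rw [div_le_iff₀ hX0]
      refine hα.trans (le_of_eq ?_)
      ring
    have e3 : (lg X : ℝ) ^ 2 ≤ Λ ^ 2 := pow_le_pow_left₀ (Nat.cast_nonneg _) hl 2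
    calc 2 * (lg X : ℝ) ^ 2 * (3 * X + 8 * wS X α / X)
        ≤ 2 * Λ ^ 2 * (3 * (Λ * (X : ℝ) ^ 2 / R) + 8 * (Λ * (X : ℝ) ^ 2 / R)) := by
          refine mul_le_mul (by linarith) ?_ ?_ (by positivity)
          · rw [mul_div_assoc]; linarith
          · have : 0 ≤ wS X α := sum_nonneg fun h _ => sum_nonneg fun l _ => kq_nonneg hX0.le _
            positivity
      _ = _ := by ring
  have hc : (w * (lg X : ℝ) ^ 11 * M12 (Ioc 0 (2 * X))) ^ 2 ≤
      w ^ 2 * Λ ^ 24 * (X : ℝ) ^ 12 := by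
    have h1 : (lg X : ℝ) ^ 11 ≤ Λ ^ 11 := pow_le_pow_left₀ (Nat.cast_nonneg _) hl 11
    calc _ ≤ (w * Λ ^ 11 * (Λ * (X : ℝ) ^ 6)) ^ 2 := by
          have := M12_nonneg (Ioc (0 : ℤ) (2 * X))
          gcongr
      _ = _ := by ring
  set G : 𝕋 → ℝ := fun α => ∫ β, ‖gS X α β‖ ^ (32 / 3 : ℝ) with hG
  have hGc : Continuous G := continuous_gS_moment X (by norm_num)
  have hG0 : ∀ α, 0 ≤ G α := fun α => integral_nonneg fun β => Real.rpow_nonneg (norm_nonneg _) _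
  have nn : ∀ (S : Set 𝕋) (m : ℕ), 0 ≤ ∫ α in S, ∫ β, ‖gS X α β‖ ^ m := fun S m =>
    integral_nonneg fun α => integral_nonneg fun β => pow_nonneg (norm_nonneg _) m
  set K := Nat.log 2 X with hK
  have hK1 : 2 ^ K ≤ X := Nat.pow_log_le_self 2 (by omega)
  have hK2 : X < 2 ^ (K + 1) := Nat.lt_pow_succ_log_self (by norm_num) X
  have hK1' : (2 : ℝ) ^ K ≤ X := by exact_mod_cast hK1
  have hK2' : (X : ℝ) < 2 ^ (K + 1) := by exact_mod_cast hK2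
  set A : ℕ → Set 𝕋 := fun k => {α | majA (2 ^ k) (2 ^ k / (X : ℝ) ^ 3) α} with hA
  have hAm : ∀ k, MeasurableSet (A k) := fun k => (isClosed_majA _ _).measurableSet
  set S : ℕ → Set 𝕋 := fun k => if k = 0 then A 0 else A k \ A (k - 1) with hS
  have hSm : ∀ k, MeasurableSet (S k) := by
    intro k; simp only [hS]; split_ifs
    · exact hAm 0
    · exact (hAm _).diff (hAm _)
  have hSA : ∀ k, S k ⊆ A k := by
    intro k; simp only [hS]; split_ifs with h
    · rw [h]
    · exact Set.sdiff_subset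
  have piece : ∀ k ∈ range (K + 1), ∫ α in S k, G α ≤ B := by
    intro k hk
    rw [mem_range] at hk
    have h2k : (2 : ℝ) ^ k ≤ X := le_trans (pow_le_pow_right₀ one_le_two (by omega)) hK1'
    have h12 := hww ▸ setIntegral_gS_twelve_le hX (hSm k) (κ := 44 * Λ ^ 3 * (X : ℝ) ^ 2 / 2 ^ k) (by
      intro α hα a b
      by_cases h0 : k = 0
      · have := kkb 1 le_rfl hX' α ((wS_le_cube X α).trans (by
          rw [div_one]; exact le_mul_of_one_le_left (by positivity) hΛ)) a b
        subst h0
        refine this.trans ?_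
        rw [pow_zero, div_one, div_one]
        have : 0 ≤ Λ ^ 3 * (X : ℝ) ^ 2 := by positivity
        linarith
      · simp only [hS, if_neg h0] at hα
        obtain ⟨k', rfl⟩ := Nat.exists_eq_succ_of_ne_zero h0
        have h2 : (2 : ℝ) ^ k' ≤ X := le_trans (pow_le_pow_right₀ one_le_two (by omega)) h2k
        have h1 : (1 : ℝ) ≤ 2 ^ k' := one_le_pow₀ one_le_two
        refine (kkb (2 ^ k') h1 h2 α (hw _ h1 h2 α hα.2) a b).trans (le_of_eq ?_)
        rw [Nat.succ_eq_add_one, pow_succ]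
        field_simp
        ring) (by positivity)
    have hI4 : ∫ α in S k, ∫ β, ‖gS X α β‖ ^ 4 ≤ 2 * Λ * 4 ^ k / X := by
      calc _ ≤ ∫ α in S k, Λ * (X : ℝ) ^ 2 :=
            setIntegral_mono_on (integrable_cont _ (continuous_gS_moment_pow X 4))
              (integrable_cont _ continuous_const) (hSm k) fun α _ => h4 α
        _ = (volume : Measure 𝕋).real (S k) * (Λ * (X : ℝ) ^ 2) := by
            rw [setIntegral_const, smul_eq_mul]
        _ ≤ (2 ^ k * (2 * (2 ^ k / (X : ℝ) ^ 3))) * (Λ * (X : ℝ) ^ 2) := by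
            refine mul_le_mul_of_nonneg_right ?_ (by positivity)
            exact (measureReal_mono (hSA k) (measure_ne_top _ _)).trans
              (volume_majA_le (by positivity) (by positivity))
        _ = _ := by
            rw [show (4 : ℝ) ^ k = 2 ^ k * 2 ^ k by rw [← mul_pow]; norm_num]
            field_simp
    refine (holder_gS X (S k) (m := 12) (n := 4) (θ := 5 / 6) (by norm_num) (by norm_num)
      (by norm_num)).trans ?_
    refine rpow_mul_rpow_le (nn _ _) (nn _ _) hB0 (a := 10) (b := 2) (n := 12) (by norm_num)
      (by norm_num) (by norm_num) ?_
    have e1 := h12.trans (mul_le_mul_of_nonneg_right hc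
      (show 0 ≤ 44 * Λ ^ 3 * (X : ℝ) ^ 2 / 2 ^ k by positivity))
    have e2 := pow_le_pow_left₀ (sq_nonneg _) e1 5
    have e3 := pow_le_pow_left₀ (nn _ _) hI4 2
    rw [← pow_mul] at e2
    refine (mul_le_mul e2 e3 (sq_nonneg _) (by positivity)).trans ?_
    rw [hB12]
    have h32 : ((2 : ℝ) ^ k) ^ 5 = 32 ^ k := by rw [← pow_mul, mul_comm, pow_mul]; norm_num
    have h16 : ((4 : ℝ) ^ k) ^ 2 = 16 ^ k := by rw [← pow_mul, mul_comm, pow_mul]; norm_num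
    have h1632 : (16 : ℝ) ^ k ≤ 32 ^ k := pow_le_pow_left₀ (by norm_num) (by norm_num) k
    have hΛm : Λ ^ 137 ≤ Λ ^ 144 := pow_le_pow_right₀ hΛ (by norm_num)
    calc (w ^ 2 * Λ ^ 24 * (X : ℝ) ^ 12 * (44 * Λ ^ 3 * (X : ℝ) ^ 2 / 2 ^ k)) ^ 5 *
        (2 * Λ * 4 ^ k / X) ^ 2 = (w ^ 10 * (44 ^ 5 * 4)) * Λ ^ 137 * (X : ℝ) ^ 68 * (16 ^ k / 32 ^ k) := by
          rw [← h32, ← h16]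
          field_simp
          ring
      _ ≤ (w ^ 10 * w ^ 2) * Λ ^ 144 * (X : ℝ) ^ 68 * 1 := by
          gcongr
          exact div_le_one_of_le₀ h1632 (by positivity)
      _ = _ := by ring
  have off : ∫ α in (A K)ᶜ, G α ≤ B := by
    have h1 : (1 : ℝ) ≤ 2 ^ K := one_le_pow₀ one_le_two
    have h12 := hww ▸ setIntegral_gS_twelve_le hX (hAm K).compl (κ := 44 * Λ ^ 3 * X) (by
      intro α hα a b
      refine (kkb (2 ^ K) h1 hK1' α (hw _ h1 hK1' α hα) a b).trans ?_
      rw [div_le_iff₀ (by positivity)]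
      rw [pow_succ] at hK2'
      nlinarith [mul_le_mul_of_nonneg_left hK2'.le (show 0 ≤ Λ ^ 3 * (X : ℝ) by positivity)])
      (by positivity)
    have h8 : (∫ α in (A K)ᶜ, ∫ β, ‖gS X α β‖ ^ 8) ^ 3 ≤ 40 * w ^ 2 * Λ ^ 26 * (X : ℝ) ^ 12 := by
      calc _ ≤ (∫ α, ∫ β, ‖gS X α β‖ ^ 8) ^ 3 := by
            refine pow_le_pow_left₀ (nn _ _) ?_ 3
            exact setIntegral_le_integral (integrable_cont _ (continuous_gS_moment_pow X 8))
              (.of_forall fun α => integral_nonneg fun β => pow_nonneg (norm_nonneg _) 8)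
        _ ≤ _ := integral_gS_eight_le hX
        _ ≤ (512 ^ 8 * Λ ^ 7) ^ 3 * (Λ * (X : ℝ) ^ 6) ^ 2 * (40 * Λ ^ 3) := by
            have := M12_nonneg (Ioc (0 : ℤ) (2 * X))
            gcongr
        _ = (512 ^ 8 * 512 ^ 8 * 512 ^ 8) * (40 * Λ ^ 26 * (X : ℝ) ^ 12) := by ring
        _ = _ := by rw [hw8]; ring
    refine (holder_gS X _ (m := 12) (n := 8) (θ := 2 / 3) (by norm_num) (by norm_num)
      (by norm_num)).trans ?_
    refine rpow_mul_rpow_le (nn _ _) (nn _ _) hB0 (a := 24) (b := 12) (n := 36) (by norm_num)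
      (by norm_num) (by norm_num) ?_
    have e1 := h12.trans (mul_le_mul_of_nonneg_right hc (show 0 ≤ 44 * Λ ^ 3 * (X : ℝ) by positivity))
    have e2 := pow_le_pow_left₀ (sq_nonneg _) e1 12
    have e3 := pow_le_pow_left₀ (pow_nonneg (nn _ _) 3) h8 4
    rw [← pow_mul] at e2 e3
    refine (mul_le_mul e2 e3 (pow_nonneg (nn _ _) _) (by positivity)).trans ?_
    rw [show (36 : ℕ) = 12 * 3 by norm_num, pow_mul, hB12]
    have hΛm : Λ ^ 428 ≤ Λ ^ 432 := pow_le_pow_right₀ hΛ (by norm_num)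
    calc (w ^ 2 * Λ ^ 24 * (X : ℝ) ^ 12 * (44 * Λ ^ 3 * (X : ℝ))) ^ 12 *
        (40 * w ^ 2 * Λ ^ 26 * (X : ℝ) ^ 12) ^ 4 =
          (w ^ 32 * (44 ^ 12 * 40 ^ 4)) * Λ ^ 428 * (X : ℝ) ^ 204 := by ring
      _ ≤ (w ^ 32 * w ^ 4) * Λ ^ 432 * (X : ℝ) ^ 204 := by
          gcongr
      _ = _ := by ring
  have hsum : ∫ α, G α ≤ (∫ α in (A K)ᶜ, G α) + ∑ k ∈ range (K + 1), ∫ α in S k, G α := by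
    have hGi : Integrable G := integrable_cont _ hGc
    simp_rw [← integral_indicator (hAm K).compl, ← integral_indicator (hSm _)]
    rw [← integral_finsetSum _ fun k _ => hGi.indicator (hSm k), ← integral_add
      (hGi.indicator (hAm K).compl) (integrable_finsetSum _ fun k _ => hGi.indicator (hSm k))]
    refine integral_mono hGi ((hGi.indicator (hAm K).compl).add
      (integrable_finsetSum _ fun k _ => hGi.indicator (hSm k))) fun α => ?_
    simp only []
    have n1 : 0 ≤ (A K)ᶜ.indicator G α := Set.indicator_nonneg (fun α _ => hG0 α) α
    have n2 : ∀ k ∈ range (K + 1), 0 ≤ (S k).indicator G α := fun k _ =>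
      Set.indicator_nonneg (fun α _ => hG0 α) α
    by_cases hα : α ∈ A K
    · have hex : ∃ k, α ∈ A k := ⟨K, hα⟩
      classical
      have hk := Nat.find_spec hex
      have hkK : Nat.find hex ≤ K := Nat.find_min' hex hα
      have hkS : α ∈ S (Nat.find hex) := by
        by_cases h0 : Nat.find hex = 0
        · simp only [hS, if_pos h0]; rwa [h0] at hk
        · simp only [hS, if_neg h0]
          exact ⟨hk, Nat.find_min hex (by omega)⟩
      have := single_le_sum n2 (mem_range.2 (by omega : Nat.find hex < K + 1))
      rw [Set.indicator_of_mem hkS] at this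
      linarith
    · rw [Set.indicator_of_mem (show α ∈ (A K)ᶜ from hα)]
      linarith [sum_nonneg n2]
  have hlg : ((K + 1 : ℕ) : ℝ) ≤ Λ := hl
  calc ∫ α, G α ≤ _ := hsum
    _ ≤ B + ∑ k ∈ range (K + 1), B := add_le_add off (sum_le_sum piece)
    _ = (1 + ((K + 1 : ℕ) : ℝ)) * B := by rw [sum_const, card_range, nsmul_eq_mul]; ring
    _ ≤ (2 * Λ) * B := by gcongr; linarith
    _ = _ := by rw [hB]; ring

/-- The mean value estimate for the cubic-quadratic exponential sum of order `32/3`. -/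
theorem moment_le {ε : ℝ} (hε : 0 < ε) : ∃ C : ℝ, 1 ≤ C ∧ ∀ X : ℕ, 1 ≤ X →
    ∫ α, ∫ β, ‖gS X α β‖ ^ (32 / 3 : ℝ) ≤ C * (X : ℝ) ^ (17 / 3 + ε) := by
  have hδ : 0 < ε / 13 := by linarith
  obtain ⟨κ, hκ⟩ := vinogradov_cubic (ε / 13) hδ
  obtain ⟨C1, hC1, h1⟩ := fourth_moment_le hδ
  obtain ⟨C2, hC2, h2⟩ := wS_le hδ
  obtain ⟨C3, hC3, h3⟩ := log_bound hδ
  obtain ⟨C0, hC0⟩ : ∃ C0, C0 = 2 * C3 + C1 + C2 + Real.exp (κ + (6 + ε / 13) * Real.log 2) := ⟨_, rfl⟩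
  have he := Real.exp_pos (κ + (6 + ε / 13) * Real.log 2)
  have hC01 : 1 ≤ C0 := by linarith
  obtain ⟨w, hw⟩ : ∃ w : ℝ, w = 512 ^ 12 := ⟨_, rfl⟩
  refine ⟨2 * w * C0 ^ 13, ?_, fun X hX => ?_⟩
  · have hw1 : 1 ≤ w := by rw [hw]; norm_num
    have := one_le_pow₀ hC01 (n := 13)
    nlinarith
  have hX' : (1 : ℝ) ≤ X := by exact_mod_cast hX
  have hX0 : (0 : ℝ) < X := by linarith
  have hY : 1 ≤ (X : ℝ) ^ (ε / 13) := Real.one_le_rpow hX' hδ.le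
  have hY0 : 0 < (X : ℝ) ^ (ε / 13) := by linarith
  have := moment_core hX (Λ := C0 * (X : ℝ) ^ (ε / 13)) (one_le_mul_of_one_le_of_one_le hC01 hY) ?_ ?_ ?_ hw ?_
  · refine this.trans (le_of_eq ?_)
    rw [mul_pow, ← Real.rpow_natCast (_ ^ _) 13, ← Real.rpow_mul hX0.le, Real.rpow_add hX0]
    push_cast
    rw [div_mul_cancel₀ _ (by norm_num)]
    ring
  · have hlog : (Nat.log 2 X : ℝ) ≤ 2 * Real.log X := by
      have h : ((2 ^ Nat.log 2 X : ℕ) : ℝ) ≤ X := by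
        exact_mod_cast Nat.pow_log_le_self 2 (by omega)
      have h' := Real.log_le_log (by positivity) h
      rw [Nat.cast_pow, Real.log_pow] at h'
      have := Real.log_two_gt_d9
      push_cast at h'
      nlinarith [(Nat.cast_nonneg (Nat.log 2 X) : (0 : ℝ) ≤ _)]
    have h4 := h3 X hX
    have hle : Real.log X ≤ Real.log (2 * (X : ℝ) ^ 3) := by
      refine Real.log_le_log hX0 ?_
      have : (X : ℝ) ≤ (X : ℝ) ^ 3 := le_self_pow₀ hX' (by norm_num)
      linarith
    rw [lg]
    push_cast
    have : C3 * (X : ℝ) ^ (ε / 13) * 2 ≤ C0 * (X : ℝ) ^ (ε / 13) := by nlinarith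
    linarith [Real.log_nonneg hX']
  · have h := hκ 0 (2 * X) (by omega)
    rw [zero_add] at h
    push_cast at h
    refine h.trans ?_
    rw [Real.log_mul (by norm_num) (by positivity), mul_add, ← add_assoc, Real.exp_add,
      mul_comm (6 + ε / 13) (Real.log X), ← Real.rpow_def_of_pos hX0, Real.rpow_add hX0]
    norm_cast
    have e6 : 0 ≤ (X : ℝ) ^ (ε / 13) * (X : ℝ) ^ 6 := by positivity
    have : Real.exp (κ + (6 + ε / 13) * Real.log 2) ≤ C0 := by linarith
    calc _ = Real.exp (κ + (6 + ε / 13) * Real.log 2) * ((X : ℝ) ^ (ε / 13) * (X : ℝ) ^ 6) := by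
          push_cast; ring
      _ ≤ _ := by rw [mul_assoc C0]; push_cast; exact mul_le_mul_of_nonneg_right this e6
  · intro α
    refine (h1 X hX α).trans ?_
    gcongr
    linarith
  · intro R hR hRX α hα
    refine (h2 X hX R hR hRX α hα).trans (div_le_div_of_nonneg_right ?_ (by linarith))
    rw [Real.rpow_add hX0, mul_assoc, mul_comm ((X : ℝ) ^ (ε / 13))]
    norm_cast
    gcongr
    linarith

lemma norm_sum_sub_sum_shift_le {u : ℤ → ℂ} (hu : ∀ x, ‖u x‖ ≤ 1) (X h : ℕ) :
    ‖∑ x ∈ Ioc (0 : ℤ) X, u x - ∑ x ∈ Ioc (0 : ℤ) X, u (x + h)‖ ≤ 2 * h := by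
  have key : ∀ (v : ℤ → ℂ) (n : ℕ), ∑ x ∈ Ioc (0 : ℤ) n, v x - ∑ x ∈ Ioc (0 : ℤ) n, v (x + 1) =
      v 1 - v (n + 1) := by
    intro v n
    induction n with
    | zero => simp
    | succ n ih =>
      rw [sum_Ioc_int_succ, sum_Ioc_int_succ]
      push_cast
      linear_combination ih
  induction h with
  | zero => simp
  | succ h ih =>
    have h1 := key (fun x => u (x + h)) X
    have h2 : ∀ x : ℤ, u (x + 1 + h) = u (x + (h + 1 : ℕ)) := fun x => by push_cast; congr 1; ring
    simp_rw [h2] at h1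
    have h3 := norm_sub_le (u (1 + h)) (u (X + 1 + h))
    have h4 := norm_add_le (∑ x ∈ Ioc (0 : ℤ) X, u x - ∑ x ∈ Ioc (0 : ℤ) X, u (x + h))
      (u (1 + h) - u (X + 1 + h))
    rw [h2] at h3 h4
    rw [← h1, sub_add_sub_cancel, h1, ← h2] at h4
    rw [← h2] at h3
    push_cast at h4 ⊢
    linarith [hu (1 + h), hu (X + 1 + h)]

lemma exists_progression {u : ℤ → ℂ} (hu : ∀ x, ‖u x‖ ≤ 1) {X : ℕ} (hX : 1 ≤ X) (q Y : ℕ) :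
    ∃ x₀ ∈ Ioc (0 : ℤ) X, Y * (‖∑ x ∈ Ioc (0 : ℤ) X, u x‖ - 2 * (q * Y)) ≤
      X * ‖∑ y ∈ Ioc (0 : ℤ) Y, u (x₀ + q * y)‖ := by
  have hne : (Ioc (0 : ℤ) X).Nonempty := ⟨1, by simp; omega⟩
  obtain ⟨x₀, hx₀, hmax⟩ := exists_max_image (Ioc (0 : ℤ) X)
    (fun x => ‖∑ y ∈ Ioc (0 : ℤ) Y, u (x + q * y)‖) hne
  refine ⟨x₀, hx₀, ?_⟩
  set g := ∑ x ∈ Ioc (0 : ℤ) X, u x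
  have h1 : ∀ y ∈ Ioc (0 : ℤ) Y, ‖g - ∑ x ∈ Ioc (0 : ℤ) X, u (x + q * y)‖ ≤ 2 * (q * Y) := by
    intro y hy
    rw [mem_Ioc] at hy
    obtain ⟨n, rfl⟩ := Int.eq_ofNat_of_zero_le hy.1.le
    have := norm_sum_sub_sum_shift_le hu X (q * n)
    push_cast at this
    refine this.trans ?_
    have : (n : ℝ) ≤ Y := by exact_mod_cast hy.2
    gcongr
  have h2 := norm_sum_le_of_le _ h1
  rw [sum_sub_distrib, sum_const, sum_comm, sum_const, Int.card_Ioc] at h2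
  simp only [sub_zero, Int.toNat_natCast, nsmul_eq_mul] at h2
  have h3 : ‖∑ x ∈ Ioc (0 : ℤ) X, ∑ y ∈ Ioc (0 : ℤ) Y, u (x + q * y)‖ ≤
      X * ‖∑ y ∈ Ioc (0 : ℤ) Y, u (x₀ + q * y)‖ := by
    refine (norm_sum_le_of_le _ hmax).trans ?_
    simp
  have h4 := norm_sub_norm_le ((Y : ℂ) * g) (∑ x ∈ Ioc (0 : ℤ) X, ∑ y ∈ Ioc (0 : ℤ) Y, u (x + q * y))
  rw [norm_mul, Complex.norm_natCast] at h4
  linarith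

lemma weyl_cubic {X : ℕ} (hX : 1 ≤ X) {L Λ : ℝ} (hΛ : 1 ≤ Λ) (hL : 2000 * Λ ≤ L)
    (hLX : L ^ 22 ≤ X)
    (hw : ∀ R : ℝ, 1 ≤ R → R ≤ X → ∀ α, ¬ majA R (R / (X : ℝ) ^ 3) α →
      wS X α ≤ Λ * L * (X : ℝ) ^ 3 / R) {α β : 𝕋} (hg : X / L ≤ ‖gS X α β‖) :
    majA (L ^ 6) (L ^ 6 / (X : ℝ) ^ 3) α := by
  have hX' : (1 : ℝ) ≤ X := by exact_mod_cast hX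
  have hX0 : (0 : ℝ) < X := by linarith
  have hL1 : 1 ≤ L := by linarith
  have hL0 : 0 < L := by linarith
  by_contra hcon
  have h1 := hw (L ^ 6) (one_le_pow₀ hL1) ((pow_le_pow_right₀ hL1 (by norm_num)).trans hLX) α hcon
  have h2 := (pow_le_pow_left₀ (by positivity) hg 4).trans (norm_gS_pow_four_le X α β)
  have h3 : (X / L : ℝ) ^ 4 ≤ 10 * (X : ℝ) ^ 3 + 32 * X * (Λ * L * (X : ℝ) ^ 3 / L ^ 6) :=
    h2.trans (by gcongr)
  have h4 : (X : ℝ) ^ 4 * L ≤ 10 * (X : ℝ) ^ 3 * L ^ 5 + 32 * Λ * (X : ℝ) ^ 4 := by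
    have := mul_le_mul_of_nonneg_right h3 (show 0 ≤ L ^ 5 by positivity)
    calc (X : ℝ) ^ 4 * L = (X / L : ℝ) ^ 4 * L ^ 5 := by field_simp
      _ ≤ _ := this
      _ = _ := by field_simp
  have h5 : L ^ 5 ≤ X := (pow_le_pow_right₀ hL1 (by norm_num)).trans hLX
  have h6 : 10 * (X : ℝ) ^ 3 * L ^ 5 ≤ 10 * (X : ℝ) ^ 4 := by
    have := mul_le_mul_of_nonneg_left h5 (show 0 ≤ 10 * (X : ℝ) ^ 3 by positivity)
    linarith [this, (by ring : 10 * (X : ℝ) ^ 3 * X = 10 * (X : ℝ) ^ 4)]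
  have h7 : 0 < (X : ℝ) ^ 4 := by positivity
  nlinarith [mul_le_mul_of_nonneg_left (show 32 * Λ + 10 < L by linarith).le h7.le,
    mul_lt_mul_of_pos_left (show 32 * Λ + 10 < L by linarith) h7]

lemma weyl_quad {Y : ℕ} {L Λ : ℝ} (hΛ : 1 ≤ Λ) (hL : 2000 * Λ ≤ L) (hLY : L ^ 4 ≤ Y)
    (hlog : 1 + Real.log (2 * (Y : ℝ) ^ 2) ≤ Λ * L) {a b c : 𝕋}
    (hg : Y / (4 * L) ≤ ‖∑ z ∈ Ioc (0 : ℤ) Y, ee ((z ^ 2) • b + z • a + c)‖) :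
    majA (L ^ 4) (L ^ 4 / (Y : ℝ) ^ 2) (2 • b) := by
  have hL1 : 1 ≤ L := by linarith
  have hL0 : 0 < L := by linarith
  have hL4 : 1 ≤ L ^ 4 := one_le_pow₀ hL1
  have hY' : (1 : ℝ) ≤ Y := hL4.trans hLY
  have hY0 : (0 : ℝ) < Y := by linarith
  by_contra hcon
  have hcon' : ∀ q : ℕ, 0 < q → (q : ℝ) ≤ L ^ 4 → L ^ 4 / (Y : ℝ) ^ 2 < ‖q • (2 • b)‖ := by
    intro q h1 h2
    by_contra h
    exact hcon ⟨q, h1, h2, not_lt.1 h⟩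
  set Q := ⌊(Y : ℝ) ^ 2 / L ^ 4⌋₊ with hQ
  have hYL : (1 : ℝ) ≤ (Y : ℝ) ^ 2 / L ^ 4 := by
    rw [le_div_iff₀ (by positivity), one_mul]; nlinarith
  have hQ0 : 0 < Q := Nat.floor_pos.2 hYL
  have hQle : (Q : ℝ) ≤ (Y : ℝ) ^ 2 / L ^ 4 := Nat.floor_le (by positivity)
  have hQY : (Q : ℝ) ≤ (Y : ℝ) ^ 2 := hQle.trans (div_le_self (by positivity) hL4)
  have hQlt : (Y : ℝ) ^ 2 / L ^ 4 < Q + 1 := Nat.lt_floor_add_one _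
  have hQ0' : (1 : ℝ) ≤ Q := by exact_mod_cast hQ0
  have h1 := sum_kq_le (2 • b) hY0.le (show 0 < L ^ 4 by positivity) hQ0 (δ := L ^ 4 / (Y : ℝ) ^ 2)
    (by rw [div_le_iff₀ (by positivity), mul_comm, ← div_le_iff₀ (by positivity), one_div_div]
        exact hQlt.le) hcon' (Y + 1)
  have hlog' : 1 + Real.log (2 * Q) ≤ Λ * L := by
    refine le_trans (by gcongr) hlog
  have h2 := norm_sq_quad_le Y a b c
  have h3 : ∑ l ∈ Icc 1 Y, kq Y ((2 * l) • b) ≤ ∑ n ∈ range (Y + 1), kq Y (n • (2 • b)) := by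
    simp_rw [smul_smul, mul_comm _ 2]
    refine sum_le_sum_of_subset_of_nonneg ?_ fun _ _ _ => kq_nonneg hY0.le _
    intro l
    rw [mem_Icc, mem_range]
    omega
  have h4 := pow_le_pow_left₀ (by positivity) hg 2
  set W := (Y : ℝ) ^ 2 / L ^ 4 with hW
  have hW0 : 0 ≤ W := by positivity
  have hYW : (Y : ℝ) ≤ W := by
    rw [hW, le_div_iff₀ (by positivity), sq]; exact mul_le_mul_of_nonneg_left hLY hY0.le
  have hN : ((Y + 1 : ℕ) : ℝ) ≤ 2 * Y := by push_cast; linarith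
  have h5 : ∑ n ∈ range (Y + 1), kq Y (n • (2 • b)) ≤ 30 * (Λ * L) * W := by
    refine h1.trans ?_
    have a1 : 4 * ((Y + 1 : ℕ) : ℝ) * Y / L ^ 4 ≤ 8 * W := by
      rw [hW, ← mul_div_assoc]
      refine div_le_div_of_nonneg_right ?_ (by positivity)
      nlinarith
    have hΛL : 1 ≤ Λ * L := by nlinarith
    have a2 : (8 * ((Y + 1 : ℕ) : ℝ) + 4 * Q) * (1 + Real.log (2 * Q)) ≤ 20 * W * (Λ * L) := by
      refine mul_le_mul (by linarith) hlog' ?_ (by positivity)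
      have : 0 ≤ Real.log (2 * Q) := Real.log_nonneg (by linarith)
      linarith
    nlinarith [mul_le_mul_of_nonneg_right hΛL hW0]
  have h6 : (Y / (4 * L) : ℝ) ^ 2 = W * (L ^ 2 / 16) := by
    rw [hW]; field_simp; norm_num
  rw [h6] at h4
  have h7 : W * (L ^ 2 / 16) ≤ W * (121 * (Λ * L)) := by
    have hΛL : 1 ≤ Λ * L := by nlinarith
    nlinarith [mul_le_mul_of_nonneg_left hΛL hW0]
  have h8 := le_of_mul_le_mul_left h7 (by linarith)
  nlinarith
theorem weyl {X : ℕ} (hX : 1 ≤ X) {L Λ : ℝ} (hΛ : 1 ≤ Λ) (hL : 2000 * Λ ≤ L)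
    (hLX : L ^ 22 ≤ X)
    (hw : ∀ R : ℝ, 1 ≤ R → R ≤ X → ∀ α, ¬ majA R (R / (X : ℝ) ^ 3) α →
      wS X α ≤ Λ * L * (X : ℝ) ^ 3 / R) (hlog : 1 + Real.log (2 * (X : ℝ) ^ 3) ≤ Λ * L)
    {α β : 𝕋} (hg : X / L ≤ ‖gS X α β‖) :
    ∃ q : ℕ, 0 < q ∧ (q : ℝ) ≤ L ^ 30 ∧ ‖q • α‖ ≤ L ^ 30 / (X : ℝ) ^ 3 ∧
      ‖q • β‖ ≤ L ^ 30 / (X : ℝ) ^ 2 := by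
  have hX' : (1 : ℝ) ≤ X := by exact_mod_cast hX
  have hX0 : (0 : ℝ) < X := by linarith
  have hL1 : 1 ≤ L := by linarith
  have hL0 : 0 < L := by linarith
  have hL8 : 0 < L ^ 8 := by positivity
  obtain ⟨q, hq0, hq, hqα⟩ := weyl_cubic hX hΛ hL hLX hw hg
  set Y := ⌊(X : ℝ) / L ^ 8⌋₊ with hY
  have hYle : (Y : ℝ) ≤ X / L ^ 8 := Nat.floor_le (by positivity)
  have hYX : (Y : ℝ) ≤ X := hYle.trans (div_le_self hX0.le (one_le_pow₀ hL1))
  have hYlt : X / L ^ 8 < (Y : ℝ) + 1 := Nat.lt_floor_add_one _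
  have hYL : L ^ 14 ≤ X / L ^ 8 := by
    rw [le_div_iff₀ hL8, ← pow_add]; exact hLX
  have hL4 : L ^ 4 + 1 ≤ L ^ 14 := by
    have h1 : L ^ 5 ≤ L ^ 14 := pow_le_pow_right₀ hL1 (by norm_num)
    have h2 : 1 ≤ L ^ 4 := one_le_pow₀ hL1
    nlinarith
  have hY4 : L ^ 4 ≤ Y := by linarith
  have hY1 : (1 : ℝ) ≤ Y := (one_le_pow₀ hL1).trans hY4
  have hY0 : (0 : ℝ) < Y := by linarith
  have hYge : X / (2 * L ^ 8) ≤ (Y : ℝ) := by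
    have : X / (2 * L ^ 8) = X / L ^ 8 / 2 := by field_simp
    linarith
  have hqY : (q : ℝ) * Y ≤ X / L ^ 2 := by
    calc (q : ℝ) * Y ≤ L ^ 6 * (X / L ^ 8) := by gcongr
      _ = _ := by field_simp
  have hqYX : (q : ℝ) * Y ≤ X := hqY.trans (div_le_self hX0.le (one_le_pow₀ hL1))
  obtain ⟨x₀, hx₀, hp⟩ := exists_progression
    (u := fun x => ee ((x ^ 3) • α + (x ^ 2) • β)) (fun _ => (norm_ee _).le) hX q Y
  rw [mem_Ioc] at hx₀
  set v : ℤ → ℂ := fun y => ee ((y ^ 2) • ((q ^ 2) • β) + y • ((2 * x₀ * q) • β) +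
    ((x₀ ^ 3) • α + (x₀ ^ 2) • β)) with hv
  set m : ℤ → ℤ := fun y => 3 * x₀ ^ 2 * y + 3 * x₀ * q * y ^ 2 + q ^ 2 * y ^ 3 with hm
  have hdiff : ∀ y ∈ Ioc (0 : ℤ) Y, ‖ee (((x₀ + q * y) ^ 3) • α + ((x₀ + q * y) ^ 2) • β) - v y‖ ≤
      1 / (4 * L) := by
    intro y hy
    rw [mem_Ioc] at hy
    have e1 : ((x₀ + q * y) ^ 3) • α + ((x₀ + q * y) ^ 2) • β =
        m y • (q • α) + ((y ^ 2) • ((q ^ 2) • β) + y • ((2 * x₀ * q) • β) +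
          ((x₀ ^ 3) • α + (x₀ ^ 2) • β)) := by
      simp only [← natCast_zsmul, smul_smul, hm]
      push_cast
      module
    rw [e1, ee_add, ← sub_one_mul, norm_mul, norm_ee, mul_one]
    refine (norm_ee_sub_one_le _).trans ?_
    have hx : (x₀ : ℝ) ≤ X := by exact_mod_cast hx₀.2
    have hx0 : (0 : ℝ) ≤ x₀ := by exact_mod_cast hx₀.1.le
    have hy' : (y : ℝ) ≤ Y := by exact_mod_cast hy.2
    have hy0 : (0 : ℝ) ≤ y := by exact_mod_cast hy.1.le
    have hqy : (q : ℝ) * y ≤ X := (by gcongr : (q : ℝ) * y ≤ q * Y).trans hqYX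
    have hm7 : |(m y : ℝ)| ≤ 7 * (X : ℝ) ^ 2 * Y := by
      rw [abs_of_nonneg (by simp only [hm]; push_cast; positivity)]
      simp only [hm]
      push_cast
      calc 3 * (x₀ : ℝ) ^ 2 * y + 3 * x₀ * q * y ^ 2 + q ^ 2 * y ^ 3
          = 3 * (x₀ : ℝ) ^ 2 * y + 3 * x₀ * (q * y) * y + (q * y) ^ 2 * y := by ring
        _ ≤ 3 * (X : ℝ) ^ 2 * Y + 3 * X * X * Y + X ^ 2 * Y := by gcongr
        _ = _ := by ring
    have e2 : ‖m y • (q • α)‖ ≤ 7 * L ^ 6 * Y / X := by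
      calc _ ≤ ‖m y‖ * ‖q • α‖ := norm_zsmul_le _ _
        _ ≤ (7 * (X : ℝ) ^ 2 * Y) * (L ^ 6 / (X : ℝ) ^ 3) := by
            rw [Int.norm_eq_abs]; gcongr
        _ = _ := by field_simp
    have e3 : 7 * L ^ 6 * Y / X ≤ 7 / L ^ 2 := by
      rw [div_le_iff₀ hX0]
      calc 7 * L ^ 6 * Y ≤ 7 * L ^ 6 * (X / L ^ 8) := by gcongr
        _ = _ := by field_simp
    have hπ := Real.pi_lt_four
    calc 2 * Real.pi * ‖m y • (q • α)‖ ≤ 2 * 4 * (7 / L ^ 2) := by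
          have := e2.trans e3
          gcongr
      _ ≤ _ := by
          rw [← mul_div_assoc, div_le_div_iff₀ (by positivity) (by positivity)]
          nlinarith
  have hsum : ‖∑ y ∈ Ioc (0 : ℤ) Y, ee (((x₀ + q * y) ^ 3) • α + ((x₀ + q * y) ^ 2) • β) -
      ∑ y ∈ Ioc (0 : ℤ) Y, v y‖ ≤ Y * (1 / (4 * L)) := by
    rw [← sum_sub_distrib]
    refine (norm_sum_le_of_le _ hdiff).trans ?_
    simp
  have hbig : Y / (2 * L) ≤
      ‖∑ y ∈ Ioc (0 : ℤ) Y, ee (((x₀ + q * y) ^ 3) • α + ((x₀ + q * y) ^ 2) • β)‖ := by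
    refine le_of_mul_le_mul_left (le_trans ?_ hp) hX0
    have h1 : X / L ≤ ‖∑ x ∈ Ioc (0 : ℤ) X, ee ((x ^ 3) • α + (x ^ 2) • β)‖ := hg
    have h2 : 2 * (X / L ^ 2) ≤ X / (2 * L) := by
      rw [← mul_div_assoc, div_le_div_iff₀ (by positivity) (by positivity)]
      nlinarith [mul_le_mul_of_nonneg_left (show 4 ≤ L by linarith) (show 0 ≤ X * L by positivity)]
    calc X * (Y / (2 * L)) = Y * (X / L - X / (2 * L)) := by field_simp; ring
      _ ≤ _ := by gcongr; linarith
  have hv4 : Y / (4 * L) ≤ ‖∑ y ∈ Ioc (0 : ℤ) Y, v y‖ := by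
    have h1 := norm_sub_norm_le
      (∑ y ∈ Ioc (0 : ℤ) Y, ee (((x₀ + q * y) ^ 3) • α + ((x₀ + q * y) ^ 2) • β))
      (∑ y ∈ Ioc (0 : ℤ) Y, v y)
    have h2 : Y / (2 * L) = Y / (4 * L) + Y * (1 / (4 * L)) := by field_simp; ring
    linarith
  have hlogY : 1 + Real.log (2 * (Y : ℝ) ^ 2) ≤ Λ * L := by
    refine le_trans ?_ hlog
    have : (Y : ℝ) ^ 2 ≤ (X : ℝ) ^ 3 := by
      calc (Y : ℝ) ^ 2 ≤ (X : ℝ) ^ 2 := by gcongr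
        _ ≤ _ := pow_le_pow_right₀ hX' (by norm_num)
    gcongr
  obtain ⟨r, hr0, hr, hrβ⟩ := weyl_quad hΛ hL hY4 hlogY hv4
  have hL30 : ∀ k : ℕ, k + 1 ≤ 30 → 4 * L ^ k ≤ L ^ 30 := fun k hk => by
    calc 4 * L ^ k ≤ L * L ^ k := by gcongr; linarith
      _ = L ^ (k + 1) := by ring
      _ ≤ _ := pow_le_pow_right₀ hL1 hk
  refine ⟨2 * q ^ 2 * r, by positivity, ?_, ?_, ?_⟩
  · push_cast
    calc 2 * (q : ℝ) ^ 2 * r ≤ 2 * (L ^ 6) ^ 2 * L ^ 4 := by gcongr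
      _ ≤ 4 * L ^ 16 := by
        have : 0 < L ^ 16 := by positivity
        ring_nf; linarith
      _ ≤ _ := hL30 16 (by norm_num)
  · rw [show 2 * q ^ 2 * r = (2 * q * r) * q by ring, mul_smul]
    calc _ ≤ ((2 * q * r : ℕ) : ℝ) * ‖q • α‖ := norm_nsmul_le
      _ ≤ (2 * L ^ 6 * L ^ 4) * (L ^ 6 / (X : ℝ) ^ 3) := by push_cast; gcongr
      _ = 2 * L ^ 16 / (X : ℝ) ^ 3 := by ring
      _ ≤ _ := by
        refine div_le_div_of_nonneg_right (le_trans ?_ (hL30 16 (by norm_num))) (by positivity)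
        linarith [show 0 < L ^ 16 by positivity]
  · have e1 : (2 * q ^ 2 * r) • β = r • (2 • (((q : ℤ) ^ 2) • β)) := by
      simp only [← natCast_zsmul, smul_smul]
      push_cast
      congr 1
      ring
    rw [e1]
    refine hrβ.trans ?_
    calc L ^ 4 / (Y : ℝ) ^ 2 ≤ L ^ 4 / (X / (2 * L ^ 8)) ^ 2 := by gcongr
      _ = 4 * L ^ 20 / (X : ℝ) ^ 2 := by field_simp; ring
      _ ≤ _ := div_le_div_of_nonneg_right (hL30 20 (by norm_num)) (by positivity)

lemma eventually_mul_rpow_le (c : ℝ) {a b : ℝ} (h : a < b) :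
    ∀ᶠ X : ℕ in Filter.atTop, c * (X : ℝ) ^ a ≤ (X : ℝ) ^ b := by
  have h1 := ((tendsto_rpow_atTop (sub_pos.2 h)).comp tendsto_natCast_atTop_atTop).eventually_ge_atTop c
  filter_upwards [h1, Filter.eventually_ge_atTop 1] with X hX hX1
  have hX0 : (0 : ℝ) < X := by exact_mod_cast hX1
  calc c * (X : ℝ) ^ a ≤ (X : ℝ) ^ (b - a) * (X : ℝ) ^ a := by
        gcongr; exact hX
    _ = _ := by rw [← Real.rpow_add hX0]; congr 1; ring

/-- Weyl's inequality in inverse form. -/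
theorem weyl_rpow {τ : ℝ} (hτ : 0 < τ) (hτ' : τ ≤ 1 / 22) : ∀ᶠ X : ℕ in Filter.atTop, ∀ α β,
    (X : ℝ) ^ (1 - τ) ≤ ‖gS X α β‖ → ∃ q : ℕ, 0 < q ∧ (q : ℝ) ≤ (X : ℝ) ^ (30 * τ) ∧
      ‖q • α‖ ≤ (X : ℝ) ^ (30 * τ - 3) ∧ ‖q • β‖ ≤ (X : ℝ) ^ (30 * τ - 2) := by
  obtain ⟨C2, hC2, h2⟩ := wS_le hτ
  obtain ⟨C3, hC3, h3⟩ := log_bound hτ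
  filter_upwards [eventually_mul_rpow_le (2000 * (C2 + C3)) hτ, Filter.eventually_ge_atTop 1]
    with X hXL hX α β hg
  have hX' : (1 : ℝ) ≤ X := by exact_mod_cast hX
  have hX0 : (0 : ℝ) < X := by linarith
  rw [Real.rpow_zero, mul_one] at hXL
  have hpow : ∀ k : ℕ, ((X : ℝ) ^ τ) ^ k = (X : ℝ) ^ (k * τ) := fun k => by
    rw [← Real.rpow_natCast, ← Real.rpow_mul hX0.le, mul_comm]
  have hL0 : 0 < (X : ℝ) ^ τ := by positivity
  obtain ⟨q, hq0, hq, hα, hβ⟩ := weyl hX (L := (X : ℝ) ^ τ) (Λ := C2 + C3) (by linarith) hXL (by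
    rw [hpow]
    calc (X : ℝ) ^ (((22 : ℕ) : ℝ) * τ) ≤ (X : ℝ) ^ (1 : ℝ) :=
          Real.rpow_le_rpow_of_exponent_le hX' (by push_cast; linarith)
      _ = X := Real.rpow_one _) (fun R hR hRX α hα => by
    refine (h2 X hX R hR hRX α hα).trans (div_le_div_of_nonneg_right ?_ (by linarith))
    rw [add_comm (3 : ℝ), Real.rpow_add hX0, ← mul_assoc]
    norm_cast
    gcongr
    linarith) ((h3 X hX).trans (by gcongr; linarith)) (by
    rwa [Real.rpow_sub hX0, Real.rpow_one] at hg)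
  rw [hpow] at hq hα hβ
  refine ⟨q, hq0, by exact_mod_cast hq, ?_, ?_⟩
  · rw [Real.rpow_sub hX0]; exact_mod_cast hα
  · rw [Real.rpow_sub hX0]; exact_mod_cast hβ

instance instHaarPi (ι : Type*) [Fintype ι] : (volume : Measure (ι → 𝕋)).IsAddHaarMeasure :=
  inferInstanceAs (Measure.pi fun _ : ι => (volume : Measure 𝕋)).IsAddHaarMeasure

/-- The endomorphism of a torus attached to an integer matrix. -/
noncomputable def matHom {ι κ : Type*} [Fintype ι] (A : ι → κ → ℤ) : (ι → 𝕋) →+ (κ → 𝕋) where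
  toFun a k := ∑ i, A i k • a i
  map_zero' := by ext; simp
  map_add' a b := by ext; simp [smul_add, sum_add_distrib]

lemma matHom_apply {ι κ : Type*} [Fintype ι] (A : ι → κ → ℤ) (a : ι → 𝕋) (k : κ) :
    matHom A a k = ∑ i, A i k • a i := rfl

lemma sum_adjugate_smul {n : ℕ} (A : Fin n → Fin n → ℤ) (b : Fin n → 𝕋) (k : Fin n) :
    ∑ i, A i k • ∑ l, (Matrix.of A).adjugate l i • b l = (Matrix.of A).det • b k := by
  simp_rw [smul_sum, smul_smul]
  rw [sum_comm]
  simp_rw [← sum_smul]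
  have h : ∀ l, ∑ i, A i k * (Matrix.of A).adjugate l i =
      if l = k then (Matrix.of A).det else 0 := by
    intro l
    have := congrFun (congrFun (Matrix.adjugate_mul (Matrix.of A)) l) k
    rw [Matrix.mul_apply] at this
    simp only [Matrix.of_apply, Matrix.smul_apply, Matrix.one_apply, smul_eq_mul, mul_ite, mul_one,
      mul_zero] at this
    rw [← this]
    exact sum_congr rfl fun i _ => mul_comm _ _
  simp_rw [h, ite_smul, zero_smul]
  simp

lemma sum_adjugate_smul' {n : ℕ} (A : Fin n → Fin n → ℤ) (a : Fin n → 𝕋) (i : Fin n) :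
    ∑ k, (Matrix.of A).adjugate k i • ∑ l, A l k • a l = (Matrix.of A).det • a i := by
  simp_rw [smul_sum, smul_smul]
  rw [sum_comm]
  simp_rw [← sum_smul]
  have h : ∀ l, ∑ k, (Matrix.of A).adjugate k i * A l k =
      if l = i then (Matrix.of A).det else 0 := by
    intro l
    have := congrFun (congrFun (Matrix.mul_adjugate (Matrix.of A)) l) i
    rw [Matrix.mul_apply] at this
    simp only [Matrix.of_apply, Matrix.smul_apply, Matrix.one_apply, smul_eq_mul, mul_ite, mul_one,
      mul_zero] at this
    rw [← this]
    exact sum_congr rfl fun i _ => mul_comm _ _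
  simp_rw [h, ite_smul, zero_smul]
  simp

lemma measurePreserving_matHom {n : ℕ} (A : Fin n → Fin n → ℤ) (hA : (Matrix.of A).det ≠ 0) :
    MeasurePreserving (matHom A) volume volume := by
  refine AddMonoidHom.measurePreserving ?_ ?_ rfl
  · show Continuous fun a : Fin n → 𝕋 => fun k => ∑ i, A i k • a i
    fun_prop
  · intro b
    choose u hu using fun k => exists_zsmul_eq _ hA (b k)
    refine ⟨fun i => ∑ l, (Matrix.of A).adjugate l i • u l, ?_⟩
    ext k
    rw [matHom_apply, sum_adjugate_smul, hu]

lemma integral_prod_comp_matHom {n : ℕ} (A : Fin n → Fin n → ℤ) (hA : (Matrix.of A).det ≠ 0)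
    {h : Fin n → 𝕋 → ℝ} (hc : ∀ k, Continuous (h k)) :
    ∫ a : Fin n → 𝕋, ∏ k, h k (∑ i, A i k • a i) = ∏ k, ∫ t, h k t := by
  have mp := measurePreserving_matHom A hA
  have hcont : Continuous fun b : Fin n → 𝕋 => ∏ k, h k (b k) :=
    continuous_finsetProd _ fun k _ => (hc k).comp (continuous_apply k)
  have h2 := integral_map (f := fun b : Fin n → 𝕋 => ∏ k, h k (b k)) mp.aemeasurable
    hcont.aestronglyMeasurable
  rw [mp.map_eq] at h2
  rw [← integral_fintype_prod_eq_prod]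
  exact h2.symm

/-- The product mean value over a full set of independent linear forms. -/
theorem mean_value {ε : ℝ} (hε : 0 < ε) (r m : ℕ) : ∃ C : ℝ, 1 ≤ C ∧ ∀ X : ℕ, 1 ≤ X →
    ∀ (c : Fin r → Fin (r + m) → ℤ) (d : Fin (r + m) → Fin (r + m) → ℤ),
    (Matrix.of fun i k => c i (Fin.castAdd m k)).det ≠ 0 → (Matrix.of d).det ≠ 0 →
    ∫ p : (Fin r → 𝕋) × (Fin (r + m) → 𝕋),
      (∏ k : Fin r, ‖gS X (∑ i, c i (Fin.castAdd m k) • p.1 i)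
        (∑ i, d i (Fin.castAdd m k) • p.2 i)‖ ^ (32 / 3 : ℝ)) *
      ∏ k : Fin m, ‖gS X (∑ i, c i (Fin.natAdd r k) • p.1 i)
        (∑ i, d i (Fin.natAdd r k) • p.2 i)‖ ^ 4 ≤
      C * (X : ℝ) ^ (17 / 3 * r + 2 * m + ε : ℝ) := by
  have hδ : 0 < ε / (r + m + 1) := by positivity
  obtain ⟨C1, hC1, h1⟩ := moment_le hδ
  obtain ⟨C2, hC2, h2⟩ := fourth_moment_le hδ
  refine ⟨C1 ^ r * C2 ^ m, one_le_mul_of_one_le_of_one_le (one_le_pow₀ hC1) (one_le_pow₀ hC2),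
    fun X hX c d hc hd => ?_⟩
  have hX' : (1 : ℝ) ≤ X := by exact_mod_cast hX
  have hX0 : (0 : ℝ) < X := by linarith
  set B := C2 * (X : ℝ) ^ (ε / (r + m + 1)) * (X : ℝ) ^ 2 with hB
  have hB0 : 0 ≤ B := by positivity
  obtain ⟨H, hH1, hH2⟩ : ∃ H : Fin (r + m) → 𝕋 → 𝕋 → ℝ,
      (∀ k : Fin r, H (Fin.castAdd m k) = fun α β => ‖gS X α β‖ ^ (32 / 3 : ℝ)) ∧
      ∀ k : Fin m, H (Fin.natAdd r k) = fun α β => ‖gS X α β‖ ^ 4 :=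
    ⟨fun k α β => Fin.addCases (fun _ => ‖gS X α β‖ ^ (32 / 3 : ℝ)) (fun _ => ‖gS X α β‖ ^ 4) k,
      fun k => by ext α β; simp, fun k => by ext α β; simp⟩
  have hHc : ∀ k, Continuous fun q : 𝕋 × 𝕋 => H k q.1 q.2 := by
    intro k
    refine Fin.addCases (fun k => ?_) (fun k => ?_) k
    · rw [hH1]
      exact Continuous.rpow_const (by fun_prop) fun _ => Or.inr (by norm_num)
    · rw [hH2]; fun_prop
  have hG : Continuous fun α => ∫ β, ‖gS X α β‖ ^ (32 / 3 : ℝ) := continuous_gS_moment X (by norm_num)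
  have hHc2 : ∀ k, Continuous fun q : (Fin r → 𝕋) × (Fin (r + m) → 𝕋) =>
      H k (∑ i, c i k • q.1 i) (∑ i, d i k • q.2 i) := by
    intro k
    have : Continuous fun q : (Fin r → 𝕋) × (Fin (r + m) → 𝕋) =>
      ((∑ i, c i k • q.1 i, ∑ i, d i k • q.2 i) : 𝕋 × 𝕋) := by fun_prop
    exact Continuous.comp (g := fun q : 𝕋 × 𝕋 => H k q.1 q.2) (hHc k) this
  have hHcont : Continuous fun q : (Fin r → 𝕋) × (Fin (r + m) → 𝕋) =>
      ∏ k, H k (∑ i, c i k • q.1 i) (∑ i, d i k • q.2 i) :=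
    continuous_finsetProd _ fun k _ => hHc2 k
  have e1 : ∀ p : (Fin r → 𝕋) × (Fin (r + m) → 𝕋),
      (∏ k : Fin r, ‖gS X (∑ i, c i (Fin.castAdd m k) • p.1 i)
        (∑ i, d i (Fin.castAdd m k) • p.2 i)‖ ^ (32 / 3 : ℝ)) *
      ∏ k : Fin m, ‖gS X (∑ i, c i (Fin.natAdd r k) • p.1 i)
        (∑ i, d i (Fin.natAdd r k) • p.2 i)‖ ^ 4 =
      ∏ k, H k (∑ i, c i k • p.1 i) (∑ i, d i k • p.2 i) := by
    intro p
    rw [Fin.prod_univ_add]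
    simp_rw [hH1, hH2]
  simp_rw [e1]
  have hint : Integrable (fun q : (Fin r → 𝕋) × (Fin (r + m) → 𝕋) =>
      ∏ k, H k (∑ i, c i k • q.1 i) (∑ i, d i k • q.2 i)) (volume.prod volume) :=
    integrable_cont _ hHcont
  rw [Measure.volume_eq_prod, integral_prod _ hint]
  have e2 : ∀ a : Fin r → 𝕋, ∫ b : Fin (r + m) → 𝕋,
      ∏ k, H k (∑ i, c i k • a i) (∑ i, d i k • b i) ≤
      B ^ m * ∏ k : Fin r, ∫ β, ‖gS X (∑ i, c i (Fin.castAdd m k) • a i) β‖ ^ (32 / 3 : ℝ) := by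
    intro a
    rw [integral_prod_comp_matHom d hd (h := fun k => H k (∑ i, c i k • a i)) fun k =>
      (hHc k).comp (by fun_prop : Continuous fun β : 𝕋 => ((∑ i, c i k • a i, β) : 𝕋 × 𝕋)),
      Fin.prod_univ_add, mul_comm]
    simp_rw [hH1, hH2]
    refine mul_le_mul_of_nonneg_right ?_ (prod_nonneg fun k _ => integral_nonneg fun β =>
      Real.rpow_nonneg (norm_nonneg _) _)
    calc _ ≤ ∏ _k : Fin m, B := prod_le_prod (fun k _ => integral_nonneg fun β => by positivity)
          fun k _ => h2 X hX _
      _ = B ^ m := by simp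
  have hGc2 : Continuous fun a : Fin r → 𝕋 => B ^ m * ∏ k : Fin r, ∫ β,
      ‖gS X (∑ i, c i (Fin.castAdd m k) • a i) β‖ ^ (32 / 3 : ℝ) := by
    refine continuous_const.mul (continuous_finsetProd _ fun k _ => ?_)
    exact hG.comp (by fun_prop : Continuous fun a : Fin r → 𝕋 => ∑ i, c i (Fin.castAdd m k) • a i)
  refine (integral_mono hint.integral_prod_left
    (integrable_cont _ hGc2) e2).trans ?_
  rw [integral_const_mul, integral_prod_comp_matHom (fun i k => c i (Fin.castAdd m k)) hc
    (h := fun _ α => ∫ β, ‖gS X α β‖ ^ (32 / 3 : ℝ)) fun _ => hG, prod_const, card_univ,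
    Fintype.card_fin]
  have hI0 : 0 ≤ ∫ α, ∫ β, ‖gS X α β‖ ^ (32 / 3 : ℝ) := integral_nonneg fun α =>
    integral_nonneg fun β => Real.rpow_nonneg (norm_nonneg _) _
  calc _ ≤ B ^ m * (C1 * (X : ℝ) ^ (17 / 3 + ε / (r + m + 1))) ^ r := by
        gcongr; exact h1 X hX
    _ = C1 ^ r * C2 ^ m * (X : ℝ) ^ (17 / 3 * r + 2 * m + ε / (r + m + 1) * (r + m) : ℝ) := by
        rw [hB, mul_pow, mul_pow, mul_pow, ← Real.rpow_natCast (X : ℝ) 2]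
        simp only [← Real.rpow_mul_natCast hX0.le]
        rw [show (17 / 3 * r + 2 * m + ε / (r + m + 1) * (r + m) : ℝ) =
          ε / (r + m + 1) * m + ((2 : ℕ) : ℝ) * m + (17 / 3 + ε / (r + m + 1)) * r by push_cast; ring,
          Real.rpow_add hX0, Real.rpow_add hX0]
        ring
    _ ≤ _ := by
        gcongr
        rw [div_mul_eq_mul_div, div_le_iff₀ (by positivity)]
        nlinarith

lemma exists_top_embedding {s n : ℕ} (h : n ≤ s) (b : Fin s → ℝ) :
    ∃ σ : Fin n ↪ Fin s, ∀ k, ∀ j ∉ univ.map σ, b j ≤ b (σ k) := by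
  have hinj : Function.Injective fun k => Tuple.sort b (Fin.rev (Fin.castLE h k)) :=
    fun x y hxy => by simpa using hxy
  refine ⟨⟨_, hinj⟩, fun k j hj => ?_⟩
  obtain ⟨i, rfl⟩ := (Tuple.sort b).surjective j
  refine Tuple.monotone_sort b ?_
  rw [mem_map] at hj
  push Not at hj
  by_contra hlt
  rw [not_le, Fin.lt_def, Fin.val_rev, Fin.val_castLE] at hlt
  have hi := i.2
  refine hj ⟨s - 1 - i, by omega⟩ (mem_univ _) ?_
  change Tuple.sort b (Fin.rev (Fin.castLE h ⟨s - 1 - i, _⟩)) = Tuple.sort b i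
  congr 1
  ext
  simp only [Fin.val_rev, Fin.val_castLE]
  omega

lemma prod_le_top {s r m : ℕ} {P τ : ℝ} (hP : 1 ≤ P) (hτ : 0 ≤ τ)
    (hs : (32 / 3 * r + 4 * m : ℝ) < s) {b : Fin s → ℝ} (hb : ∀ j, 0 ≤ b j) (hbP : ∀ j, b j ≤ P)
    {j₀ : Fin s} (hj₀ : b j₀ ≤ P ^ (1 - τ)) :
    ∃ σ : Fin (r + m) ↪ Fin s, ∏ j, b j ≤
      P ^ (s - (32 / 3 * r + 4 * m) - τ * ((s - (32 / 3 * r + 4 * m)) / s) : ℝ) *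
      ((∏ k : Fin r, b (σ (Fin.castAdd m k)) ^ (32 / 3 : ℝ)) *
        ∏ k : Fin m, b (σ (Fin.natAdd r k)) ^ 4) := by
  have hP0 : 0 < P := by linarith
  have hr0 : (0 : ℝ) ≤ r := Nat.cast_nonneg r
  have hm0 : (0 : ℝ) ≤ m := Nat.cast_nonneg m
  have hsn' : (r + m : ℝ) < s := by linarith
  have hsn : r + m < s := by exact_mod_cast hsn'
  obtain ⟨σ, hσ⟩ := exists_top_embedding hsn.le b
  refine ⟨σ, ?_⟩
  set T := univ.map σ with hT
  have hTc : #T = r + m := by simp [hT]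
  have hTcc : #Tᶜ = s - (r + m) := by rw [card_compl, hTc, Fintype.card_fin]
  have hne : (Tᶜ).Nonempty := by rw [← card_pos, hTcc]; omega
  obtain ⟨jM, hjM, hM⟩ := exists_max_image Tᶜ b hne
  obtain ⟨j₁, hj₁, hb1⟩ : ∃ j ∈ Tᶜ, b j ≤ P ^ (1 - τ) := by
    by_cases h : j₀ ∈ T
    · obtain ⟨k, -, hk⟩ := mem_map.1 h
      exact ⟨jM, hjM, (hσ k jM (mem_compl.1 hjM)).trans (by rw [hk]; exact hj₀)⟩
    · exact ⟨j₀, mem_compl.2 h, hj₀⟩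
  set N : ℝ := s - (r + m) with hN
  have hN0 : 0 < N := by linarith
  have hNc : ((#Tᶜ : ℕ) : ℝ) = N := by rw [hTcc, Nat.cast_sub hsn.le]; push_cast; rfl
  set t : ℝ := (29 / 3 * r + 3 * m) / N with ht
  have ht0 : 0 ≤ t := by positivity
  have htN : t * N = 29 / 3 * r + 3 * m := by rw [ht]; field_simp
  have ht1 : t < 1 := by rw [ht, div_lt_one hN0]; linarith
  set M := b jM with hMd
  have hM0 : 0 ≤ M := hb jM
  have hsplit : ∀ j, b j = b j ^ (1 - t) * b j ^ t := fun j => by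
    rw [← Real.rpow_add' (hb j) (by norm_num)]; norm_num
  have h1 : ∏ j ∈ Tᶜ, b j ^ t ≤ (∏ k : Fin r, b (σ (Fin.castAdd m k)) ^ (29 / 3 : ℝ)) *
      ∏ k : Fin m, b (σ (Fin.natAdd r k)) ^ 3 := by
    calc ∏ j ∈ Tᶜ, b j ^ t ≤ ∏ j ∈ Tᶜ, M ^ t := prod_le_prod (fun j _ => Real.rpow_nonneg (hb j) _)
          fun j hj => Real.rpow_le_rpow (hb j) (hM j hj) ht0
      _ = M ^ (t * N) := by
          rw [prod_const, ← Real.rpow_natCast, ← Real.rpow_mul hM0, hNc]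
      _ = (∏ k : Fin r, M ^ (29 / 3 : ℝ)) * ∏ k : Fin m, M ^ 3 := by
          rw [htN, Real.rpow_add_of_nonneg hM0 (by positivity) (by positivity), Real.rpow_mul hM0,
            Real.rpow_mul hM0]
          simp only [prod_const, card_univ, Fintype.card_fin, Real.rpow_natCast]
          norm_cast
      _ ≤ _ := by
          refine mul_le_mul ?_ ?_ (prod_nonneg fun _ _ => pow_nonneg hM0 _)
            (prod_nonneg fun _ _ => Real.rpow_nonneg (hb _) _)
          · exact prod_le_prod (fun _ _ => Real.rpow_nonneg hM0 _) fun k _ =>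
              Real.rpow_le_rpow hM0 (hσ _ jM (mem_compl.1 hjM)) (by norm_num)
          · exact prod_le_prod (fun _ _ => pow_nonneg hM0 _) fun k _ =>
              pow_le_pow_left₀ hM0 (hσ _ jM (mem_compl.1 hjM)) 3
  have h2 : ∏ j ∈ Tᶜ, b j ^ (1 - t) ≤ P ^ ((1 - t) * (N - τ)) := by
    rw [← mul_prod_erase _ _ hj₁]
    calc b j₁ ^ (1 - t) * ∏ j ∈ Tᶜ.erase j₁, b j ^ (1 - t)
        ≤ (P ^ (1 - τ)) ^ (1 - t) * ∏ j ∈ Tᶜ.erase j₁, P ^ (1 - t) := by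
          refine mul_le_mul (Real.rpow_le_rpow (hb _) hb1 (by linarith)) ?_
            (prod_nonneg fun _ _ => Real.rpow_nonneg (hb _) _) (by positivity)
          exact prod_le_prod (fun _ _ => Real.rpow_nonneg (hb _) _) fun k _ =>
              Real.rpow_le_rpow (hb k) (hbP k) (by linarith)
      _ = _ := by
          rw [prod_const, card_erase_of_mem hj₁, ← Real.rpow_natCast, ← Real.rpow_mul hP0.le,
            ← Real.rpow_mul hP0.le, ← Real.rpow_add hP0, Nat.cast_sub (card_pos.2 hne), hNc]
          congr 1
          push_cast
          ring
  have h3 : ∏ j ∈ T, b j = (∏ k : Fin r, b (σ (Fin.castAdd m k))) *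
      ∏ k : Fin m, b (σ (Fin.natAdd r k)) := by
    rw [hT, prod_map, Fin.prod_univ_add]
  have h4 : (1 - t) * (N - τ) ≤
      s - (32 / 3 * r + 4 * m) - τ * ((s - (32 / 3 * r + 4 * m)) / s) := by
    have e1 : (1 - t) * N = s - (32 / 3 * r + 4 * m) := by
      rw [sub_mul, htN, hN]; ring
    have e2 : (s - (32 / 3 * r + 4 * m)) / s ≤ (1 - t : ℝ) := by
      rw [← e1, div_le_iff₀ (by linarith)]
      exact mul_le_mul_of_nonneg_left (by linarith) (by linarith)
    nlinarith [mul_le_mul_of_nonneg_left e2 hτ]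
  rw [← prod_compl_mul_prod T, h3]
  have h5 : ∏ j ∈ Tᶜ, b j = (∏ j ∈ Tᶜ, b j ^ (1 - t)) * ∏ j ∈ Tᶜ, b j ^ t := by
    rw [← prod_mul_distrib]; exact prod_congr rfl fun j _ => hsplit j
  rw [h5]
  have hpr : 0 ≤ ∏ k : Fin r, b (σ (Fin.castAdd m k)) := prod_nonneg fun _ _ => hb _
  have hpm : 0 ≤ ∏ k : Fin m, b (σ (Fin.natAdd r k)) := prod_nonneg fun _ _ => hb _
  have h6 : (∏ k : Fin r, b (σ (Fin.castAdd m k)) ^ (32 / 3 : ℝ)) =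
      (∏ k : Fin r, b (σ (Fin.castAdd m k)) ^ (29 / 3 : ℝ)) * ∏ k : Fin r, b (σ (Fin.castAdd m k)) := by
    rw [← prod_mul_distrib]
    refine prod_congr rfl fun k _ => ?_
    rw [← Real.rpow_add_one' (hb _) (by norm_num)]
    norm_num
  have h7 : (∏ k : Fin m, b (σ (Fin.natAdd r k)) ^ 4) =
      (∏ k : Fin m, b (σ (Fin.natAdd r k)) ^ 3) * ∏ k : Fin m, b (σ (Fin.natAdd r k)) := by
    rw [← prod_mul_distrib]
    exact prod_congr rfl fun k _ => pow_succ _ _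
  rw [h6, h7]
  have hn1 : 0 ≤ ∏ j ∈ Tᶜ, b j ^ t := prod_nonneg fun _ _ => Real.rpow_nonneg (hb _) _
  calc _ ≤ (P ^ ((1 - t) * (N - τ)) * ((∏ k : Fin r, b (σ (Fin.castAdd m k)) ^ (29 / 3 : ℝ)) *
      ∏ k : Fin m, b (σ (Fin.natAdd r k)) ^ 3)) * ((∏ k : Fin r, b (σ (Fin.castAdd m k))) *
      ∏ k : Fin m, b (σ (Fin.natAdd r k))) := by
        refine mul_le_mul_of_nonneg_right ?_ (mul_nonneg hpr hpm)
        exact mul_le_mul h2 h1 hn1 (by positivity)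
    _ ≤ (P ^ (s - (32 / 3 * r + 4 * m) - τ * ((s - (32 / 3 * r + 4 * m)) / s) : ℝ) *
      ((∏ k : Fin r, b (σ (Fin.castAdd m k)) ^ (29 / 3 : ℝ)) *
      ∏ k : Fin m, b (σ (Fin.natAdd r k)) ^ 3)) * ((∏ k : Fin r, b (σ (Fin.castAdd m k))) *
      ∏ k : Fin m, b (σ (Fin.natAdd r k))) := by
        refine mul_le_mul_of_nonneg_right ?_ (mul_nonneg hpr hpm)
        refine mul_le_mul_of_nonneg_right (Real.rpow_le_rpow_of_exponent_le hP h4) ?_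
        exact mul_nonneg (prod_nonneg fun _ _ => Real.rpow_nonneg (hb _) _)
          (prod_nonneg fun _ _ => pow_nonneg (hb _) _)
    _ = _ := by ring

section

variable {ι : Type*} [Fintype ι]

/-- The general diagonal exponential sum. -/
noncomputable def dS (k : ι → ℕ) (v : ι → ℤ) (P : ℕ) (a : ι → 𝕋) : ℂ :=
  ∑ x ∈ Ioc (0 : ℤ) P, ee (∑ i, (v i * x ^ k i) • a i)

@[fun_prop] lemma continuous_dS (k : ι → ℕ) (v : ι → ℤ) (P : ℕ) : Continuous (dS k v P) := by
  unfold dS; fun_prop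

lemma norm_dS_le (k : ι → ℕ) (v : ι → ℤ) (P : ℕ) (a : ι → 𝕋) : ‖dS k v P a‖ ≤ P := by
  refine (norm_sum_le _ _).trans ?_
  simp

open scoped Classical in
/-- The points of the torus killed by `q`. -/
noncomputable def tors (ι : Type*) [Fintype ι] (q : ℕ) : Finset (ι → 𝕋) :=
  Fintype.piFinset fun _ => (range q).image fun a : ℕ => (((a : ℝ) / q : ℝ) : 𝕋)

lemma mem_tors {q : ℕ} (hq : 0 < q) (t : ι → 𝕋) : t ∈ tors ι q ↔ q • t = 0 := by
  classical
  have h : ∀ u : 𝕋, q • u = 0 ↔ ∃ m < q, (((m : ℝ) / q : ℝ) : 𝕋) = u := fun u => by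
    simpa using AddCircle.nsmul_eq_zero_iff (p := (1 : ℝ)) (u := u) hq
  rw [tors, Fintype.mem_piFinset, funext_iff]
  refine forall_congr' fun i => ?_
  rw [Pi.smul_apply, Pi.zero_apply, h]
  simp

lemma card_tors_le (q : ℕ) : #(tors ι q) ≤ q ^ Fintype.card ι := by
  classical
  rw [tors, Fintype.card_piFinset, prod_const, card_univ]
  exact Nat.pow_le_pow_left (card_image_le.trans (card_range q).le) _

open scoped Classical in
/-- The torsion points of order at most `Q`. -/
noncomputable def torsLE (ι : Type*) [Fintype ι] (Q : ℕ) : Finset (ι → 𝕋) :=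
  (Icc 1 Q).biUnion (tors ι)

lemma mem_torsLE {Q : ℕ} {t : ι → 𝕋} :
    t ∈ torsLE ι Q ↔ 0 < addOrderOf t ∧ addOrderOf t ≤ Q := by
  classical
  rw [torsLE, mem_biUnion]
  constructor
  · rintro ⟨q, hq, ht⟩
    rw [mem_Icc] at hq
    rw [mem_tors hq.1] at ht
    have hd := addOrderOf_dvd_of_nsmul_eq_zero ht
    exact ⟨Nat.pos_of_dvd_of_pos hd hq.1, (Nat.le_of_dvd hq.1 hd).trans hq.2⟩
  · rintro ⟨h1, h2⟩
    exact ⟨_, mem_Icc.2 ⟨h1, h2⟩, (mem_tors h1 t).2 (addOrderOf_nsmul_eq_zero t)⟩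

lemma card_torsLE_le (Q : ℕ) : #(torsLE ι Q) ≤ Q ^ (Fintype.card ι + 1) := by
  classical
  refine card_biUnion_le.trans ((sum_le_card_nsmul _ _ (Q ^ Fintype.card ι) fun q hq =>
    (card_tors_le q).trans (Nat.pow_le_pow_left (mem_Icc.1 hq).2 _)).trans ?_)
  rw [Nat.card_Icc, smul_eq_mul, pow_succ']
  simp

lemma torsLE_mono {Q Q' : ℕ} (h : Q ≤ Q') : torsLE ι Q ⊆ torsLE ι Q' := fun t ht => by
  rw [mem_torsLE] at ht ⊢
  exact ⟨ht.1, ht.2.trans h⟩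

/-- The box of radius `Q P^{-k}` in the torus. -/
def tbox (k : ι → ℕ) (P Q : ℕ) : Set (ι → 𝕋) := {b | ∀ i, ‖b i‖ ≤ Q / (P : ℝ) ^ k i}

omit [Fintype ι] in
lemma isClosed_tbox (k : ι → ℕ) (P Q : ℕ) : IsClosed (tbox k P Q) := by
  rw [tbox, Set.ofPred_forall]
  exact isClosed_iInter fun i => isClosed_le (by fun_prop) continuous_const

/-- The major arcs. -/
def majM (k : ι → ℕ) (P Q : ℕ) : Set (ι → 𝕋) := ⋃ t ∈ torsLE ι Q, {a | a - t ∈ tbox k P Q}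

lemma isClosed_majM (k : ι → ℕ) (P Q : ℕ) : IsClosed (majM k P Q) :=
  isClosed_biUnion_finset fun t _ => (isClosed_tbox k P Q).preimage (by fun_prop)

lemma mem_majM {k : ι → ℕ} {P Q : ℕ} {a : ι → 𝕋} :
    a ∈ majM k P Q ↔ ∃ t ∈ torsLE ι Q, a - t ∈ tbox k P Q := by
  simp [majM]

lemma mem_majM_of_nsmul {k : ι → ℕ} {P Q q : ℕ} {a : ι → 𝕋} (hq : 0 < q) (hqQ : q ≤ Q)
    (h : ∀ i, ‖q • a i‖ ≤ Q / (P : ℝ) ^ k i) : a ∈ majM k P Q := by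
  choose y hy hy2 hy3 using fun i => exists_rep (q • a i)
  have hq' : (0 : ℝ) < q := by exact_mod_cast hq
  have hq1 : (1 : ℝ) ≤ q := by exact_mod_cast hq
  have hz : ∀ i, q • (((y i / q : ℝ)) : 𝕋) = q • a i := fun i => by
    rw [← hy, ← AddCircle.coe_nsmul, nsmul_eq_mul, mul_div_cancel₀ _ hq'.ne']
  have ht : q • (fun i => a i - ((y i / q : ℝ) : 𝕋)) = 0 := by
    ext i
    simp only [Pi.smul_apply, Pi.zero_apply, smul_sub, hz, sub_self]
  refine mem_majM.2 ⟨fun i => a i - ((y i / q : ℝ) : 𝕋), ?_, fun i => ?_⟩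
  · rw [mem_torsLE]
    have hd := addOrderOf_dvd_of_nsmul_eq_zero ht
    exact ⟨Nat.pos_of_dvd_of_pos hd hq, (Nat.le_of_dvd hq hd).trans hqQ⟩
  · simp only [Pi.sub_apply, sub_sub_cancel]
    refine (norm_coe_le _ 0).trans (le_trans ?_ (h i))
    rw [Int.cast_zero, sub_zero, abs_div, hy2, abs_of_pos hq']
    exact div_le_self (norm_nonneg _) hq1

end

lemma norm_nsmul_det_le {n : ℕ} (A : Fin n → Fin n → ℤ) (a : Fin n → 𝕋) (q : ℕ) {δ : ℝ}
    (h : ∀ k, ‖q • ∑ l, A l k • a l‖ ≤ δ) (i : Fin n) :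
    ‖(q * (Matrix.of A).det.natAbs) • a i‖ ≤ (∑ i, ∑ k, |((Matrix.of A).adjugate k i : ℝ)|) * δ := by
  have hδ : 0 ≤ δ := (norm_nonneg _).trans (h i)
  have h1 : ‖(q * (Matrix.of A).det.natAbs) • a i‖ = ‖q • ((Matrix.of A).det • a i)‖ := by
    rw [mul_smul, ← natCast_zsmul (a i) (Int.natAbs _)]
    rcases Int.natAbs_eq (Matrix.of A).det with h | h
    · rw [← h]
    · have h' : ((Matrix.of A).det.natAbs : ℤ) = -(Matrix.of A).det := by omega
      rw [h', neg_smul, smul_neg, norm_neg]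
  rw [h1, ← sum_adjugate_smul', smul_sum]
  refine (norm_sum_le _ _).trans ?_
  have h2 : ∑ k, |((Matrix.of A).adjugate k i : ℝ)| ≤ ∑ i, ∑ k, |((Matrix.of A).adjugate k i : ℝ)| :=
    single_le_sum (f := fun i => ∑ k, |((Matrix.of A).adjugate k i : ℝ)|)
      (fun i _ => sum_nonneg fun k _ => abs_nonneg _) (mem_univ i)
  refine le_trans ?_ (mul_le_mul_of_nonneg_right h2 hδ)
  rw [sum_mul]
  refine sum_le_sum fun k _ => ?_
  rw [smul_comm]
  refine (norm_zsmul_le _ _).trans ?_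
  rw [Int.norm_eq_abs]
  exact mul_le_mul_of_nonneg_left (h k) (abs_nonneg _)

/-- The exponents of a cubic-quadratic system. -/
def degs (r n : ℕ) : Fin r ⊕ Fin n → ℕ := Sum.elim (fun _ => 3) fun _ => 2

/-- The coefficients attached to the `j`-th variable. -/
def coefs {r n s : ℕ} (c : Fin r → Fin s → ℤ) (d : Fin n → Fin s → ℤ) (j : Fin s) :
    Fin r ⊕ Fin n → ℤ := Sum.elim (fun i => c i j) fun i => d i j

lemma dS_degs {r n s : ℕ} (c : Fin r → Fin s → ℤ) (d : Fin n → Fin s → ℤ) (j : Fin s) (P : ℕ)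
    (a : Fin r ⊕ Fin n → 𝕋) : dS (degs r n) (coefs c d j) P a =
      gS P (∑ i, c i j • a (Sum.inl i)) (∑ i, d i j • a (Sum.inr i)) := by
  unfold dS gS
  refine sum_congr rfl fun x _ => ?_
  rw [Fintype.sum_sum_type, smul_sum, smul_sum]
  congr 2 <;> refine sum_congr rfl fun i _ => ?_ <;>
    simp only [degs, coefs, Sum.elim_inl, Sum.elim_inr, smul_smul, mul_comm]

lemma mem_majM_of_large {r m s : ℕ} (hsn : r + m ≤ s) (c : Fin r → Fin s → ℤ)
    (d : Fin (r + m) → Fin s → ℤ)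
    (hc : ∀ J : Fin r → Fin s, Function.Injective J → (Matrix.of fun i m => c i (J m)).det ≠ 0)
    (hd : ∀ J : Fin (r + m) → Fin s, Function.Injective J →
      (Matrix.of fun i m => d i (J m)).det ≠ 0) :
    ∃ H : ℕ, ∀ (P Q : ℕ) (R : ℝ) (a : Fin r ⊕ Fin (r + m) → 𝕋), 1 ≤ P → 1 ≤ R →
      (∀ j, ∃ q : ℕ, 0 < q ∧ q ≤ R ∧ ‖q • ∑ i, c i j • a (Sum.inl i)‖ ≤ R / (P : ℝ) ^ 3 ∧
        ‖q • ∑ i, d i j • a (Sum.inr i)‖ ≤ R / (P : ℝ) ^ 2) →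
      H * R ^ (r + m) ≤ Q → a ∈ majM (degs r (r + m)) P Q := by
  set J : Fin (r + m) → Fin s := Fin.castLE hsn
  have hJ : Function.Injective J := Fin.castLE_injective hsn
  have hJ' : Function.Injective fun k => J (Fin.castAdd m k) := hJ.comp (Fin.castAdd_injective r m)
  have hc' := hc _ hJ'
  have hd' := hd _ hJ
  obtain ⟨A, hA⟩ : ∃ A : Fin r → Fin r → ℤ, A = fun i k => c i (J (Fin.castAdd m k)) := ⟨_, rfl⟩
  obtain ⟨B, hB⟩ : ∃ B : Fin (r + m) → Fin (r + m) → ℤ, B = fun i k => d i (J k) := ⟨_, rfl⟩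
  rw [← hA] at hc'
  rw [← hB] at hd'
  have hA0 := Int.natAbs_pos.2 hc'
  have hB0 := Int.natAbs_pos.2 hd'
  obtain ⟨x, hx⟩ : ∃ x, x = (Matrix.of A).det.natAbs := ⟨_, rfl⟩
  obtain ⟨y, hy⟩ : ∃ y, y = (Matrix.of B).det.natAbs := ⟨_, rfl⟩
  obtain ⟨SA, hSA⟩ : ∃ S, S = ∑ i, ∑ k, |((Matrix.of A).adjugate k i : ℝ)| := ⟨_, rfl⟩
  obtain ⟨SB, hSB⟩ : ∃ S, S = ∑ i, ∑ k, |((Matrix.of B).adjugate k i : ℝ)| := ⟨_, rfl⟩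
  have hSA0 : 0 ≤ SA := by rw [hSA]; exact sum_nonneg fun _ _ => sum_nonneg fun _ _ => abs_nonneg _
  have hSB0 : 0 ≤ SB := by rw [hSB]; exact sum_nonneg fun _ _ => sum_nonneg fun _ _ => abs_nonneg _
  rw [← hx] at hA0
  rw [← hy] at hB0
  have hA0' : (1 : ℝ) ≤ x := by exact_mod_cast hA0
  have hB0' : (1 : ℝ) ≤ y := by exact_mod_cast hB0
  obtain ⟨H, hH⟩ := exists_nat_ge (x * y + y * SA + x * SB)
  refine ⟨H, fun P Q R a hP hR h hQ => ?_⟩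
  have hPp : (0 : ℝ) < P := by exact_mod_cast hP
  choose q hq0 hqR hqa hqb using h
  have hprod : ∀ k, ∃ u : ℕ, ∏ k, q (J k) = u * q (J k) ∧ (u * R : ℝ) ≤ R ^ (r + m) := fun k => by
    refine ⟨∏ l ∈ univ.erase k, q (J l), (prod_erase_mul _ _ (mem_univ k)).symm, ?_⟩
    have : ((∏ l ∈ univ.erase k, q (J l) : ℕ) : ℝ) ≤ R ^ #(univ.erase k) := by
      rw [Nat.cast_prod, ← prod_const]
      exact prod_le_prod (fun _ _ => Nat.cast_nonneg _) fun l _ => hqR _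
    calc _ ≤ R ^ #(univ.erase k) * R := mul_le_mul_of_nonneg_right this (by linarith)
      _ = R ^ (r + m) := by
        have := card_erase_add_one (mem_univ k)
        rw [card_univ, Fintype.card_fin] at this
        rw [← pow_succ, this]
  have hle : ∀ (z : 𝕋) (k : Fin (r + m)) (D : ℝ), 0 < D → ‖q (J k) • z‖ ≤ R / D →
      ‖(∏ k, q (J k)) • z‖ ≤ R ^ (r + m) / D := fun z k D hD hz => by
    obtain ⟨u, hu, hu2⟩ := hprod k
    rw [hu, mul_smul]
    refine (norm_nsmul_le).trans ?_
    calc (u : ℝ) * ‖q (J k) • z‖ ≤ u * (R / D) := mul_le_mul_of_nonneg_left hz (Nat.cast_nonneg _)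
      _ = u * R / D := by ring
      _ ≤ _ := div_le_div_of_nonneg_right hu2 hD.le
  have hRn : 0 ≤ R ^ (r + m) := by positivity
  have hqle : ((∏ k, q (J k) : ℕ) : ℝ) ≤ R ^ (r + m) := by
    have : R ^ (r + m) = ∏ k : Fin (r + m), R := by simp
    rw [this, Nat.cast_prod]
    exact prod_le_prod (fun _ _ => Nat.cast_nonneg _) fun l _ => hqR _
  have hq00 : 0 < ∏ k, q (J k) := prod_pos fun k _ => hq0 _
  obtain ⟨q', hq'⟩ : ∃ q', q' = ∏ k, q (J k) := ⟨_, rfl⟩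
  rw [← hq'] at hqle hq00
  simp only [← hq'] at hle
  have hHQ : ∀ z : ℝ, z ≤ x * y + y * SA + x * SB → z * R ^ (r + m) ≤ Q := fun z hz =>
    (mul_le_mul_of_nonneg_right (hz.trans hH) hRn).trans hQ
  refine mem_majM_of_nsmul (q := q' * x * y) (by positivity) ?_ ?_
  · have : ((q' * x * y : ℕ) : ℝ) ≤ Q := by
      refine le_trans ?_ (hHQ (x * y) (by nlinarith))
      push_cast
      calc (q' * x * y : ℝ) = x * y * q' := by ring
        _ ≤ _ := mul_le_mul_of_nonneg_left hqle (by positivity)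
    exact_mod_cast this
  · rintro (i | i)
    · have h1 := norm_nsmul_det_le A (fun l => a (Sum.inl l)) q'
        (fun k => by
          have := hle _ (Fin.castAdd m k) ((P : ℝ) ^ 3) (by positivity) (hqa (J (Fin.castAdd m k)))
          rw [hA]; exact this) i
      rw [← hx, ← hSA] at h1
      rw [mul_comm, mul_smul]
      refine (norm_nsmul_le).trans ((mul_le_mul_of_nonneg_left h1 (by positivity)).trans ?_)
      rw [← mul_assoc, ← mul_div_assoc]
      exact div_le_div_of_nonneg_right (hHQ _ (by nlinarith)) (by positivity)
    · have h1 := norm_nsmul_det_le B (fun l => a (Sum.inr l)) q'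
        (fun k => by
          have := hle _ k ((P : ℝ) ^ 2) (by positivity) (hqb (J k))
          rw [hB]; exact this) i
      rw [← hy, ← hSB] at h1
      rw [mul_right_comm, mul_comm, mul_smul]
      refine (norm_nsmul_le).trans ((mul_le_mul_of_nonneg_left h1 (by positivity)).trans ?_)
      rw [← mul_assoc, ← mul_div_assoc]
      exact div_le_div_of_nonneg_right (hHQ _ (by nlinarith)) (by positivity)

lemma mean_value_sum {ε : ℝ} (hε : 0 < ε) {r m s : ℕ} (c : Fin r → Fin s → ℤ)
    (d : Fin (r + m) → Fin s → ℤ)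
    (hc : ∀ J : Fin r → Fin s, Function.Injective J → (Matrix.of fun i m => c i (J m)).det ≠ 0)
    (hd : ∀ J : Fin (r + m) → Fin s, Function.Injective J →
      (Matrix.of fun i m => d i (J m)).det ≠ 0) : ∃ C : ℝ, 1 ≤ C ∧ ∀ X : ℕ, 1 ≤ X →
    ∀ σ : Fin (r + m) ↪ Fin s, ∫ a,
      ((∏ k : Fin r, ‖dS (degs r (r + m)) (coefs c d (σ (Fin.castAdd m k))) X a‖ ^ (32 / 3 : ℝ)) *
      ∏ k : Fin m, ‖dS (degs r (r + m)) (coefs c d (σ (Fin.natAdd r k))) X a‖ ^ 4) ≤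
      C * (X : ℝ) ^ (17 / 3 * r + 2 * m + ε : ℝ) := by
  obtain ⟨C, hC, h⟩ := mean_value hε r m
  refine ⟨C, hC, fun X hX σ => le_trans (le_of_eq ?_) (h X hX (fun i k => c i (σ k))
    (fun i k => d i (σ k)) (hc _ (σ.injective.comp (Fin.castAdd_injective r m)))
    (hd _ σ.injective))⟩
  simp only [dS_degs]
  exact (volume_measurePreserving_sumPiEquivProdPi fun _ : Fin r ⊕ Fin (r + m) => 𝕋).integral_comp'
    (fun p : (Fin r → 𝕋) × (Fin (r + m) → 𝕋) =>
      (∏ k : Fin r, ‖gS X (∑ i, c i (σ (Fin.castAdd m k)) • p.1 i)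
        (∑ i, d i (σ (Fin.castAdd m k)) • p.2 i)‖ ^ (32 / 3 : ℝ)) *
      ∏ k : Fin m, ‖gS X (∑ i, c i (σ (Fin.natAdd r k)) • p.1 i)
        (∑ i, d i (σ (Fin.natAdd r k)) • p.2 i)‖ ^ 4)

theorem minor_arcs {r m s : ℕ} (c : Fin r → Fin s → ℤ)
    (d : Fin (r + m) → Fin s → ℤ)
    (hc : ∀ J : Fin r → Fin s, Function.Injective J → (Matrix.of fun i m => c i (J m)).det ≠ 0)
    (hd : ∀ J : Fin (r + m) → Fin s, Function.Injective J →
      (Matrix.of fun i m => d i (J m)).det ≠ 0)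
    (hs : (32 / 3 * r + 4 * m : ℝ) < s) (A : ℕ) (hA : 1 ≤ A) :
    ∃ κ : ℝ, 0 < κ ∧ ∃ C : ℝ, ∀ᶠ P : ℕ in Filter.atTop, ∀ Q : ℕ, P ≤ Q ^ A →
      ∫ a in (majM (degs r (r + m)) P Q)ᶜ, ∏ j, ‖dS (degs r (r + m)) (coefs c d j) P a‖ ≤
        C * (P : ℝ) ^ (s - (5 * r + 2 * m) - κ : ℝ) := by
  have hr0 : (0 : ℝ) ≤ r := Nat.cast_nonneg r
  have hm0 : (0 : ℝ) ≤ m := Nat.cast_nonneg m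
  have hsn' : (r + m : ℝ) ≤ s := by linarith
  have hsn : r + m ≤ s := by exact_mod_cast hsn'
  have hs0 : (0 : ℝ) < s := by linarith
  have hA1 : (1 : ℝ) ≤ A := by exact_mod_cast hA
  have hA0 : (0 : ℝ) < A := by linarith
  obtain ⟨τ, hτ⟩ : ∃ τ : ℝ, τ = 1 / (30 * (r + m + 1) * A) := ⟨_, rfl⟩
  have hτ0 : 0 < τ := by rw [hτ]; positivity
  have hτ1 : τ ≤ 1 / 22 := by
    rw [hτ]
    refine one_div_le_one_div_of_le (by norm_num) ?_
    nlinarith [mul_nonneg hr0 hA0.le, mul_nonneg hm0 hA0.le]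
  have hτ2 : 30 * τ * (r + m) < 1 / A := by
    rw [hτ]
    have : 30 * (1 / (30 * (r + m + 1) * A)) * (r + m) = (r + m) / (r + m + 1) * (1 / A : ℝ) := by
      field_simp
    rw [this]
    refine mul_lt_of_lt_one_left (by positivity) ?_
    rw [div_lt_one (by positivity)]
    linarith
  obtain ⟨θ, hθ⟩ : ∃ θ : ℝ, θ = (s - (32 / 3 * r + 4 * m)) / s := ⟨_, rfl⟩
  have hθ0 : 0 < θ := by rw [hθ]; exact div_pos (by linarith) hs0
  obtain ⟨H, hH⟩ := mem_majM_of_large hsn c d hc hd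
  obtain ⟨C, hC, hmv⟩ := mean_value_sum (ε := τ * θ / 2) (by positivity) c d hc hd
  refine ⟨τ * θ / 2, by positivity, C * Fintype.card (Fin (r + m) ↪ Fin s), ?_⟩
  filter_upwards [weyl_rpow hτ0 hτ1, eventually_mul_rpow_le H hτ2, Filter.eventually_ge_atTop 1]
    with P hP1 hP2 hP3 Q hQ
  have hP0 : (0 : ℝ) < P := by exact_mod_cast hP3
  have hP1' : (1 : ℝ) ≤ P := by exact_mod_cast hP3
  have hPQ : (P : ℝ) ^ (1 / A : ℝ) ≤ Q := by
    have : (P : ℝ) ≤ (Q : ℝ) ^ A := by exact_mod_cast hQ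
    calc (P : ℝ) ^ (1 / A : ℝ) ≤ ((Q : ℝ) ^ A) ^ (1 / A : ℝ) :=
          Real.rpow_le_rpow hP0.le this (by positivity)
      _ = Q := by
        rw [← Real.rpow_natCast, ← Real.rpow_mul (Nat.cast_nonneg _), mul_one_div_cancel hA0.ne',
          Real.rpow_one]
  obtain ⟨G, hG⟩ : ∃ G : (Fin (r + m) ↪ Fin s) → (Fin r ⊕ Fin (r + m) → 𝕋) → ℝ, G = fun σ a =>
      ((∏ k : Fin r, ‖dS (degs r (r + m)) (coefs c d (σ (Fin.castAdd m k))) P a‖ ^ (32 / 3 : ℝ)) *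
      ∏ k : Fin m, ‖dS (degs r (r + m)) (coefs c d (σ (Fin.natAdd r k))) P a‖ ^ 4) := ⟨_, rfl⟩
  have hGc : ∀ σ, Continuous (G σ) := fun σ => by
    rw [hG]
    refine Continuous.mul (continuous_finsetProd _ fun k _ => ?_)
      (continuous_finsetProd _ fun k _ => by fun_prop)
    exact Continuous.rpow_const (by fun_prop) fun _ => Or.inr (by norm_num)
  have hG0 : ∀ σ a, 0 ≤ G σ a := fun σ a => by
    rw [hG]
    exact mul_nonneg (prod_nonneg fun _ _ => Real.rpow_nonneg (norm_nonneg _) _)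
      (prod_nonneg fun _ _ => by positivity)
  obtain ⟨E, hE⟩ : ∃ E : ℝ, E = s - (32 / 3 * r + 4 * m) - τ * θ := ⟨_, rfl⟩
  have hpt : ∀ a ∈ (majM (degs r (r + m)) P Q)ᶜ,
      ∏ j, ‖dS (degs r (r + m)) (coefs c d j) P a‖ ≤ (P : ℝ) ^ E * ∑ σ, G σ a := by
    intro a ha
    have : ∃ j, ‖dS (degs r (r + m)) (coefs c d j) P a‖ ≤ (P : ℝ) ^ (1 - τ) := by
      by_contra hcon
      push Not at hcon
      refine ha (hH P Q ((P : ℝ) ^ (30 * τ)) a hP3 (Real.one_le_rpow hP1' (by positivity))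
        (fun j => ?_) ?_)
      · have := hcon j
        rw [dS_degs] at this
        obtain ⟨q, hq0, hq1, hq2, hq3⟩ := hP1 _ _ this.le
        refine ⟨q, hq0, hq1, ?_, ?_⟩
        · rwa [Real.rpow_sub hP0, show (3 : ℝ) = ((3 : ℕ) : ℝ) by norm_num,
            Real.rpow_natCast] at hq2
        · rwa [Real.rpow_sub hP0, show (2 : ℝ) = ((2 : ℕ) : ℝ) by norm_num,
            Real.rpow_natCast] at hq3
      · rw [← Real.rpow_natCast, ← Real.rpow_mul hP0.le]
        push_cast
        exact hP2.trans hPQ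
    obtain ⟨j₀, hj₀⟩ := this
    obtain ⟨σ, hσ⟩ := prod_le_top (r := r) (m := m) hP1' hτ0.le hs
      (b := fun j => ‖dS (degs r (r + m)) (coefs c d j) P a‖) (fun _ => norm_nonneg _)
      (fun _ => norm_dS_le _ _ _ _) hj₀
    rw [← hθ, ← hE] at hσ
    refine hσ.trans (mul_le_mul_of_nonneg_left ?_ (by positivity))
    have := single_le_sum (f := fun σ => G σ a) (fun σ _ => hG0 σ a) (mem_univ σ)
    refine le_trans (le_of_eq ?_) this
    rw [hG]
  have hmeas : MeasurableSet (majM (degs r (r + m)) P Q)ᶜ := (isClosed_majM _ _ _).measurableSet.compl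
  have hint : Integrable fun a => (P : ℝ) ^ E * ∑ σ, G σ a :=
    integrable_cont _ (continuous_const.mul (continuous_finsetSum _ fun σ _ => hGc σ))
  have hint' : Integrable fun a => ∏ j, ‖dS (degs r (r + m)) (coefs c d j) P a‖ :=
    integrable_cont _ (continuous_finsetProd _ fun j _ => by fun_prop)
  calc _ ≤ ∫ a in (majM (degs r (r + m)) P Q)ᶜ, (P : ℝ) ^ E * ∑ σ, G σ a :=
        setIntegral_mono_on hint'.integrableOn hint.integrableOn hmeas hpt
    _ ≤ ∫ a, (P : ℝ) ^ E * ∑ σ, G σ a :=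
        setIntegral_le_integral hint (Filter.Eventually.of_forall fun a =>
          mul_nonneg (by positivity) (sum_nonneg fun σ _ => hG0 σ a))
    _ = (P : ℝ) ^ E * ∑ σ, ∫ a, G σ a := by
        rw [integral_const_mul, integral_finsetSum _ fun σ _ => integrable_cont _ (hGc σ)]
    _ ≤ (P : ℝ) ^ E * ∑ σ : Fin (r + m) ↪ Fin s, C * (P : ℝ) ^ (17 / 3 * r + 2 * m + τ * θ / 2 : ℝ) := by
        refine mul_le_mul_of_nonneg_left (sum_le_sum fun σ _ => ?_) (by positivity)
        have := hmv P hP3 σ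
        rw [hG]
        exact this
    _ = C * Fintype.card (Fin (r + m) ↪ Fin s) *
        ((P : ℝ) ^ E * (P : ℝ) ^ (17 / 3 * r + 2 * m + τ * θ / 2 : ℝ)) := by
        rw [sum_const, card_univ, nsmul_eq_mul]; ring
    _ = _ := by
        rw [← Real.rpow_add hP0, hE]
        congr 2
        ring

lemma sum_Ioc_int_add (u : ℤ → ℂ) (q n : ℕ) : ∑ x ∈ Ioc (0 : ℤ) ((n + q : ℕ) : ℤ), u x =
    ∑ x ∈ Ioc (0 : ℤ) q, u x + ∑ x ∈ Ioc (0 : ℤ) n, u (x + q) := by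
  induction n with
  | zero => simp
  | succ n ih =>
    rw [show n + 1 + q = (n + q) + 1 by ring, sum_Ioc_int_succ, sum_Ioc_int_succ, ih, add_left_comm]
    congr 3
    push_cast
    ring

lemma norm_sum_periodic_le {u : ℤ → ℂ} {q : ℕ} (hq : 0 < q) (hu : ∀ x, u (x + q) = u x)
    (h0 : ∑ x ∈ Ioc (0 : ℤ) q, u x = 0) (h2 : ∀ x, ‖u x‖ ≤ 2) (n : ℕ) :
    ‖∑ x ∈ Ioc (0 : ℤ) n, u x‖ ≤ 2 * q := by
  induction n using Nat.strong_induction_on with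
  | _ n ih =>
    rcases lt_or_ge n q with h | h
    · refine (norm_sum_le _ _).trans ((sum_le_sum fun x _ => h2 x).trans ?_)
      have : (n : ℝ) ≤ q := by exact_mod_cast h.le
      simp only [sum_const, Int.card_Ioc, sub_zero, Int.toNat_natCast, nsmul_eq_mul]
      linarith
    · obtain ⟨l, rfl⟩ := Nat.exists_eq_add_of_le' h
      rw [sum_Ioc_int_add, h0, zero_add]
      simp only [hu]
      exact ih l (by omega)

lemma sum_Ioc_mul_eq (u b : ℤ → ℂ) (n : ℕ) : ∑ x ∈ Ioc (0 : ℤ) n, u x * b x =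
    (∑ x ∈ Ioc (0 : ℤ) n, u x) * b n -
      ∑ m ∈ range n, (∑ x ∈ Ioc (0 : ℤ) m, u x) * (b (m + 1) - b m) := by
  induction n with
  | zero => simp
  | succ n ih =>
    rw [sum_Ioc_int_succ, sum_range_succ, ih, sum_Ioc_int_succ]
    push_cast
    ring

lemma norm_sum_sub_integral_le {b : ℝ → ℂ} (hb : Continuous b) {L : ℝ}
    (hL : ∀ u ∈ Set.Icc (0 : ℝ) 1, ∀ v ∈ Set.Icc (0 : ℝ) 1, ‖b u - b v‖ ≤ L * |u - v|)
    {P : ℕ} (hP : 0 < P) :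
    ‖∑ x ∈ Ioc (0 : ℤ) P, b (x / P) - P * ∫ u in (0 : ℝ)..1, b u‖ ≤ L := by
  have hP' : (0 : ℝ) < P := by exact_mod_cast hP
  have h1 : ∫ u in (0 : ℝ)..1, b u = ∑ j ∈ range P, ∫ u in (j / P : ℝ)..((j + 1 : ℕ) / P : ℝ), b u := by
    rw [intervalIntegral.sum_integral_adjacent_intervals (a := fun j : ℕ => (j / P : ℝ))
      fun k _ => hb.intervalIntegrable _ _]
    simp [hP'.ne']
  have h2 : ∀ n : ℕ, ∑ x ∈ Ioc (0 : ℤ) n, b (x / P) = ∑ j ∈ range n, b ((j + 1 : ℕ) / P) := by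
    intro n
    induction n with
    | zero => simp
    | succ n ih =>
      rw [sum_Ioc_int_succ, sum_range_succ, ih, add_comm]
      push_cast
      rfl
  rw [h1, h2, mul_sum, ← sum_sub_distrib]
  refine (norm_sum_le _ _).trans ?_
  have h3 : ∀ j ∈ range P, ‖b ((j + 1 : ℕ) / P) -
      P * ∫ u in (j / P : ℝ)..((j + 1 : ℕ) / P : ℝ), b u‖ ≤ L / P := by
    intro j hj
    rw [mem_range] at hj
    have hj' : ((j + 1 : ℕ) : ℝ) ≤ P := by exact_mod_cast hj
    have hle : (j / P : ℝ) ≤ ((j + 1 : ℕ) : ℝ) / P := by gcongr; simp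
    have hlen : ((j + 1 : ℕ) : ℝ) / P - j / P = 1 / P := by push_cast; field_simp; ring
    have h4 : b ((j + 1 : ℕ) / P) - P * ∫ u in (j / P : ℝ)..((j + 1 : ℕ) / P : ℝ), b u =
        P * ∫ u in (j / P : ℝ)..((j + 1 : ℕ) / P : ℝ), (b ((j + 1 : ℕ) / P) - b u) := by
      rw [intervalIntegral.integral_sub (by simp) (hb.intervalIntegrable _ _),
        intervalIntegral.integral_const, hlen, mul_sub, Complex.real_smul, ← mul_assoc]
      have : (P : ℂ) * ((1 / P : ℝ) : ℂ) = 1 := by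
        push_cast
        rw [mul_one_div_cancel (by exact_mod_cast hP.ne')]
      rw [this, one_mul]
    have h5 : ‖∫ u in (j / P : ℝ)..((j + 1 : ℕ) / P : ℝ), (b ((j + 1 : ℕ) / P) - b u)‖ ≤
        (L / P) * |((j + 1 : ℕ) : ℝ) / P - j / P| := by
      refine intervalIntegral.norm_integral_le_of_norm_le_const fun u hu => ?_
      rw [Set.uIoc_of_le hle] at hu
      have hL0 : 0 ≤ L := by
        have := hL 0 (by simp) 1 (by simp)
        simp only [zero_sub, abs_neg, abs_one, mul_one] at this
        exact (norm_nonneg _).trans this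
      have hj0 : (0 : ℝ) ≤ j / P := by positivity
      have hj1 : ((j + 1 : ℕ) : ℝ) / P ≤ 1 := by rwa [div_le_one hP']
      refine (hL _ ⟨by positivity, hj1⟩ u ⟨hj0.trans hu.1.le, hu.2.trans hj1⟩).trans ?_
      rw [abs_of_nonneg (by linarith [hu.2]), div_eq_mul_one_div L]
      exact mul_le_mul_of_nonneg_left (by rw [← hlen]; linarith [hu.1]) hL0
    rw [h4, norm_mul, Complex.norm_natCast]
    refine (mul_le_mul_of_nonneg_left h5 hP'.le).trans (le_of_eq ?_)
    rw [hlen, abs_of_pos (by positivity)]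
    field_simp
  refine (sum_le_sum h3).trans (le_of_eq ?_)
  rw [sum_const, card_range, nsmul_eq_mul]
  field_simp

theorem periodic_sum_approx {A : ℤ → ℂ} {q : ℕ} (hq : 0 < q) (hA : ∀ x, A (x + q) = A x)
    (hA1 : ∀ x, ‖A x‖ ≤ 1) {b : ℝ → ℂ} (hb : Continuous b) (hb1 : ∀ u, ‖b u‖ ≤ 1) {L : ℝ}
    (hL : ∀ u ∈ Set.Icc (0 : ℝ) 1, ∀ v ∈ Set.Icc (0 : ℝ) 1, ‖b u - b v‖ ≤ L * |u - v|)
    {P : ℕ} (hP : 0 < P) :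
    ‖∑ x ∈ Ioc (0 : ℤ) P, A x * b (x / P) -
      P * (((q : ℂ)⁻¹ * ∑ x ∈ Ioc (0 : ℤ) q, A x) * ∫ u in (0 : ℝ)..1, b u)‖ ≤
      2 * q * (1 + L) + L := by
  have hq' : (0 : ℝ) < q := by exact_mod_cast hq
  have hP' : (0 : ℝ) < P := by exact_mod_cast hP
  obtain ⟨W, hW⟩ : ∃ W, W = (q : ℂ)⁻¹ * ∑ x ∈ Ioc (0 : ℤ) q, A x := ⟨_, rfl⟩
  have hW1 : ‖W‖ ≤ 1 := by
    rw [hW, norm_mul, norm_inv, Complex.norm_natCast, inv_mul_le_iff₀ hq']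
    refine (norm_sum_le _ _).trans ((sum_le_sum fun x _ => hA1 x).trans ?_)
    simp
  rw [← hW]
  have hsplit : ∑ x ∈ Ioc (0 : ℤ) P, A x * b (x / P) - P * (W * ∫ u in (0 : ℝ)..1, b u) =
      ∑ x ∈ Ioc (0 : ℤ) P, (A x - W) * b (x / P) +
      W * (∑ x ∈ Ioc (0 : ℤ) P, b (x / P) - P * ∫ u in (0 : ℝ)..1, b u) := by
    simp_rw [sub_mul]
    rw [sum_sub_distrib, ← mul_sum]
    ring
  rw [hsplit]
  refine (norm_add_le _ _).trans (add_le_add ?_ ?_)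
  · have hU := norm_sum_periodic_le (u := fun x => A x - W) hq (fun x => by simp only [hA])
      (by
        rw [sum_sub_distrib, hW]
        simp only [sum_const, Int.card_Ioc, sub_zero, Int.toNat_natCast, nsmul_eq_mul]
        rw [← mul_assoc, mul_inv_cancel₀ (by exact_mod_cast hq.ne'), one_mul, sub_self])
      (fun x => (norm_sub_le _ _).trans (by linarith [hA1 x]))
    rw [sum_Ioc_mul_eq (fun x => A x - W) (fun x => b (x / P))]
    refine (norm_sub_le _ _).trans ?_
    have e : 2 * q * (1 + L) = 2 * q * 1 + ∑ m ∈ range P, 2 * q * (L / P) := by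
      rw [sum_const, card_range, nsmul_eq_mul]; field_simp
    rw [e]
    refine add_le_add ?_ ((norm_sum_le _ _).trans (sum_le_sum fun m hm => ?_))
    · rw [norm_mul]
      exact mul_le_mul (hU _) (hb1 _) (norm_nonneg _) (by positivity)
    · rw [norm_mul]
      rw [mem_range] at hm
      refine mul_le_mul (hU _) ?_ (norm_nonneg _) (by positivity)
      have h1 : ((m + 1 : ℕ) : ℝ) / P ≤ 1 := by rw [div_le_one hP']; exact_mod_cast hm
      have h2 : (m : ℝ) / P ≤ 1 := by rw [div_le_one hP']; exact_mod_cast hm.le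
      have := hL (((m + 1 : ℕ) : ℝ) / P) ⟨by positivity, h1⟩ (m / P) ⟨by positivity, h2⟩
      refine le_trans (le_of_eq ?_) (this.trans (le_of_eq ?_))
      · push_cast; rfl
      · rw [← sub_div, abs_of_nonneg (by push_cast; simp)]
        push_cast
        ring
  · rw [norm_mul]
    calc _ ≤ 1 * L := mul_le_mul hW1 (norm_sum_sub_integral_le hb hL hP) (norm_nonneg _) (by norm_num)
      _ = L := one_mul L

section

variable {ι : Type*} [Fintype ι]

/-- The normalised complete exponential sum at a torsion point. -/
noncomputable def Wt (k : ι → ℕ) (v : ι → ℤ) (t : ι → 𝕋) : ℂ :=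
  (addOrderOf t : ℂ)⁻¹ * dS k v (addOrderOf t) t

/-- The phase of the oscillatory integral. -/
noncomputable def phs (k : ι → ℕ) (v : ι → ℤ) (η : ι → ℝ) (u : ℝ) : ℝ := ∑ i, v i * η i * u ^ k i

/-- The oscillatory integral. -/
noncomputable def wI (k : ι → ℕ) (v : ι → ℤ) (η : ι → ℝ) : ℂ :=
  ∫ u in (0 : ℝ)..1, ee ((phs k v η u : ℝ) : 𝕋)

@[fun_prop] lemma continuous_phs (k : ι → ℕ) (v : ι → ℤ) (η : ι → ℝ) : Continuous (phs k v η) := by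
  unfold phs; fun_prop

@[fun_prop] lemma continuous_coe_circle : Continuous fun x : ℝ => (x : 𝕋) :=
  AddCircle.continuous_mk' 1

lemma norm_Wt_le (k : ι → ℕ) (v : ι → ℤ) (t : ι → 𝕋) : ‖Wt k v t‖ ≤ 1 := by
  rw [Wt, norm_mul, norm_inv, Complex.norm_natCast]
  rcases Nat.eq_zero_or_pos (addOrderOf t) with h | h
  · simp [h]
  · rw [inv_mul_le_iff₀ (by exact_mod_cast h), mul_one]
    exact norm_dS_le _ _ _ _

lemma norm_wI_le (k : ι → ℕ) (v : ι → ℤ) (η : ι → ℝ) : ‖wI k v η‖ ≤ 1 := by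
  have := intervalIntegral.norm_integral_le_of_norm_le_const (a := (0 : ℝ)) (b := 1) (C := 1)
    (f := fun u => ee ((phs k v η u : ℝ) : 𝕋)) (fun u _ => (norm_ee _).le)
  simpa [wI] using this

@[fun_prop] lemma continuous_wI (k : ι → ℕ) (v : ι → ℤ) : Continuous (wI k v) := by
  unfold wI
  refine intervalIntegral.continuous_parametric_intervalIntegral_of_continuous' ?_ 0 1
  have : Continuous fun p : (ι → ℝ) × ℝ => phs k v p.1 p.2 := by unfold phs; fun_prop
  exact continuous_ee.comp (continuous_coe_circle.comp this)

lemma abs_pow_sub_pow_le_of_mem {u v : ℝ} (hu : u ∈ Set.Icc (0 : ℝ) 1) (hv : v ∈ Set.Icc (0 : ℝ) 1)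
    (n : ℕ) : |u ^ n - v ^ n| ≤ n * |u - v| := by
  induction n with
  | zero => simp
  | succ n ih =>
    have h1 : u ^ (n + 1) - v ^ (n + 1) = u * (u ^ n - v ^ n) + v ^ n * (u - v) := by ring
    have h2 : |v ^ n| ≤ 1 := by
      rw [abs_of_nonneg (pow_nonneg hv.1 _)]; exact pow_le_one₀ hv.1 hv.2
    have h3 : |u| ≤ 1 := by rw [abs_of_nonneg hu.1]; exact hu.2
    rw [h1]
    refine (abs_add_le _ _).trans ?_
    rw [abs_mul, abs_mul]
    push_cast
    nlinarith [abs_nonneg (u ^ n - v ^ n), abs_nonneg (u - v)]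

lemma abs_phs_sub_le (k : ι → ℕ) (v : ι → ℤ) {η : ι → ℝ} {Q : ℝ} (hη : ∀ i, |η i| ≤ Q) {x y : ℝ}
    (hx : x ∈ Set.Icc (0 : ℝ) 1) (hy : y ∈ Set.Icc (0 : ℝ) 1) :
    |phs k v η x - phs k v η y| ≤ (∑ i, |(v i : ℝ)| * k i) * Q * |x - y| := by
  rw [phs, phs, ← sum_sub_distrib, mul_assoc, sum_mul]
  refine (abs_sum_le_sum_abs _ _).trans (sum_le_sum fun i _ => ?_)
  rw [← mul_sub, abs_mul, abs_mul]
  calc _ ≤ |(v i : ℝ)| * Q * (k i * |x - y|) :=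
        mul_le_mul (mul_le_mul_of_nonneg_left (hη i) (abs_nonneg _))
          (abs_pow_sub_pow_le_of_mem hx hy _) (abs_nonneg _)
          (mul_nonneg (abs_nonneg _) ((abs_nonneg _).trans (hη i)))
    _ = _ := by ring

lemma norm_ee_coe_sub_le (x y : ℝ) : ‖ee (x : 𝕋) - ee (y : 𝕋)‖ ≤ 2 * Real.pi * |x - y| := by
  have h : ee (x : 𝕋) - ee (y : 𝕋) = ee (y : 𝕋) * (ee ((x - y : ℝ) : 𝕋) - 1) := by
    rw [mul_sub, ← ee_add, mul_one, ← AddCircle.coe_add]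
    congr 3
    ring
  rw [h, norm_mul, norm_ee, one_mul]
  refine (norm_ee_sub_one_le _).trans (mul_le_mul_of_nonneg_left ?_ (by positivity))
  simpa using norm_coe_le (x - y) 0

theorem dS_approx (k : ι → ℕ) (v : ι → ℤ) : ∃ Λ : ℝ, 0 ≤ Λ ∧ ∀ (P Q : ℕ) (t : ι → 𝕋) (η : ι → ℝ),
    1 ≤ P → 1 ≤ Q → t ∈ torsLE ι Q → (∀ i, |η i| ≤ Q) →
    ‖dS k v P (fun i => t i + ((η i / (P : ℝ) ^ k i : ℝ) : 𝕋)) - P * (Wt k v t * wI k v η)‖ ≤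
      Λ * (Q : ℝ) ^ 2 := by
  obtain ⟨Λ, hΛ⟩ : ∃ Λ, Λ = 2 * Real.pi * ∑ i, |(v i : ℝ)| * k i := ⟨_, rfl⟩
  have hΛ0 : 0 ≤ Λ := by
    rw [hΛ]
    exact mul_nonneg (by positivity) (sum_nonneg fun i _ => by positivity)
  refine ⟨2 + 3 * Λ, by positivity, fun P Q t η hP hQ ht hη => ?_⟩
  rw [mem_torsLE] at ht
  have hP' : (0 : ℝ) < P := by exact_mod_cast hP
  have hQ' : (1 : ℝ) ≤ Q := by exact_mod_cast hQ
  have key := periodic_sum_approx (A := fun x => ee (∑ i, (v i * x ^ k i) • t i)) ht.1 (fun x => by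
      congr 1
      refine sum_congr rfl fun i _ => ?_
      rw [← sub_eq_zero, ← sub_smul, ← mul_sub]
      obtain ⟨w, hw⟩ := sub_dvd_pow_sub_pow (x + (addOrderOf t : ℤ)) x (k i)
      have h0 : addOrderOf t • t i = 0 := congrFun (addOrderOf_nsmul_eq_zero t) i
      rw [hw, add_sub_cancel_left, ← mul_assoc, mul_comm, ← mul_assoc, mul_smul, natCast_zsmul,
        h0, smul_zero])
    (fun x => (norm_ee _).le) (b := fun u => ee ((phs k v η u : ℝ) : 𝕋)) (by fun_prop)
    (fun u => (norm_ee _).le) (L := Λ * Q) (fun x hx y hy => by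
      refine (norm_ee_coe_sub_le _ _).trans ?_
      refine (mul_le_mul_of_nonneg_left (abs_phs_sub_le k v hη hx hy) (by positivity)).trans ?_
      rw [hΛ]
      exact le_of_eq (by ring)) hP
  have e : dS k v P (fun i => t i + ((η i / (P : ℝ) ^ k i : ℝ) : 𝕋)) =
      ∑ x ∈ Ioc (0 : ℤ) P, ee (∑ i, (v i * x ^ k i) • t i) * ee ((phs k v η (x / P) : ℝ) : 𝕋) := by
    unfold dS
    refine sum_congr rfl fun x _ => ?_
    rw [← ee_add]
    congr 1
    simp_rw [smul_add]
    rw [sum_add_distrib]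
    congr 1
    rw [phs]
    refine Eq.trans ?_ (map_sum (QuotientAddGroup.mk' (AddSubgroup.zmultiples (1 : ℝ))) _ _).symm
    refine sum_congr rfl fun i _ => ?_
    rw [← AddCircle.coe_zsmul]
    change _ = ((_ : ℝ) : 𝕋)
    congr 1
    rw [zsmul_eq_mul, div_pow]
    push_cast
    ring
  rw [e]
  refine key.trans ?_
  have hq : (addOrderOf t : ℝ) ≤ Q := by exact_mod_cast ht.2
  have hq0 : (0 : ℝ) ≤ addOrderOf t := Nat.cast_nonneg _
  have hΛQ : 0 ≤ Λ * Q := by positivity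
  nlinarith [mul_le_mul_of_nonneg_right hq (by positivity : 0 ≤ 2 * (1 + Λ * Q)),
    mul_le_mul_of_nonneg_left hQ' hΛQ]

end

lemma norm_prod_sub_prod_le_of_le {s : ℕ} {a b : Fin s → ℂ} {P M : ℝ} (hP : 1 ≤ P) (hM : 0 ≤ M)
    (ha : ∀ j, ‖a j‖ ≤ P) (hb : ∀ j, ‖b j‖ ≤ P) (h : ∀ j, ‖a j - b j‖ ≤ M) :
    ‖∏ j, a j - ∏ j, b j‖ * P ≤ s * M * P ^ s := by
  induction s with
  | zero => simp
  | succ s ih =>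
    rw [Fin.prod_univ_succ, Fin.prod_univ_succ]
    have ih' := ih (fun j => ha j.succ) (fun j => hb j.succ) fun j => h j.succ
    have e : a 0 * ∏ j : Fin s, a j.succ - b 0 * ∏ j : Fin s, b j.succ =
      a 0 * (∏ j : Fin s, a j.succ - ∏ j : Fin s, b j.succ) +
        (a 0 - b 0) * ∏ j : Fin s, b j.succ := by ring
    have hpb : ‖∏ j : Fin s, b j.succ‖ ≤ P ^ s := by
      rw [norm_prod]
      calc _ ≤ ∏ j : Fin s, P := prod_le_prod (fun _ _ => norm_nonneg _) fun j _ => hb _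
        _ = P ^ s := by simp
    have hP0 : 0 ≤ P := by linarith
    calc _ ≤ (‖a 0‖ * ‖∏ j : Fin s, a j.succ - ∏ j : Fin s, b j.succ‖ +
        ‖a 0 - b 0‖ * ‖∏ j : Fin s, b j.succ‖) * P := by
          rw [e, ← norm_mul, ← norm_mul]
          exact mul_le_mul_of_nonneg_right (norm_add_le _ _) hP0
      _ ≤ (P * ‖∏ j : Fin s, a j.succ - ∏ j : Fin s, b j.succ‖ + M * P ^ s) * P := by
          refine mul_le_mul_of_nonneg_right (add_le_add ?_ ?_) hP0
          · exact mul_le_mul_of_nonneg_right (ha 0) (norm_nonneg _)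
          · exact mul_le_mul (h 0) hpb (norm_nonneg _) hM
      _ ≤ _ := by
          push_cast
          rw [pow_succ]
          nlinarith [mul_le_mul_of_nonneg_left ih' hP0]

section

variable {ι : Type*} [Fintype ι] {E : Type*} [NormedAddCommGroup E] [NormedSpace ℝ E]

/-- The coordinatewise covering map. -/
noncomputable def cov (β : ι → ℝ) : ι → 𝕋 := fun i => ((β i : ℝ) : 𝕋)

omit [Fintype ι] in
@[fun_prop] lemma continuous_cov : Continuous (cov : (ι → ℝ) → ι → 𝕋) := by
  unfold cov; fun_prop

/-- The box with the given radii in Euclidean space. -/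
def rbox (δ : ι → ℝ) : Set (ι → ℝ) := {β | ∀ i, |β i| ≤ δ i}

omit [Fintype ι] in
lemma rbox_eq (δ : ι → ℝ) : rbox δ = Set.Icc (fun i => -δ i) δ := by
  ext β
  simp only [rbox, Set.mem_ofPred_eq, Set.mem_Icc, abs_le, Pi.le_def]
  exact forall_and

omit [Fintype ι] in
lemma isCompact_rbox (δ : ι → ℝ) : IsCompact (rbox δ) := by
  rw [rbox_eq]; exact isCompact_Icc

lemma measurableSet_rbox (δ : ι → ℝ) : MeasurableSet (rbox δ) := (isCompact_rbox δ).measurableSet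

lemma measureReal_rbox {Q : ℝ} (hQ : 0 ≤ Q) :
    (volume : Measure (ι → ℝ)).real (rbox fun _ => Q) = (2 * Q) ^ Fintype.card ι := by
  rw [rbox_eq, Measure.real, Real.volume_Icc_pi, ENNReal.toReal_prod]
  simp only [sub_neg_eq_add, prod_const, card_univ]
  rw [ENNReal.toReal_ofReal (by linarith), two_mul]

lemma setIntegral_torus_box {δ : ι → ℝ} (hδ : ∀ i, δ i < 1 / 2) {G : (ι → 𝕋) → E}
    (hG : Continuous G) :
    ∫ b in {b | ∀ i, ‖b i‖ ≤ δ i}, G b = ∫ β in rbox δ, G (cov β) := by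
  have hcl : IsClosed {b : ι → 𝕋 | ∀ i, ‖b i‖ ≤ δ i} := by
    rw [Set.ofPred_forall]
    exact isClosed_iInter fun i => isClosed_le (by fun_prop) continuous_const
  have hB := hcl.measurableSet
  have mp : MeasurePreserving (cov : (ι → ℝ) → ι → 𝕋)
      ((volume : Measure (ι → ℝ)).restrict (Set.univ.pi fun _ => Set.Ioc (-1 / 2 : ℝ) (-1 / 2 + 1)))
      volume := by
    have := measurePreserving_pi (fun _ : ι => (volume : Measure ℝ).restrict
      (Set.Ioc (-1 / 2 : ℝ) (-1 / 2 + 1))) (fun _ : ι => (volume : Measure 𝕋))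
      (fun _ => UnitAddCircle.measurePreserving_mk (-1 / 2))
    rwa [← Measure.restrict_pi_pi] at this
  rw [← integral_indicator hB, ← mp.map_eq, integral_map mp.aemeasurable
    ((hG.stronglyMeasurable.indicator hB).aestronglyMeasurable)]
  have hpre : ∀ β : ι → ℝ, Set.indicator {b : ι → 𝕋 | ∀ i, ‖b i‖ ≤ δ i} G (cov β) =
      (cov ⁻¹' {b : ι → 𝕋 | ∀ i, ‖b i‖ ≤ δ i}).indicator (fun β => G (cov β)) β := fun β => by
    by_cases hb : cov β ∈ {b : ι → 𝕋 | ∀ i, ‖b i‖ ≤ δ i}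
    · rw [Set.indicator_of_mem hb, Set.indicator_of_mem (Set.mem_preimage.2 hb)]
    · rw [Set.indicator_of_notMem hb, Set.indicator_of_notMem (fun h => hb (Set.mem_preimage.1 h))]
  simp_rw [hpre]
  have hB' : MeasurableSet (cov ⁻¹' {b : ι → 𝕋 | ∀ i, ‖b i‖ ≤ δ i}) :=
    (hcl.preimage continuous_cov).measurableSet
  rw [integral_indicator hB', Measure.restrict_restrict hB']
  congr 2
  ext β
  have hn : ∀ i, |β i| ≤ 1 / 2 → ‖cov β i‖ = |β i| := fun i h =>
    (AddCircle.norm_coe_eq_abs_iff (p := (1 : ℝ)) one_ne_zero).2 (by simpa using h)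
  simp only [Set.mem_inter_iff, Set.mem_preimage, Set.mem_ofPred_eq, Set.mem_pi, Set.mem_univ,
    true_imp_iff, Set.mem_Ioc, rbox]
  constructor
  · rintro ⟨h1, h2⟩ i
    rw [← hn i (abs_le.2 ⟨by linarith [(h2 i).1], by linarith [(h2 i).2]⟩)]
    exact h1 i
  · intro h
    have h' : ∀ i, |β i| < 1 / 2 := fun i => (h i).trans_lt (hδ i)
    refine ⟨fun i => by rw [hn i (h' i).le]; exact h i, fun i => ?_⟩
    have := abs_lt.1 (h' i)
    constructor <;> linarith [this.1, this.2]

lemma setIntegral_rbox_scale {D : ι → ℝ} (hD : ∀ i, 0 < D i) (Q : ℝ) (H : (ι → ℝ) → E) :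
    ∫ β in rbox (fun i => Q / D i), H β =
      (∏ i, D i)⁻¹ • ∫ η in rbox (fun _ => Q), H fun i => η i / D i := by
  classical
  have hdet : (Matrix.diagonal fun i => (D i)⁻¹).det ≠ 0 := by
    rw [Matrix.det_diagonal]; exact prod_ne_zero_iff.2 fun i _ => (inv_pos.2 (hD i)).ne'
  have hL := Real.smul_map_diagonal_volume_pi hdet
  have hfun : ⇑(Matrix.toLin' (Matrix.diagonal fun i => (D i)⁻¹)) = fun η i => η i / D i := by
    ext η i
    rw [Matrix.toLin'_apply, Matrix.mulVec_diagonal]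
    field_simp
  rw [hfun, Matrix.det_diagonal, prod_inv_distrib, abs_of_pos (inv_pos.2 (prod_pos fun i _ => hD i))] at hL
  have hemb : MeasurableEmbedding fun (η : ι → ℝ) i => η i / D i := by
    have h := (Homeomorph.piCongrRight fun i => Homeomorph.mulRight₀ (D i)⁻¹
      (inv_pos.2 (hD i)).ne').measurableEmbedding
    convert h using 1
    ext η i
    exact div_eq_mul_inv _ _
  conv_lhs => rw [← integral_indicator (measurableSet_rbox _), ← hL]
  rw [integral_smul_measure, hemb.integral_map,
    ENNReal.toReal_ofReal (inv_pos.2 (prod_pos fun i _ => hD i)).le,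
    ← integral_indicator (measurableSet_rbox _)]
  congr 2
  ext η
  simp only [Set.indicator, rbox, Set.mem_ofPred_eq]
  congr 1
  refine propext (forall_congr' fun i => ?_)
  rw [abs_div, abs_of_pos (hD i), div_le_div_iff_of_pos_right (hD i)]

lemma setIntegral_arc (k : ι → ℕ) {P Q : ℕ} (hP : 0 < P) (hPQ : ∀ i, (Q : ℝ) / (P : ℝ) ^ k i < 1 / 2)
    (t : ι → 𝕋) {G : (ι → 𝕋) → E} (hG : Continuous G) :
    ∫ a in {a | a - t ∈ tbox k P Q}, G a = ((P : ℝ) ^ ∑ i, k i)⁻¹ •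
      ∫ η in rbox (fun _ => (Q : ℝ)), G fun i => t i + ((η i / (P : ℝ) ^ k i : ℝ) : 𝕋) := by
  have hP' : (0 : ℝ) < P := by exact_mod_cast hP
  have h1 : ∫ a in {a | a - t ∈ tbox k P Q}, G a = ∫ b in tbox k P Q, G (b + t) := by
    have hm : MeasurableSet {a | a - t ∈ tbox k P Q} :=
      ((isClosed_tbox k P Q).preimage (by fun_prop : Continuous fun a => a - t)).measurableSet
    rw [← integral_indicator hm, ← integral_indicator (isClosed_tbox k P Q).measurableSet,
      ← integral_add_right_eq_self _ t]
    congr 1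
    ext b
    by_cases hb : b ∈ tbox k P Q
    · rw [Set.indicator_of_mem hb, Set.indicator_of_mem]
      rwa [Set.mem_ofPred_eq, add_sub_cancel_right]
    · rw [Set.indicator_of_notMem hb, Set.indicator_of_notMem]
      rwa [Set.mem_ofPred_eq, add_sub_cancel_right]
  rw [h1, tbox, setIntegral_torus_box hPQ (G := fun b => G (b + t)) (by fun_prop),
    setIntegral_rbox_scale (D := fun i => (P : ℝ) ^ k i) (fun i => by positivity), prod_pow_eq_pow_sum]
  congr 3
  ext η
  congr 1
  ext i
  rw [Pi.add_apply, add_comm]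
  rfl

lemma disjoint_arcs {k : ι → ℕ} (hk : ∀ i, 1 ≤ k i) {P Q : ℕ} (hP : 2 * Q ^ 3 < P) {t t' : ι → 𝕋}
    (ht : t ∈ torsLE ι Q) (ht' : t' ∈ torsLE ι Q) (hne : t ≠ t') :
    Disjoint {a | a - t ∈ tbox k P Q} {a | a - t' ∈ tbox k P Q} := by
  rw [Set.disjoint_left]
  intro a ha ha'
  obtain ⟨i, hi⟩ := Function.ne_iff.1 hne
  rw [mem_torsLE] at ht ht'
  have hP1 : (1 : ℝ) ≤ P := by exact_mod_cast (by omega : 1 ≤ P)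
  have hbd : ∀ b ∈ tbox k P Q, ‖b i‖ ≤ Q / P := fun b hb => (hb i).trans
    (div_le_div_of_nonneg_left (Nat.cast_nonneg _) (by linarith)
      (le_self_pow₀ hP1 (by have := hk i; omega)))
  have h1 : ‖t i - t' i‖ ≤ Q / P + Q / P := by
    have e : t i - t' i = (a - t') i - (a - t) i := by simp
    rw [e]
    exact (norm_sub_le _ _).trans (add_le_add (hbd _ ha') (hbd _ ha))
  set N := addOrderOf t * addOrderOf t' with hN
  have hN0 : 0 < N := Nat.mul_pos ht.1 ht'.1
  have hN1 : N • (t i - t' i) = 0 := by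
    have e1 : addOrderOf t • t i = 0 := congrFun (addOrderOf_nsmul_eq_zero t) i
    have e2 : addOrderOf t' • t' i = 0 := congrFun (addOrderOf_nsmul_eq_zero t') i
    rw [smul_sub, hN, mul_smul, smul_comm, e1, mul_smul, e2, smul_zero, smul_zero, sub_zero]
  have hfin : IsOfFinAddOrder (t i - t' i) := isOfFinAddOrder_iff_nsmul_eq_zero.2 ⟨N, hN0, hN1⟩
  have h2 := AddCircle.le_add_order_smul_norm_of_isOfFinAddOrder hfin (sub_ne_zero.2 hi)
  have h3 : addOrderOf (t i - t' i) ≤ Q ^ 2 := by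
    refine (Nat.le_of_dvd hN0 (addOrderOf_dvd_of_nsmul_eq_zero hN1)).trans ?_
    rw [sq]
    exact Nat.mul_le_mul ht.2 ht'.2
  have h3' : (addOrderOf (t i - t' i) : ℝ) ≤ (Q : ℝ) ^ 2 := by exact_mod_cast h3
  have h4 : (2 * Q ^ 3 : ℝ) < P := by exact_mod_cast hP
  rw [nsmul_eq_mul] at h2
  have h5 : (1 : ℝ) ≤ Q ^ 2 * (Q / P + Q / P) :=
    h2.trans (mul_le_mul h3' h1 (norm_nonneg _) (by positivity))
  have h6 : (Q : ℝ) ^ 2 * (Q / P + Q / P) = 2 * Q ^ 3 / P := by field_simp; ring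
  rw [h6, le_div_iff₀ (by linarith)] at h5
  linarith

theorem norm_setIntegral_majM_sub_le {k : ι → ℕ} (hk : ∀ i, 1 ≤ k i) {P Q : ℕ} (hQ : 1 ≤ Q)
    (hP : 2 * Q ^ 3 < P) {G : (ι → 𝕋) → E} (hG : Continuous G) {M : (ι → 𝕋) → (ι → ℝ) → E}
    (hM : ∀ t, Continuous (M t)) {ε : ℝ}
    (h : ∀ t ∈ torsLE ι Q, ∀ η : ι → ℝ, (∀ i, |η i| ≤ Q) →
      ‖G (fun i => t i + ((η i / (P : ℝ) ^ k i : ℝ) : 𝕋)) - M t η‖ ≤ ε) :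
    ‖(∫ a in majM k P Q, G a) - ((P : ℝ) ^ ∑ i, k i)⁻¹ •
      ∑ t ∈ torsLE ι Q, ∫ η in rbox (fun _ => (Q : ℝ)), M t η‖ ≤
      ((P : ℝ) ^ ∑ i, k i)⁻¹ * ((Q : ℝ) ^ (Fintype.card ι + 1) * (ε * (2 * Q) ^ Fintype.card ι)) := by
  have hP1 : (1 : ℝ) ≤ P := by exact_mod_cast (by omega : 1 ≤ P)
  have hQ1 : (1 : ℝ) ≤ Q := by exact_mod_cast hQ
  have h4 : (2 * Q ^ 3 : ℝ) < P := by exact_mod_cast hP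
  have hPQ : ∀ i, (Q : ℝ) / (P : ℝ) ^ k i < 1 / 2 := fun i => by
    have : (P : ℝ) ≤ (P : ℝ) ^ k i := le_self_pow₀ hP1 (by have := hk i; omega)
    rw [div_lt_iff₀ (by positivity)]
    have : (Q : ℝ) ≤ Q ^ 3 := le_self_pow₀ hQ1 (by norm_num)
    linarith
  have hdis : Set.Pairwise (↑(torsLE ι Q) : Set (ι → 𝕋))
      (Function.onFun Disjoint fun t => {a | a - t ∈ tbox k P Q}) :=
    fun t ht t' ht' hne => disjoint_arcs hk hP ht ht' hne
  have hmeas : ∀ t ∈ torsLE ι Q, MeasurableSet {a | a - t ∈ tbox k P Q} := fun t _ =>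
    ((isClosed_tbox k P Q).preimage (by fun_prop : Continuous fun a => a - t)).measurableSet
  rw [majM, integral_biUnion_finset (s := fun t => {a | a - t ∈ tbox k P Q}) _ hmeas hdis
    (fun t _ => (integrable_cont _ hG).integrableOn)]
  simp_rw [setIntegral_arc k (by omega : 0 < P) hPQ _ hG]
  rw [← smul_sum, ← smul_sub, ← sum_sub_distrib, norm_smul, Real.norm_of_nonneg (by positivity)]
  refine mul_le_mul_of_nonneg_left ?_ (by positivity)
  have hfin : (volume : Measure (ι → ℝ)) (rbox fun _ => (Q : ℝ)) < ⊤ :=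
    (isCompact_rbox _).measure_lt_top
  have hε : 0 ≤ ε := by
    refine (norm_nonneg _).trans (h 0 ?_ 0 (by simp))
    rw [mem_torsLE, addOrderOf_zero]
    exact ⟨one_pos, hQ⟩
  have hcts : ∀ t : ι → 𝕋, Continuous fun η : ι → ℝ =>
      G (fun i => t i + ((η i / (P : ℝ) ^ k i : ℝ) : 𝕋)) := fun t => by fun_prop
  have hterm : ∀ t ∈ torsLE ι Q, ‖(∫ η in rbox (fun _ => (Q : ℝ)),
      G (fun i => t i + ((η i / (P : ℝ) ^ k i : ℝ) : 𝕋))) -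
      ∫ η in rbox (fun _ => (Q : ℝ)), M t η‖ ≤ ε * (2 * Q) ^ Fintype.card ι := by
    intro t ht
    rw [← integral_sub ((hcts t).continuousOn.integrableOn_compact (isCompact_rbox _))
      ((hM t).continuousOn.integrableOn_compact (isCompact_rbox _)),
      ← measureReal_rbox (ι := ι) (Nat.cast_nonneg Q)]
    exact norm_setIntegral_le_of_norm_le_const hfin fun η hη => h t ht η hη
  refine (norm_sum_le _ _).trans ((sum_le_sum hterm).trans ?_)
  rw [sum_const, nsmul_eq_mul]
  refine mul_le_mul_of_nonneg_right ?_ (by positivity)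
  exact_mod_cast card_torsLE_le Q

end

section

variable {ι : Type*} [Fintype ι] {s : ℕ}

/-- The truncated singular series. -/
noncomputable def serQ (k : ι → ℕ) (e : Fin s → ι → ℤ) (Q : ℕ) : ℂ :=
  ∑ t ∈ torsLE ι Q, ∏ j, Wt k (e j) t

/-- The truncated singular integral. -/
noncomputable def sintQ (k : ι → ℕ) (e : Fin s → ι → ℤ) (Q : ℕ) : ℂ :=
  ∫ η in rbox (fun _ => (Q : ℝ)), ∏ j, wI k (e j) η

/-- The truncated absolute singular series. -/
noncomputable def aserQ (k : ι → ℕ) (e : Fin s → ι → ℤ) (Q : ℕ) : ℝ :=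
  ∑ t ∈ torsLE ι Q, ∏ j, ‖Wt k (e j) t‖

/-- The truncated absolute singular integral. -/
noncomputable def asintQ (k : ι → ℕ) (e : Fin s → ι → ℤ) (Q : ℕ) : ℝ :=
  ∫ η in rbox (fun _ => (Q : ℝ)), ∏ j, ‖wI k (e j) η‖

theorem majM_main {k : ι → ℕ} (hk : ∀ i, 1 ≤ k i) (e : Fin s → ι → ℤ) :
    ∃ C : ℝ, 0 ≤ C ∧ ∃ B : ℕ, ∀ P Q : ℕ, 1 ≤ Q → 2 * Q ^ 3 < P →
      ‖(∫ a in majM k P Q, ∏ j, dS k (e j) P a) -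
        (((P : ℝ) ^ s * ((P : ℝ) ^ ∑ i, k i)⁻¹ : ℝ) : ℂ) * (serQ k e Q * sintQ k e Q)‖ ≤
        (P : ℝ) ^ s * ((P : ℝ) ^ ∑ i, k i)⁻¹ * (C * (Q : ℝ) ^ B / P) ∧
      |(∫ a in majM k P Q, ∏ j, ‖dS k (e j) P a‖) -
        (P : ℝ) ^ s * ((P : ℝ) ^ ∑ i, k i)⁻¹ * (aserQ k e Q * asintQ k e Q)| ≤
        (P : ℝ) ^ s * ((P : ℝ) ^ ∑ i, k i)⁻¹ * (C * (Q : ℝ) ^ B / P) := by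
  choose Λ hΛ0 hΛ using fun j => dS_approx k (e j)
  set L := ∑ j, Λ j with hL
  have hL0 : 0 ≤ L := sum_nonneg fun j _ => hΛ0 j
  refine ⟨s * L * 2 ^ Fintype.card ι, by positivity, 2 * Fintype.card ι + 3, fun P Q hQ hP => ?_⟩
  have hP1' : 1 ≤ P := by omega
  have hP1 : (1 : ℝ) ≤ P := by exact_mod_cast hP1'
  have hP0 : (0 : ℝ) < P := by linarith
  obtain ⟨ε, hε⟩ : ∃ ε : ℝ, ε = s * (L * (Q : ℝ) ^ 2) * (P : ℝ) ^ s / P := ⟨_, rfl⟩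
  have key : ∀ t ∈ torsLE ι Q, ∀ η : ι → ℝ, (∀ i, |η i| ≤ Q) →
      ‖∏ j, dS k (e j) P (fun i => t i + ((η i / (P : ℝ) ^ k i : ℝ) : 𝕋)) -
        ∏ j, ((P : ℂ) * (Wt k (e j) t * wI k (e j) η))‖ ≤ ε := by
    intro t ht η hη
    rw [hε, le_div_iff₀ hP0]
    refine norm_prod_sub_prod_le_of_le hP1 (by positivity) (fun j => norm_dS_le _ _ _ _)
      (fun j => ?_) (fun j => (hΛ j P Q t η hP1' hQ ht hη).trans ?_)
    · rw [norm_mul, norm_mul, Complex.norm_natCast]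
      have := mul_le_one₀ (norm_Wt_le k (e j) t) (norm_nonneg _) (norm_wI_le k (e j) η)
      nlinarith
    · exact mul_le_mul_of_nonneg_right (single_le_sum (fun j _ => hΛ0 j) (mem_univ j)) (by positivity)
  have herr : ((P : ℝ) ^ ∑ i, k i)⁻¹ *
      ((Q : ℝ) ^ (Fintype.card ι + 1) * (ε * (2 * Q) ^ Fintype.card ι)) =
      (P : ℝ) ^ s * ((P : ℝ) ^ ∑ i, k i)⁻¹ *
        (s * L * 2 ^ Fintype.card ι * (Q : ℝ) ^ (2 * Fintype.card ι + 3) / P) := by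
    rw [hε, mul_pow]; ring
  constructor
  · have := norm_setIntegral_majM_sub_le hk hQ hP (G := fun a => ∏ j, dS k (e j) P a)
      (by fun_prop) (M := fun t η => ∏ j, ((P : ℂ) * (Wt k (e j) t * wI k (e j) η)))
      (fun t => by fun_prop) key
    rw [herr] at this
    refine (congrArg (fun z : ℂ => ‖_ - z‖) ?_).trans_le this
    have h1 : ∀ (t : ι → 𝕋) (η : ι → ℝ), ∏ j, ((P : ℂ) * (Wt k (e j) t * wI k (e j) η)) =
        (P : ℂ) ^ s * ((∏ j, Wt k (e j) t) * ∏ j, wI k (e j) η) := fun t η => by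
      rw [prod_mul_distrib, prod_mul_distrib, prod_const, card_univ, Fintype.card_fin]
    have h2 : ∀ t : ι → 𝕋, ∫ η in rbox (fun _ => (Q : ℝ)),
        ∏ j, ((P : ℂ) * (Wt k (e j) t * wI k (e j) η)) =
        (P : ℂ) ^ s * ((∏ j, Wt k (e j) t) * sintQ k e Q) := fun t => by
      simp_rw [h1]
      rw [integral_const_mul, integral_const_mul, sintQ]
    rw [sum_congr rfl fun t _ => h2 t, serQ, sum_mul, ← mul_sum, Complex.real_smul]
    push_cast
    ring
  · have := norm_setIntegral_majM_sub_le hk hQ hP (G := fun a => ∏ j, ‖dS k (e j) P a‖)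
      (by fun_prop) (M := fun t η => ∏ j, ‖((P : ℂ) * (Wt k (e j) t * wI k (e j) η))‖)
      (fun t => by fun_prop) (ε := ε) (fun t ht η hη => by
        rw [← norm_prod, ← norm_prod]
        exact (abs_norm_sub_norm_le _ _).trans (key t ht η hη))
    rw [herr, Real.norm_eq_abs] at this
    refine (congrArg (fun z : ℝ => |_ - z|) ?_).trans_le this
    have h1 : ∀ (t : ι → 𝕋) (η : ι → ℝ), ∏ j, ‖(P : ℂ) * (Wt k (e j) t * wI k (e j) η)‖ =
        (P : ℝ) ^ s * ((∏ j, ‖Wt k (e j) t‖) * ∏ j, ‖wI k (e j) η‖) := fun t η => by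
      simp_rw [norm_mul]
      rw [prod_mul_distrib, prod_mul_distrib, prod_const, card_univ, Fintype.card_fin,
        Complex.norm_natCast]
    have h2 : ∀ t : ι → 𝕋, ∫ η in rbox (fun _ => (Q : ℝ)),
        ∏ j, ‖(P : ℂ) * (Wt k (e j) t * wI k (e j) η)‖ =
        (P : ℝ) ^ s * ((∏ j, ‖Wt k (e j) t‖) * asintQ k e Q) := fun t => by
      simp_rw [h1]
      rw [integral_const_mul, integral_const_mul, asintQ]
    rw [sum_congr rfl fun t _ => h2 t, aserQ, sum_mul, ← mul_sum, smul_eq_mul]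
    ring

end

section

variable {ι : Type*} [Fintype ι] {s : ℕ}

omit [Fintype ι] in
lemma rbox_mono {Q Q' : ℝ} (h : Q ≤ Q') : rbox (fun _ : ι => Q) ⊆ rbox fun _ => Q' :=
  fun _ hη i => (hη i).trans h

lemma aserQ_mono (k : ι → ℕ) (e : Fin s → ι → ℤ) : Monotone (aserQ k e) := fun _ _ h =>
  sum_le_sum_of_subset_of_nonneg (torsLE_mono h) fun _ _ _ => prod_nonneg fun _ _ => norm_nonneg _

lemma integrableOn_rbox {E : Type*} [NormedAddCommGroup E] {f : (ι → ℝ) → E} (hf : Continuous f)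
    (δ : ι → ℝ) : IntegrableOn f (rbox δ) :=
  hf.continuousOn.integrableOn_compact (isCompact_rbox δ)

lemma asintQ_mono (k : ι → ℕ) (e : Fin s → ι → ℤ) : Monotone (asintQ k e) := fun Q Q' h =>
  setIntegral_mono_set (integrableOn_rbox (by fun_prop) _)
    (Filter.Eventually.of_forall fun _ => prod_nonneg fun _ _ => norm_nonneg _)
    (rbox_mono (by exact_mod_cast h : (Q : ℝ) ≤ Q')).eventuallyLE

lemma aserQ_nonneg (k : ι → ℕ) (e : Fin s → ι → ℤ) (Q : ℕ) : 0 ≤ aserQ k e Q :=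
  sum_nonneg fun _ _ => prod_nonneg fun _ _ => norm_nonneg _

lemma asintQ_nonneg (k : ι → ℕ) (e : Fin s → ι → ℤ) (Q : ℕ) : 0 ≤ asintQ k e Q :=
  integral_nonneg fun _ => prod_nonneg fun _ _ => norm_nonneg _

lemma Wt_zero (k : ι → ℕ) (v : ι → ℤ) : Wt k v 0 = 1 := by
  simp [Wt, dS, ee_zero]

lemma wI_zero (k : ι → ℕ) (v : ι → ℤ) : wI k v 0 = 1 := by
  simp [wI, phs, ee_zero]

lemma one_le_aserQ (k : ι → ℕ) (e : Fin s → ι → ℤ) : 1 ≤ aserQ k e 1 := by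
  have h0 : (0 : ι → 𝕋) ∈ torsLE ι 1 := by rw [mem_torsLE, addOrderOf_zero]; simp
  refine le_trans ?_ (single_le_sum (f := fun t => ∏ j, ‖Wt k (e j) t‖)
    (fun t _ => prod_nonneg fun _ _ => norm_nonneg _) h0)
  simp [Wt_zero]

lemma asintQ_one_pos (k : ι → ℕ) (e : Fin s → ι → ℤ) : 0 < asintQ k e 1 := by
  have hcont : Continuous fun η : ι → ℝ => ∏ j, ‖wI k (e j) η‖ := by fun_prop
  have hnn : ∀ η : ι → ℝ, 0 ≤ ∏ j, ‖wI k (e j) η‖ := fun η => prod_nonneg fun _ _ => norm_nonneg _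
  rw [asintQ, setIntegral_pos_iff_support_of_nonneg_ae (Filter.Eventually.of_forall hnn)
    (integrableOn_rbox hcont _)]
  have hopen : IsOpen ((Function.support fun η : ι → ℝ => ∏ j, ‖wI k (e j) η‖) ∩
      Metric.ball 0 1) := hcont.isOpen_support.inter Metric.isOpen_ball
  refine (hopen.measure_pos volume ⟨0, ?_, by simp⟩).trans_le (measure_mono ?_)
  · simp [wI_zero]
  · rintro η ⟨h1, h2⟩
    refine ⟨h1, fun i => ?_⟩
    rw [mem_ball_zero_iff] at h2
    simpa using (norm_le_pi_norm η i).trans h2.le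

/-- Power-saving bound for the mean value over the minor arcs. -/
def MinorBound (k : ι → ℕ) (e : Fin s → ι → ℤ) : Prop :=
  ∀ A : ℕ, 1 ≤ A → ∃ κ : ℝ, 0 < κ ∧ ∃ C : ℝ, ∀ᶠ P : ℕ in Filter.atTop, ∀ Q : ℕ, P ≤ Q ^ A →
    ∫ a in (majM k P Q)ᶜ, ∏ j, ‖dS k (e j) P a‖ ≤
      (P : ℝ) ^ s * ((P : ℝ) ^ ∑ i, k i)⁻¹ * (C * (P : ℝ) ^ (-κ))

lemma exists_dyadic_increment {k : ι → ℕ} (hk : ∀ i, 1 ≤ k i) {e : Fin s → ι → ℤ}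
    (hmin : MinorBound k e) : ∃ κ : ℝ, 0 < κ ∧ ∃ C : ℝ, 0 ≤ C ∧ ∀ᶠ n : ℕ in Filter.atTop,
      aserQ k e (2 * n) * asintQ k e (2 * n) ≤ aserQ k e n * asintQ k e n + C * (n : ℝ) ^ (-κ) := by
  obtain ⟨C, hC0, B, hC⟩ := majM_main hk e
  obtain ⟨κ, hκ, C', hC'⟩ := hmin (B + 5) (by omega)
  refine ⟨min 1 κ, by positivity, C * 2 ^ B + C + |C'|, by positivity, ?_⟩
  have hpow : Filter.Tendsto (fun n : ℕ => n ^ (B + 5)) Filter.atTop Filter.atTop :=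
    Filter.tendsto_pow_atTop (by omega)
  filter_upwards [hpow.eventually hC', Filter.eventually_ge_atTop 17] with n hn hn17
  obtain ⟨P, hP⟩ : ∃ P, P = n ^ (B + 5) := ⟨_, rfl⟩
  rw [← hP] at hn
  have h1 := hn n hP.le
  have hn1 : (1 : ℝ) ≤ n := by exact_mod_cast (by omega : 1 ≤ n)
  have hn0 : (0 : ℝ) < n := by linarith
  have hPR : (P : ℝ) = (n : ℝ) ^ (B + 5) := by rw [hP]; push_cast; rfl
  have hP0 : (0 : ℝ) < P := by rw [hPR]; positivity
  have hPbig : 16 * n ^ 3 < P := by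
    have h2 : n ^ 4 ≤ P := by rw [hP]; exact Nat.pow_le_pow_right (by omega) (by omega)
    have h3 : 16 * n ^ 3 < n * n ^ 3 := Nat.mul_lt_mul_of_pos_right (by omega) (by positivity)
    calc _ < n * n ^ 3 := h3
      _ = n ^ 4 := by ring
      _ ≤ P := h2
  have hA := (hC P n (by omega) (by omega)).2
  have hB := (hC P (2 * n) (by omega) (by rw [mul_pow]; omega)).2
  obtain ⟨R, hR⟩ : ∃ R : ℝ, R = (P : ℝ) ^ s * ((P : ℝ) ^ ∑ i, k i)⁻¹ := ⟨_, rfl⟩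
  have hR0 : 0 < R := by rw [hR]; positivity
  rw [← hR] at hA hB h1
  have hint : Integrable (fun a : ι → 𝕋 => ∏ j, ‖dS k (e j) P a‖) := integrable_cont _ (by fun_prop)
  have hnn : ∀ a : ι → 𝕋, 0 ≤ ∏ j, ‖dS k (e j) P a‖ := fun η => prod_nonneg fun _ _ => norm_nonneg _
  have hsplit := integral_add_compl (isClosed_majM k P n).measurableSet hint
  have hle := setIntegral_le_integral (s := majM k P (2 * n)) hint (Filter.Eventually.of_forall hnn)
  have hA' := (abs_le.1 hA).2
  have hB' := (abs_le.1 hB).1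
  have hmain : R * (aserQ k e (2 * n) * asintQ k e (2 * n)) ≤ R * (aserQ k e n * asintQ k e n +
      (C * ((2 * n : ℕ) : ℝ) ^ B / P + C * (n : ℝ) ^ B / P + C' * (P : ℝ) ^ (-κ))) := by
    linarith
  refine (le_of_mul_le_mul_left hmain hR0).trans (add_le_add le_rfl ?_)
  have hq : (n : ℝ) ^ B / P ≤ (n : ℝ) ^ (-min 1 κ) := by
    have : (n : ℝ) ^ B / P = (n : ℝ) ^ (-5 : ℝ) := by
      rw [hPR, pow_add, Real.rpow_neg hn0.le, show (5 : ℝ) = ((5 : ℕ) : ℝ) by norm_num,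
        Real.rpow_natCast]
      field_simp
    rw [this]
    exact Real.rpow_le_rpow_of_exponent_le hn1 (by linarith [min_le_left 1 κ])
  have hq' : (P : ℝ) ^ (-κ) ≤ (n : ℝ) ^ (-min 1 κ) := by
    rw [hPR, ← Real.rpow_natCast, ← Real.rpow_mul hn0.le]
    refine Real.rpow_le_rpow_of_exponent_le hn1 ?_
    push_cast
    nlinarith [min_le_right 1 κ, (Nat.cast_nonneg B : (0 : ℝ) ≤ B)]
  have hx := mul_le_mul_of_nonneg_left hq hC0
  have hx2 := mul_le_mul_of_nonneg_left hq (by positivity : 0 ≤ C * 2 ^ B)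
  have hx3 : C' * (P : ℝ) ^ (-κ) ≤ |C'| * (n : ℝ) ^ (-min 1 κ) :=
    (mul_le_mul_of_nonneg_right (le_abs_self _) (by positivity)).trans
      (mul_le_mul_of_nonneg_left hq' (abs_nonneg _))
  have e1 : C * ((2 * n : ℕ) : ℝ) ^ B / P = C * 2 ^ B * ((n : ℝ) ^ B / P) := by
    push_cast; rw [mul_pow]; ring
  have e2 : C * (n : ℝ) ^ B / P = C * ((n : ℝ) ^ B / P) := by ring
  rw [e1, e2]
  linarith

lemma exists_bound_aserQ_mul_asintQ {k : ι → ℕ} (hk : ∀ i, 1 ≤ k i) {e : Fin s → ι → ℤ}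
    (hmin : MinorBound k e) : ∃ H : ℝ, ∀ Q, aserQ k e Q * asintQ k e Q ≤ H := by
  obtain ⟨κ, hκ, C, hC, hev⟩ := exists_dyadic_increment hk hmin
  have hev2 := (tendsto_pow_atTop_atTop_of_one_lt one_lt_two).eventually hev
  obtain ⟨m, hm⟩ := Filter.eventually_atTop.1 hev2
  obtain ⟨ρ, hρ⟩ : ∃ ρ : ℝ, ρ = (2 : ℝ) ^ (-κ) := ⟨_, rfl⟩
  have hρ0 : 0 < ρ := by rw [hρ]; positivity
  have hρ1 : ρ < 1 := by rw [hρ]; exact Real.rpow_lt_one_of_one_lt_of_neg one_lt_two (by linarith)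
  have hρ1' : 0 < 1 - ρ := by linarith
  have hpw : ∀ i : ℕ, (((2 ^ i : ℕ) : ℝ)) ^ (-κ) = ρ ^ i := fun i => by
    rw [hρ, ← Real.rpow_natCast (2 ^ (-κ)), ← Real.rpow_mul (by norm_num)]
    push_cast
    rw [← Real.rpow_natCast, ← Real.rpow_mul (by norm_num), mul_comm]
  obtain ⟨H, hH⟩ : ∃ H, H = aserQ k e (2 ^ m) * asintQ k e (2 ^ m) + C * ρ ^ m / (1 - ρ) := ⟨_, rfl⟩
  have hind : ∀ i, aserQ k e (2 ^ (m + i)) * asintQ k e (2 ^ (m + i)) +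
      C * ρ ^ (m + i) / (1 - ρ) ≤ H := by
    intro i
    induction i with
    | zero => exact hH.ge
    | succ i ih =>
      have h1 := hm (m + i) (by omega)
      rw [hpw, ← pow_succ'] at h1
      have h2 : C * ρ ^ (m + i) / (1 - ρ) = C * ρ ^ (m + i) + C * ρ ^ (m + i + 1) / (1 - ρ) := by
        field_simp; ring
      rw [← add_assoc]
      linarith
  refine ⟨H, fun Q => ?_⟩
  have hQ : Q ≤ 2 ^ (m + Q) := Nat.lt_two_pow_self.le.trans (Nat.pow_le_pow_right (by norm_num) (by omega))
  have h3 : 0 ≤ C * ρ ^ (m + Q) / (1 - ρ) := by positivity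
  have h4 := mul_le_mul (aserQ_mono k e hQ) (asintQ_mono k e hQ) (asintQ_nonneg k e _)
    (aserQ_nonneg k e _)
  linarith [hind Q]

lemma summable_prod_Wt (hs : 0 < s) {k : ι → ℕ} (hk : ∀ i, 1 ≤ k i) {e : Fin s → ι → ℤ}
    (hmin : MinorBound k e) : Summable fun t : ι → 𝕋 => ∏ j, ‖Wt k (e j) t‖ := by
  obtain ⟨H, hH⟩ := exists_bound_aserQ_mul_asintQ hk hmin
  refine summable_of_sum_le (c := H / asintQ k e 1) (fun t => prod_nonneg fun _ _ => norm_nonneg _)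
    fun u => ?_
  obtain ⟨Q, hQ⟩ : ∃ Q, Q = ∑ t ∈ u, addOrderOf t + 1 := ⟨_, rfl⟩
  have h1 : ∑ t ∈ u, ∏ j, ‖Wt k (e j) t‖ ≤ aserQ k e Q := by
    classical
    rw [← sum_filter_add_sum_filter_not u (fun t => 0 < addOrderOf t)]
    rw [sum_eq_zero (s := u.filter fun t => ¬ 0 < addOrderOf t), add_zero]
    · refine sum_le_sum_of_subset_of_nonneg (fun t ht => ?_)
        fun _ _ _ => prod_nonneg fun _ _ => norm_nonneg _
      rw [mem_filter] at ht
      rw [mem_torsLE]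
      have := single_le_sum (f := fun t : ι → 𝕋 => addOrderOf t) (fun _ _ => Nat.zero_le _) ht.1
      exact ⟨ht.2, by omega⟩
    · intro t ht
      have h0 : addOrderOf t = 0 := by have := (mem_filter.1 ht).2; omega
      refine prod_eq_zero (mem_univ ⟨0, hs⟩) ?_
      simp [Wt, h0]
  rw [le_div_iff₀ (asintQ_one_pos k e)]
  exact (mul_le_mul h1 (asintQ_mono k e (by omega)) (asintQ_nonneg k e _)
    (aserQ_nonneg k e _)).trans (hH Q)

lemma aecover_rbox : AECover (volume : Measure (ι → ℝ)) Filter.atTop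
    fun n : ℕ => rbox fun _ => (n : ℝ) where
  ae_eventually_mem := by
    refine Filter.Eventually.of_forall fun η => ?_
    obtain ⟨n, hn⟩ := exists_nat_ge ‖η‖
    filter_upwards [Filter.eventually_ge_atTop n] with m hm i
    exact (norm_le_pi_norm η i).trans (hn.trans (Nat.cast_le.2 hm))
  measurableSet n := measurableSet_rbox _

lemma integrable_prod_wI {k : ι → ℕ} (hk : ∀ i, 1 ≤ k i) {e : Fin s → ι → ℤ}
    (hmin : MinorBound k e) : Integrable fun η : ι → ℝ => ∏ j, wI k (e j) η := by
  obtain ⟨H, hH⟩ := exists_bound_aserQ_mul_asintQ hk hmin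
  refine aecover_rbox.integrable_of_integral_norm_bounded H
    (fun n => integrableOn_rbox (by fun_prop) _) ?_
  filter_upwards [Filter.eventually_ge_atTop 1] with n hn
  simp_rw [norm_prod]
  refine le_trans ?_ (hH n)
  exact le_mul_of_one_le_left (asintQ_nonneg k e n) ((one_le_aserQ k e).trans (aserQ_mono k e hn))

end

end CQ

namespace CQ
open MeasureTheory Filter

lemma HasSum.tendsto_of_exhaust {α β : Type*} [AddCommMonoid β] [TopologicalSpace β] {f : α → β}
    {b : β} (hf : HasSum f b) {T : ℕ → Finset α} (hT : ∀ x, f x ≠ 0 → ∀ᶠ n in atTop, x ∈ T n) :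
    Tendsto (fun n => ∑ x ∈ T n, f x) atTop (nhds b) := by
  classical
  refine tendsto_def.2 fun V hV => ?_
  obtain ⟨u, hu⟩ := mem_atTop_sets.1 (tendsto_def.1 hf V hV)
  have hev : ∀ᶠ n in atTop, ∀ x ∈ u, f x ≠ 0 → x ∈ T n :=
    (eventually_all_finset u).2 fun x _ => by
      by_cases h : f x = 0
      · simp [h]
      · simpa [h] using hT x h
  filter_upwards [hev] with n hn
  have h1 : ∑ x ∈ T n, f x = ∑ x ∈ T n ∪ u, f x :=
    sum_subset subset_union_left fun x hx hx' => by
      by_contra h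
      exact hx' (hn x ((mem_union.1 hx).resolve_left hx') h)
  rw [Set.mem_preimage, h1]
  exact hu _ subset_union_right

section

variable {ι : Type*} [Fintype ι] {s : ℕ}

lemma summable_Wt (hs : 0 < s) {k : ι → ℕ} (hk : ∀ i, 1 ≤ k i) {e : Fin s → ι → ℤ}
    (hmin : MinorBound k e) : Summable fun t : ι → 𝕋 => ∏ j, Wt k (e j) t := by
  refine Summable.of_norm ?_
  simpa only [norm_prod] using summable_prod_Wt hs hk hmin

lemma tendsto_serQ (hs : 0 < s) {k : ι → ℕ} (hk : ∀ i, 1 ≤ k i) {e : Fin s → ι → ℤ}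
    (hmin : MinorBound k e) :
    Tendsto (serQ k e) atTop (nhds (∑' t : ι → 𝕋, ∏ j, Wt k (e j) t)) := by
  refine HasSum.tendsto_of_exhaust (summable_Wt hs hk hmin).hasSum fun t ht => ?_
  have h0 : 0 < addOrderOf t := by
    by_contra h
    exact ht (prod_eq_zero (mem_univ ⟨0, hs⟩) (by simp [Wt, Nat.eq_zero_of_not_pos h]))
  filter_upwards [eventually_ge_atTop (addOrderOf t)] with n hn
  exact mem_torsLE.2 ⟨h0, hn⟩

lemma tendsto_sintQ {k : ι → ℕ} (hk : ∀ i, 1 ≤ k i) {e : Fin s → ι → ℤ}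
    (hmin : MinorBound k e) :
    Tendsto (sintQ k e) atTop (nhds (∫ η : ι → ℝ, ∏ j, wI k (e j) η)) :=
  aecover_rbox.integral_tendsto_of_countably_generated (integrable_prod_wI hk hmin)

theorem tendsto_integral_dS (hs : 0 < s) {k : ι → ℕ} (hk : ∀ i, 1 ≤ k i) {e : Fin s → ι → ℤ}
    (hmin : MinorBound k e) :
    Tendsto (fun P : ℕ => (∫ a : ι → 𝕋, ∏ j, dS k (e j) P a) /
      (((P : ℝ) ^ s * ((P : ℝ) ^ ∑ i, k i)⁻¹ : ℝ) : ℂ)) atTop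
      (nhds ((∑' t : ι → 𝕋, ∏ j, Wt k (e j) t) * ∫ η : ι → ℝ, ∏ j, wI k (e j) η)) := by
  obtain ⟨C, hC0, B, hC⟩ := majM_main hk e
  obtain ⟨κ, hκ, C', hC'⟩ := hmin (B + 5) (by omega)
  obtain ⟨x, hx⟩ : ∃ x : ℕ → ℝ, x = fun P : ℕ => (P : ℝ) ^ (((B + 5 : ℕ) : ℝ)⁻¹) := ⟨_, rfl⟩
  have hxt : Tendsto x atTop atTop := by
    rw [hx]
    exact (tendsto_rpow_atTop (by positivity)).comp tendsto_natCast_atTop_atTop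
  have hxpow : ∀ P : ℕ, x P ^ (B + 5) = P := fun P => by
    rw [hx]
    exact Real.rpow_inv_natCast_pow (Nat.cast_nonneg P) (by omega)
  have hnt : Tendsto (fun P => ⌈x P⌉₊) atTop atTop := tendsto_nat_ceil_atTop.comp hxt
  have hmain := ((tendsto_serQ hs hk hmin).mul (tendsto_sintQ hk hmin)).comp hnt
  refine tendsto_of_tendsto_of_dist hmain ?_
  have hz : Tendsto (fun P : ℕ => C * (2 ^ B * (x P)⁻¹) + |C'| * (P : ℝ) ^ (-κ)) atTop (nhds 0) := by
    have h1 := (tendsto_inv_atTop_zero.comp hxt).const_mul (2 ^ B) |>.const_mul C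
    have h2 := ((tendsto_rpow_neg_atTop hκ).comp tendsto_natCast_atTop_atTop).const_mul |C'|
    simpa using h1.add h2
  refine squeeze_zero' (Eventually.of_forall fun _ => dist_nonneg) ?_ hz
  filter_upwards [hC', hxt.eventually_ge_atTop 17] with P hmP hx17
  obtain ⟨n, hn⟩ : ∃ n, n = ⌈x P⌉₊ := ⟨_, rfl⟩
  have hxn : x P ≤ n := by rw [hn]; exact Nat.le_ceil _
  have hnx : (n : ℝ) ≤ 2 * x P := by
    have := Nat.ceil_lt_add_one (a := x P) (by linarith)
    rw [hn]; linarith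
  have hPn : P ≤ n ^ (B + 5) := by
    have : (P : ℝ) ≤ (n : ℝ) ^ (B + 5) := by rw [← hxpow P]; gcongr
    exact_mod_cast this
  have hn1 : 1 ≤ n := by
    have : (0 : ℝ) < n := by linarith
    exact_mod_cast this
  have hP0 : (0 : ℝ) < P := by rw [← hxpow P]; positivity
  have hPbig : 2 * n ^ 3 < P := by
    have h1 : (2 * (n : ℝ) ^ 3) < P := by
      rw [← hxpow P]
      calc 2 * (n : ℝ) ^ 3 ≤ 2 * (2 * x P) ^ 3 := by gcongr
        _ = 16 * x P ^ 3 := by ring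
        _ < x P * x P ^ 3 := by gcongr; linarith
        _ = x P ^ 4 := by ring
        _ ≤ x P ^ (B + 5) := pow_le_pow_right₀ (by linarith) (by omega)
    exact_mod_cast h1
  have hA := (hC P n hn1 hPbig).1
  have hm := hmP n hPn
  obtain ⟨R, hR⟩ : ∃ R : ℝ, R = (P : ℝ) ^ s * ((P : ℝ) ^ ∑ i, k i)⁻¹ := ⟨_, rfl⟩
  have hR0 : 0 < R := by rw [hR]; positivity
  have hRc : (R : ℂ) ≠ 0 := by exact_mod_cast hR0.ne'
  rw [← hR] at hA hm ⊢
  have hint : Integrable (fun a : ι → 𝕋 => ∏ j, dS k (e j) P a) := integrable_cont _ (by fun_prop)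
  have hsplit := integral_add_compl (isClosed_majM k P n).measurableSet hint
  have hcompl : ‖∫ a in (majM k P n)ᶜ, ∏ j, dS k (e j) P a‖ ≤ R * (C' * (P : ℝ) ^ (-κ)) := by
    refine (norm_integral_le_integral_norm _).trans ?_
    simpa only [norm_prod] using hm
  rw [Function.comp_apply, ← hn, dist_comm, dist_eq_norm, div_sub' hRc, norm_div,
    Complex.norm_real, Real.norm_of_nonneg hR0.le, div_le_iff₀ hR0, ← hsplit, add_sub_right_comm]
  refine (norm_add_le _ _).trans ((add_le_add hA hcompl).trans ?_)
  have h5 : (n : ℝ) ^ B / P ≤ 2 ^ B * (x P)⁻¹ := by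
    rw [div_le_iff₀ hP0]
    calc (n : ℝ) ^ B ≤ (2 * x P) ^ B := by gcongr
      _ = 2 ^ B * (x P)⁻¹ * x P ^ (B + 1) := by
        have : x P ≠ 0 := by linarith
        rw [mul_pow, pow_succ (x P)]; field_simp
      _ ≤ 2 ^ B * (x P)⁻¹ * P := by
        rw [← hxpow P]
        gcongr
        · linarith
        · omega
  have h6 : C' * (P : ℝ) ^ (-κ) ≤ |C'| * (P : ℝ) ^ (-κ) :=
    mul_le_mul_of_nonneg_right (le_abs_self _) (by positivity)
  have h7 := mul_le_mul_of_nonneg_left h5 hC0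
  rw [← mul_add, mul_comm _ R]
  refine mul_le_mul_of_nonneg_left ?_ hR0.le
  rw [mul_div_assoc]
  linarith

end

end CQ

namespace CQ
open MeasureTheory

section

variable {ι : Type*} [Fintype ι] {s : ℕ}

lemma prod_dS_eq (k : ι → ℕ) (e : Fin s → ι → ℤ) (P : ℕ) (a : ι → 𝕋) :
    ∏ j, dS k (e j) P a = ∑ x ∈ Fintype.piFinset fun _ : Fin s => Ioc (0 : ℤ) P,
      ∏ i, ee ((∑ j, e j i * x j ^ k i) • a i) := by
  classical
  unfold dS
  rw [prod_univ_sum]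
  refine sum_congr rfl fun x _ => ?_
  rw [← ee_sum, ← ee_sum, sum_comm]
  congr 1
  exact sum_congr rfl fun i _ => (sum_smul ..).symm

theorem integral_prod_dS (k : ι → ℕ) (e : Fin s → ι → ℤ) (P : ℕ) :
    ∫ a : ι → 𝕋, ∏ j, dS k (e j) P a = #{x ∈ Fintype.piFinset fun _ : Fin s => Ioc (0 : ℤ) P |
      ∀ i, ∑ j, e j i * x j ^ k i = 0} := by
  classical
  simp_rw [prod_dS_eq]
  rw [integral_finsetSum _ fun x _ => integrable_cont _ (by fun_prop), card_filter, Nat.cast_sum]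
  refine sum_congr rfl fun x _ => ?_
  rw [volume_pi, integral_fintype_prod_eq_prod (fun i (u : 𝕋) => ee ((∑ j, e j i * x j ^ k i) • u))]
  split_ifs with h
  · rw [Nat.cast_one]
    exact prod_eq_one fun i _ => by simp [h i]
  · obtain ⟨i, hi⟩ := not_forall.1 h
    rw [Nat.cast_zero]
    exact prod_eq_zero (mem_univ i) (integral_ee_zsmul hi)

lemma dS_add_period {q : ℕ} (k : ι → ℕ) (v : ι → ℤ) {t : ι → 𝕋} (ht : q • t = 0) (x : ℤ) :
    ee (∑ i, (v i * (x + q) ^ k i) • t i) = ee (∑ i, (v i * x ^ k i) • t i) := by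
  congr 1
  refine sum_congr rfl fun i _ => ?_
  rw [← sub_eq_zero, ← sub_smul, ← mul_sub]
  obtain ⟨w, hw⟩ := sub_dvd_pow_sub_pow (x + (q : ℤ)) x (k i)
  have h0 : q • t i = 0 := congrFun ht i
  rw [hw, add_sub_cancel_left, ← mul_assoc, mul_comm, ← mul_assoc, mul_smul, natCast_zsmul,
    h0, smul_zero]

lemma dS_mul_period {q : ℕ} (k : ι → ℕ) (v : ι → ℤ) {t : ι → 𝕋} (ht : q • t = 0) (n : ℕ) :
    dS k v (n * q) t = n * dS k v q t := by
  induction n with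
  | zero => simp [dS]
  | succ n ih =>
    have h := sum_Ioc_int_add (fun x => ee (∑ i, (v i * x ^ k i) • t i)) q (n * q)
    simp_rw [dS_add_period k v ht] at h
    rw [add_mul, one_mul]
    refine h.trans ?_
    change dS k v q t + dS k v (n * q) t = _
    rw [ih]; push_cast; ring

lemma Wt_eq {q : ℕ} (hq : 0 < q) (k : ι → ℕ) (v : ι → ℤ) {t : ι → 𝕋} (ht : q • t = 0) :
    Wt k v t = (q : ℂ)⁻¹ * dS k v q t := by
  obtain ⟨n, hn⟩ := addOrderOf_dvd_of_nsmul_eq_zero ht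
  have h0 : 0 < addOrderOf t := Nat.pos_of_ne_zero fun h => by simp [h] at hn; omega
  have hn0 : 0 < n := Nat.pos_of_ne_zero fun h => by simp [h] at hn; omega
  have h1 : (n : ℂ) ≠ 0 := by exact_mod_cast hn0.ne'
  have hd : dS k v q t = n * dS k v (addOrderOf t) t := by
    conv_lhs => rw [hn, mul_comm]
    exact dS_mul_period k v (addOrderOf_nsmul_eq_zero t) n
  have hq' : (q : ℂ) = addOrderOf t * n := by exact_mod_cast hn
  rw [Wt, hd, hq', mul_inv]
  field_simp

/-- The number of solutions modulo `q`. -/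
noncomputable def msol (k : ι → ℕ) (e : Fin s → ι → ℤ) (q : ℕ) : ℕ :=
  Nat.card {x : Fin s → ZMod q // ∀ i, ∑ j, (e j i : ZMod q) * x j ^ k i = 0}

lemma card_eq_msol {q : ℕ} (hq : 0 < q) (k : ι → ℕ) (e : Fin s → ι → ℤ) :
    #{x ∈ Fintype.piFinset fun _ : Fin s => Ioc (0 : ℤ) q |
      ∀ i, (q : ℤ) ∣ ∑ j, e j i * x j ^ k i} = msol k e q := by
  classical
  have : NeZero q := ⟨hq.ne'⟩
  rw [msol, Nat.card_eq_fintype_card, Fintype.card_subtype]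
  have hiff : ∀ x : Fin s → ℤ, (∀ i, (q : ℤ) ∣ ∑ j, e j i * x j ^ k i) ↔
      ∀ i, ∑ j, (e j i : ZMod q) * (x j : ZMod q) ^ k i = 0 := fun x => by
    refine forall_congr' fun i => ?_
    rw [← ZMod.intCast_zmod_eq_zero_iff_dvd]
    push_cast
    rfl
  refine card_nbij (fun x j => (x j : ZMod q)) (fun x hx => ?_) (fun x hx y hy h => ?_)
    fun z hz => ?_
  · exact mem_coe.2 (mem_filter.2 ⟨mem_univ _, (hiff x).1 (mem_filter.1 (mem_coe.1 hx)).2⟩)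
  · have hx := Fintype.mem_piFinset.1 (mem_filter.1 hx).1
    have hy := Fintype.mem_piFinset.1 (mem_filter.1 hy).1
    ext j
    have h1 := (ZMod.intCast_eq_intCast_iff_dvd_sub _ _ _).1 (congrFun h j)
    have hxj := mem_Ioc.1 (hx j)
    have hyj := mem_Ioc.1 (hy j)
    have := Int.eq_zero_of_abs_lt_dvd h1 (abs_lt.2 ⟨by omega, by omega⟩)
    omega
  · have hc : (fun j => (((z j - 1).val + 1 : ℤ) : ZMod q)) = z := by
      ext j; push_cast; rw [ZMod.natCast_zmod_val]; ring
    refine ⟨fun j => ((z j - 1).val + 1 : ℤ), ?_, hc⟩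
    rw [coe_filter, Set.mem_ofPred_eq, Fintype.mem_piFinset, hiff]
    refine ⟨fun j => mem_Ioc.2 ?_, ?_⟩
    · have := ZMod.val_lt (z j - 1)
      omega
    · have := (mem_filter.1 hz).2
      intro i
      rw [← this i]
      exact sum_congr rfl fun j _ => by rw [congrFun hc j]

/-- The set of `q`-torsion points of the circle. -/
noncomputable def tors1 (q : ℕ) : Finset 𝕋 := (range q).image fun a : ℕ => (((a : ℝ) / q : ℝ) : 𝕋)

lemma mem_tors1 {q : ℕ} (hq : 0 < q) (u : 𝕋) : u ∈ tors1 q ↔ q • u = 0 := by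
  rw [AddCircle.nsmul_eq_zero_iff (p := (1 : ℝ)) (u := u) hq]
  simp [tors1]

lemma card_tors1 {q : ℕ} (hq : 0 < q) : #(tors1 q) = q := by
  rw [tors1, card_image_of_injOn, card_range]
  intro a ha b hb h
  have ha := mem_range.1 ha
  have hb := mem_range.1 hb
  have hq' : (0 : ℝ) < q := by exact_mod_cast hq
  have hI : ∀ c < q, ((c : ℝ) / q) ∈ Set.Ico (0 : ℝ) (0 + 1) := fun c hc =>
    ⟨by positivity, by rw [zero_add, div_lt_one hq']; exact_mod_cast hc⟩
  have := (AddCircle.coe_eq_coe_iff_of_mem_Ico (hI a ha) (hI b hb)).1 h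
  rw [div_left_inj' hq'.ne'] at this
  exact_mod_cast this

lemma sum_tors1_ee {q : ℕ} (hq : 0 < q) (N : ℤ) :
    ∑ u ∈ tors1 q, ee (N • u) = if (q : ℤ) ∣ N then (q : ℂ) else 0 := by
  have hq' : (0 : ℝ) < q := by exact_mod_cast hq
  split_ifs with h
  · obtain ⟨m, rfl⟩ := h
    rw [sum_congr rfl (g := fun _ => (1 : ℂ)) fun u hu => ?_, sum_const, card_tors1 hq, nsmul_one]
    rw [mul_comm, mul_smul, natCast_zsmul, (mem_tors1 hq u).1 hu, smul_zero, ee_zero]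
  · obtain ⟨u0, hu0⟩ : ∃ u : 𝕋, u = ((1 / (q : ℝ) : ℝ) : 𝕋) := ⟨_, rfl⟩
    have h1 : q • u0 = 0 := by
      rw [hu0, ← AddCircle.coe_nsmul, nsmul_eq_mul, mul_one_div_cancel hq'.ne']
      exact AddCircle.coe_period 1
    have h2 : ee (N • u0) ≠ 1 := by
      rw [Ne, ee_eq_one_iff, hu0, ← AddCircle.coe_zsmul, AddCircle.coe_eq_zero_iff]
      rintro ⟨n, hn⟩
      refine h ⟨n, ?_⟩
      rw [zsmul_eq_mul, zsmul_eq_mul, mul_one, mul_one_div, eq_div_iff hq'.ne'] at hn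
      rw [mul_comm]
      exact_mod_cast hn.symm
    have h3 : ∑ u ∈ tors1 q, ee (N • u) = ee (N • u0) * ∑ u ∈ tors1 q, ee (N • u) := by
      rw [mul_sum]
      symm
      refine sum_nbij' (fun u => u0 + u) (fun u => u - u0) ?_ ?_ ?_ ?_ ?_
      · intro u hu
        rw [mem_tors1 hq] at hu ⊢
        rw [smul_add, h1, hu, add_zero]
      · intro u hu
        rw [mem_tors1 hq] at hu ⊢
        rw [smul_sub, h1, hu, sub_zero]
      · intro u _; abel
      · intro u _; abel
      · intro u _; rw [smul_add, ee_add]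
    by_contra h0
    exact h2 (mul_right_cancel₀ h0 (by rw [one_mul]; exact h3.symm))

theorem sum_tors_prod_Wt {q : ℕ} (hq : 0 < q) (k : ι → ℕ) (e : Fin s → ι → ℤ) :
    ∑ t ∈ tors ι q, ∏ j, Wt k (e j) t =
      ((msol k e q * (q : ℝ) ^ Fintype.card ι / (q : ℝ) ^ s : ℝ) : ℂ) := by
  classical
  have h1 : ∀ t ∈ tors ι q, ∏ j, Wt k (e j) t = ((q : ℂ) ^ s)⁻¹ *
      ∑ x ∈ Fintype.piFinset fun _ : Fin s => Ioc (0 : ℤ) q,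
        ∏ i, ee ((∑ j, e j i * x j ^ k i) • t i) := fun t ht => by
    have ht := (mem_tors hq t).1 ht
    simp_rw [Wt_eq hq k _ ht]
    rw [prod_mul_distrib, prod_dS_eq, prod_const, card_univ, Fintype.card_fin, inv_pow]
  rw [sum_congr rfl h1, ← mul_sum, sum_comm]
  have h2 : ∀ x : Fin s → ℤ, ∑ t ∈ tors ι q, ∏ i, ee ((∑ j, e j i * x j ^ k i) • t i) =
      if ∀ i, (q : ℤ) ∣ ∑ j, e j i * x j ^ k i then (q : ℂ) ^ Fintype.card ι else 0 := fun x => by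
    have := prod_univ_sum (fun _ : ι => tors1 q) fun i u => ee ((∑ j, e j i * x j ^ k i) • u)
    refine this.symm.trans ?_
    simp_rw [sum_tors1_ee hq]
    rw [prod_ite_zero]
    simp
  simp_rw [h2]
  rw [← sum_filter, sum_const, nsmul_eq_mul, card_eq_msol hq]
  push_cast
  ring

end

end CQ

namespace CQ

section Phi

variable {ι μ 𝕜 : Type*} [Fintype ι] [Fintype μ]

theorem exists_columns [Field 𝕜] {s : ℕ} (M : Matrix ι (Fin s) 𝕜)
    (h : M.rank = Fintype.card ι) :
    ∃ (m : ℕ) (σ : ι ⊕ Fin m ≃ Fin s), LinearIndependent 𝕜 fun i => M.col (σ (Sum.inl i)) := by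
  classical
  obtain ⟨κ, a, ha, hsp, hli⟩ := exists_linearIndependent' 𝕜 M.col
  have : Finite κ := Finite.of_injective a ha
  have := Fintype.ofFinite κ
  have hcard : Fintype.card κ = Fintype.card ι := by
    rw [← h, M.rank_eq_finrank_span_cols, ← hsp, finrank_span_eq_card hli]
  let g : ι ≃ κ := (Fintype.equivOfCardEq hcard).symm
  let p : Fin s → Prop := fun j => j ∈ Set.range a
  let τ : ι ≃ {j // p j} := g.trans (Equiv.ofInjective a ha)
  let ρ : Fin (Fintype.card {j // ¬ p j}) ≃ {j // ¬ p j} := (Fintype.equivFin _).symm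
  refine ⟨_, (Equiv.sumCongr τ ρ).trans (Equiv.sumCompl p), ?_⟩
  exact hli.comp g g.injective

/-- The forms `∑ⱼ eⱼᵢ zⱼ ^ kᵢ` in the coordinates of the first summand, together with the
coordinates of the second summand. -/
def phiM [CommRing 𝕜] (k : ι → ℕ) (e : ι ⊕ μ → ι → ℤ) (z : ι ⊕ μ → 𝕜) : ι ⊕ μ → 𝕜 :=
  Sum.elim (fun i => ∑ j, (e j i : 𝕜) * z j ^ k i) fun l => z (Sum.inr l)

variable [NontriviallyNormedField 𝕜]

/-- The derivative of `phiM`. -/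
noncomputable def phiD (k : ι → ℕ) (e : ι ⊕ μ → ι → ℤ) (y : ι ⊕ μ → 𝕜) :
    (ι ⊕ μ → 𝕜) →L[𝕜] (ι ⊕ μ → 𝕜) :=
  ContinuousLinearMap.pi (Sum.elim
    (fun i => ∑ j, ((e j i : 𝕜) * (k i * y j ^ (k i - 1))) • ContinuousLinearMap.proj j)
    fun l => ContinuousLinearMap.proj (Sum.inr l))

theorem phiD_inl (k : ι → ℕ) (e : ι ⊕ μ → ι → ℤ) (y v : ι ⊕ μ → 𝕜) (i : ι) :
    phiD k e y v (Sum.inl i) = ∑ j, (e j i : 𝕜) * (k i * y j ^ (k i - 1)) * v j := by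
  simp [phiD]

theorem hasStrictFDerivAt_phiM (k : ι → ℕ) (e : ι ⊕ μ → ι → ℤ) (y : ι ⊕ μ → 𝕜) :
    HasStrictFDerivAt (phiM k e) (phiD k e y) y := by
  rw [hasStrictFDerivAt_pi']
  rintro (i | l)
  · have h1 : ∀ j ∈ (univ : Finset (ι ⊕ μ)), HasStrictFDerivAt
        (fun z : ι ⊕ μ → 𝕜 => (e j i : 𝕜) * z j ^ k i)
        (((e j i : 𝕜) * (k i * y j ^ (k i - 1))) •
          (ContinuousLinearMap.proj j : (ι ⊕ μ → 𝕜) →L[𝕜] 𝕜)) y := fun j _ => by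
      have h2 := ((hasStrictDerivAt_pow (k i) (y j)).comp_hasStrictFDerivAt y
        ((ContinuousLinearMap.proj j : (ι ⊕ μ → 𝕜) →L[𝕜] 𝕜).hasStrictFDerivAt)).const_mul (e j i : 𝕜)
      rw [smul_smul] at h2
      exact h2
    refine (HasStrictFDerivAt.fun_sum h1).congr_fderiv ?_
    ext v
    simp [phiD]
  · exact (ContinuousLinearMap.proj (Sum.inr l) : (ι ⊕ μ → 𝕜) →L[𝕜] 𝕜).hasStrictFDerivAt

theorem map_nhds_phiM [CompleteSpace 𝕜] (k : ι → ℕ) (e : ι ⊕ μ → ι → ℤ) (y : ι ⊕ μ → 𝕜)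
    (h : LinearIndependent 𝕜 fun i' : ι => fun i : ι =>
      (e (Sum.inl i') i : 𝕜) * (k i * y (Sum.inl i') ^ (k i - 1))) :
    Filter.map (phiM k e) (nhds y) = nhds (phiM k e y) := by
  refine (hasStrictFDerivAt_phiM k e y).map_nhds_eq_of_surj ?_
  refine LinearMap.range_eq_top.2 (LinearMap.injective_iff_surjective.1 ?_)
  rw [← LinearMap.ker_eq_bot, LinearMap.ker_eq_bot']
  intro v hv
  have hv' : ∀ x, phiD k e y v x = 0 := fun x => congrFun hv x
  have hr : ∀ l, v (Sum.inr l) = 0 := fun l => by simpa [phiD] using hv' (Sum.inr l)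
  have hl := Fintype.linearIndependent_iff.1 h (fun i => v (Sum.inl i)) <| by
    ext i
    have h3 := hv' (Sum.inl i)
    rw [phiD_inl, Fintype.sum_sum_type] at h3
    simp only [hr, mul_zero, sum_const_zero, add_zero] at h3
    rw [Pi.zero_apply, ← h3, Finset.sum_apply]
    exact sum_congr rfl fun j _ => by rw [Pi.smul_apply, smul_eq_mul, mul_comm]
  ext (i | l)
  · exact hl i
  · exact hr l

end Phi

section Local

variable {ι 𝕜 : Type*} [Fintype ι] {s : ℕ}

theorem exists_chart [Field 𝕜] (k : ι → ℕ) (e : Fin s → ι → ℤ) (y : Fin s → 𝕜)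
    (h : (Matrix.of fun (i : ι) (j : Fin s) =>
      (e j i : 𝕜) * (k i * y j ^ (k i - 1))).rank = Fintype.card ι) :
    ∃ (m : ℕ) (σ : ι ⊕ Fin m ≃ Fin s), ∀ c : 𝕜, c ≠ 0 →
      LinearIndependent 𝕜 fun i' : ι => fun i : ι =>
        (e (σ (Sum.inl i')) i : 𝕜) * (k i * (c * y (σ (Sum.inl i'))) ^ (k i - 1)) := by
  obtain ⟨m, σ, hσ⟩ := exists_columns _ h
  refine ⟨m, σ, fun c hc => ?_⟩
  rw [Fintype.linearIndependent_iff] at hσ ⊢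
  intro g hg
  refine hσ g ?_
  ext i
  have h1 := congrFun hg i
  rw [Finset.sum_apply] at h1 ⊢
  simp only [Pi.smul_apply, smul_eq_mul, Pi.zero_apply, Matrix.col_apply, Matrix.of_apply,
    mul_pow] at h1 ⊢
  have h2 : c ^ (k i - 1) ≠ 0 := pow_ne_zero _ hc
  refine (mul_eq_zero.1 (?_ : c ^ (k i - 1) * _ = 0)).resolve_left h2
  rw [← h1, mul_sum]
  exact sum_congr rfl fun j _ => by ring

omit [Fintype ι] in
theorem sum_smul_pow [CommRing 𝕜] {k : ι → ℕ} {e : Fin s → ι → ℤ} {y : Fin s → 𝕜} {i : ι}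
    (h : ∑ j, (e j i : 𝕜) * y j ^ k i = 0) (c : 𝕜) :
    ∑ j, (e j i : 𝕜) * (c * y j) ^ k i = 0 := by
  have : ∑ j, (e j i : 𝕜) * (c * y j) ^ k i = c ^ k i * ∑ j, (e j i : 𝕜) * y j ^ k i := by
    rw [mul_sum]
    exact sum_congr rfl fun j _ => by ring
  rw [this, h, mul_zero]

omit [Fintype ι] in
theorem msol_pos {q : ℕ} (hq : 0 < q) {k : ι → ℕ} (hk : ∀ i, 1 ≤ k i) (e : Fin s → ι → ℤ) :
    1 ≤ msol k e q := by
  have : NeZero q := ⟨hq.ne'⟩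
  have : Nonempty {x : Fin s → ZMod q // ∀ i, ∑ j, (e j i : ZMod q) * x j ^ k i = 0} :=
    ⟨0, fun i => sum_eq_zero fun j _ => by
      rw [Pi.zero_apply, zero_pow (by have := hk i; omega), mul_zero]⟩
  exact Nat.card_pos

theorem exists_padic_scale (p : ℕ) [Fact p.Prime] (y : Fin s → ℚ_[p]) :
    ∃ c : ℚ_[p], c ≠ 0 ∧ ∀ j, ‖c * y j‖ ≤ 1 := by
  have hp : (p : ℚ_[p]) ≠ 0 := Nat.cast_ne_zero.2 (Fact.out : p.Prime).ne_zero
  have h1 : Filter.Tendsto (fun n : ℕ => ‖(p : ℚ_[p])‖ ^ n) Filter.atTop (nhds 0) :=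
    tendsto_pow_atTop_nhds_zero_of_lt_one (norm_nonneg _) (Padic.norm_p_lt_one)
  have h2 : ∀ j, ∀ᶠ n : ℕ in Filter.atTop, ‖(p : ℚ_[p])‖ ^ n * ‖y j‖ ≤ 1 := fun j => by
    have h3 := h1.mul_const ‖y j‖
    rw [zero_mul] at h3
    exact (h3.eventually_lt_const one_pos).mono fun n hn => hn.le
  obtain ⟨n, hn⟩ := (Filter.eventually_all.2 h2).exists
  exact ⟨p ^ n, pow_ne_zero _ hp, fun j => by rw [norm_mul, norm_pow]; exact hn j⟩

theorem exists_msol_ge (p : ℕ) [Fact p.Prime] (k : ι → ℕ) (e : Fin s → ι → ℤ)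
    (y : Fin s → ℚ_[p]) (hsol : ∀ i, ∑ j, (e j i : ℚ_[p]) * y j ^ k i = 0)
    (hrank : (Matrix.of fun (i : ι) (j : Fin s) =>
      (e j i : ℚ_[p]) * (k i * y j ^ (k i - 1))).rank = Fintype.card ι) :
    ∃ m b : ℕ, Fintype.card ι + m = s ∧ ∀ v, b ≤ v → p ^ ((v - b) * m) ≤ msol k e (p ^ v) := by
  have hp : p.Prime := Fact.out
  obtain ⟨m, σ, hσ⟩ := exists_chart k e y hrank
  obtain ⟨c, hc, hint⟩ := exists_padic_scale p y
  have hli := hσ c hc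
  obtain ⟨z, hz⟩ : ∃ z : ι ⊕ Fin m → ℚ_[p], z = fun x => c * y (σ x) := ⟨_, rfl⟩
  obtain ⟨E, hE⟩ : ∃ E : ι ⊕ Fin m → ι → ℤ, E = fun x => e (σ x) := ⟨_, rfl⟩
  have hz1 : ∀ x, ‖z x‖ ≤ 1 := fun x => by rw [hz]; exact hint _
  obtain ⟨w, hw⟩ : ∃ w : ι ⊕ Fin m → ℤ_[p], ∀ x, (w x : ℚ_[p]) = z x :=
    ⟨fun x => ⟨z x, hz1 x⟩, fun x => rfl⟩
  have hmap := map_nhds_phiM k E z (by rw [hE, hz]; exact hli)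
  have hinl : ∀ i, phiM k E z (Sum.inl i) = 0 := fun i => by
    have h1 := sum_smul_pow (hsol i) c
    rw [← σ.sum_comp] at h1
    rw [hE, hz]
    exact h1
  have hball : phiM k E '' Metric.closedBall z 1 ∈ nhds (phiM k E z) := by
    rw [← hmap]
    exact Filter.image_mem_map (Metric.closedBall_mem_nhds z one_pos)
  obtain ⟨ε, hε, hsub⟩ := Metric.mem_nhds_iff.1 hball
  have h1 : Filter.Tendsto (fun n : ℕ => ‖(p : ℚ_[p])‖ ^ n) Filter.atTop (nhds 0) :=
    tendsto_pow_atTop_nhds_zero_of_lt_one (norm_nonneg _) (Padic.norm_p_lt_one)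
  obtain ⟨b, hb⟩ := (h1.eventually_lt_const hε).exists
  refine ⟨m, b, ?_, fun v hv => ?_⟩
  · have := Fintype.card_congr σ
    simpa using this
  have key : ∀ a : Fin m → Fin (p ^ (v - b)), ∃ x : ι ⊕ Fin m → ℤ_[p],
      (∀ i, ∑ j, (E j i : ℤ_[p]) * x j ^ k i = 0) ∧
      ∀ l, x (Sum.inr l) = w (Sum.inr l) + (p : ℤ_[p]) ^ b * ((a l : ℕ) : ℤ_[p]) := by
    intro a
    obtain ⟨x, hx1, hx2⟩ := hsub (show (Sum.elim (fun _ => 0) fun l =>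
        z (Sum.inr l) + (p : ℚ_[p]) ^ b * ((a l : ℕ) : ℚ_[p]) : ι ⊕ Fin m → ℚ_[p]) ∈ _ by
      rw [Metric.mem_ball, dist_pi_lt_iff hε]
      rintro (i | l)
      · rw [hinl]; simpa using hε
      · rw [Sum.elim_inr]
        change dist _ (z (Sum.inr l)) < ε
        rw [dist_eq_norm, add_sub_cancel_left, norm_mul, norm_pow]
        refine lt_of_le_of_lt (mul_le_of_le_one_right (by positivity) ?_) hb
        exact_mod_cast Padic.norm_int_le_one (p := p) ((a l : ℕ) : ℤ))
    have hx3 : ∀ j, ‖x j‖ ≤ 1 := fun j => by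
      have h2 : ‖x j - z j‖ ≤ 1 := by
        rw [← dist_eq_norm]; exact (dist_le_pi_dist x z j).trans hx1
      have h3 := Padic.nonarchimedean (x j - z j) (z j)
      rw [sub_add_cancel] at h3
      exact h3.trans (max_le h2 (hz1 j))
    obtain ⟨u, hu⟩ : ∃ u : ι ⊕ Fin m → ℤ_[p], ∀ j, (u j : ℚ_[p]) = x j :=
      ⟨fun j => ⟨x j, hx3 j⟩, fun j => rfl⟩
    refine ⟨u, fun i => ?_, fun l => ?_⟩
    · have h4 := congrFun hx2 (Sum.inl i)
      change ∑ j, (E j i : ℚ_[p]) * x j ^ k i = 0 at h4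
      refine PadicInt.ext ?_
      rw [PadicInt.coe_sum]
      push_cast
      simp_rw [hu]
      exact h4
    · have h4 := congrFun hx2 (Sum.inr l)
      refine PadicInt.ext ?_
      push_cast
      rw [hu, hw]
      exact h4
  choose x hx1 hx2 using key
  have hv0 : NeZero (p ^ v) := ⟨pow_ne_zero _ hp.ne_zero⟩
  let f : (Fin m → Fin (p ^ (v - b))) →
      {x : Fin s → ZMod (p ^ v) // ∀ i, ∑ j, (e j i : ZMod (p ^ v)) * x j ^ k i = 0} := fun a =>
    ⟨fun j => PadicInt.toZModPow v (x a (σ.symm j)), fun i => by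
      have h2 := congrArg (PadicInt.toZModPow v) (hx1 a i)
      rw [map_zero, map_sum] at h2
      rw [← h2, ← σ.sum_comp]
      refine sum_congr rfl fun j _ => ?_
      beta_reduce
      rw [σ.symm_apply_apply, map_mul, map_pow, map_intCast, hE]⟩
  have hf : Function.Injective f := fun a a' haa => by
    ext l
    have h2 := congrFun (congrArg Subtype.val haa) (σ (Sum.inr l))
    simp only [f, σ.symm_apply_apply, hx2] at h2
    rw [map_add, map_add] at h2
    have h3 := add_left_cancel h2
    rw [map_mul, map_mul, map_pow, map_natCast, map_natCast, map_natCast] at h3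
    have h4 : ((p ^ b * (a l : ℕ) : ℕ) : ZMod (p ^ v)) = ((p ^ b * (a' l : ℕ) : ℕ) : ZMod (p ^ v)) := by
      push_cast; exact h3
    rw [ZMod.natCast_eq_natCast_iff, show p ^ v = p ^ b * p ^ (v - b) by
      rw [← pow_add]; congr 1; omega] at h4
    exact (Nat.ModEq.mul_left_cancel' (pow_ne_zero _ hp.ne_zero) h4).eq_of_lt_of_lt
      (a l).2 (a' l).2
  have h5 := Nat.card_le_card_of_injective f hf
  rw [Nat.card_eq_fintype_card, Fintype.card_fun, Fintype.card_fin, Fintype.card_fin, ← pow_mul] at h5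
  exact h5

/-- The density of solutions modulo `q`. -/
noncomputable def rho (k : ι → ℕ) (e : Fin s → ι → ℤ) (q : ℕ) : ℝ :=
  msol k e q * (q : ℝ) ^ Fintype.card ι / (q : ℝ) ^ s

theorem exists_rho_ge (p : ℕ) [Fact p.Prime] {k : ι → ℕ} (hk : ∀ i, 1 ≤ k i) (e : Fin s → ι → ℤ)
    (y : Fin s → ℚ_[p]) (hsol : ∀ i, ∑ j, (e j i : ℚ_[p]) * y j ^ k i = 0)
    (hrank : (Matrix.of fun (i : ι) (j : Fin s) =>
      (e j i : ℚ_[p]) * (k i * y j ^ (k i - 1))).rank = Fintype.card ι) :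
    ∃ c : ℝ, 0 < c ∧ ∀ v, c ≤ rho k e (p ^ v) := by
  have hp : p.Prime := Fact.out
  obtain ⟨m, b, hm, hb⟩ := exists_msol_ge p k e y hsol hrank
  have hp0 : (0 : ℝ) < p := Nat.cast_pos.2 hp.pos
  have hp1 : (1 : ℝ) ≤ p := Nat.one_le_cast.2 hp.one_lt.le
  refine ⟨((p : ℝ) ^ (b * m))⁻¹, by positivity, fun v => ?_⟩
  have h1 : rho k e (p ^ v) = msol k e (p ^ v) / (p : ℝ) ^ (v * m) := by
    have h0 : ((p ^ v : ℕ) : ℝ) ^ s = ((p ^ v : ℕ) : ℝ) ^ (Fintype.card ι + m) := by rw [hm]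
    rw [rho, h0]
    push_cast
    rw [pow_add, ← pow_mul, ← pow_mul]
    field_simp
  rw [h1, inv_eq_one_div, div_le_div_iff₀ (by positivity) (by positivity), one_mul]
  rcases le_total b v with h | h
  · have h2 : ((p ^ ((v - b) * m) : ℕ) : ℝ) ≤ msol k e (p ^ v) := Nat.cast_le.2 (hb v h)
    push_cast at h2
    refine le_trans (le_of_eq ?_) (mul_le_mul_of_nonneg_right h2 (by positivity))
    rw [← pow_add, ← add_mul]
    congr 2; omega
  · have h2 : (1 : ℝ) ≤ msol k e (p ^ v) := Nat.one_le_cast.2 (msol_pos (pow_pos hp.pos _) hk e)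
    refine le_trans (pow_le_pow_right₀ hp1 (Nat.mul_le_mul_right m h)) ?_
    exact le_mul_of_one_le_left (by positivity) h2

end Local

section SingularSeries

variable {ι : Type*} [Fintype ι] {s : ℕ}

omit [Fintype ι] in
theorem msol_mul {m n : ℕ} (h : m.Coprime n) (k : ι → ℕ) (e : Fin s → ι → ℤ) :
    msol k e (m * n) = msol k e m * msol k e n := by
  rw [msol, msol, msol, ← Nat.card_prod]
  let g := ZMod.chineseRemainder h
  have hg : ∀ (x : Fin s → ZMod (m * n)) i, g (∑ j, (e j i : ZMod (m * n)) * x j ^ k i) =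
      (∑ j, (e j i : ZMod m) * (g (x j)).1 ^ k i, ∑ j, (e j i : ZMod n) * (g (x j)).2 ^ k i) :=
    fun x i => by
      rw [map_sum]
      refine Prod.ext ?_ ?_
      · rw [Prod.fst_sum]
        exact sum_congr rfl fun j _ => by rw [map_mul, map_pow, map_intCast]; rfl
      · rw [Prod.snd_sum]
        exact sum_congr rfl fun j _ => by rw [map_mul, map_pow, map_intCast]; rfl
  refine Nat.card_congr
    { toFun := fun x => (⟨fun j => (g (x.1 j)).1, fun i => ?_⟩, ⟨fun j => (g (x.1 j)).2, fun i => ?_⟩)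
      invFun := fun y => ⟨fun j => g.symm (y.1.1 j, y.2.1 j), fun i => ?_⟩
      left_inv := fun x => ?_
      right_inv := fun y => ?_ }
  · have := hg x.1 i
    rw [x.2 i, map_zero] at this
    exact (congrArg Prod.fst this).symm
  · have := hg x.1 i
    rw [x.2 i, map_zero] at this
    exact (congrArg Prod.snd this).symm
  · refine g.injective ?_
    rw [hg, map_zero]
    simp only [RingEquiv.apply_symm_apply]
    rw [y.1.2 i, y.2.2 i]; rfl
  · refine Subtype.ext (funext fun j => ?_)
    exact g.symm_apply_apply (x.1 j)
  · refine Prod.ext (Subtype.ext (funext fun j => ?_)) (Subtype.ext (funext fun j => ?_))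
    · exact congrArg Prod.fst (g.apply_symm_apply (y.1.1 j, y.2.1 j))
    · exact congrArg Prod.snd (g.apply_symm_apply (y.1.1 j, y.2.1 j))

theorem rho_mul {m n : ℕ} (h : m.Coprime n) (k : ι → ℕ) (e : Fin s → ι → ℤ) :
    rho k e (m * n) = rho k e m * rho k e n := by
  rw [rho, rho, rho, msol_mul h]
  push_cast
  rw [mul_pow, mul_pow]
  ring

theorem rho_nonneg (k : ι → ℕ) (e : Fin s → ι → ℤ) (q : ℕ) : 0 ≤ rho k e q := by
  unfold rho; positivity

theorem exists_rho_ge_mul {k : ι → ℕ} {e : Fin s → ι → ℤ}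
    (h : ∀ p : ℕ, p.Prime → ∃ c : ℝ, 0 < c ∧ ∀ v, c ≤ rho k e (p ^ v)) (S : Finset ℕ)
    (hS : ∀ p ∈ S, p.Prime) :
    ∃ c : ℝ, 0 < c ∧ ∀ n, 0 < n → ∃ m, 0 < m ∧ (∀ p ∈ S, ¬ p ∣ m) ∧
      c * rho k e m ≤ rho k e n := by
  classical
  induction S using Finset.induction_on with
  | empty => exact ⟨1, one_pos, fun n hn => ⟨n, hn, by simp, by rw [one_mul]⟩⟩
  | insert p S hp ih =>
    obtain ⟨c, hc, H⟩ := ih fun q hq => hS q (mem_insert_of_mem hq)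
    have hpp := hS p (mem_insert_self p S)
    obtain ⟨c', hc', H'⟩ := h p hpp
    refine ⟨c * c', mul_pos hc hc', fun n hn => ?_⟩
    obtain ⟨m, hm, hm1, hm2⟩ := H n hn
    obtain ⟨v, m', hm', rfl⟩ := Nat.exists_eq_pow_mul_and_not_dvd hm.ne' p hpp.ne_one
    refine ⟨m', Nat.pos_of_mul_pos_left hm, fun q hq => ?_, ?_⟩
    · rcases mem_insert.1 hq with rfl | hq
      · exact hm'
      · exact fun hd => hm1 q hq (dvd_mul_of_dvd_right hd _)
    · rw [rho_mul (((Nat.Prime.coprime_iff_not_dvd hpp).2 hm').pow_left v)] at hm2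
      rw [mul_assoc]
      refine le_trans (mul_le_mul_of_nonneg_left ?_ hc.le) hm2
      exact mul_le_mul_of_nonneg_right (H' v) (rho_nonneg k e m')

theorem exists_rho_ge_half {k : ι → ℕ} {e : Fin s → ι → ℤ}
    (h : Summable fun t : ι → 𝕋 => ∏ j, ‖Wt k (e j) t‖) :
    ∃ N : ℕ, ∀ m, 0 < m → (∀ p : ℕ, p.Prime → p ≤ N → ¬ p ∣ m) → 1 / 2 ≤ rho k e m := by
  classical
  obtain ⟨S, hS⟩ := summable_iff_vanishing_norm.1 h (1 / 2) (by norm_num)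
  refine ⟨∑ t ∈ S, addOrderOf t, fun m hm hmp => ?_⟩
  have h0 : (0 : ι → 𝕋) ∈ tors ι m := (mem_tors hm 0).2 (smul_zero _)
  have h1 := sum_tors_prod_Wt hm k e
  rw [← add_sum_erase _ _ h0] at h1
  have hd : Disjoint ((tors ι m).erase 0) S := by
    rw [disjoint_left]
    intro t ht htS
    obtain ⟨ht0, ht⟩ := mem_erase.1 ht
    have h2 : addOrderOf t ∣ m := addOrderOf_dvd_of_nsmul_eq_zero ((mem_tors hm t).1 ht)
    have h3 : addOrderOf t ≠ 1 := fun h => ht0 (AddMonoid.addOrderOf_eq_one_iff.1 h)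
    have h4 : 0 < addOrderOf t := Nat.pos_of_dvd_of_pos h2 hm
    refine hmp _ (Nat.minFac_prime h3) ?_ ((Nat.minFac_dvd _).trans h2)
    exact (Nat.minFac_le h4).trans (single_le_sum (f := fun t => addOrderOf t)
      (fun _ _ => Nat.zero_le _) htS)
  have h2 := hS _ hd
  have h3 : ∏ j, Wt k (e j) (0 : ι → 𝕋) = 1 := prod_eq_one fun j _ => Wt_zero _ _
  rw [h3] at h1
  have h4 : ‖∑ t ∈ (tors ι m).erase 0, ∏ j, Wt k (e j) t‖ < 1 / 2 := by
    refine lt_of_le_of_lt (norm_sum_le _ _) (lt_of_le_of_lt (le_of_eq ?_)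
      ((le_abs_self _).trans_lt h2))
    exact sum_congr rfl fun t _ => norm_prod _ _
  have h5 := congrArg Complex.re h1
  rw [Complex.add_re, Complex.one_re, Complex.ofReal_re] at h5
  have h6 := (abs_le.1 (Complex.abs_re_le_norm
    (∑ t ∈ (tors ι m).erase 0, ∏ j, Wt k (e j) t))).1
  rw [rho]
  linarith

theorem tsum_prod_Wt_ne_zero (hs : 0 < s) {k : ι → ℕ} {e : Fin s → ι → ℤ}
    (h : Summable fun t : ι → 𝕋 => ∏ j, ‖Wt k (e j) t‖)
    (hloc : ∀ p : ℕ, p.Prime → ∃ c : ℝ, 0 < c ∧ ∀ v, c ≤ rho k e (p ^ v)) :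
    ∑' t : ι → 𝕋, ∏ j, Wt k (e j) t ≠ 0 := by
  obtain ⟨N, hN⟩ := exists_rho_ge_half h
  obtain ⟨c, hc, H⟩ := exists_rho_ge_mul hloc ((range (N + 1)).filter Nat.Prime)
    fun p hp => (mem_filter.1 hp).2
  have h1 : ∀ n, 0 < n → c / 2 ≤ rho k e n := fun n hn => by
    obtain ⟨m, hm, hm1, hm2⟩ := H n hn
    have h2 := hN m hm fun p hp hpN => hm1 p (mem_filter.2 ⟨mem_range.2 (by omega), hp⟩)
    have h3 := mul_le_mul_of_nonneg_left h2 hc.le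
    linarith
  have hsum : Summable fun t : ι → 𝕋 => ∏ j, Wt k (e j) t :=
    Summable.of_norm (h.congr fun t => (norm_prod _ _).symm)
  have h2 := HasSum.tendsto_of_exhaust hsum.hasSum (T := fun n : ℕ => tors ι (n.factorial))
    fun t ht => by
      have h3 : addOrderOf t ≠ 0 := fun h0 => by
        refine ht (prod_eq_zero (mem_univ (⟨0, hs⟩ : Fin s)) ?_)
        rw [Wt, h0, Nat.cast_zero, inv_zero, zero_mul]
      filter_upwards [Filter.eventually_ge_atTop (addOrderOf t)] with n hn
      rw [mem_tors n.factorial_pos]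
      exact addOrderOf_dvd_iff_nsmul_eq_zero.1 (Nat.dvd_factorial (Nat.pos_of_ne_zero h3) hn)
  intro h0
  rw [h0] at h2
  have h3 := (Complex.continuous_re.tendsto _).comp h2
  rw [Complex.zero_re] at h3
  have h4 := ge_of_tendsto' h3 (b := c / 2) fun n => by
    have h5 := h1 _ n.factorial_pos
    rw [rho] at h5
    rw [Function.comp_apply, sum_tors_prod_Wt n.factorial_pos, Complex.ofReal_re]
    exact h5
  linarith

end SingularSeries

end CQ

namespace CQ
open MeasureTheory

section Volume

variable {ι μ : Type*} [Fintype ι] [Fintype μ]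

theorem continuous_phiD (k : ι → ℕ) (e : ι ⊕ μ → ι → ℤ) :
    Continuous fun y : ι ⊕ μ → ℝ => phiD k e y := by
  rw [continuous_clm_apply]
  intro v
  refine continuous_pi ?_
  rintro (i | l)
  · simp_rw [phiD_inl]
    fun_prop
  · exact continuous_const

theorem exists_volume_ge (k : ι → ℕ) (e : ι ⊕ μ → ι → ℤ) (z : ι ⊕ μ → ℝ)
    (hz : ∀ x, z x ∈ Set.Ioo 0 1) (hF : ∀ i, ∑ j, (e j i : ℝ) * z j ^ k i = 0)
    (hli : LinearIndependent ℝ fun i' : ι => fun i : ι =>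
      (e (Sum.inl i') i : ℝ) * (k i * z (Sum.inl i') ^ (k i - 1))) :
    ∃ c : ℝ, 0 < c ∧ ∃ h₀ : ℝ, 0 < h₀ ∧ ∀ h, 0 < h → h < h₀ → c * h ^ Fintype.card ι ≤
      (Measure.pi fun _ : ι ⊕ μ => (volume.restrict (Set.Ioc (0 : ℝ) 1))).real
        {u | ∀ i, |∑ j, (e j i : ℝ) * u j ^ k i| ≤ h} := by
  have hopen : IsOpen (Set.univ.pi fun _ : ι ⊕ μ => Set.Ioo (0 : ℝ) 1) :=
    isOpen_set_pi Set.finite_univ fun _ _ => isOpen_Ioo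
  obtain ⟨ρ, hρ, hsub⟩ := Metric.nhds_basis_closedBall.mem_iff.1 (hopen.mem_nhds fun x _ => hz x)
  have hmap := map_nhds_phiM k e z hli
  have hball : phiM k e '' Metric.closedBall z ρ ∈ nhds (phiM k e z) := by
    rw [← hmap]
    exact Filter.image_mem_map (Metric.closedBall_mem_nhds z hρ)
  obtain ⟨ε, hε, hsub2⟩ := Metric.nhds_basis_closedBall.mem_iff.1 hball
  obtain ⟨D, hD⟩ := (isCompact_closedBall z ρ).exists_bound_of_continuousOn
    ((ContinuousLinearMap.continuous_det.comp (continuous_phiD k e)).continuousOn)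
  have hD0 : 0 ≤ D := (norm_nonneg _).trans (hD z (Metric.mem_closedBall_self hρ.le))
  refine ⟨(D + 1)⁻¹ * (2 ^ Fintype.card ι * (2 * ε) ^ Fintype.card μ), by positivity, ε, hε,
    fun h h0 hhε => ?_⟩
  obtain ⟨A, hA⟩ : ∃ A : Set (ι ⊕ μ → ℝ), A = {u | ∀ i, |∑ j, (e j i : ℝ) * u j ^ k i| ≤ h} :=
    ⟨_, rfl⟩
  have hAc : IsClosed A := by
    rw [hA, Set.ofPred_forall]
    exact isClosed_iInter fun i => isClosed_le (by fun_prop) continuous_const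
  obtain ⟨B, hB⟩ : ∃ B, B = Metric.closedBall z ρ ∩ A := ⟨_, rfl⟩
  have hBm : MeasurableSet B := by
    rw [hB]; exact (Metric.isClosed_closedBall.inter hAc).measurableSet
  have h1 := addHaar_image_le_lintegral_abs_det_fderiv volume hBm (f := phiM k e)
    (f' := phiD k e) fun x _ =>
      (hasStrictFDerivAt_phiM k e x).hasFDerivAt.hasFDerivWithinAt
  have h2 : ∫⁻ x in B, ENNReal.ofReal |(phiD k e x).det| ≤ ENNReal.ofReal (D + 1) * volume B := by
    rw [← setLIntegral_const]
    refine setLIntegral_mono' hBm fun x hx => ENNReal.ofReal_le_ofReal ?_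
    rw [hB] at hx
    exact (hD x hx.1).trans (by linarith)
  have hbox : (Set.univ.pi (Sum.elim (fun _ : ι => Set.Icc (-h) h)
      fun l : μ => Set.Icc (z (Sum.inr l) - ε) (z (Sum.inr l) + ε))) ⊆ phiM k e '' B := by
    intro w hw
    have hw1 : ∀ i, |w (Sum.inl i)| ≤ h := fun i => abs_le.2 (hw (Sum.inl i) trivial)
    have hw2 : w ∈ Metric.closedBall (phiM k e z) ε := by
      rw [Metric.mem_closedBall, dist_pi_le_iff hε.le]
      rintro (i | l)
      · have : phiM k e z (Sum.inl i) = 0 := hF i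
        rw [this, Real.dist_eq, sub_zero]
        exact (hw1 i).trans hhε.le
      · have h3 := hw (Sum.inr l) trivial
        rw [Sum.elim_inr] at h3
        rw [Real.dist_eq, abs_le]
        change -ε ≤ w (Sum.inr l) - z (Sum.inr l) ∧ w (Sum.inr l) - z (Sum.inr l) ≤ ε
        constructor <;> linarith [h3.1, h3.2]
    obtain ⟨u, hu, rfl⟩ := hsub2 hw2
    refine ⟨u, ?_, rfl⟩
    rw [hB, hA]
    exact ⟨hu, hw1⟩
  have hvol : volume (Set.univ.pi (Sum.elim (fun _ : ι => Set.Icc (-h) h)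
      fun l : μ => Set.Icc (z (Sum.inr l) - ε) (z (Sum.inr l) + ε))) =
      ENNReal.ofReal ((2 * h) ^ Fintype.card ι * (2 * ε) ^ Fintype.card μ) := by
    have h3 : ∀ l : μ, z (Sum.inr l) + ε - (z (Sum.inr l) - ε) = 2 * ε := fun l => by ring
    rw [volume_pi_pi, Fintype.prod_sum_type]
    simp only [Sum.elim_inl, Sum.elim_inr, Real.volume_Icc, h3, sub_neg_eq_add, ← two_mul,
      prod_const, card_univ]
    rw [ENNReal.ofReal_mul (p := (2 * h) ^ _) (by positivity),
      ENNReal.ofReal_pow (by positivity),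
      ENNReal.ofReal_pow (by positivity)]
  have hBfin : volume B ≠ ⊤ := by
    refine ne_top_of_le_ne_top (isCompact_closedBall z ρ).measure_ne_top (measure_mono ?_)
    rw [hB]; exact Set.inter_subset_left
  have h3 : (2 * h) ^ Fintype.card ι * (2 * ε) ^ Fintype.card μ ≤ (D + 1) * volume.real B := by
    have h4 := (hvol.symm.le.trans (measure_mono hbox)).trans (h1.trans h2)
    have h5 := ENNReal.toReal_mono (ENNReal.mul_ne_top ENNReal.ofReal_ne_top hBfin) h4
    rwa [ENNReal.toReal_ofReal (by positivity), ENNReal.toReal_mul,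
      ENNReal.toReal_ofReal (by positivity)] at h5
  have h4 : volume.real B ≤
      (Measure.pi fun _ : ι ⊕ μ => (volume.restrict (Set.Ioc (0 : ℝ) 1))).real A := by
    rw [← Measure.restrict_pi_pi, ← volume_pi, measureReal_restrict_apply hAc.measurableSet]
    refine measureReal_mono ?_ ?_
    · rw [hB]
      exact fun u hu => ⟨hu.2, fun x hx => ⟨(hsub hu.1 x hx).1, (hsub hu.1 x hx).2.le⟩⟩
    · refine ne_top_of_le_ne_top ?_ (measure_mono Set.inter_subset_right)
      rw [volume_pi_pi]
      exact ENNReal.prod_ne_top fun _ _ => by simp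
  rw [← hA]
  refine le_trans ?_ h4
  rw [mul_assoc, inv_mul_le_iff₀ (by positivity)]
  refine le_trans (le_of_eq ?_) h3
  rw [mul_pow]; ring

end Volume

section SingularIntegral

variable {ι κ : Type*} [Fintype ι] [Fintype κ]

theorem prod_wI_eq (k : ι → ℕ) (e : κ → ι → ℤ) (η : ι → ℝ) :
    ∏ x, wI k (e x) η = ∫ u : κ → ℝ, ∏ i, ee ((η i * ∑ x, (e x i : ℝ) * u x ^ k i : ℝ) : 𝕋)
      ∂Measure.pi fun _ : κ => volume.restrict (Set.Ioc (0 : ℝ) 1) := by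
  simp_rw [wI, intervalIntegral.integral_of_le zero_le_one]
  rw [← integral_fintype_prod_eq_prod]
  refine integral_congr_ae (Filter.Eventually.of_forall fun u => ?_)
  beta_reduce
  rw [← ee_sum, ← ee_sum]
  refine congrArg ee ((map_sum (QuotientAddGroup.mk' (AddSubgroup.zmultiples (1 : ℝ)))
    _ _).symm.trans (Eq.trans ?_ (map_sum (QuotientAddGroup.mk' (AddSubgroup.zmultiples (1 : ℝ)))
    _ _)))
  congr 1
  simp_rw [phs, mul_sum]
  rw [sum_comm]
  exact sum_congr rfl fun i _ => sum_congr rfl fun x _ => by ring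

theorem integral_gaussian_ee {b : ℝ} (hb : 0 < b) (y : ℝ) :
    ∫ t : ℝ, (Real.exp (-b * t ^ 2) : ℂ) * ee ((t * y : ℝ) : 𝕋) =
      ((Real.sqrt (Real.pi / b) * Real.exp (-(Real.pi * y) ^ 2 / b) : ℝ) : ℂ) := by
  have h1 := fourierIntegral_gaussian (b := (b : ℂ)) (by simpa using hb) (2 * Real.pi * y)
  have h2 : ∀ t : ℝ, (Real.exp (-b * t ^ 2) : ℂ) * ee ((t * y : ℝ) : 𝕋) =
      Complex.exp (Complex.I * (2 * Real.pi * y) * t) * Complex.exp (-b * t ^ 2) := fun t => by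
    rw [ee_coe, mul_comm]
    congr 1
    · congr 1; push_cast; ring
    · push_cast; rfl
  simp_rw [h2]
  rw [h1]
  push_cast
  congr 1
  · rw [Real.sqrt_eq_rpow, Complex.ofReal_cpow (by positivity)]
    push_cast; rfl
  · congr 1
    have : (b : ℂ) ≠ 0 := Complex.ofReal_ne_zero.2 hb.ne'
    field_simp
    ring

theorem integral_gaussian_prod_wI (k : ι → ℕ) (e : κ → ι → ℤ) {b : ℝ} (hb : 0 < b) :
    ∫ η : ι → ℝ, (∏ i, (Real.exp (-b * η i ^ 2) : ℂ)) * ∏ x, wI k (e x) η =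
      ((∫ u : κ → ℝ, ∏ i, (Real.sqrt (Real.pi / b) *
          Real.exp (-(Real.pi * ∑ x, (e x i : ℝ) * u x ^ k i) ^ 2 / b))
        ∂Measure.pi fun _ : κ => volume.restrict (Set.Ioc (0 : ℝ) 1) : ℝ) : ℂ) := by
  have hint : Integrable (Function.uncurry fun (η : ι → ℝ) (u : κ → ℝ) =>
      ∏ i, ((Real.exp (-b * η i ^ 2) : ℂ) *
        ee ((η i * ∑ x, (e x i : ℝ) * u x ^ k i : ℝ) : 𝕋)))
      (volume.prod (Measure.pi fun _ : κ => volume.restrict (Set.Ioc (0 : ℝ) 1))) := by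
    have h1 : Integrable fun η : ι → ℝ => ∏ i, Real.exp (-b * η i ^ 2) :=
      Integrable.fintype_prod (f := fun _ : ι => fun t : ℝ => Real.exp (-b * t ^ 2))
        fun _ => integrable_exp_neg_mul_sq hb
    refine (h1.comp_fst (Measure.pi fun _ : κ => volume.restrict (Set.Ioc (0 : ℝ) 1))).mono'
      (Continuous.aestronglyMeasurable ?_) (Filter.Eventually.of_forall fun p => ?_)
    · unfold Function.uncurry
      refine continuous_finsetProd _ fun i _ => Continuous.mul (by fun_prop) ?_
      exact continuous_ee.comp (continuous_coe_circle.comp (by fun_prop))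
    · rw [Function.uncurry, norm_prod]
      refine (prod_congr rfl fun i _ => ?_).le
      rw [norm_mul, norm_ee, mul_one, Complex.norm_real, Real.norm_of_nonneg (Real.exp_pos _).le]
  have h1 : ∀ η : ι → ℝ, (∏ i, (Real.exp (-b * η i ^ 2) : ℂ)) * ∏ x, wI k (e x) η =
      ∫ u : κ → ℝ, ∏ i, ((Real.exp (-b * η i ^ 2) : ℂ) *
        ee ((η i * ∑ x, (e x i : ℝ) * u x ^ k i : ℝ) : 𝕋))
      ∂Measure.pi fun _ : κ => volume.restrict (Set.Ioc (0 : ℝ) 1) := fun η => by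
    rw [prod_wI_eq, ← integral_const_mul]
    refine integral_congr_ae (Filter.Eventually.of_forall fun u => ?_)
    exact prod_mul_distrib.symm
  simp_rw [h1]
  rw [integral_integral_swap hint, ← integral_complex_ofReal]
  refine integral_congr_ae (Filter.Eventually.of_forall fun u => ?_)
  beta_reduce
  rw [volume_pi, integral_fintype_prod_eq_prod (𝕜 := ℂ) (fun (i : ι) (t : ℝ) =>
    (Real.exp (-b * t ^ 2) : ℂ) * ee ((t * ∑ x, (e x i : ℝ) * u x ^ k i : ℝ) : 𝕋)),
    Complex.ofReal_prod]
  exact prod_congr rfl fun i _ => integral_gaussian_ee hb _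

theorem tendsto_gaussian_prod_wI {k : ι → ℕ} {e : κ → ι → ℤ}
    (h : Integrable fun η : ι → ℝ => ∏ x, wI k (e x) η) :
    Filter.Tendsto (fun b : ℝ => ∫ η : ι → ℝ,
      (∏ i, (Real.exp (-(b ^ 2) * η i ^ 2) : ℂ)) * ∏ x, wI k (e x) η)
      (nhdsWithin 0 (Set.Ioi 0)) (nhds (∫ η : ι → ℝ, ∏ x, wI k (e x) η)) := by
  refine tendsto_integral_filter_of_dominated_convergence
    (fun η => ‖∏ x, wI k (e x) η‖) (Filter.Eventually.of_forall fun b => ?_)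
    (Filter.Eventually.of_forall fun b => Filter.Eventually.of_forall fun η => ?_) h.norm
    (Filter.Eventually.of_forall fun η => ?_)
  · exact (Continuous.mul (by fun_prop) (by fun_prop)).aestronglyMeasurable
  · rw [norm_mul, norm_prod]
    refine mul_le_of_le_one_left (norm_nonneg _) (prod_le_one (fun _ _ => norm_nonneg _)
      fun i _ => ?_)
    rw [Complex.norm_real, Real.norm_of_nonneg (Real.exp_pos _).le, Real.exp_le_one_iff]
    nlinarith [mul_nonneg (sq_nonneg b) (sq_nonneg (η i))]
  · have hc : Continuous fun b : ℝ =>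
        (∏ i, (Real.exp (-(b ^ 2) * η i ^ 2) : ℂ)) * ∏ x, wI k (e x) η := by fun_prop
    have h1 := (hc.tendsto 0).mono_left (nhdsWithin_le_nhds (s := Set.Ioi 0))
    simpa using h1

theorem integral_prod_wI_ne_zero {k : ι → ℕ} {e : κ → ι → ℤ}
    (h : Integrable fun η : ι → ℝ => ∏ x, wI k (e x) η)
    (hvol : ∃ c : ℝ, 0 < c ∧ ∃ h₀ : ℝ, 0 < h₀ ∧ ∀ h, 0 < h → h < h₀ → c * h ^ Fintype.card ι ≤
      (Measure.pi fun _ : κ => (volume.restrict (Set.Ioc (0 : ℝ) 1))).real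
        {u | ∀ i, |∑ j, (e j i : ℝ) * u j ^ k i| ≤ h}) :
    ∫ η : ι → ℝ, ∏ x, wI k (e x) η ≠ 0 := by
  obtain ⟨c, hc, h₀, hh₀, H⟩ := hvol
  obtain ⟨g, hg⟩ : ∃ g : ℝ, g = Real.exp (-Real.pi ^ 2) := ⟨_, rfl⟩
  have hg0 : 0 < g := hg ▸ Real.exp_pos _
  have key : ∀ b : ℝ, 0 < b → b < h₀ → g ^ Fintype.card ι * c ≤
      ∫ u : κ → ℝ, ∏ i, (Real.sqrt (Real.pi / b ^ 2) *
          Real.exp (-(Real.pi * ∑ x, (e x i : ℝ) * u x ^ k i) ^ 2 / b ^ 2))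
        ∂Measure.pi fun _ : κ => volume.restrict (Set.Ioc (0 : ℝ) 1) := by
    intro b hb hbh
    obtain ⟨A, hA⟩ : ∃ A : Set (κ → ℝ), A = {u | ∀ i, |∑ j, (e j i : ℝ) * u j ^ k i| ≤ b} :=
      ⟨_, rfl⟩
    have hAc : IsClosed A := by
      rw [hA, Set.ofPred_forall]
      exact isClosed_iInter fun i => isClosed_le (by fun_prop) continuous_const
    have h1 := H b hb hbh
    rw [← hA] at h1
    have h2 : ∀ u ∈ A, (g / b) ^ Fintype.card ι ≤ ∏ i, (Real.sqrt (Real.pi / b ^ 2) *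
        Real.exp (-(Real.pi * ∑ x, (e x i : ℝ) * u x ^ k i) ^ 2 / b ^ 2)) := fun u hu => by
      rw [← card_univ, ← prod_const]
      refine prod_le_prod (fun _ _ => by positivity) fun i _ => ?_
      have h3 : b⁻¹ ≤ Real.sqrt (Real.pi / b ^ 2) := by
        refine Real.le_sqrt_of_sq_le ?_
        rw [inv_pow, inv_eq_one_div]
        gcongr
        linarith [Real.pi_gt_three]
      have h4 : g ≤ Real.exp (-(Real.pi * ∑ x, (e x i : ℝ) * u x ^ k i) ^ 2 / b ^ 2) := by
        rw [hg, Real.exp_le_exp, neg_div, neg_le_neg_iff, div_le_iff₀ (by positivity), mul_pow]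
        rw [hA] at hu
        have := sq_le_sq' (abs_le.1 (hu i)).1 (abs_le.1 (hu i)).2
        exact mul_le_mul_of_nonneg_left this (by positivity)
      rw [div_eq_mul_inv, mul_comm]
      exact mul_le_mul h3 h4 hg0.le (Real.sqrt_nonneg _)
    have hint : Integrable (fun u : κ → ℝ => ∏ i, (Real.sqrt (Real.pi / b ^ 2) *
        Real.exp (-(Real.pi * ∑ x, (e x i : ℝ) * u x ^ k i) ^ 2 / b ^ 2)))
        (Measure.pi fun _ : κ => volume.restrict (Set.Ioc (0 : ℝ) 1)) := by
      refine (integrable_const (Real.sqrt (Real.pi / b ^ 2) ^ Fintype.card ι)).mono'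
        (Continuous.aestronglyMeasurable (by fun_prop)) (Filter.Eventually.of_forall fun u => ?_)
      rw [Real.norm_of_nonneg (prod_nonneg fun _ _ => by positivity), ← card_univ, ← prod_const]
      refine prod_le_prod (fun _ _ => by positivity) fun i _ => ?_
      refine mul_le_of_le_one_right (Real.sqrt_nonneg _) (Real.exp_le_one_iff.2 ?_)
      rw [neg_div]
      exact neg_nonpos.2 (by positivity)
    refine le_trans ?_ (setIntegral_le_integral (s := A) hint
      (Filter.Eventually.of_forall fun u => prod_nonneg fun _ _ => by positivity))
    refine le_trans ?_ (setIntegral_ge_of_const_le_real hAc.measurableSet (measure_ne_top _ _)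
      h2 hint.integrableOn)
    refine le_trans (le_of_eq ?_) (mul_le_mul_of_nonneg_left h1 (by positivity))
    rw [div_pow]
    field_simp
  intro h0
  have h1 := tendsto_gaussian_prod_wI h
  rw [h0] at h1
  have h2 := (Complex.continuous_re.tendsto _).comp h1
  rw [Complex.zero_re] at h2
  have h3 : g ^ Fintype.card ι * c ≤ 0 := by
    refine ge_of_tendsto h2 ?_
    filter_upwards [Ioo_mem_nhdsGT hh₀] with b hb
    rw [Function.comp_apply, integral_gaussian_prod_wI k e (pow_pos hb.1 2), Complex.ofReal_re]
    exact key b hb.1 hb.2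
  have : 0 < g ^ Fintype.card ι * c := by positivity
  linarith

end SingularIntegral

section Assembly

theorem sum_degs (r n : ℕ) : ∑ i, degs r n i = 3 * r + 2 * n := by
  simp [degs, Fintype.sum_sum_type, mul_comm]

theorem one_le_degs (r n : ℕ) (i : Fin r ⊕ Fin n) : 1 ≤ degs r n i := by
  rcases i with i | i <;> simp [degs]

theorem minorBound_degs {r m s : ℕ} {c : Fin r → Fin s → ℤ} {d : Fin (r + m) → Fin s → ℤ}
    (hc : ∀ J : Fin r → Fin s, Function.Injective J → (Matrix.of fun i m => c i (J m)).det ≠ 0)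
    (hd : ∀ J : Fin (r + m) → Fin s, Function.Injective J →
      (Matrix.of fun i m => d i (J m)).det ≠ 0)
    (hs : (32 / 3 * r + 4 * m : ℝ) < s) : MinorBound (degs r (r + m)) (coefs c d) := by
  intro A hA
  obtain ⟨κ, hκ, C, h⟩ := minor_arcs c d hc hd hs A hA
  refine ⟨κ, hκ, C, ?_⟩
  filter_upwards [h, Filter.eventually_ge_atTop 1] with P hP hP1 Q hQ
  refine (hP Q hQ).trans (le_of_eq ?_)
  have hP0 : (0 : ℝ) < P := Nat.cast_pos.2 hP1
  have h1 : (s - (5 * r + 2 * m) - κ : ℝ) =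
      (s : ℝ) + -((3 * r + 2 * (r + m) : ℕ) : ℝ) + -κ := by push_cast; ring
  rw [sum_degs, h1, Real.rpow_add hP0, Real.rpow_add hP0, Real.rpow_neg hP0.le,
    Real.rpow_natCast, Real.rpow_natCast]
  ring

theorem sum_coefs_eq_zero {A : Type*} [CommRing A] {r n s : ℕ} {c : Fin r → Fin s → ℤ}
    {d : Fin n → Fin s → ℤ} {x : Fin s → A} :
    CQIsSol r n s c d x ↔ ∀ i, ∑ j, (coefs c d j i : A) * x j ^ degs r n i = 0 := by
  rw [Sum.forall]
  rfl

theorem rank_coefs {A : Type*} [CommRing A] {r n s : ℕ} {c : Fin r → Fin s → ℤ}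
    {d : Fin n → Fin s → ℤ} {x : Fin s → A} (h : CQJacFullRank r n s c d x) :
    (Matrix.of fun (i : Fin r ⊕ Fin n) (j : Fin s) => (coefs c d j i : A) *
      (degs r n i * x j ^ (degs r n i - 1))).rank = Fintype.card (Fin r ⊕ Fin n) := by
  rw [Fintype.card_sum, Fintype.card_fin, Fintype.card_fin, ← h]
  congr 2
  ext i j
  rcases i with i | i <;> simp [degs, coefs] <;> ring

theorem CQNcount_eq_card (r n s : ℕ) (c : Fin r → Fin s → ℤ) (d : Fin n → Fin s → ℤ) (P : ℕ) :
    CQNcount r n s c d P = #{x ∈ Fintype.piFinset fun _ : Fin s => Ioc (0 : ℤ) P |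
      ∀ i, ∑ j, coefs c d j i * x j ^ degs r n i = 0} := by
  rw [CQNcount, ← Fintype.card_coe, ← Nat.card_eq_fintype_card]
  refine Nat.card_congr
    { toFun := fun x => ⟨fun j => (x.1 j : ℤ), ?_⟩
      invFun := fun y => ⟨fun j => (y.1 j).toNat, ?_⟩
      left_inv := fun x => ?_
      right_inv := fun y => ?_ }
  · refine mem_filter.2 ⟨Fintype.mem_piFinset.2 fun j => ?_, sum_coefs_eq_zero.1 x.2.2⟩
    have := x.2.1 j
    rw [mem_Ioc]
    omega
  · obtain ⟨h1, h2⟩ := mem_filter.1 y.2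
    have h3 : ∀ j, 0 < y.1 j ∧ y.1 j ≤ P := fun j => mem_Ioc.1 (Fintype.mem_piFinset.1 h1 j)
    have h4 : (fun j => ((y.1 j).toNat : ℤ)) = y.1 :=
      funext fun j => Int.toNat_of_nonneg (h3 j).1.le
    refine ⟨fun j => ?_, ?_⟩
    · obtain ⟨h5, h6⟩ := h3 j
      change 1 ≤ (y.1 j).toNat ∧ (y.1 j).toNat ≤ P
      generalize y.1 j = w at h5 h6
      omega
    · rw [h4]
      exact sum_coefs_eq_zero.2 h2
  · exact Subtype.ext (funext fun j => Int.toNat_natCast _)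
  · have h1 := (mem_filter.1 y.2).1
    exact Subtype.ext (funext fun j =>
      Int.toNat_of_nonneg (mem_Ioc.1 (Fintype.mem_piFinset.1 h1 j)).1.le)

theorem exists_unit_scale {s : ℕ} {x : Fin s → ℝ} (hx : ∀ j, 0 < x j) :
    ∃ a : ℝ, a ≠ 0 ∧ ∀ j, a * x j ∈ Set.Ioo (0 : ℝ) 1 := by
  have h0 : 0 ≤ ∑ j, x j := sum_nonneg fun j _ => (hx j).le
  refine ⟨(1 + ∑ j, x j)⁻¹, by positivity, fun j => ⟨mul_pos (by positivity) (hx j), ?_⟩⟩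
  rw [inv_mul_lt_iff₀ (by positivity), mul_one]
  have := single_le_sum (f := x) (fun i _ => (hx i).le) (mem_univ j)
  linarith

theorem integral_prod_wI_chart_ne_zero {ι : Type*} [Fintype ι] {s : ℕ} {k : ι → ℕ}
    {e : Fin s → ι → ℤ} (hint : Integrable fun η : ι → ℝ => ∏ j, wI k (e j) η) (x : Fin s → ℝ)
    (hx : ∀ j, 0 < x j) (hsol : ∀ i, ∑ j, (e j i : ℝ) * x j ^ k i = 0)
    (hrank : (Matrix.of fun (i : ι) (j : Fin s) =>
      (e j i : ℝ) * (k i * x j ^ (k i - 1))).rank = Fintype.card ι) :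
    ∫ η : ι → ℝ, ∏ j, wI k (e j) η ≠ 0 := by
  obtain ⟨m, σ, hσ⟩ := exists_chart k e x hrank
  obtain ⟨a, ha, hax⟩ := exists_unit_scale hx
  have h1 : ∀ η : ι → ℝ, ∏ j, wI k (e j) η = ∏ y, wI k (e (σ y)) η := fun η =>
    (σ.prod_comp fun j => wI k (e j) η).symm
  simp_rw [h1] at hint ⊢
  refine integral_prod_wI_ne_zero hint (exists_volume_ge k (fun y => e (σ y))
    (fun y => a * x (σ y)) (fun y => hax _) (fun i => ?_) (hσ a ha))
  have h2 := sum_smul_pow (hsol i) a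
  rwa [← σ.sum_comp] at h2

end Assembly

end CQ

/-- Theorem 1.5 of Brandes–Parsell, case `r_Q ≥ r_C`:
`G̃*(2,3; r_Q, r_C) ≤ 4r_Q + ⌊20 r_C/3⌋ + 1`. -/
theorem statement6 (rC rQ s : ℕ) (hrC : 1 ≤ rC) (hrQrC : rC ≤ rQ)
    (hs : 4 * rQ + 20 * rC / 3 + 1 ≤ s)
    (c : Fin rC → Fin s → ℤ) (d : Fin rQ → Fin s → ℤ)
    (hns : CQHighlyNonSingular rC rQ s c d)
    (hreal : ∃ x : Fin s → ℝ, (∀ j, 0 < x j) ∧ CQIsSol rC rQ s c d x ∧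
      CQJacFullRank rC rQ s c d x)
    (hpadic : ∀ (p : ℕ) [Fact p.Prime], ∃ x : Fin s → ℚ_[p],
      CQIsSol rC rQ s c d x ∧ CQJacFullRank rC rQ s c d x) :
    ∃ C : ℝ, 0 < C ∧ Filter.Tendsto
      (fun P : ℕ => (CQNcount rC rQ s c d P : ℝ) /
        (P : ℝ) ^ ((s : ℝ) - 3 * (rC : ℝ) - 2 * (rQ : ℝ)))
      Filter.atTop (nhds C) := by
  obtain ⟨-, -, hc, hd⟩ := hns
  obtain ⟨m, rfl⟩ := Nat.exists_eq_add_of_le hrQrC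
  have hs1 : (32 / 3 * rC + 4 * m : ℝ) < s := by
    have h1 : 32 * rC + 12 * m < 3 * s := by omega
    have h2 : ((32 * rC + 12 * m : ℕ) : ℝ) < (3 * s : ℕ) := Nat.cast_lt.2 h1
    push_cast at h2
    linarith
  have hs0 : 0 < s := by omega
  have hmin := CQ.minorBound_degs hc hd hs1
  have hk := CQ.one_le_degs rC (rC + m)
  have hser := CQ.tsum_prod_Wt_ne_zero hs0 (CQ.summable_prod_Wt hs0 hk hmin) fun p hp => by
    have : Fact p.Prime := ⟨hp⟩
    obtain ⟨y, hy, hy'⟩ := hpadic p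
    exact CQ.exists_rho_ge p hk _ y (CQ.sum_coefs_eq_zero.1 hy) (CQ.rank_coefs hy')
  obtain ⟨x, hx, hxs, hxr⟩ := hreal
  have hint := CQ.integral_prod_wI_chart_ne_zero (CQ.integrable_prod_wI hk hmin) x hx
    (CQ.sum_coefs_eq_zero.1 hxs) (CQ.rank_coefs hxr)
  have hlim := CQ.tendsto_integral_dS hs0 hk hmin
  obtain ⟨L, hL⟩ : ∃ L : ℂ, L = (∑' t : Fin rC ⊕ Fin (rC + m) → CQ.𝕋,
      ∏ j, CQ.Wt (CQ.degs rC (rC + m)) (CQ.coefs c d j) t) *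
      ∫ η : Fin rC ⊕ Fin (rC + m) → ℝ,
        ∏ j, CQ.wI (CQ.degs rC (rC + m)) (CQ.coefs c d j) η := ⟨_, rfl⟩
  have hL0 : L ≠ 0 := hL ▸ mul_ne_zero hser hint
  rw [← hL] at hlim
  have hN : ∀ᶠ P : ℕ in Filter.atTop, (∫ a : Fin rC ⊕ Fin (rC + m) → CQ.𝕋,
      ∏ j, CQ.dS (CQ.degs rC (rC + m)) (CQ.coefs c d j) P a) /
      (((P : ℝ) ^ s * ((P : ℝ) ^ ∑ i, CQ.degs rC (rC + m) i)⁻¹ : ℝ) : ℂ) =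
      ((CQNcount rC (rC + m) s c d P /
        (P : ℝ) ^ ((s : ℝ) - 3 * (rC : ℝ) - 2 * ((rC + m : ℕ) : ℝ)) : ℝ) : ℂ) := by
    filter_upwards [Filter.eventually_ge_atTop 1] with P hP
    have hP0 : (0 : ℝ) < P := Nat.cast_pos.2 hP
    have h1 : (s : ℝ) - 3 * (rC : ℝ) - 2 * ((rC + m : ℕ) : ℝ) =
        (s : ℝ) + -((3 * rC + 2 * (rC + m) : ℕ) : ℝ) := by push_cast; ring
    rw [CQ.integral_prod_dS, ← CQ.CQNcount_eq_card, CQ.sum_degs, h1, Real.rpow_add hP0,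
      Real.rpow_neg hP0.le, Real.rpow_natCast, Real.rpow_natCast, Complex.ofReal_div,
      Complex.ofReal_natCast]
  have hlim' := hlim.congr' hN
  have hre := (Complex.continuous_re.tendsto _).comp hlim'
  have him := (Complex.continuous_im.tendsto _).comp hlim'
  have him0 : L.im = 0 := tendsto_nhds_unique him (by
    simp only [Function.comp_def, Complex.ofReal_im]
    exact tendsto_const_nhds)
  have hre0 : 0 ≤ L.re := ge_of_tendsto' hre fun P => by
    rw [Function.comp_apply, Complex.ofReal_re]
    positivity
  have hre1 : L.re ≠ 0 := fun h => hL0 (Complex.ext h him0)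
  exact ⟨L.re, lt_of_le_of_ne hre0 hre1.symm, hre⟩
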